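/- For every integer r ≥ 3 there exists M_r such that the following holds: if T is a tree on k ≥ M_r vertices satisfying the Erdős–Sós property (every graph with average degree greater than k−2 contains T as a subgraph), then there exist N_0 and c_T > 0 such that for all integers n ≥ N_0 and all integers t with 0 ≤ t ≤ c_T·n, one has EX(n,(t+1)H^{Exp(T)}_{k+r−2}) = { K_t^r ⋈ T_r(n−t, k+r−3) }. -/

import Mathlib

open Filter

namespace DensityCH

/-- An `r`-uniform hypergraph with vertices in `ℕ`:
a finite vertex set together with a set of `r`-element edges. -/
structure HGraph (r : ℕ) where
  verts : Finset ℕ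
  edges : Finset (Finset ℕ)
  edges_sub : ∀ e ∈ edges, e ⊆ verts
  edges_card : ∀ e ∈ edges, e.card = r

namespace HGraph

/-- Build an `r`-graph from a vertex set and a set of candidate edges,
keeping exactly the well-formed candidates. -/
def ofEdges (r : ℕ) (V : Finset ℕ) (E : Finset (Finset ℕ)) : HGraph r where
  verts := V
  edges := E.filter fun e => e ⊆ V ∧ e.card = r
  edges_sub := fun e he => ((Finset.mem_filter.mp he).2).1
  edges_card := fun e he => ((Finset.mem_filter.mp he).2).2

variable {r : ℕ}

/-- `H` contains a copy of `F`, i.e. a subgraph isomorphic to `F`. -/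
def IsCopyIn (F H : HGraph r) : Prop :=
  ∃ f : ℕ → ℕ, Set.InjOn f ↑F.verts ∧ (∀ v ∈ F.verts, f v ∈ H.verts) ∧
    ∀ e ∈ F.edges, e.image f ∈ H.edges

/-- The subgraph of `H` induced on `S`. -/
def induce (H : HGraph r) (S : Finset ℕ) : HGraph r :=
  ofEdges r (H.verts ∩ S) (H.edges.filter fun e => e ⊆ S)

/-- Delete a vertex from `H`. -/
def deleteVert (H : HGraph r) (v : ℕ) : HGraph r :=
  ofEdges r (H.verts.erase v) (H.edges.filter fun e => v ∉ e)

/-- The degree of a vertex. -/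
def deg (H : HGraph r) (v : ℕ) : ℕ := (H.edges.filter fun e => v ∈ e).card

/-- The maximum degree `Δ(H)`. -/
def maxDeg (H : HGraph r) : ℕ := H.verts.sup H.deg

/-- The minimum degree `δ(H)`. -/
def minDeg (H : HGraph r) : ℕ :=
  if h : H.verts.Nonempty then H.verts.inf' h H.deg else 0

/-- The average degree `d(H) = r·|E(H)|/|V(H)|`. -/
noncomputable def avgDeg (H : HGraph r) : ℝ :=
  (r : ℝ) * (H.edges.card : ℝ) / (H.verts.card : ℝ)

/-- `H` contains `k` pairwise vertex-disjoint copies of `F`, i.e. `ν(F,H) ≥ k`. -/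
def HasMatching (F H : HGraph r) (k : ℕ) : Prop :=
  ∃ S : Fin k → Finset ℕ,
    (∀ i, S i ⊆ H.verts ∧ (S i).card = F.verts.card) ∧
    (∀ i j, i ≠ j → Disjoint (S i) (S j)) ∧
    ∀ i, F.IsCopyIn (H.induce (S i))

/-- Isomorphism of hypergraphs. -/
def Iso (G H : HGraph r) : Prop :=
  ∃ f : ℕ → ℕ, Set.BijOn f ↑G.verts ↑H.verts ∧
    ∀ e ∈ Finset.powersetCard r G.verts, (e ∈ G.edges ↔ e.image f ∈ H.edges)

/-- The join `G ⋈ H`: all edges of `G`, all edges of `H`, and all `r`-sets meeting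
both vertex sets. -/
def join (G H : HGraph r) : HGraph r :=
  ofEdges r (G.verts ∪ H.verts)
    (G.edges ∪ H.edges ∪ ((Finset.powersetCard r (G.verts ∪ H.verts)).filter
      fun e => (e ∩ G.verts).Nonempty ∧ (e ∩ H.verts).Nonempty))

end HGraph

/-- The complete `r`-graph on a vertex set `S`. -/
def completeOn (r : ℕ) (S : Finset ℕ) : HGraph r :=
  HGraph.ofEdges r S (Finset.powersetCard r S)

/-- The `r`-graph on `V` with no edges. -/
def emptyOn (r : ℕ) (V : Finset ℕ) : HGraph r := HGraph.ofEdges r V ∅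

/-- The Turán number `ex(n,F)`. -/
noncomputable def exN (r n : ℕ) (F : HGraph r) : ℕ :=
  sSup {m | ∃ H : HGraph r, H.verts.card = n ∧ ¬ F.IsCopyIn H ∧ H.edges.card = m}

/-- `d(n,F) = r·ex(n,F)/n`. -/
noncomputable def dN (r n : ℕ) (F : HGraph r) : ℝ := (r : ℝ) * (exN r n F : ℝ) / (n : ℝ)

/-- `δ(n,F) = ex(n,F) − ex(n−1,F)` (as a real number). -/
noncomputable def deltaN (r n : ℕ) (F : HGraph r) : ℝ := (exN r n F : ℝ) - (exN r (n-1) F : ℝ)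

/-- `x` is the Turán density `π(F)`, i.e. the limit of `ex(n,F)/C(n,r)`. -/
def HasTuranDensity (r : ℕ) (F : HGraph r) (x : ℝ) : Prop :=
  Tendsto (fun n : ℕ => (exN r n F : ℝ) / (n.choose r : ℝ)) atTop (nhds x)

/-- `ex(n,(t+1)F)`: the maximum number of edges of an `n`-vertex `r`-graph with no
`t+1` pairwise vertex-disjoint copies of `F`. -/
noncomputable def exMatchN (r n t : ℕ) (F : HGraph r) : ℕ :=
  sSup {m | ∃ H : HGraph r, H.verts.card = n ∧ ¬ F.HasMatching H (t+1) ∧ H.edges.card = m}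

/-- `H ∈ EX(n,F)`. -/
def IsExtremalFree (r n : ℕ) (F H : HGraph r) : Prop :=
  H.verts.card = n ∧ ¬ F.IsCopyIn H ∧ H.edges.card = exN r n F

/-- `H ∈ EX(n,(t+1)F)`. -/
def IsExtremalMatchingFree (r n t : ℕ) (F H : HGraph r) : Prop :=
  H.verts.card = n ∧ ¬ F.HasMatching H (t+1) ∧ H.edges.card = exMatchN r n t F

/-- `F` is `(f1, f2)`-bounded at `n`. -/
def BoundedAt (r n : ℕ) (F : HGraph r) (f1 f2 : ℝ) : Prop :=
  ∀ H : HGraph r, H.verts.card = n → ¬ F.IsCopyIn H →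
    dN r n F - f1 ≤ H.avgDeg → (H.maxDeg : ℝ) ≤ dN r n F + f2

/-- `ex(·,F)` is `g`-smooth at `n`: `|δ(n,F) − d(n−1,F)| ≤ g(n)`. -/
def SmoothAt (r n : ℕ) (F : HGraph r) (g : ℝ) : Prop :=
  |deltaN r n F - dN r (n-1) F| ≤ g

/-- The collection `H 0, …, H t` (on a common vertex set) has a rainbow `F`-matching. -/
def HasRainbowMatching (r t : ℕ) (F : HGraph r) (H : Fin (t+1) → HGraph r) : Prop :=
  ∃ S : Fin (t+1) → Finset ℕ,
    (∀ i, S i ⊆ (H i).verts ∧ (S i).card = F.verts.card) ∧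
    (∀ i j, i ≠ j → Disjoint (S i) (S j)) ∧
    ∀ i, F.IsCopyIn ((H i).induce (S i))

/-!  Patterns -/

/-- An `r`-uniform pattern: a finite index set together with a collection of
`r`-multisets on it. -/
structure Pattern (r : ℕ) where
  idx : Finset ℕ
  mE : Finset (Multiset ℕ)
  card_eq : ∀ s ∈ mE, Multiset.card s = r
  mem_idx : ∀ s ∈ mE, ∀ i ∈ s, i ∈ idx

namespace Pattern

variable {r : ℕ}

/-- The pattern `P − i`. -/
def erase (P : Pattern r) (i : ℕ) : Pattern r where
  idx := P.idx.erase i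
  mE := P.mE.filter fun s => i ∉ s
  card_eq := fun s hs => P.card_eq s (Finset.mem_filter.mp hs).1
  mem_idx := by
    intro s hs j hj
    have h1 := Finset.mem_filter.mp hs
    refine Finset.mem_erase.mpr ⟨?_, P.mem_idx s h1.1 j hj⟩
    rintro rfl
    exact h1.2 hj

/-- `H` is a `P`-construction: a blowup of the pattern `P`. -/
def IsConstruction (P : Pattern r) (H : HGraph r) : Prop :=
  ∃ part : ℕ → ℕ, (∀ v ∈ H.verts, part v ∈ P.idx) ∧
    ∀ e : Finset ℕ, e ∈ H.edges ↔ (e ⊆ H.verts ∧ e.card = r ∧ Multiset.map part e.val ∈ P.mE)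

/-- `H` is a `P`-subconstruction: a subgraph of a `P`-construction. -/
def IsSubconstruction (P : Pattern r) (H : HGraph r) : Prop :=
  ∃ G : HGraph r, P.IsConstruction G ∧ H.verts ⊆ G.verts ∧ H.edges ⊆ G.edges

end Pattern

/-- `Λ(P,n)`: the maximum number of edges of an `n`-vertex `P`-construction. -/
noncomputable def patEx (r : ℕ) (P : Pattern r) (n : ℕ) : ℕ :=
  sSup {m | ∃ H : HGraph r, P.IsConstruction H ∧ H.verts.card = n ∧ H.edges.card = m}

/-- The Lagrangian `λ(P) = lim Λ(P,n)/C(n,r)`. -/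
noncomputable def patLagrangian (r : ℕ) (P : Pattern r) : ℝ :=
  limUnder atTop fun n : ℕ => (patEx r P n : ℝ) / (n.choose r : ℝ)

/-- The pattern `P` is minimal: `λ(P−i) < λ(P)` for all `i`. -/
def Pattern.Minimal {r : ℕ} (P : Pattern r) : Prop :=
  ∀ i ∈ P.idx, patLagrangian r (P.erase i) < patLagrangian r P

/-- `(F,P)` is a Turán pair. -/
def IsTuranPair (r : ℕ) (F : HGraph r) (P : Pattern r) : Prop :=
  (∀ H : HGraph r, P.IsConstruction H → ¬ F.IsCopyIn H) ∧
  (∀ H : HGraph r, ¬ F.IsCopyIn H → H.edges.card = exN r H.verts.card F →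
    P.IsConstruction H)

/-- `F` is edge-stable with respect to `P` (with Turán density `π`). -/
def EdgeStable (r : ℕ) (F : HGraph r) (P : Pattern r) (π : ℝ) : Prop :=
  ∀ δ : ℝ, 0 < δ → ∃ N₀ : ℕ, ∃ ζ : ℝ, 0 < ζ ∧
    ∀ H : HGraph r, N₀ ≤ H.verts.card → ¬ F.IsCopyIn H →
      (π - ζ) * (H.verts.card.choose r : ℝ) ≤ (H.edges.card : ℝ) →
      ∃ H' : HGraph r, H'.verts ⊆ H.verts ∧ H'.edges ⊆ H.edges ∧
        (π - δ) * (H.verts.card.choose r : ℝ) ≤ (H'.edges.card : ℝ) ∧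
        P.IsSubconstruction H'

/-- `F` is weakly vertex-extendable with respect to `P` (with Turán density `π`). -/
def WeaklyVertexExtendable (r : ℕ) (F : HGraph r) (P : Pattern r) (π : ℝ) : Prop :=
  ∀ δ : ℝ, 0 < δ → ∃ N₀ : ℕ, ∃ ζ : ℝ, 0 < ζ ∧
    ∀ H : HGraph r, N₀ ≤ H.verts.card → ¬ F.IsCopyIn H →
      (π - ζ) * (((H.verts.card - 1).choose (r-1) : ℕ) : ℝ) ≤ (H.minDeg : ℝ) →
      ∀ v ∈ H.verts, P.IsSubconstruction (H.deleteVert v) →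
        (H.deg v : ℝ) ≤ (π + δ) * (((H.verts.card - 1).choose (r-1) : ℕ) : ℝ)

/-- `F` is degree-stable with respect to `P` (with Turán density `π`). -/
def DegreeStable (r : ℕ) (F : HGraph r) (P : Pattern r) (π : ℝ) : Prop :=
  ∃ ζ : ℝ, 0 < ζ ∧ ∃ N₀ : ℕ,
    ∀ H : HGraph r, N₀ ≤ H.verts.card → ¬ F.IsCopyIn H →
      (π - ζ) * (((H.verts.card - 1).choose (r-1) : ℕ) : ℝ) ≤ (H.minDeg : ℝ) →
      P.IsSubconstruction H

/-!  Concrete constructions -/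

/-- The generalized Turán graph `T_r(·,ℓ)` on vertex set `V` (parts are residue
classes mod `ℓ`; on an interval these are balanced). -/
def turanOn (r ℓ : ℕ) (V : Finset ℕ) : HGraph r :=
  HGraph.ofEdges r V ((Finset.powersetCard r V).filter
    fun e => ∀ u ∈ e, ∀ v ∈ e, u % ℓ = v % ℓ → u = v)

/-- The `r`-graph on `V₁ ∪ V₂` whose edges are all `r`-sets meeting both parts. -/
def crossOn (r : ℕ) (V₁ V₂ : Finset ℕ) : HGraph r :=
  HGraph.ofEdges r (V₁ ∪ V₂) ((Finset.powersetCard r (V₁ ∪ V₂)).filter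
    fun e => (e ∩ V₁).Nonempty ∧ (e ∩ V₂).Nonempty)

/-- The `r`-graph on `V₁ ∪ V₂` whose edges are all `r`-sets meeting `V₁` in an odd
number of vertices. -/
def oddCross (r : ℕ) (V₁ V₂ : Finset ℕ) : HGraph r :=
  HGraph.ofEdges r (V₁ ∪ V₂) ((Finset.powersetCard r (V₁ ∪ V₂)).filter
    fun e => Odd (e ∩ V₁).card)

/-- The Fano plane. -/
def fano : HGraph 3 :=
  HGraph.ofEdges 3 (Finset.Icc 1 7)
    {({1,2,3} : Finset ℕ), {3,4,5}, {5,6,1}, {1,7,4}, {2,7,5}, {3,7,6}, {2,4,6}}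

/-- The generalized triangle `𝕋_r`, with edges `{1,…,r}`, `{1,…,r−1,r+1}` and
`{r,…,2r−1}`. -/
def genTri (r : ℕ) : HGraph r :=
  HGraph.ofEdges r (Finset.Icc 1 (2*r - 1))
    {Finset.Icc 1 r, Finset.Icc 1 (r-1) ∪ {r+1}, Finset.Icc r (2*r - 1)}

/-- `G` is a blowup of the `r`-graph `W` (viewing `W` as a pattern). -/
def IsBlowupOf {r : ℕ} (W G : HGraph r) : Prop :=
  ∃ part : ℕ → ℕ, (∀ v ∈ G.verts, part v ∈ W.verts) ∧
    ∀ e : Finset ℕ, e ∈ G.edges ↔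
      (e ⊆ G.verts ∧ e.card = r ∧ ∃ f ∈ W.edges, Multiset.map part e.val = f.val)

/-- The expansion `H^F` of an `r`-graph `F`: for every pair of vertices not covered
by an edge of `F`, add an edge consisting of this pair plus `r−2` new vertices,
these sets of new vertices being pairwise disjoint. -/
def HGraph.expansion {r : ℕ} (F : HGraph r) : HGraph r :=
  HGraph.ofEdges r
    (F.verts ∪ (((F.verts ×ˢ F.verts).filter fun p =>
        p.1 < p.2 ∧ ∀ e ∈ F.edges, ¬ (p.1 ∈ e ∧ p.2 ∈ e)).biUnion fun p =>
      (Finset.range (r-2)).image fun s =>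
        (F.verts.sup id + 1) + (p.1 * (F.verts.sup id + 1) + p.2) * r + s))
    (F.edges ∪ (((F.verts ×ˢ F.verts).filter fun p =>
        p.1 < p.2 ∧ ∀ e ∈ F.edges, ¬ (p.1 ∈ e ∧ p.2 ∈ e)).image fun p =>
      insert p.1 (insert p.2 ((Finset.range (r-2)).image fun s =>
        (F.verts.sup id + 1) + (p.1 * (F.verts.sup id + 1) + p.2) * r + s))))

/-- A `2`-graph is a tree on `k` vertices: `k` vertices, `k−1` edges, connected. -/
def IsTreeGraph (k : ℕ) (T : HGraph 2) : Prop :=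
  T.verts.card = k ∧ T.edges.card = k - 1 ∧
  ∀ S : Finset ℕ, S ⊆ T.verts → S.Nonempty → S ≠ T.verts →
    ∃ e ∈ T.edges, (e ∩ S).Nonempty ∧ (e \ S).Nonempty

/-- `T` satisfies the Erdős–Sós property for `k`: every graph with average degree
greater than `k−2` contains `T`. -/
def ErdosSos (k : ℕ) (T : HGraph 2) : Prop :=
  ∀ G : HGraph 2, ((k : ℝ) - 2) * (G.verts.card : ℝ) < 2 * (G.edges.card : ℝ) →
    T.IsCopyIn G

/-- The `(r−2)`-expansion `Exp(T)` of a `2`-graph `T`: enlarge every edge by one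
common fixed set of `r−2` new vertices. -/
def expTree (r : ℕ) (T : HGraph 2) : HGraph r :=
  HGraph.ofEdges r
    (T.verts ∪ ((Finset.range (r-2)).image fun s => T.verts.sup id + 1 + s))
    (T.edges.image fun e =>
      e ∪ ((Finset.range (r-2)).image fun s => T.verts.sup id + 1 + s))

/-- The chromatic number of a `2`-graph. -/
noncomputable def chrom (F : HGraph 2) : ℕ :=
  sInf {k | ∃ c : ℕ → ℕ, (∀ v ∈ F.verts, c v < k) ∧
    ∀ e ∈ F.edges, ∀ u ∈ e, ∀ v ∈ e, u ≠ v → c u ≠ c v}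

/-- A graph is edge-critical if deleting some edge lowers its chromatic number. -/
def EdgeCritical (F : HGraph 2) : Prop :=
  ∃ e ∈ F.edges, chrom (HGraph.ofEdges 2 F.verts (F.edges.erase e)) < chrom F

/-- `H` is semibipartite: the vertex set splits into `V₁ ∪ V₂` so that every edge
has exactly one vertex in `V₁`. -/
def Semibipartite (r : ℕ) (H : HGraph r) : Prop :=
  ∃ V₁ ⊆ H.verts, ∀ e ∈ H.edges, (e ∩ V₁).card = 1

/-- `H` is a `K_ℓ^r`-subconstruction, i.e. an `ℓ`-partite `r`-graph. -/
def IsKlSub (r ℓ : ℕ) (H : HGraph r) : Prop :=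
  ∃ f : ℕ → ℕ, (∀ v ∈ H.verts, f v < ℓ) ∧
    ∀ e ∈ H.edges, ∀ u ∈ e, ∀ v ∈ e, f u = f v → u = v

/-- The Lagrangian `λ(W)` of an `r`-graph `W`, viewing `W` as a pattern. -/
noncomputable def hgLagrangian (r : ℕ) (W : HGraph r) : ℝ :=
  limUnder atTop fun n : ℕ =>
    ((sSup {m | ∃ G : HGraph r, IsBlowupOf W G ∧ G.verts.card = n ∧ G.edges.card = m} : ℕ) : ℝ)
      / (n.choose r : ℝ)

/-- The `r`-graph `B(r,ℓ+1)`. -/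
def BGraph (r ℓ : ℕ) : HGraph r :=
  HGraph.ofEdges r (Finset.Icc 1 (ℓ+1))
    (insert (Finset.Icc 1 r)
      ((Finset.powersetCard r (Finset.Icc 2 (ℓ+1))).filter
        fun e => (e ∩ Finset.Icc 2 r).card ≤ 1))

/-- The `r`-uniform matching of size two, `M_2^r`. -/
def matching2 (r : ℕ) : HGraph r :=
  HGraph.ofEdges r (Finset.Icc 1 (2*r)) {Finset.Icc 1 r, Finset.Icc (r+1) (2*r)}

/-- The expanded triangle `𝓒_3^{2r}`. -/
def expandedTriangle (r : ℕ) : HGraph (2*r) :=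
  HGraph.ofEdges (2*r) (Finset.Icc 1 (3*r))
    {Finset.Icc 1 (2*r), Finset.Icc (r+1) (3*r), Finset.Icc 1 r ∪ Finset.Icc (2*r+1) (3*r)}

/-- The `4`-graph `𝔽_{4,3}`. -/
def F43 : HGraph 4 :=
  HGraph.ofEdges 4 (Finset.Icc 1 7)
    {({1,2,3,4} : Finset ℕ), {1,2,3,5}, {1,2,3,6}, {1,2,3,7}, {4,5,6,7}}

/-- The `3`-graph `𝔽_{3,2}`. -/
def F32 : HGraph 3 :=
  HGraph.ofEdges 3 (Finset.Icc 1 5)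
    {({1,2,3} : Finset ℕ), {1,2,4}, {1,2,5}, {3,4,5}}

/-- `H` contains pairwise vertex-disjoint copies of `F i`, `ts i` many of each. -/
def HasMixedMatching (r k : ℕ) (F : Fin k → HGraph r) (ts : Fin k → ℕ)
    (H : HGraph r) : Prop :=
  ∃ S : (i : Fin k) → Fin (ts i) → Finset ℕ,
    (∀ i j, S i j ⊆ H.verts ∧ (S i j).card = (F i).verts.card) ∧
    (∀ p q : Σ i : Fin k, Fin (ts i), p ≠ q → Disjoint (S p.1 p.2) (S q.1 q.2)) ∧
    ∀ i j, (F i).IsCopyIn (H.induce (S i j))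

/-- `ex(n, ⊔ᵢ tᵢ Fᵢ)`. -/
noncomputable def exMixedN (r k : ℕ) (F : Fin k → HGraph r) (ts : Fin k → ℕ)
    (n : ℕ) : ℕ :=
  sSup {m | ∃ H : HGraph r, H.verts.card = n ∧ ¬ HasMixedMatching r k F ts H ∧
    H.edges.card = m}

/-- `ex(n, {F₁,…,F_k})`. -/
noncomputable def exFamN (r k : ℕ) (F : Fin k → HGraph r) (n : ℕ) : ℕ :=
  sSup {m | ∃ H : HGraph r, H.verts.card = n ∧ (∀ i, ¬ (F i).IsCopyIn H) ∧
    H.edges.card = m}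


/-! ### The edge polynomial -/

/-- The edge polynomial of a set system. -/
noncomputable def PP (E : Finset (Finset ℕ)) (x : ℕ → ℝ) : ℝ := ∑ e ∈ E, ∏ i ∈ e, x i

/-- The link of a vertex. -/
def lk (E : Finset (Finset ℕ)) (v : ℕ) : Finset (Finset ℕ) :=
  (E.filter (fun e => v ∈ e)).image (fun e => e.erase v)

/-- The edges avoiding a vertex. -/
def dl (E : Finset (Finset ℕ)) (v : ℕ) : Finset (Finset ℕ) := E.filter (fun e => v ∉ e)

theorem mem_lk {E : Finset (Finset ℕ)} {v : ℕ} {f : Finset ℕ} :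
    f ∈ lk E v ↔ v ∉ f ∧ insert v f ∈ E := by
  unfold lk
  simp only [Finset.mem_image, Finset.mem_filter]
  constructor
  · rintro ⟨e, ⟨he, hv⟩, rfl⟩
    refine ⟨Finset.notMem_erase _ _, ?_⟩
    rwa [Finset.insert_erase hv]
  · rintro ⟨h1, h2⟩
    exact ⟨insert v f, ⟨h2, Finset.mem_insert_self _ _⟩, Finset.erase_insert h1⟩

theorem mem_dl {E : Finset (Finset ℕ)} {v : ℕ} {f : Finset ℕ} :
    f ∈ dl E v ↔ f ∈ E ∧ v ∉ f := by
  unfold dl; simp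

theorem lk_inj {E : Finset (Finset ℕ)} {v : ℕ} :
    Set.InjOn (fun e : Finset ℕ => e.erase v) ↑(E.filter (fun e => v ∈ e)) := by
  intro a ha b hb hab
  simp only [Finset.coe_filter, Set.mem_ofPred_eq] at ha hb
  have : insert v (a.erase v) = insert v (b.erase v) := by rw [show a.erase v = b.erase v from hab]
  rwa [Finset.insert_erase ha.2, Finset.insert_erase hb.2] at this

theorem card_lk (E : Finset (Finset ℕ)) (v : ℕ) :
    (lk E v).card = (E.filter (fun e => v ∈ e)).card :=
  Finset.card_image_of_injOn lk_inj

theorem PP_filter_mem (E : Finset (Finset ℕ)) (v : ℕ) (x : ℕ → ℝ) :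
    ∑ e ∈ E.filter (fun e => v ∈ e), ∏ i ∈ e, x i = x v * PP (lk E v) x := by
  unfold PP lk
  rw [Finset.sum_image lk_inj, Finset.mul_sum]
  apply Finset.sum_congr rfl
  intro e he
  exact (Finset.mul_prod_erase e x (Finset.mem_filter.mp he).2).symm

theorem PP_split (E : Finset (Finset ℕ)) (v : ℕ) (x : ℕ → ℝ) :
    PP E x = x v * PP (lk E v) x + PP (dl E v) x := by
  rw [← PP_filter_mem]
  exact (Finset.sum_filter_add_sum_filter_not E (fun e => v ∈ e) _).symm

theorem PP_congr {E : Finset (Finset ℕ)} {x y : ℕ → ℝ}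
    (h : ∀ e ∈ E, ∀ i ∈ e, x i = y i) : PP E x = PP E y :=
  Finset.sum_congr rfl fun e he => Finset.prod_congr rfl fun i hi => h e he i hi

theorem PP_nonneg {E : Finset (Finset ℕ)} {x : ℕ → ℝ} (hx : ∀ i, 0 ≤ x i) : 0 ≤ PP E x :=
  Finset.sum_nonneg fun _ _ => Finset.prod_nonneg fun i _ => hx i

theorem PP_mono {E E' : Finset (Finset ℕ)} (h : E ⊆ E') {x : ℕ → ℝ} (hx : ∀ i, 0 ≤ x i) :
    PP E x ≤ PP E' x :=
  Finset.sum_le_sum_of_subset_of_nonneg h fun _ _ _ => Finset.prod_nonneg fun i _ => hx i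

theorem PP_smul {E : Finset (Finset ℕ)} {V : Finset ℕ} {r : ℕ} (hE : E ⊆ V.powersetCard r)
    (x : ℕ → ℝ) (a : ℝ) : PP E (fun i => a * x i) = a ^ r * PP E x := by
  unfold PP
  rw [Finset.mul_sum]
  apply Finset.sum_congr rfl
  intro e he
  rw [Finset.prod_mul_distrib, Finset.prod_const, (Finset.mem_powersetCard.mp (hE he)).2]

theorem lk_sub {E : Finset (Finset ℕ)} {V : Finset ℕ} {r : ℕ} (hE : E ⊆ V.powersetCard (r+1))
    (v : ℕ) : lk E v ⊆ (V.erase v).powersetCard r := by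
  intro f hf
  obtain ⟨h1, h2⟩ := mem_lk.mp hf
  obtain ⟨h3, h4⟩ := Finset.mem_powersetCard.mp (hE h2)
  rw [Finset.card_insert_of_notMem h1] at h4
  rw [Finset.mem_powersetCard]
  refine ⟨?_, by omega⟩
  intro a ha
  rw [Finset.mem_erase]
  exact ⟨fun h => h1 (h ▸ ha), h3 (Finset.mem_insert_of_mem ha)⟩

theorem PP_euler {E : Finset (Finset ℕ)} {V : Finset ℕ} {r : ℕ} (hE : E ⊆ V.powersetCard r)
    (x : ℕ → ℝ) : ∑ v ∈ V, x v * PP (lk E v) x = r * PP E x := by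
  simp_rw [← PP_filter_mem]
  simp_rw [Finset.sum_filter]
  rw [Finset.sum_comm]
  unfold PP
  rw [Finset.mul_sum]
  apply Finset.sum_congr rfl
  intro e he
  obtain ⟨h1, h2⟩ := Finset.mem_powersetCard.mp (hE he)
  rw [← Finset.sum_filter, Finset.sum_const, nsmul_eq_mul]
  congr 2
  rw [Finset.filter_mem_eq_inter, Finset.inter_eq_right.mpr h1, h2]

theorem lk_comm (E : Finset (Finset ℕ)) (u v : ℕ) : lk (lk E u) v = lk (lk E v) u := by
  ext f
  simp only [mem_lk, Finset.mem_insert, not_or]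
  rw [Finset.insert_comm]
  tauto

theorem dl_lk_comm (E : Finset (Finset ℕ)) {u v : ℕ} (h : u ≠ v) :
    dl (lk E u) v = lk (dl E v) u := by
  ext f
  simp only [mem_lk, mem_dl, Finset.mem_insert, not_or]
  have := h.symm
  tauto

theorem PP_lk_update (E : Finset (Finset ℕ)) (v : ℕ) (x : ℕ → ℝ) (t : ℝ) :
    PP (lk E v) (Function.update x v t) = PP (lk E v) x := by
  apply PP_congr
  intro e he i hi
  have : i ≠ v := by rintro rfl; exact (mem_lk.mp he).1 hi
  simp [this]

theorem PP_dl_update (E : Finset (Finset ℕ)) (v : ℕ) (x : ℕ → ℝ) (t : ℝ) :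
    PP (dl E v) (Function.update x v t) = PP (dl E v) x := by
  apply PP_congr
  intro e he i hi
  have : i ≠ v := by rintro rfl; exact (mem_dl.mp he).2 hi
  simp [this]

theorem PP_update (E : Finset (Finset ℕ)) (v : ℕ) (x : ℕ → ℝ) (t : ℝ) :
    PP E (Function.update x v t) = t * PP (lk E v) x + PP (dl E v) x := by
  rw [PP_split E v, PP_lk_update, PP_dl_update]; simp

/-- Shifting weight from `v` to `u`. -/
theorem PP_shift (E : Finset (Finset ℕ)) {u v : ℕ} (h : u ≠ v) (x : ℕ → ℝ) (t : ℝ) :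
    PP E (Function.update (Function.update x u (x u + t)) v (x v - t))
      = PP E x + t * (PP (lk E u) x - PP (lk E v) x) - t ^ 2 * PP (lk (lk E u) v) x := by
  rw [PP_update]
  rw [PP_update, PP_update]
  have h1 := PP_split E v x
  have h2 := PP_split (lk E v) u x
  have h3 := PP_split (dl E v) u x
  have h4 := PP_split (lk E u) v x
  rw [lk_comm E v u] at *
  rw [dl_lk_comm E h] at h4
  rw [h4, h1, h2, h3]
  ring

theorem PP_le_pow {V : Finset ℕ} {x : ℕ → ℝ} (hx : ∀ i, 0 ≤ x i) (r : ℕ) :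
    ∀ {E : Finset (Finset ℕ)}, E ⊆ V.powersetCard r → PP E x ≤ (∑ i ∈ V, x i) ^ r := by
  induction r with
  | zero =>
    intro E hE
    calc PP E x ≤ PP (V.powersetCard 0) x := PP_mono hE hx
      _ = 1 := by simp [PP]
      _ ≤ _ := by simp
  | succ r ih =>
    intro E hE
    have h1 := PP_euler hE x
    have h2 : ∑ v ∈ V, x v * PP (lk E v) x ≤ ∑ v ∈ V, x v * (∑ i ∈ V, x i) ^ r := by
      apply Finset.sum_le_sum
      intro v _
      apply mul_le_mul_of_nonneg_left _ (hx v)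
      exact ih ((lk_sub hE v).trans (Finset.powersetCard_mono (Finset.erase_subset _ _)))
    rw [h1, ← Finset.sum_mul, ← pow_succ'] at h2
    have h3 : 0 ≤ PP E x := PP_nonneg hx
    push_cast at h2
    nlinarith [mul_nonneg (Nat.cast_nonneg (α := ℝ) r) h3]

theorem sum_biUnion_le' {α β : Type*} [DecidableEq α] [DecidableEq β] (s : Finset α)
    (t : α → Finset β) (f : β → ℝ) (hf : ∀ b, 0 ≤ f b) :
    ∑ b ∈ s.biUnion t, f b ≤ ∑ a ∈ s, ∑ b ∈ t a, f b := by
  induction s using Finset.induction_on with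
  | empty => simp
  | insert a s ha ih =>
    rw [Finset.biUnion_insert, Finset.sum_insert ha]
    have h := Finset.sum_union_inter (s₁ := t a) (s₂ := s.biUnion t) (f := f)
    have h2 : 0 ≤ ∑ b ∈ t a ∩ s.biUnion t, f b := Finset.sum_nonneg fun b _ => hf b
    linarith

/-- Edges meeting a set `B` have small total weight. -/
theorem PP_meet {V B : Finset ℕ} {x : ℕ → ℝ} (hx : ∀ i, 0 ≤ x i) (r : ℕ)
    {E : Finset (Finset ℕ)} (hE : E ⊆ V.powersetCard (r+1)) :
    PP E x ≤ PP (E.filter (fun e => Disjoint e B)) x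
      + (∑ i ∈ B, x i) * (∑ i ∈ V, x i) ^ r := by
  have h0 : PP E x = PP (E.filter (fun e => Disjoint e B)) x
      + PP (E.filter (fun e => ¬ Disjoint e B)) x :=
    (Finset.sum_filter_add_sum_filter_not E _ _).symm
  rw [h0]
  gcongr
  have h1 : PP (E.filter (fun e => ¬ Disjoint e B)) x
      ≤ ∑ b ∈ B, ∑ e ∈ E.filter (fun e => b ∈ e), ∏ i ∈ e, x i := by
    have h2 : (E.filter (fun e => ¬ Disjoint e B)) ⊆
      B.biUnion (fun b => E.filter (fun e => b ∈ e)) := by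
      intro e he
      simp only [Finset.mem_filter, Finset.not_disjoint_iff] at he
      obtain ⟨he, a, h3, h4⟩ := he
      simp only [Finset.mem_biUnion, Finset.mem_filter]
      exact ⟨a, h4, he, h3⟩
    refine (PP_mono h2 hx).trans ?_
    unfold PP
    exact sum_biUnion_le' _ _ _ fun e => Finset.prod_nonneg fun i _ => hx i
  refine h1.trans ?_
  rw [Finset.sum_mul]
  apply Finset.sum_le_sum
  intro b _
  rw [PP_filter_mem]
  apply mul_le_mul_of_nonneg_left _ (hx b)
  exact PP_le_pow hx r ((lk_sub hE b).trans (Finset.powersetCard_mono (Finset.erase_subset _ _)))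

theorem PP_continuous (E : Finset (Finset ℕ)) : Continuous (PP E) := by
  unfold PP
  fun_prop

/-- Optimal weights under box constraints. -/
theorem opt_exists {V : Finset ℕ} {r : ℕ} {E : Finset (Finset ℕ)} (hE : E ⊆ V.powersetCard r)
    {x : ℕ → ℝ} (hx : ∀ i, 0 ≤ x i) {μ s : ℝ} (hμ : ∀ i ∈ V, x i ≤ μ) (hs : ∑ i ∈ V, x i ≤ s)
    (hV : V.Nonempty) :
    ∃ y : ℕ → ℝ, (∀ i, 0 ≤ y i) ∧ (∀ i ∈ V, y i ≤ μ) ∧ ∑ i ∈ V, y i ≤ s ∧ PP E x ≤ PP E y ∧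
      ∃ v ∈ V, (∀ i ∈ V, y i ≤ y v) ∧ r * PP E y ≤ s * PP (lk E v) y := by
  classical
  set K : Set (ℕ → ℝ) := Set.pi Set.univ (fun i => Set.Icc 0 (if i ∈ V then μ else 0)) ∩
    {y | ∑ i ∈ V, y i ≤ s} with hK
  have hKc : IsCompact K := by
    apply IsCompact.inter_right
    · exact isCompact_univ_pi fun i => isCompact_Icc
    · exact isClosed_le (by fun_prop) continuous_const
  set x0 : ℕ → ℝ := fun i => if i ∈ V then x i else 0 with hx0
  have hx0K : x0 ∈ K := by
    refine ⟨?_, ?_⟩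
    · intro i _
      simp only [hx0]
      split_ifs with h
      · exact ⟨hx i, hμ i h⟩
      · simp
    · simp only [Set.mem_ofPred_eq, hx0]
      rw [Finset.sum_congr rfl (fun i hi => if_pos hi)]
      exact hs
  obtain ⟨y, hyK, hymax⟩ := hKc.exists_isMaxOn ⟨x0, hx0K⟩ (PP_continuous E).continuousOn
  have hxx0 : PP E x = PP E x0 := by
    apply PP_congr
    intro e he i hi
    simp [hx0, (Finset.mem_powersetCard.mp (hE he)).1 hi]
  have hy0 : ∀ i, 0 ≤ y i := fun i => (hyK.1 i trivial).1
  have hyμ : ∀ i ∈ V, y i ≤ μ := by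
    intro i hi
    have := (hyK.1 i trivial).2
    simpa [hi] using this
  have hyz : ∀ i ∉ V, y i ≤ 0 := by
    intro i hi
    have := (hyK.1 i trivial).2
    simpa [hi] using this
  have hys : ∑ i ∈ V, y i ≤ s := hyK.2
  refine ⟨y, hy0, hyμ, hys, ?_, ?_⟩
  · rw [hxx0]; exact hymax hx0K
  obtain ⟨u, huV, hu⟩ := V.exists_max_image (fun i => PP (lk E i) y) hV
  obtain ⟨w, hwV, hw⟩ := V.exists_max_image y hV
  have key : ∃ v ∈ V, (∀ i ∈ V, y i ≤ y v) ∧ PP (lk E v) y = PP (lk E u) y := by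
    by_cases h1 : y u = y w
    · exact ⟨u, huV, fun i hi => h1 ▸ hw i hi, rfl⟩
    · have h2 : y u < y w := lt_of_le_of_ne (hw u huV) h1
      refine ⟨w, hwV, hw, ?_⟩
      by_contra h3
      have h4 : PP (lk E w) y < PP (lk E u) y := lt_of_le_of_ne (hu w hwV) h3
      have huw : u ≠ w := by rintro rfl; exact h1 rfl
      set a := PP (lk (lk E u) w) y with ha
      have ha0 : 0 ≤ a := PP_nonneg hy0
      set d := PP (lk E u) y - PP (lk E w) y with hd
      have hdpos : 0 < d := by rw [hd]; linarith
      obtain ⟨t, ht0, ht1, ht2⟩ : ∃ t : ℝ, 0 < t ∧ t ≤ y w - y u ∧ t * a < d := by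
        refine ⟨min (y w - y u) (d / (2 * (a + 1))), lt_min (by linarith) (by positivity),
          min_le_left _ _, ?_⟩
        calc min (y w - y u) (d / (2 * (a + 1))) * a ≤ d / (2 * (a + 1)) * a :=
              mul_le_mul_of_nonneg_right (min_le_right _ _) ha0
          _ < d := by
            rw [div_mul_eq_mul_div, div_lt_iff₀ (by positivity)]
            nlinarith
      have hz := PP_shift E huw y t
      set z := Function.update (Function.update y u (y u + t)) w (y w - t) with hzdef
      have hzu : z u = y u + t := by simp [hzdef, huw]
      have hzw : z w = y w - t := by simp [hzdef]
      have hzo : ∀ i, i ≠ u → i ≠ w → z i = y i := by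
        intro i h5 h6; simp [hzdef, h5, h6]
      have hzK : z ∈ K := by
        refine ⟨?_, ?_⟩
        · intro i _
          by_cases h5 : i = u
          · subst h5
            simp only [huV, if_true]
            rw [hzu]
            have := hyμ w hwV
            exact ⟨by linarith [hy0 i], by linarith⟩
          · by_cases h6 : i = w
            · subst h6
              simp only [hwV, if_true]
              rw [hzw]
              have := hyμ i hwV
              exact ⟨by linarith [hy0 u], by linarith⟩
            · rw [hzo i h5 h6]; exact hyK.1 i trivial
        · have h7 : ∑ i ∈ V, z i = ∑ i ∈ V, y i := by
            have h8 : w ∈ V.erase u := Finset.mem_erase.mpr ⟨huw.symm, hwV⟩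
            rw [← Finset.add_sum_erase V z huV, ← Finset.add_sum_erase V y huV,
              ← Finset.add_sum_erase _ z h8, ← Finset.add_sum_erase _ y h8, hzu, hzw]
            rw [Finset.sum_congr rfl (fun i hi => hzo i
              (Finset.mem_erase.mp (Finset.mem_erase.mp hi).2).1 (Finset.mem_erase.mp hi).1)]
            ring
          simp only [Set.mem_ofPred_eq, h7]; exact hys
      have h9 : PP E z ≤ PP E y := hymax hzK
      rw [hz] at h9
      nlinarith
  obtain ⟨v, hvV, hvmax, hveq⟩ := key
  refine ⟨v, hvV, hvmax, ?_⟩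
  rw [hveq, ← PP_euler hE y]
  calc ∑ i ∈ V, y i * PP (lk E i) y ≤ ∑ i ∈ V, y i * PP (lk E u) y :=
        Finset.sum_le_sum fun i hi => mul_le_mul_of_nonneg_left (hu i hi) (hy0 i)
    _ = (∑ i ∈ V, y i) * PP (lk E u) y := by rw [Finset.sum_mul]
    _ ≤ s * PP (lk E u) y := mul_le_mul_of_nonneg_right hys (PP_nonneg hy0)

/-! ### Trees and their expansions -/

/-- `E` contains the `(r-2)`-expansion of `T`. -/
def ExpIn (r : ℕ) (T : HGraph 2) (E : Finset (Finset ℕ)) : Prop :=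
  ∃ φ : ℕ → ℕ, ∃ A : Finset ℕ, Set.InjOn φ ↑T.verts ∧ A.card = r - 2 ∧
    (∀ a ∈ T.verts, φ a ∉ A) ∧ ∀ e ∈ T.edges, e.image φ ∪ A ∈ E

theorem ExpIn.mono {r : ℕ} {T : HGraph 2} {E E' : Finset (Finset ℕ)} (h : E ⊆ E')
    (hE : ExpIn r T E) : ExpIn r T E' := by
  obtain ⟨φ, A, h1, h2, h3, h4⟩ := hE
  exact ⟨φ, A, h1, h2, h3, fun e he => h (h4 e he)⟩

theorem tree_edge {k : ℕ} {T : HGraph 2} (hT : IsTreeGraph k T) (hk : 2 ≤ k) {v : ℕ}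
    (hv : v ∈ T.verts) : ∃ e ∈ T.edges, v ∈ e := by
  obtain ⟨h1, h2, h3⟩ := hT
  obtain ⟨e, he, h4, h5⟩ := h3 {v} (by simpa using hv) (by simp) (by
    intro h; rw [← h] at h1; simp at h1; omega)
  refine ⟨e, he, ?_⟩
  obtain ⟨a, ha⟩ := h4
  simp at ha
  exact ha.2 ▸ ha.1

theorem tree_leaf {k : ℕ} {T : HGraph 2} (hT : IsTreeGraph k T) (hk : 3 ≤ k) :
    ∃ a ∈ T.verts, ∃ b ∈ T.verts, ∃ c ∈ T.verts, a ≠ b ∧ a ≠ c ∧ b ≠ c ∧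
      ∀ e ∈ T.edges, a ∈ e → e = {a, b} := by
  classical
  have hsum : ∑ v ∈ T.verts, (T.edges.filter (fun e => v ∈ e)).card = 2 * (k - 1) := by
    have : ∑ v ∈ T.verts, (T.edges.filter (fun e => v ∈ e)).card = ∑ e ∈ T.edges, e.card := by
      simp_rw [Finset.card_filter]
      rw [Finset.sum_comm]
      apply Finset.sum_congr rfl
      intro e he
      rw [← Finset.card_filter, Finset.filter_mem_eq_inter,
        Finset.inter_eq_right.mpr (T.edges_sub e he)]
    rw [this, Finset.sum_congr rfl (fun e he => T.edges_card e he), Finset.sum_const, hT.2.1]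
    simp [mul_comm]
  obtain ⟨a, ha, hlt⟩ : ∃ a ∈ T.verts, (T.edges.filter (fun e => a ∈ e)).card < 2 := by
    by_contra hcon
    push Not at hcon
    have := Finset.sum_le_sum hcon
    rw [hsum, Finset.sum_const, hT.1] at this
    simp at this
    omega
  obtain ⟨e0, he0, hae0⟩ := tree_edge hT (by omega) ha
  have hone : (T.edges.filter (fun e => a ∈ e)).card ≤ 1 := by omega
  rw [Finset.card_le_one] at hone
  obtain ⟨p, q, hpq, rfl⟩ := Finset.card_eq_two.mp (T.edges_card e0 he0)
  obtain ⟨b, hb, hab, heq⟩ : ∃ b ∈ T.verts, a ≠ b ∧ ({p, q} : Finset ℕ) = {a, b} := by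
    have hs := T.edges_sub _ he0
    simp only [Finset.mem_insert, Finset.mem_singleton] at hae0
    rcases hae0 with rfl | rfl
    · exact ⟨q, hs (by simp), hpq, rfl⟩
    · exact ⟨p, hs (by simp), hpq.symm, Finset.pair_comm _ _⟩
  obtain ⟨c, hc, hcn⟩ : ∃ c ∈ T.verts, c ∉ ({a, b} : Finset ℕ) := by
    apply Finset.exists_mem_notMem_of_card_lt_card
    rw [hT.1, Finset.card_pair hab]; omega
  simp only [Finset.mem_insert, Finset.mem_singleton, not_or] at hcn
  refine ⟨a, ha, b, hb, c, hc, hab, fun h => hcn.1 h.symm, fun h => hcn.2 h.symm, ?_⟩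
  intro e he hae
  rw [← heq]
  exact hone e (by simp [he, hae]) _ (by simp only [Finset.mem_filter]; exact ⟨he0, hae0⟩)

theorem exists_bij {s t : Finset ℕ} (h : s.card = t.card) :
    ∃ φ : ℕ → ℕ, Set.InjOn φ ↑s ∧ s.image φ = t := by
  classical
  let e := Finset.equivOfCardEq h
  refine ⟨fun i => if hi : i ∈ s then (e ⟨i, hi⟩ : ℕ) else 0, ?_, ?_⟩
  · intro a ha b hb hab
    have ha' : a ∈ s := ha
    have hb' : b ∈ s := hb
    simp only [ha', hb', dif_pos] at hab
    have := e.injective (Subtype.ext hab)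
    exact congrArg Subtype.val this
  · ext y
    simp only [Finset.mem_image]
    constructor
    · rintro ⟨a, ha, rfl⟩
      simp [ha]
    · intro hy
      refine ⟨e.symm ⟨y, hy⟩, (e.symm ⟨y, hy⟩).2, ?_⟩
      simp

/-- Extend a bijection by two prescribed values. -/
theorem exists_bij2 {s t : Finset ℕ} {a b p q : ℕ} (hab : a ≠ b) (hpq : p ≠ q)
    (ha : a ∈ s) (hb : b ∈ s) (hp : p ∉ t) (hq : q ∉ t) (h : s.card = t.card + 2) :
    ∃ φ : ℕ → ℕ, Set.InjOn φ ↑s ∧ φ a = p ∧ φ b = q ∧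
      (∀ i ∈ s, i ≠ a → i ≠ b → φ i ∈ t) ∧ s.image φ = insert p (insert q t) := by
  classical
  have hc : ((s.erase a).erase b).card = t.card := by
    rw [Finset.card_erase_of_mem (by simp [hab.symm, hb]), Finset.card_erase_of_mem ha]; omega
  obtain ⟨ψ, hψ, hψi⟩ := exists_bij hc
  have hmem : ∀ i ∈ s, i ≠ a → i ≠ b → ψ i ∈ t := by
    intro i hi h1 h2
    rw [← hψi]
    exact Finset.mem_image_of_mem _ (by simp [h1, h2, hi])
  refine ⟨Function.update (Function.update ψ a p) b q, ?_, by simp [hab], by simp, ?_, ?_⟩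
  · intro i hi j hj hij
    have hi' : i ∈ s := hi
    have hj' : j ∈ s := hj
    by_cases i1 : i = a <;> by_cases i2 : i = b <;> by_cases j1 : j = a <;> by_cases j2 : j = b
    all_goals first
      | (subst i1; subst i2; exact absurd rfl hab)
      | (subst j1; subst j2; exact absurd rfl hab)
      | (subst i1; subst j1; rfl)
      | (subst i2; subst j2; rfl)
      | skip
    · simp [i1, j2, hab] at hij; exact absurd hij hpq
    · subst i1
      simp [i2, j1, j2] at hij
      exact absurd (hmem j hj' j1 j2) (hij ▸ hp)
    · simp [i2, j1, hab] at hij; exact absurd hij.symm hpq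
    · subst i2
      simp [j1, j2] at hij
      exact absurd (hmem j hj' j1 j2) (hij ▸ hq)
    · subst j1
      simp [i1, i2, j2] at hij
      exact absurd (hmem i hi' i1 i2) (hij ▸ hp)
    · subst j2
      simp [i1, i2] at hij
      exact absurd (hmem i hi' i1 i2) (hij ▸ hq)
    · simp [i1, i2, j1, j2] at hij
      exact hψ (by simp [i1, i2, hi']) (by simp [j1, j2, hj']) hij
  · intro i hi h1 h2
    simp [h1, h2, hmem i hi h1 h2]
  · have hs : s = insert a (insert b ((s.erase a).erase b)) := by
      rw [Finset.insert_erase (by simp [hab.symm, hb]), Finset.insert_erase ha]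
    rw [hs, Finset.image_insert, Finset.image_insert]
    congr 1
    · simp [hab]
    · congr 1
      · simp
      · rw [← hψi]
        apply Finset.image_congr
        intro i hi
        simp only [Finset.coe_erase, Set.mem_diff, Set.mem_singleton_iff] at hi
        simp [hi.1.2, hi.2]

theorem tree_img_card {T : HGraph 2} {φ : ℕ → ℕ} {A : Finset ℕ} {r : ℕ} (hr : 2 ≤ r)
    (hφ : Set.InjOn φ ↑T.verts) (hA : A.card = r - 2) (hd : ∀ a ∈ T.verts, φ a ∉ A)
    {e : Finset ℕ} (he : e ∈ T.edges) : (e.image φ ∪ A).card = r := by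
  have hs := T.edges_sub e he
  rw [Finset.card_union_of_disjoint, Finset.card_image_of_injOn (hφ.mono hs),
    T.edges_card e he, hA]
  · omega
  · rw [Finset.disjoint_left]
    intro x hx
    obtain ⟨a, ha, rfl⟩ := Finset.mem_image.mp hx
    exact hd a (hs ha)

theorem leaf_embed {k r : ℕ} {T : HGraph 2} (hT : IsTreeGraph k T) (hk : 3 ≤ k) (hr : 2 ≤ r)
    {L f : Finset ℕ} {w : ℕ} (hL : L.card = k + r - 3) (hw : w ∉ L) (hfL : f ⊆ L)
    (hf : f.card = r - 1) :
    ∃ φ : ℕ → ℕ, ∃ A : Finset ℕ, Set.InjOn φ ↑T.verts ∧ A.card = r - 2 ∧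
      (∀ a ∈ T.verts, φ a ∉ A) ∧ T.verts.image φ ∪ A = insert w L ∧
      ∀ e ∈ T.edges, e.image φ ∪ A ∈ L.powersetCard r ∨ e.image φ ∪ A = insert w f := by
  obtain ⟨a, ha, b, hb, c, hc, hab, hac, hbc, hleaf⟩ := tree_leaf hT hk
  obtain ⟨u, hu⟩ : f.Nonempty := by rw [← Finset.card_pos]; omega
  have hAc : (f.erase u).card = r - 2 := by rw [Finset.card_erase_of_mem hu]; omega
  have hwu : w ≠ u := by rintro rfl; exact hw (hfL hu)
  obtain ⟨φ, h1, h2, h3, h4, h5⟩ := exists_bij2 (s := T.verts) (t := L \ f) hab hwu ha hb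
    (by simp [hw]) (by simp [hu])
    (by rw [hT.1, Finset.card_sdiff_of_subset hfL]; omega)
  have hd : ∀ i ∈ T.verts, φ i ∉ f.erase u := by
    intro i hi
    by_cases hia : i = a
    · subst hia; rw [h2]; simp only [Finset.mem_erase, not_and]; intro _ h; exact hw (hfL h)
    · by_cases hib : i = b
      · subst hib; rw [h3]; simp
      · have := h4 i hi hia hib
        simp only [Finset.mem_sdiff] at this
        simp [this.2]
  refine ⟨φ, f.erase u, h1, hAc, hd, ?_, ?_⟩
  · rw [h5, Finset.insert_union, Finset.insert_union]
    congr 1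
    ext x
    simp only [Finset.mem_insert, Finset.mem_union, Finset.mem_sdiff, Finset.mem_erase]
    constructor
    · rintro (rfl | h | h)
      · exact hfL hu
      · exact h.1
      · exact hfL h.2
    · intro h
      by_cases hx : x ∈ f
      · by_cases hxu : x = u
        · exact Or.inl hxu
        · exact Or.inr (Or.inr ⟨hxu, hx⟩)
      · exact Or.inr (Or.inl ⟨h, hx⟩)
  · intro e he
    by_cases hae : a ∈ e
    · right
      rw [hleaf e he hae]
      rw [Finset.image_insert, Finset.image_singleton, h2, h3]
      rw [Finset.insert_union, Finset.singleton_union, Finset.insert_erase hu]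
    · left
      rw [Finset.mem_powersetCard]
      refine ⟨?_, tree_img_card hr h1 hAc hd he⟩
      apply Finset.union_subset
      · intro x hx
        obtain ⟨i, hi, rfl⟩ := Finset.mem_image.mp hx
        have hia : i ≠ a := by rintro rfl; exact hae hi
        by_cases hib : i = b
        · subst hib; rw [h3]; exact hfL hu
        · exact (Finset.mem_sdiff.mp (h4 i (T.edges_sub e he hi) hia hib)).1
      · exact (Finset.erase_subset _ _).trans hfL

theorem pair_embed {k r : ℕ} {T : HGraph 2} (hT : IsTreeGraph k T) (hk : 3 ≤ k) (hr : 2 ≤ r)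
    {U : Finset ℕ} {w w' : ℕ} (hU : U.card = k + r - 4) (hw : w ∉ U) (hw' : w' ∉ U)
    (hww : w ≠ w') :
    ∃ φ : ℕ → ℕ, ∃ A : Finset ℕ, Set.InjOn φ ↑T.verts ∧ A.card = r - 2 ∧
      (∀ a ∈ T.verts, φ a ∉ A) ∧ T.verts.image φ ∪ A = insert w (insert w' U) ∧
      ∀ e ∈ T.edges, e.image φ ∪ A ∈ U.powersetCard r ∨
        ∃ g ∈ U.powersetCard (r-1), e.image φ ∪ A = insert w g ∨ e.image φ ∪ A = insert w' g := by
  obtain ⟨a, ha, b, hb, c, hc, hab, hac, hbc, hleaf⟩ := tree_leaf hT hk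
  obtain ⟨A, hAU, hAc⟩ := Finset.exists_subset_card_eq (s := U) (n := r - 2) (by omega)
  obtain ⟨φ, h1, h2, h3, h4, h5⟩ := exists_bij2 (s := T.verts) (t := U \ A) hac hww ha hc
    (by simp [hw]) (by simp [hw'])
    (by rw [hT.1, Finset.card_sdiff_of_subset hAU]; omega)
  have hd : ∀ i ∈ T.verts, φ i ∉ A := by
    intro i hi
    by_cases hia : i = a
    · subst hia; rw [h2]; exact fun h => hw (hAU h)
    · by_cases hib : i = c
      · subst hib; rw [h3]; exact fun h => hw' (hAU h)
      · exact (Finset.mem_sdiff.mp (h4 i hi hia hib)).2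
  refine ⟨φ, A, h1, hAc, hd, ?_, ?_⟩
  · rw [h5, Finset.insert_union, Finset.insert_union, Finset.sdiff_union_of_subset hAU]
  · intro e he
    have hcard := tree_img_card hr h1 hAc hd he
    have hmem : ∀ i ∈ e, i ≠ a → i ≠ c → φ i ∈ U := fun i hi hia hic =>
      (Finset.mem_sdiff.mp (h4 i (T.edges_sub e he hi) hia hic)).1
    have hwA : w ∉ A := fun h => hw (hAU h)
    have hwA' : w' ∉ A := fun h => hw' (hAU h)
    by_cases hae : a ∈ e
    · right
      have hce : c ∉ e := by
        rw [hleaf e he hae]; simp [hac.symm, hbc.symm]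
      have hwe : w ∈ e.image φ ∪ A :=
        Finset.mem_union_left _ (h2 ▸ Finset.mem_image_of_mem _ hae)
      refine ⟨(e.image φ ∪ A).erase w, ?_, Or.inl (Finset.insert_erase hwe).symm⟩
      rw [Finset.mem_powersetCard]
      refine ⟨?_, by rw [Finset.card_erase_of_mem hwe, hcard]⟩
      intro x hx
      rw [Finset.mem_erase, Finset.mem_union, Finset.mem_image] at hx
      obtain ⟨hxw, ⟨i, hi, rfl⟩ | hx⟩ := hx
      · refine hmem i hi ?_ ?_
        · rintro rfl; exact hxw h2
        · rintro rfl; exact hce hi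
      · exact hAU hx
    · by_cases hce : c ∈ e
      · right
        have hwe : w' ∈ e.image φ ∪ A :=
          Finset.mem_union_left _ (h3 ▸ Finset.mem_image_of_mem _ hce)
        refine ⟨(e.image φ ∪ A).erase w', ?_, Or.inr (Finset.insert_erase hwe).symm⟩
        rw [Finset.mem_powersetCard]
        refine ⟨?_, by rw [Finset.card_erase_of_mem hwe, hcard]⟩
        intro x hx
        rw [Finset.mem_erase, Finset.mem_union, Finset.mem_image] at hx
        obtain ⟨hxw, ⟨i, hi, rfl⟩ | hx⟩ := hx
        · refine hmem i hi ?_ ?_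
          · rintro rfl; exact hae hi
          · rintro rfl; exact hxw h3
        · exact hAU hx
      · left
        rw [Finset.mem_powersetCard]
        refine ⟨?_, hcard⟩
        apply Finset.union_subset _ hAU
        intro x hx
        obtain ⟨i, hi, rfl⟩ := Finset.mem_image.mp hx
        refine hmem i hi ?_ ?_
        · rintro rfl; exact hae hi
        · rintro rfl; exact hce hi

/-- Expansions in links give expansions. -/
theorem ExpIn_of_lk {k r : ℕ} {T : HGraph 2} (hT : IsTreeGraph k T) (hk : 2 ≤ k) (hr : 2 ≤ r)
    {E : Finset (Finset ℕ)} {v : ℕ} (h : ExpIn r T (lk E v)) : ExpIn (r+1) T E := by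
  obtain ⟨φ, A, h1, h2, h3, h4⟩ := h
  have hne : T.edges.Nonempty := by rw [← Finset.card_pos, hT.2.1]; omega
  have hvA : v ∉ A := by
    obtain ⟨e, he⟩ := hne
    intro h
    exact (mem_lk.mp (h4 e he)).1 (Finset.mem_union_right _ h)
  refine ⟨φ, insert v A, h1, ?_, ?_, ?_⟩
  · rw [Finset.card_insert_of_notMem hvA, h2]; omega
  · intro a ha h
    rcases Finset.mem_insert.mp h with h | h
    · obtain ⟨e, he, hae⟩ := tree_edge hT hk ha
      exact (mem_lk.mp (h4 e he)).1
        (Finset.mem_union_left _ (h ▸ Finset.mem_image_of_mem _ hae))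
    · exact h3 a ha h
  · intro e he
    have := (mem_lk.mp (h4 e he)).2
    rwa [Finset.union_insert]

theorem not_ExpIn_small {k r : ℕ} {T : HGraph 2} (hT : IsTreeGraph k T) (hk : 2 ≤ k)
    (hr : 2 ≤ r) {E : Finset (Finset ℕ)} {V : Finset ℕ} (hE : ∀ e ∈ E, e ⊆ V)
    (hV : V.card ≤ k + r - 3) : ¬ ExpIn r T E := by
  rintro ⟨φ, A, h1, h2, h3, h4⟩
  have hsub : T.verts.image φ ∪ A ⊆ V := by
    apply Finset.union_subset
    · intro x hx
      obtain ⟨a, ha, rfl⟩ := Finset.mem_image.mp hx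
      obtain ⟨e, he, hae⟩ := tree_edge hT hk ha
      exact hE _ (h4 e he) (Finset.mem_union_left _ (Finset.mem_image_of_mem _ hae))
    · have hne : T.edges.Nonempty := by rw [← Finset.card_pos, hT.2.1]; omega
      obtain ⟨e, he⟩ := hne
      exact Finset.subset_union_right.trans (hE _ (h4 e he))
  have := Finset.card_le_card hsub
  rw [Finset.card_union_of_disjoint, Finset.card_image_of_injOn h1, hT.1, h2] at this
  · omega
  · rw [Finset.disjoint_left]
    intro x hx
    obtain ⟨a, ha, rfl⟩ := Finset.mem_image.mp hx
    exact h3 a ha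

/-! ### The weighted Erdős–Sós bound -/

theorem es_sub {k : ℕ} {T : HGraph 2} (hES : ErdosSos k T) {E : Finset (Finset ℕ)}
    {V : Finset ℕ} (hE : E ⊆ V.powersetCard 2) (hfree : ¬ ExpIn 2 T E) (S : Finset ℕ) :
    2 * ((E.filter (fun e => e ⊆ S)).card : ℝ) ≤ ((k:ℝ) - 2) * S.card := by
  by_contra hcon
  push Not at hcon
  apply hfree
  obtain ⟨f, h1, h2, h3⟩ := hES ⟨S, E.filter (fun e => e ⊆ S),
    fun e he => (Finset.mem_filter.mp he).2,
    fun e he => (Finset.mem_powersetCard.mp (hE (Finset.mem_filter.mp he).1)).2⟩ hcon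
  refine ⟨f, ∅, h1, by simp, by simp, ?_⟩
  intro e he
  have := h3 e he
  simp only [Finset.mem_filter] at this
  simpa using this.1

theorem es_box {k : ℕ} {T : HGraph 2} (hES : ErdosSos k T) {E : Finset (Finset ℕ)}
    {V : Finset ℕ} (hE : E ⊆ V.powersetCard 2) (hfree : ¬ ExpIn 2 T E) {μ : ℝ} (hμ : 0 ≤ μ) :
    ∀ N : ℕ, ∀ x : ℕ → ℝ, (V.filter (fun i => x i ≠ 0 ∧ x i ≠ μ)).card = N →
      (∀ i ∈ V, 0 ≤ x i ∧ x i ≤ μ) → 2 * PP E x ≤ ((k:ℝ) - 2) * μ * ∑ i ∈ V, x i := by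
  intro N
  induction N with
  | zero =>
    intro x hN hx
    rw [Finset.card_eq_zero, Finset.filter_eq_empty_iff] at hN
    set S := V.filter (fun i => x i = μ) with hS
    have hxi : ∀ i ∈ V, x i = if i ∈ S then μ else 0 := by
      intro i hi
      have h := hN hi
      by_cases h1 : x i = μ
      · simp [hS, hi, h1]
      · have h2 : x i = 0 := by by_contra h2; exact h ⟨h2, h1⟩
        rw [if_neg, h2]
        simp only [hS, Finset.mem_filter, not_and]
        exact fun _ => h1
    have hp : PP E x = (E.filter (fun e => e ⊆ S)).card * μ ^ 2 := by
      unfold PP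
      rw [← nsmul_eq_mul, ← Finset.sum_const, Finset.sum_filter]
      apply Finset.sum_congr rfl
      intro e he
      obtain ⟨h1, h2⟩ := Finset.mem_powersetCard.mp (hE he)
      split_ifs with h3
      · rw [← h2, ← Finset.prod_const]
        apply Finset.prod_congr rfl
        intro i hi
        rw [hxi i (h1 hi), if_pos (h3 hi)]
      · obtain ⟨i, hi, hiS⟩ := Finset.not_subset.mp h3
        apply Finset.prod_eq_zero hi
        rw [hxi i (h1 hi), if_neg hiS]
    have hs : ∑ i ∈ V, x i = S.card * μ := by
      rw [Finset.sum_congr rfl hxi, ← Finset.sum_filter, Finset.sum_const, nsmul_eq_mul]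
      congr 3
      rw [Finset.filter_mem_eq_inter, Finset.inter_eq_right.mpr (Finset.filter_subset _ _)]
    rw [hp, hs]
    have := es_sub hES hE hfree S
    nlinarith [mul_le_mul_of_nonneg_right this (mul_nonneg hμ hμ)]
  | succ N ih =>
    intro x hN hx
    obtain ⟨i, hi⟩ : (V.filter (fun i => x i ≠ 0 ∧ x i ≠ μ)).Nonempty := by
      rw [← Finset.card_pos]; omega
    obtain ⟨hiV, hi0, hiμ⟩ := Finset.mem_filter.mp hi
    have key : ∀ t : ℝ, (t = 0 ∨ t = μ) →
        2 * (t * PP (lk E i) x + PP (dl E i) x)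
          ≤ ((k:ℝ) - 2) * μ * (t + ∑ j ∈ V.erase i, x j) := by
      intro t ht
      have hts : 0 ≤ t ∧ t ≤ μ := by rcases ht with rfl | rfl <;> simp [hμ]
      have := ih (Function.update x i t) ?_ ?_
      · rw [PP_update] at this
        rw [← Finset.add_sum_erase _ _ hiV] at this
        rw [Function.update_self] at this
        rwa [Finset.sum_congr rfl (fun j hj => Function.update_of_ne
          (Finset.mem_erase.mp hj).1 t x)] at this
      · have : V.filter (fun j => Function.update x i t j ≠ 0 ∧ Function.update x i t j ≠ μ)
          = (V.filter (fun i => x i ≠ 0 ∧ x i ≠ μ)).erase i := by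
          ext j
          simp only [Finset.mem_filter, Finset.mem_erase]
          by_cases hj : j = i
          · subst hj
            rw [Function.update_self]
            rcases ht with rfl | rfl <;> simp
          · rw [Function.update_of_ne hj]; simp [hj]
        rw [this, Finset.card_erase_of_mem hi, hN]; rfl
      · intro j hj
        by_cases hji : j = i
        · subst hji; rw [Function.update_self]; exact hts
        · rw [Function.update_of_ne hji]; exact hx j hj
    have k0 := key 0 (Or.inl rfl)
    have k1 := key μ (Or.inr rfl)
    rw [PP_split E i x, ← Finset.add_sum_erase _ _ hiV]
    obtain ⟨hx0, hx1⟩ := hx i hiV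
    have hμpos : 0 < μ := lt_of_le_of_ne hμ (by rintro rfl; exact hi0 (le_antisymm hx1 hx0))
    have e1 := mul_le_mul_of_nonneg_left k1 hx0
    have e0 := mul_le_mul_of_nonneg_left k0 (sub_nonneg.mpr hx1)
    have : μ * (2 * (x i * PP (lk E i) x + PP (dl E i) x)) ≤
        μ * (((k:ℝ) - 2) * μ * (x i + ∑ j ∈ V.erase i, x j)) := by
      nlinarith
    exact le_of_mul_le_mul_left this hμpos

/-! ### The Lagrangian bound -/

/-- The product `∏_{j<R} (s - j m)`. -/
noncomputable def QQ (R : ℕ) (m s : ℝ) : ℝ := ∏ j ∈ Finset.range R, (s - j * m)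

theorem QQ_succ (R : ℕ) (m s : ℝ) : QQ (R+1) m s = QQ R m s * (s - R * m) := by
  unfold QQ; rw [Finset.prod_range_succ]

theorem QQ_succ' (R : ℕ) (m s : ℝ) : QQ (R+1) m s = s * QQ R m (s - m) := by
  unfold QQ; rw [Finset.prod_range_succ', mul_comm]
  congr 1
  · simp
  · apply Finset.prod_congr rfl; intro j _; push_cast; ring

theorem QQ_nonneg {R : ℕ} {m s : ℝ} (hm : 0 ≤ m) (h : R * m ≤ s) : 0 ≤ QQ R m s := by
  unfold QQ
  apply Finset.prod_nonneg
  intro j hj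
  have : (j:ℝ) ≤ R := by exact_mod_cast (Finset.mem_range.mp hj).le
  nlinarith

theorem QQ_le {R : ℕ} {m s : ℝ} (hm : 0 ≤ m) (h : R * m ≤ s) : QQ R m s ≤ s ^ R := by
  unfold QQ
  calc _ ≤ ∏ j ∈ Finset.range R, s := by
        apply Finset.prod_le_prod
        · intro j hj
          have : (j:ℝ) ≤ R := by exact_mod_cast (Finset.mem_range.mp hj).le
          nlinarith
        · intro j hj
          have : (0:ℝ) ≤ j := by positivity
          nlinarith
    _ = s ^ R := by simp

theorem QQ_diff {a b s : ℝ} (ha : 0 ≤ a) (hab : a ≤ b) (R : ℕ) (h : R * b ≤ s) :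
    s * (QQ R a s - QQ R b s) ≤ (R:ℝ)^2 * (b - a) * s ^ R := by
  have hs : 0 ≤ s := le_trans (mul_nonneg (by positivity) (ha.trans hab)) h
  induction R with
  | zero => simp [QQ]
  | succ R ih =>
    push_cast at h
    have hb : (R:ℝ) * b ≤ s := by nlinarith
    have ih := ih hb
    have h1 := QQ_le (ha.trans hab) hb
    have h2 := QQ_nonneg (ha.trans hab) hb
    rw [QQ_succ, QQ_succ, show s ^ (R+1) = s ^ R * s from pow_succ _ _]
    have hRa : 0 ≤ s - R * a := by nlinarith
    have hRa2 : s - R * a ≤ s := by have : 0 ≤ R * a := by positivity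
                                    linarith
    have e1 : s * (QQ R a s - QQ R b s) * (s - R * a) ≤ (R:ℝ)^2 * (b - a) * s ^ R * s := by
      have hn : 0 ≤ (R:ℝ)^2 * (b - a) * s ^ R := by
        have := sub_nonneg.mpr hab; positivity
      calc _ ≤ (R:ℝ)^2 * (b - a) * s ^ R * (s - R * a) := by gcongr
        _ ≤ _ := by gcongr
    have e2 : s * QQ R b s * (R * (b - a)) ≤ s * s ^ R * (R * (b - a)) := by
      have := sub_nonneg.mpr hab
      gcongr
    have hn : 0 ≤ (b - a) * (s ^ R * s) := by
        have := sub_nonneg.mpr hab; positivity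
    have hR : (0:ℝ) ≤ R := by positivity
    push_cast
    nlinarith

theorem QQ_slope {a b s : ℝ} (ha : 0 ≤ a) (hab : a ≤ b) (R ℓ : ℕ) (hℓ : 4 * R ^ 2 ≤ ℓ)
    (h1 : 1 ≤ ℓ) (hRl : R ≤ ℓ) (hs : 0 ≤ s) (h : ℓ * b ≤ s) :
    (b - a) * s ^ R / 2 ≤ b * QQ R b s - a * QQ R a s := by
  rcases hs.eq_or_lt with h0 | hs
  · subst h0
    have hl : (1:ℝ) ≤ ℓ := by exact_mod_cast h1
    have : b = 0 := by nlinarith [ha.trans hab]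
    have : a = 0 := by linarith
    subst this; simp [*]
  have hb := ha.trans hab
  have hRb : R * b ≤ s := by
    have : (R:ℝ) ≤ ℓ := by exact_mod_cast hRl
    nlinarith
  have d1 := QQ_diff ha hab R hRb
  have d2 := QQ_diff le_rfl hb R hRb
  have hQ0 : QQ R 0 s = s ^ R := by simp [QQ]
  rw [hQ0] at d2
  have hℓ' : 4 * (R:ℝ)^2 ≤ ℓ := by exact_mod_cast hℓ
  have hp : 0 < s ^ R := by positivity
  have hk : 4 * ((R:ℝ)^2 * b) ≤ s := by nlinarith
  -- multiply by s
  have : s * ((b - a) * s ^ R / 2) ≤ s * (b * QQ R b s - a * QQ R a s) := by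
    have e1 : a * (s * (QQ R a s - QQ R b s)) ≤ b * ((R:ℝ)^2 * (b - a) * s ^ R) := by
      have : 0 ≤ (R:ℝ)^2 * (b - a) * s ^ R := by
        have := sub_nonneg.mpr hab; positivity
      nlinarith
    have e2 : (b - a) * (s * (s ^ R - QQ R b s)) ≤ (b - a) * ((R:ℝ)^2 * (b - 0) * s ^ R) := by
      have := sub_nonneg.mpr hab; gcongr
    have e3 : (b - a) * s ^ R * (4 * ((R:ℝ)^2 * b)) ≤ (b - a) * s ^ R * s := by
      have := sub_nonneg.mpr hab; gcongr
    nlinarith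
  exact le_of_mul_le_mul_left this hs

theorem QQ_hom (R : ℕ) (m c : ℝ) : QQ R m (c * m) = m ^ R * QQ R 1 c := by
  unfold QQ
  have : m ^ R = ∏ _j ∈ Finset.range R, m := by simp
  rw [this, ← Finset.prod_mul_distrib]
  apply Finset.prod_congr rfl; intro j _; ring

theorem LB {k : ℕ} {T : HGraph 2} (hT : IsTreeGraph k T) (hES : ErdosSos k T) (r : ℕ)
    (hk : 4 * (r + 2) ^ 2 ≤ k) :
    ∀ {E : Finset (Finset ℕ)} {V : Finset ℕ} {x : ℕ → ℝ} {m s : ℝ},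
      E ⊆ V.powersetCard (r+2) → ¬ ExpIn (r+2) T E → (∀ i, 0 ≤ x i) → ∑ i ∈ V, x i ≤ s → 0 ≤ m →
      m * ((k:ℝ) + r - 1) ≤ s → ((∀ i ∈ V, x i ≤ m) ∨ m * ((k:ℝ) + r - 1) = s) →
      ((r+2).factorial : ℝ) * PP E x ≤ ((k:ℝ) - 2) * (m * QQ (r+1) m s) := by
  induction r with
  | zero =>
    intro E V x m s hE hfree hx hs hm hms hc
    have hk' : (16:ℝ) ≤ k := by exact_mod_cast (by omega : 16 ≤ k)
    have hs0 : 0 ≤ s := (Finset.sum_nonneg fun i _ => hx i).trans hs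
    have hQ : QQ 1 m s = s := by simp [QQ]
    rw [show (0:ℕ)+1 = 1 from rfl, hQ]
    simp only [Nat.cast_zero, zero_add, add_zero, Nat.factorial_two, Nat.cast_ofNat] at hms hc ⊢
    rcases hc with hc | hc
    · have := es_box hES hE hfree hm _ x rfl (fun i hi => ⟨hx i, hc i hi⟩)
      have h2 : ((k:ℝ) - 2) * m * ∑ i ∈ V, x i ≤ ((k:ℝ) - 2) * m * s := by
        have : 0 ≤ (k:ℝ) - 2 := by linarith
        gcongr
      linarith
    · rcases V.eq_empty_or_nonempty with rfl | hV
      · have : E = ∅ := by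
          rw [Finset.eq_empty_iff_forall_notMem]
          intro e he
          have := Finset.mem_powersetCard.mp (hE he)
          have h3 := Finset.card_le_card this.1
          simp at h3
          rw [h3] at this; simp at this
        subst this
        have : 0 ≤ (k:ℝ) - 2 := by linarith
        simp only [PP, Finset.sum_empty, mul_zero]; positivity
      obtain ⟨y, hy, hyμ, hys, hxy, v, hv, hmax, hd⟩ := opt_exists hE hx (μ := s)
        (fun i hi => (Finset.single_le_sum (fun i _ => hx i) hi).trans hs) hs hV
      have hl := PP_le_pow hy 1 (lk_sub (r := 1) hE v)
      have he := Finset.add_sum_erase V y hv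
      have hb := es_box hES hE hfree (hy v) _ y rfl (fun i hi => ⟨hy i, hmax i hi⟩)
      have h2 : ((k:ℝ) - 2) * y v * ∑ i ∈ V, y i ≤ ((k:ℝ) - 2) * y v * s := by
        have : 0 ≤ (k:ℝ) - 2 := by linarith
        have := hy v
        gcongr
      have h3 : s * PP (lk E v) y ≤ s * (s - y v) := by
        gcongr; rw [pow_one] at hl; linarith
      push_cast at hd
      have h4 : ((k:ℝ) - 1) * (2 * PP E y) ≤ ((k:ℝ) - 2) * s * s := by nlinarith
      have h5 : ((k:ℝ) - 1) * (2 * PP E y) ≤ ((k:ℝ) - 1) * (((k:ℝ) - 2) * (m * s)) := by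
        have : ((k:ℝ) - 1) * (((k:ℝ) - 2) * (m * s)) = ((k:ℝ) - 2) * s * s := by
          rw [← hc]; ring
        linarith
      have := le_of_mul_le_mul_left h5 (by linarith)
      linarith
  | succ r ih =>
    intro E V x m s hE hfree hx hs hm hms hc
    have hk2 : 4 * (r+2)^2 ≤ k := le_trans (by gcongr; omega) hk
    replace ih := @ih hk2
    have hk16 : 16 ≤ k := by
      have : 2 ^ 2 ≤ (r+2)^2 := Nat.pow_le_pow_left (by omega) 2
      omega
    have hk' : (16:ℝ) ≤ k := by exact_mod_cast hk16
    have hk0 : 0 ≤ (k:ℝ) - 2 := by linarith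
    have hs0 : 0 ≤ s := (Finset.sum_nonneg fun i _ => hx i).trans hs
    have hr0 : (0:ℝ) ≤ r := by positivity
    push_cast at hms hc
    have hms : m * ((k:ℝ) + r) ≤ s := by linarith
    have hRl : ((r+2 : ℕ):ℝ) ≤ (k:ℝ) + r := by push_cast; linarith
    have hRHS : 0 ≤ ((k:ℝ) - 2) * (m * QQ (r+1+1) m s) := by
      have := QQ_nonneg (R := r+1+1) hm (s := s) (by push_cast at *; nlinarith)
      positivity
    rcases V.eq_empty_or_nonempty with rfl | hV
    · have : E = ∅ := by
        rw [Finset.eq_empty_iff_forall_notMem]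
        intro e he
        have := Finset.mem_powersetCard.mp (hE he)
        have h3 := Finset.card_le_card this.1
        simp at h3
        rw [h3] at this; simp at this
      subst this
      simpa [PP] using hRHS
    obtain ⟨μ, hμx, hμc⟩ : ∃ μ, (∀ i ∈ V, x i ≤ μ) ∧ (μ ≤ m ∨ m * ((k:ℝ) + r) = s) := by
      rcases hc with hc | hc
      · exact ⟨m, hc, Or.inl le_rfl⟩
      · exact ⟨s, fun i hi => (Finset.single_le_sum (fun i _ => hx i) hi).trans hs,
          Or.inr (by linarith)⟩
    obtain ⟨y, hy, hyμ, hys, hxy, v, hv, hmax, hd⟩ := opt_exists hE hx hμx hs hV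
    have hlf : ¬ ExpIn (r+2) T (lk E v) := fun h =>
      hfree (ExpIn_of_lk hT (by omega) (by omega) h)
    have he := Finset.add_sum_erase V y hv
    have hsum : ∑ i ∈ V.erase v, y i ≤ s - y v := by linarith
    have hfac : ((r+1+2).factorial : ℝ) = (r+3) * (r+2).factorial := by
      rw [show r+1+2 = (r+2)+1 by ring, Nat.factorial_succ]; push_cast; ring
    have hmain : ∀ m', ((r+2).factorial : ℝ) * PP (lk E v) y ≤
        ((k:ℝ) - 2) * (m' * QQ (r+1) m' (s - m')) →
        ((r+1+2).factorial : ℝ) * PP E x ≤ ((k:ℝ) - 2) * (m' * QQ (r+1+1) m' s) := by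
      intro m' hm'
      rw [QQ_succ', hfac]
      have hf : (0:ℝ) < (r+2).factorial := by exact_mod_cast Nat.factorial_pos _
      have h1 : ((r+2).factorial : ℝ) * ((r+3) * PP E x) ≤
          ((r+2).factorial : ℝ) * (s * PP (lk E v) y) := by
        apply mul_le_mul_of_nonneg_left _ hf.le
        push_cast at hd
        have : ((r:ℝ) + 3) * PP E x ≤ (r+3) * PP E y := by gcongr
        linarith
      have h2 := mul_le_mul_of_nonneg_left hm' hs0
      linarith
    by_cases hcase : y v * ((k:ℝ) + r) ≤ s
    · have h1 := hmain (y v) (ih (lk_sub hE v) hlf hy hsum (hy v) (by nlinarith)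
        (Or.inl fun i hi => hmax i (Finset.mem_of_mem_erase hi)))
      refine h1.trans ?_
      have hle : y v ≤ m := by
        rcases hμc with h | h
        · exact (hyμ v hv).trans h
        · have : 0 < (k:ℝ) + r := by linarith
          exact le_of_mul_le_mul_right (hcase.trans h.symm.le) this
      have hsl := QQ_slope (hy v) hle (r+1+1) (k+r)
        (by have : 4 * (r+1+1)^2 ≤ k := hk2
            omega) (by omega) (by omega) hs0
        (by push_cast; linarith)
      have : 0 ≤ (m - y v) * s ^ (r+1+1) / 2 := by
        have := sub_nonneg.mpr hle; positivity
      exact mul_le_mul_of_nonneg_left (by linarith) hk0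
    · push Not at hcase
      have hms' : m * ((k:ℝ) + r) = s := by
        rcases hμc with h | h
        · have h1 := hyμ v hv
          have : y v ≤ m := h1.trans h
          nlinarith
        · exact h
      have hK : 0 < (k:ℝ) + r - 1 := by linarith
      have hyv : y v ≤ s := (Finset.single_le_sum (fun i _ => hy i) hv).trans hys
      have hmy : m ≤ y v := by
        have h1 : m * ((k:ℝ) + r) ≤ y v * ((k:ℝ) + r) := by linarith
        exact le_of_mul_le_mul_right h1 (by linarith)
      apply hmain
      have h1 := ih (m := (s - y v) / ((k:ℝ) + r - 1)) (lk_sub hE v) hlf hy hsum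
        (div_nonneg (by linarith) hK.le) (by rw [div_mul_cancel₀ _ hK.ne'])
        (Or.inr (by rw [div_mul_cancel₀ _ hK.ne']))
      refine h1.trans ?_
      set m' := (s - y v) / ((k:ℝ) + r - 1) with hm'
      have hm'0 : 0 ≤ m' := div_nonneg (by linarith) hK.le
      have hm'1 : s - y v = ((k:ℝ) + r - 1) * m' := by rw [hm']; field_simp
      have hm1 : s - m = ((k:ℝ) + r - 1) * m := by rw [← hms']; ring
      have hmm : m' ≤ m := by
        have : ((k:ℝ) + r - 1) * m' ≤ ((k:ℝ) + r - 1) * m := by linarith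
        exact le_of_mul_le_mul_left this hK
      rw [hm'1, hm1, QQ_hom, QQ_hom]
      have : 0 ≤ QQ (r+1) 1 ((k:ℝ) + r - 1) := QQ_nonneg (by norm_num) (by push_cast; linarith)
      gcongr

/-- The Lagrangian of the complete `r`-graph on `ℓ` vertices. -/
noncomputable def lam (ℓ r : ℕ) : ℝ := QQ r (1 / (ℓ:ℝ)) 1 / r.factorial

theorem lam_pos {ℓ r : ℕ} (h : r ≤ ℓ) (hℓ : 1 ≤ ℓ) : 0 < lam ℓ r := by
  unfold lam QQ
  apply div_pos _ (by exact_mod_cast Nat.factorial_pos _)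
  apply Finset.prod_pos
  intro j hj
  have h1 : (j:ℝ) < ℓ := by exact_mod_cast (Finset.mem_range.mp hj).trans_le h
  have h2 : (0:ℝ) < ℓ := by exact_mod_cast hℓ
  rw [sub_pos, mul_one_div, div_lt_one h2]; exact h1

theorem lam_le_one {ℓ r : ℕ} (h : r ≤ ℓ) (hℓ : 1 ≤ ℓ) : lam ℓ r ≤ 1 := by
  unfold lam
  have h2 : (0:ℝ) < ℓ := by exact_mod_cast hℓ
  have h1 : QQ r (1 / (ℓ:ℝ)) 1 ≤ 1 ^ r := QQ_le (by positivity) (by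
    rw [mul_one_div, div_le_one h2]; exact_mod_cast h)
  have h3 : (1:ℝ) ≤ r.factorial := by exact_mod_cast Nat.factorial_pos _
  rw [div_le_one (by linarith)]
  rw [one_pow] at h1; linarith

theorem lam_one {ℓ : ℕ} : lam ℓ 1 = 1 := by
  simp [lam, QQ]

theorem lam_succ {ℓ : ℕ} (r : ℕ) (hℓ : 1 ≤ ℓ) :
    ((r:ℝ) + 1) * lam (ℓ+1) (r+1) = lam ℓ r * (1 - 1 / ((ℓ:ℝ)+1)) ^ r := by
  unfold lam
  have hl : (0:ℝ) < ℓ := by exact_mod_cast hℓ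
  have hf : ((r+1).factorial : ℝ) = (r+1) * r.factorial := by
    rw [Nat.factorial_succ]; push_cast; ring
  have hf0 : (0:ℝ) < r.factorial := by exact_mod_cast Nat.factorial_pos _
  rw [QQ_succ', hf]
  have e1 : (1:ℝ) - 1 / ((ℓ+1:ℕ):ℝ) = ℓ * (1 / ((ℓ:ℝ)+1)) := by push_cast; field_simp; ring
  have e2 : (1:ℝ) - 1 / ((ℓ:ℝ)+1) = ℓ * (1 / ((ℓ:ℝ)+1)) := by field_simp; ring
  have e3 : QQ r (1 / (ℓ:ℝ)) 1 = (1 / (ℓ:ℝ)) ^ r * QQ r 1 ℓ := by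
    have := QQ_hom r (1 / (ℓ:ℝ)) ℓ
    rwa [mul_one_div_cancel hl.ne'] at this
  rw [e1, e2]
  rw [show 1 / ((ℓ+1:ℕ):ℝ) = 1 / ((ℓ:ℝ)+1) by push_cast; rfl]
  rw [QQ_hom, e3, mul_pow]
  have : (1 / (ℓ:ℝ)) ^ r * ℓ ^ r = 1 := by rw [← mul_pow, one_div_mul_cancel hl.ne', one_pow]
  have hr : (0:ℝ) < r + 1 := by positivity
  field_simp
  rw [mul_assoc, this, mul_one]

theorem lam_choose {ℓ r : ℕ} (h : r ≤ ℓ) (hℓ : 1 ≤ ℓ) : lam ℓ r * (ℓ:ℝ) ^ r = ℓ.choose r := by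
  have h1 : (ℓ.descFactorial r : ℝ) = r.factorial * ℓ.choose r := by
    exact_mod_cast Nat.descFactorial_eq_factorial_mul_choose ℓ r
  have h2 : (ℓ.descFactorial r : ℝ) = QQ r 1 ℓ := by
    rw [Nat.descFactorial_eq_prod_range]
    unfold QQ
    push_cast
    apply Finset.prod_congr rfl
    intro j hj
    rw [Nat.cast_sub (by have := Finset.mem_range.mp hj; omega)]; ring
  have hl : (0:ℝ) < ℓ := by exact_mod_cast hℓ
  have e3 : QQ r (1 / (ℓ:ℝ)) 1 = (1 / (ℓ:ℝ)) ^ r * QQ r 1 ℓ := by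
    have := QQ_hom r (1 / (ℓ:ℝ)) ℓ
    rwa [mul_one_div_cancel hl.ne'] at this
  have hf0 : (0:ℝ) < r.factorial := by exact_mod_cast Nat.factorial_pos _
  unfold lam
  rw [e3, ← h2, h1]
  have : (1 / (ℓ:ℝ)) ^ r * ℓ ^ r = 1 := by rw [← mul_pow, one_div_mul_cancel hl.ne', one_pow]
  field_simp
  rw [mul_right_comm, this, one_mul]

theorem lam_QQ {k r : ℕ} (hk : 2 ≤ k) :
    ((k:ℝ) - 2) * (1 / ((k:ℝ) + r - 1) * QQ (r+1) (1 / ((k:ℝ) + r - 1)) 1)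
      = (r+2).factorial * lam (k+r-1) (r+2) := by
  unfold lam
  have hf0 : (0:ℝ) < (r+2).factorial := by exact_mod_cast Nat.factorial_pos _
  have hk' : (2:ℝ) ≤ k := by exact_mod_cast hk
  have hr : (0:ℝ) ≤ r := by positivity
  have hc : ((k + r - 1 : ℕ) : ℝ) = (k:ℝ) + r - 1 := by
    rw [Nat.cast_sub (by omega)]; push_cast; ring
  have hp : (0:ℝ) < (k:ℝ) + r - 1 := by linarith
  rw [hc, mul_div_cancel₀ _ hf0.ne', show r + 2 = (r+1)+1 by ring,
    QQ_succ (r+1)]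
  have : (1:ℝ) - ((r+1:ℕ):ℝ) * (1 / ((k:ℝ) + r - 1)) = ((k:ℝ) - 2) * (1 / ((k:ℝ) + r - 1)) := by
    push_cast; field_simp; ring
  rw [this]; ring

theorem LBn {k : ℕ} {T : HGraph 2} (hT : IsTreeGraph k T) (hES : ErdosSos k T) (r : ℕ)
    (hk : 4 * (r + 2) ^ 2 ≤ k) {E : Finset (Finset ℕ)} {V : Finset ℕ} {x : ℕ → ℝ} {s : ℝ}
    (hE : E ⊆ V.powersetCard (r+2)) (hf : ¬ ExpIn (r+2) T E) (hx : ∀ i, 0 ≤ x i)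
    (hs : ∑ i ∈ V, x i ≤ s) : PP E x ≤ lam (k+r-1) (r+2) * s ^ (r+2) := by
  have hk16 : 16 ≤ k := by
    have : 2 ^ 2 ≤ (r+2)^2 := Nat.pow_le_pow_left (by omega) 2
    omega
  have hk' : (16:ℝ) ≤ k := by exact_mod_cast hk16
  have hr : (0:ℝ) ≤ r := by positivity
  have hp : (0:ℝ) < (k:ℝ) + r - 1 := by linarith
  have hs0 : 0 ≤ s := (Finset.sum_nonneg fun i _ => hx i).trans hs
  have h := LB hT hES r hk (m := s * (1 / ((k:ℝ) + r - 1))) hE hf hx hs (by positivity)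
    (by field_simp; exact le_rfl) (Or.inr (by field_simp))
  have hq := lam_QQ (k := k) (r := r) (by omega)
  have hf0 : (0:ℝ) < (r+2).factorial := by exact_mod_cast Nat.factorial_pos _
  have e : QQ (r+1) (s * (1 / ((k:ℝ) + r - 1))) s
      = s ^ (r+1) * QQ (r+1) (1 / ((k:ℝ) + r - 1)) 1 := by
    unfold QQ
    have : s ^ (r+1) = ∏ _j ∈ Finset.range (r+1), s := by simp
    rw [this, ← Finset.prod_mul_distrib]
    apply Finset.prod_congr rfl; intro j _; ring
  rw [e] at h
  have h2 : ((r+2).factorial : ℝ) * PP E x ≤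
      (r+2).factorial * (lam (k+r-1) (r+2) * s ^ (r+2)) := by
    rw [← mul_assoc, ← hq]
    refine h.trans (le_of_eq ?_)
    rw [show r + 2 = (r+1)+1 by ring]; ring
  exact le_of_mul_le_mul_left h2 hf0

theorem LBslope {k : ℕ} {T : HGraph 2} (hT : IsTreeGraph k T) (hES : ErdosSos k T) (r : ℕ)
    (hk : 4 * (r + 2) ^ 2 ≤ k) {E : Finset (Finset ℕ)} {V : Finset ℕ} {x : ℕ → ℝ} {m : ℝ}
    (hE : E ⊆ V.powersetCard (r+2)) (hf : ¬ ExpIn (r+2) T E) (hx : ∀ i, 0 ≤ x i)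
    (hs : ∑ i ∈ V, x i ≤ 1) (hm : 0 ≤ m) (hm2 : m ≤ 1 / ((k:ℝ) + r - 1)) (hxm : ∀ i ∈ V, x i ≤ m) :
    (1 / ((k:ℝ) + r - 1) - m) ≤ 2 * (r+2).factorial * (lam (k+r-1) (r+2) - PP E x) := by
  have hk16 : 16 ≤ k := by
    have : 2 ^ 2 ≤ (r+2)^2 := Nat.pow_le_pow_left (by omega) 2
    omega
  have hk' : (16:ℝ) ≤ k := by exact_mod_cast hk16
  have hr : (0:ℝ) ≤ r := by positivity
  have hp : (0:ℝ) < (k:ℝ) + r - 1 := by linarith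
  have h := LB hT hES r hk (m := m) hE hf hx hs hm
    (by rw [le_div_iff₀ hp] at hm2; exact hm2) (Or.inl hxm)
  have hq := lam_QQ (k := k) (r := r) (by omega)
  have hs := QQ_slope (s := 1) hm hm2 (r+1) (k+r-1) (by
    have : (r+2)^2 = (r+1)^2 + (2*r + 3) := by ring
    omega) (by omega) (by omega) (by norm_num) (by
      rw [Nat.cast_sub (by omega)]; push_cast; field_simp; exact le_rfl)
  rw [one_pow, mul_one] at hs
  have h1 : 0 ≤ 1 / ((k:ℝ) + r - 1) - m := by linarith
  nlinarith

theorem expand_le (r : ℕ) {t : ℝ} (h0 : 0 ≤ t) (h1 : t ≤ 1) :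
    (1 + t) ^ r ≤ 1 + r * t + 4 ^ r * t ^ 2 := by
  induction r with
  | zero => simp; positivity
  | succ r ih =>
    have e : (r:ℝ) ≤ 4 ^ r := by exact_mod_cast (Nat.lt_pow_self (by norm_num)).le
    rw [show (1+t)^(r+1) = (1+t)^r * (1+t) from pow_succ _ _,
      show (4:ℝ)^(r+1) = 4^r * 4 from pow_succ _ _]
    push_cast
    have h2 : (4:ℝ) ^ r * t ^ 2 * t ≤ (4:ℝ) ^ r * t ^ 2 * 1 := by gcongr
    have h3 : 0 ≤ 1 + t := by linarith
    have h4 := mul_le_mul_of_nonneg_right ih h3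
    have h5 : (0:ℝ) ≤ 4 ^ r * t ^ 2 := by positivity
    have h6 : (r:ℝ) * t ^2 ≤ 4 ^ r * t ^ 2 := by gcongr
    nlinarith

/-! ### Concentration of near-optimal weights -/

/-- Constant. -/
noncomputable def Ca (r : ℕ) : ℝ := 4 ^ (r+2) + r + 3

/-- Constant. -/
noncomputable def Cb (r : ℕ) : ℝ := 2 * (r+2).factorial * (1 + Ca r)

theorem Ca_pos (r : ℕ) : 0 < Ca r := by unfold Ca; positivity

theorem Cb_pos (r : ℕ) : 0 < Cb r := by
  unfold Cb; have := Ca_pos r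
  have : (0:ℝ) < (r+2).factorial := by exact_mod_cast Nat.factorial_pos _
  positivity

theorem near_opt {k : ℕ} {T : HGraph 2} (hT : IsTreeGraph k T) (hES : ErdosSos k T) (r : ℕ)
    (hk : 4 * (r + 2) ^ 2 ≤ k) {E : Finset (Finset ℕ)} {V : Finset ℕ} {x : ℕ → ℝ} {s : ℝ}
    (hE : E ⊆ V.powersetCard (r+2)) (hf : ¬ ExpIn (r+2) T E) (hx : ∀ i, 0 ≤ x i)
    (hs : ∑ i ∈ V, x i ≤ 1) (hs0 : 0 < s) (hs1 : s ≤ 1) (hs2 : Cb r * s < 1 / ((k:ℝ) + r - 1))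
    (hP : lam (k+r-1) (r+2) - s ^ 4 ≤ PP E x) :
    ∃ B ⊆ V, ∑ i ∈ B, x i ≤ Ca r * s ∧
      (∀ i ∈ V \ B, (r+2) * lam (k+r-1) (r+2) - s ≤ PP (lk E i) x) ∧
      ∃ v ∈ V \ B, (∀ i ∈ V \ B, x i ≤ x v) ∧ 1 / ((k:ℝ) + r - 1) - Cb r * s ≤ x v := by
  have hk16 : 16 ≤ k := by
    have : 2 ^ 2 ≤ (r+2)^2 := Nat.pow_le_pow_left (by omega) 2
    omega
  have hk' : (16:ℝ) ≤ k := by exact_mod_cast hk16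
  have hl0 : 0 < lam (k+r-1) (r+2) := lam_pos (by omega) (by omega)
  have hl1 : lam (k+r-1) (r+2) ≤ 1 := lam_le_one (by omega) (by omega)
  set Λ := lam (k+r-1) (r+2) with hΛ
  have hr : (0:ℝ) ≤ r := by positivity
  have hp : (0:ℝ) < (k:ℝ) + r - 1 := by linarith
  have h4 : (0:ℝ) < 4 ^ (r+2) := by positivity
  have hda : ∀ v ∈ V, PP (lk E v) x ≤ (r+2) * Λ + (4 ^ (r+2) + 1) * s ^ 2 := by
    intro v hv
    have hsq : 0 < s ^ 2 := by positivity
    have hsq1 : s ^ 2 ≤ 1 := by nlinarith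
    have h1 := LBn hT hES r hk (x := Function.update x v (x v + s ^ 2)) (s := 1 + s ^ 2) hE hf
      (by intro i
          by_cases h : i = v
          · subst h; rw [Function.update_self]; have := hx i; positivity
          · rw [Function.update_of_ne h]; exact hx i)
      (by rw [← Finset.add_sum_erase _ _ hv, Function.update_self,
            Finset.sum_congr rfl (fun j hj => Function.update_of_ne
              (Finset.mem_erase.mp hj).1 _ x)]
          rw [← Finset.add_sum_erase _ _ hv] at hs
          linarith)
    rw [PP_update] at h1
    have h2 := PP_split E v x
    have h3 := expand_le (r+2) hsq.le hsq1
    have h5 := mul_le_mul_of_nonneg_left h3 hl0.le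
    push_cast at h5
    have h6 : s ^ 2 * PP (lk E v) x ≤ s ^ 2 * ((r+2) * Λ + (4 ^ (r+2) + 1) * s ^ 2) := by
      have h7 : Λ * (4 ^ (r+2) * (s^2)^2) ≤ 1 * (4 ^ (r+2) * (s^2)^2) := by gcongr
      have h8 : s ^ 4 = (s^2)^2 := by ring
      rw [h8] at hP
      nlinarith
    exact le_of_mul_le_mul_left h6 hsq
  set B := V.filter (fun i => PP (lk E i) x < (r+2) * Λ - s) with hB
  have hBV : B ⊆ V := Finset.filter_subset _ _
  have hxB : ∑ i ∈ B, x i ≤ Ca r * s := by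
    have he := PP_euler hE x
    have h1 : ∑ v ∈ V, x v * PP (lk E v) x ≤
        ∑ v ∈ V, (x v * ((r+2) * Λ + (4 ^ (r+2) + 1) * s ^ 2) - if v ∈ B then x v * s else 0) := by
      apply Finset.sum_le_sum
      intro v hv
      split_ifs with h
      · have h2 := (Finset.mem_filter.mp h).2
        have h3 : 0 ≤ (4 ^ (r+2) + 1) * s ^ 2 := by positivity
        have := hx v
        nlinarith
      · rw [sub_zero]; exact mul_le_mul_of_nonneg_left (hda v hv) (hx v)
    rw [Finset.sum_sub_distrib, ← Finset.sum_mul, Finset.sum_ite_mem,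
      Finset.inter_eq_right.mpr hBV, ← Finset.sum_mul, he] at h1
    push_cast at h1
    have h2 : (∑ i ∈ V, x i) * ((r+2) * Λ + (4 ^ (r+2) + 1) * s ^ 2) ≤
        1 * ((r+2) * Λ + (4 ^ (r+2) + 1) * s ^ 2) := by gcongr
    have h3 : s ^ 4 ≤ s ^ 2 := pow_le_pow_of_le_one hs0.le hs1 (by norm_num)
    have h4 : s * ∑ i ∈ B, x i ≤ s * (Ca r * s) := by
      unfold Ca
      nlinarith
    exact le_of_mul_le_mul_left h4 hs0
  have hE' : E.filter (fun e => Disjoint e B) ⊆ (V \ B).powersetCard (r+2) := by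
    intro e he
    rw [Finset.mem_filter] at he
    obtain ⟨h1, h2⟩ := Finset.mem_powersetCard.mp (hE he.1)
    exact Finset.mem_powersetCard.mpr ⟨Finset.subset_sdiff.mpr ⟨h1, he.2⟩, h2⟩
  have hf' : ¬ ExpIn (r+2) T (E.filter (fun e => Disjoint e B)) := fun h =>
    hf (h.mono (Finset.filter_subset _ _))
  have hsV : ∑ i ∈ V \ B, x i ≤ 1 :=
    (Finset.sum_le_sum_of_subset_of_nonneg Finset.sdiff_subset (fun i _ _ => hx i)).trans hs
  have hPE' : Λ - (1 + Ca r) * s ≤ PP (E.filter (fun e => Disjoint e B)) x := by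
    have h1 := PP_meet (B := B) hx (r+1) hE
    have h2 : (∑ i ∈ B, x i) * (∑ i ∈ V, x i) ^ (r+1) ≤ (∑ i ∈ B, x i) * 1 := by
      gcongr
      · exact Finset.sum_nonneg fun i _ => hx i
      · exact pow_le_one₀ (Finset.sum_nonneg fun i _ => hx i) hs
    have h3 : s ^ 4 ≤ s := by simpa using pow_le_pow_of_le_one hs0.le hs1 (show 1 ≤ 4 by norm_num)
    nlinarith
  have hf0 : (0:ℝ) < (r+2).factorial := by exact_mod_cast Nat.factorial_pos _
  have hCb : 2 * (r+2).factorial * (Λ - PP (E.filter (fun e => Disjoint e B)) x) ≤ Cb r * s := by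
    unfold Cb
    calc _ ≤ 2 * ((r+2).factorial : ℝ) * ((1 + Ca r) * s) := by gcongr; linarith
      _ = _ := by ring
  have hne : (V \ B).Nonempty := by
    by_contra hne
    rw [Finset.not_nonempty_iff_eq_empty] at hne
    have := LBslope hT hES r hk hE' hf' hx hsV le_rfl (by positivity) (by
      intro i hi; rw [hne] at hi; simp at hi)
    linarith
  obtain ⟨v, hv, hmax⟩ := Finset.exists_max_image (V \ B) x hne
  refine ⟨B, hBV, hxB, ?_, v, hv, hmax, ?_⟩
  · intro i hi
    rw [Finset.mem_sdiff] at hi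
    by_contra h
    exact hi.2 (Finset.mem_filter.mpr ⟨hi.1, not_le.mp h⟩)
  · by_cases hc : x v ≤ 1 / ((k:ℝ) + r - 1)
    · have := LBslope hT hES r hk hE' hf' hx hsV (hx v) hc hmax
      linarith
    · push Not at hc
      have := Cb_pos r
      have : 0 < Cb r * s := by positivity
      linarith

theorem conc_base {k : ℕ} {T : HGraph 2} (hT : IsTreeGraph k T) (hES : ErdosSos k T)
    (hk : 16 ≤ k) {E : Finset (Finset ℕ)} {V : Finset ℕ} {x : ℕ → ℝ} {s : ℝ}
    (hE : E ⊆ V.powersetCard 2) (hf : ¬ ExpIn 2 T E) (hx : ∀ i, 0 ≤ x i)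
    (hs : ∑ i ∈ V, x i ≤ 1) (hs0 : 0 < s) (hs1 : s ≤ 1) (hs2 : Cb 0 * s < 1 / ((k:ℝ) - 1))
    (hs3 : (Ca 0 + k) * s < 1 / ((k:ℝ) - 1))
    (hP : lam (k-1) 2 - s ^ 4 ≤ PP E x) :
    ∃ L ⊆ V, L.card = k - 1 ∧ ∀ i ∈ L, 1 / ((k:ℝ) - 1) - (Cb 0 + k) * s ≤ x i := by
  have hk' : (16:ℝ) ≤ k := by exact_mod_cast hk
  have hlam : 2 * lam (k-1) 2 = 1 - 1 / ((k:ℝ) - 1) := by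
    have h := lam_succ (ℓ := k - 2) 1 (by omega)
    rw [lam_one, show k - 2 + 1 = k - 1 by omega, Nat.cast_sub (by omega)] at h
    push_cast at h
    rw [show (k:ℝ) - 2 + 1 = k - 1 by ring] at h
    linarith
  obtain ⟨B, hBV, hB, hd, v, hv, hmax, hvl⟩ := near_opt hT hES 0 (by omega) hE hf hx hs hs0 hs1
    (by simpa using hs2) (by simpa using hP)
  simp only [Nat.cast_zero, zero_add, add_zero] at hd hvl
  rw [hlam] at hd
  set Nb : ℕ → Finset ℕ := fun u => V.filter (fun w => w ≠ u ∧ insert u {w} ∈ E) with hNb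
  have hlkNb : ∀ u, PP (lk E u) x ≤ ∑ i ∈ Nb u, x i := by
    intro u
    have h1 : lk E u ⊆ (Nb u).powersetCard 1 := by
      intro f hf
      have h2 := Finset.mem_powersetCard.mp (lk_sub (r := 1) hE u hf)
      obtain ⟨w, rfl⟩ := Finset.card_eq_one.mp h2.2
      have h3 := mem_lk.mp hf
      have h4 := h2.1 (Finset.mem_singleton_self w)
      refine Finset.mem_powersetCard.mpr ⟨?_, by simp⟩
      rw [Finset.singleton_subset_iff, hNb, Finset.mem_filter]
      exact ⟨Finset.mem_of_mem_erase h4, (Finset.mem_erase.mp h4).1, h3.2⟩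
    simpa using PP_le_pow hx 1 h1
  have hNbd : ∀ u ∈ V \ B, 1 - 1 / ((k:ℝ) - 1) - s ≤ ∑ i ∈ Nb u, x i := fun u hu =>
    (hd u hu).trans (hlkNb u)
  have hcl : ∀ j : ℕ, j + 1 ≤ k - 1 → ∃ C ⊆ V \ B, v ∈ C ∧ C.card = j + 1 ∧
      ∀ a ∈ C, ∀ b ∈ C, a ≠ b → insert a {b} ∈ E := by
    intro j
    induction j with
    | zero => intro _; exact ⟨{v}, by simpa using hv, by simp, by simp, by simp +contextual⟩
    | succ j ih =>
      intro hj
      obtain ⟨C, hCV, hvC, hCc, hC⟩ := ih (by omega)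
      obtain ⟨w, hw, hwC⟩ : ∃ w ∈ V \ B, ∀ u ∈ C, w ∈ Nb u := by
        by_contra hcon
        push Not at hcon
        have hsub : V ⊆ B ∪ C.biUnion (fun u => V \ Nb u) := by
          intro w hw
          by_cases hwB : w ∈ B
          · exact Finset.mem_union_left _ hwB
          · obtain ⟨u, hu, hwu⟩ := hcon w (Finset.mem_sdiff.mpr ⟨hw, hwB⟩)
            exact Finset.mem_union_right _ (Finset.mem_biUnion.mpr
              ⟨u, hu, Finset.mem_sdiff.mpr ⟨hw, hwu⟩⟩)
        have h1 : ∑ i ∈ V, x i ≤ ∑ i ∈ B, x i + ∑ u ∈ C, ∑ i ∈ V \ Nb u, x i := by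
          calc ∑ i ∈ V, x i ≤ ∑ i ∈ B ∪ C.biUnion (fun u => V \ Nb u), x i :=
                Finset.sum_le_sum_of_subset_of_nonneg hsub (fun i _ _ => hx i)
            _ ≤ ∑ i ∈ B, x i + ∑ i ∈ C.biUnion (fun u => V \ Nb u), x i := by
                have h := Finset.sum_union_inter (s₁ := B) (s₂ := C.biUnion (fun u => V \ Nb u))
                  (f := x)
                have h2 : 0 ≤ ∑ i ∈ B ∩ C.biUnion (fun u => V \ Nb u), x i :=
                  Finset.sum_nonneg fun b _ => hx b
                linarith
            _ ≤ _ := by gcongr; exact sum_biUnion_le' _ _ _ hx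
        have h2 : ∑ u ∈ C, ∑ i ∈ V \ Nb u, x i ≤
            ∑ u ∈ C, (∑ i ∈ V, x i - (1 - 1 / ((k:ℝ) - 1) - s)) := by
          apply Finset.sum_le_sum
          intro u hu
          have h3 := Finset.sum_sdiff (s₁ := Nb u) (s₂ := V) (f := x) (Finset.filter_subset _ _)
          have h4 := hNbd u (hCV hu)
          linarith
        rw [Finset.sum_const, hCc, nsmul_eq_mul] at h2
        push_cast at h2
        have hj' : (j:ℝ) + 1 ≤ k - 2 := by
          have : j + 1 + 2 ≤ k := by omega
          have : ((j + 1 + 2 : ℕ):ℝ) ≤ k := by exact_mod_cast this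
          push_cast at this; linarith
        have hj0 : (0:ℝ) ≤ j := by positivity
        set X := ∑ i ∈ V, x i
        have h5 : (j:ℝ) * X ≤ j := by nlinarith
        have hk1 : 0 < 1 / ((k:ℝ) - 1) := by apply one_div_pos.mpr; linarith
        have h6 : ((k:ℝ) - 1) * (1 / ((k:ℝ) - 1)) = 1 := by
          rw [mul_one_div_cancel]; linarith
        set c := 1 / ((k:ℝ) - 1)
        nlinarith
      have hwn : w ∉ C := fun h => (Finset.mem_filter.mp (hwC w h)).2.1 rfl
      refine ⟨insert w C, ?_, Finset.mem_insert_of_mem hvC, ?_, ?_⟩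
      · exact Finset.insert_subset hw hCV
      · rw [Finset.card_insert_of_notMem hwn, hCc]
      · have hwE : ∀ u ∈ C, insert u {w} ∈ E := fun u hu => (Finset.mem_filter.mp (hwC u hu)).2.2
        intro a ha b hb hab
        rw [Finset.mem_insert] at ha hb
        rcases ha with rfl | ha <;> rcases hb with rfl | hb
        · exact absurd rfl hab
        · rw [show insert a ({b} : Finset ℕ) = insert b {a} from Finset.pair_comm _ _]
          exact hwE b hb
        · exact hwE a ha
        · exact hC a ha b hb hab
  obtain ⟨C, hCV, hvC, hCc, hC⟩ := hcl (k - 2) (by omega)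
  have hNC : Nb v ⊆ C.erase v := by
    intro w hw
    rw [hNb, Finset.mem_filter] at hw
    refine Finset.mem_erase.mpr ⟨hw.2.1, ?_⟩
    by_contra hwC
    obtain ⟨φ, A, h1, h2, h3, h4, h5⟩ := leaf_embed hT (by omega) (r := 2) le_rfl (L := C) (w := w)
      (f := {v}) (by omega) hwC (by simpa using hvC) (by simp)
    apply hf
    refine ⟨φ, A, h1, h2, h3, ?_⟩
    intro e he
    rcases h5 e he with h | h
    · obtain ⟨h6, h7⟩ := Finset.mem_powersetCard.mp h
      obtain ⟨a, b, hab, heq⟩ := Finset.card_eq_two.mp h7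
      rw [heq] at h6 ⊢
      exact hC a (h6 (by simp)) b (h6 (by simp)) hab
    · rw [h, show insert w ({v} : Finset ℕ) = insert v {w} from Finset.pair_comm _ _]
      exact hw.2.2
  have hsumC : 1 - 1 / ((k:ℝ) - 1) - s ≤ ∑ i ∈ C.erase v, x i :=
    (hNbd v hv).trans (Finset.sum_le_sum_of_subset_of_nonneg hNC (fun i _ _ => hx i))
  have hk1 : 0 < 1 / ((k:ℝ) - 1) := by apply one_div_pos.mpr; linarith
  have h6 : ((k:ℝ) - 1) * (1 / ((k:ℝ) - 1)) = 1 := by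
    rw [mul_one_div_cancel]; linarith
  have hCb := Cb_pos 0
  set c := 1 / ((k:ℝ) - 1)
  have hvu : x v ≤ c + s := by
    have h1 := Finset.add_sum_erase C x hvC
    have h2 : ∑ i ∈ C, x i ≤ 1 := (Finset.sum_le_sum_of_subset_of_nonneg
      (hCV.trans Finset.sdiff_subset) (fun i _ _ => hx i)).trans hs
    linarith
  refine ⟨C, hCV.trans Finset.sdiff_subset, by omega, ?_⟩
  intro i hi
  by_cases hiv : i = v
  · subst hiv
    have : 0 ≤ (k:ℝ) * s := by positivity
    nlinarith
  · have hi' : i ∈ C.erase v := Finset.mem_erase.mpr ⟨hiv, hi⟩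
    rw [← Finset.add_sum_erase _ _ hi'] at hsumC
    have h7 : ∑ j ∈ (C.erase v).erase i, x j ≤ ∑ j ∈ (C.erase v).erase i, (c + s) := by
      apply Finset.sum_le_sum
      intro j hj
      exact (hmax j (hCV (Finset.mem_of_mem_erase (Finset.mem_of_mem_erase hj)))).trans hvu
    rw [Finset.sum_const, Finset.card_erase_of_mem hi', Finset.card_erase_of_mem hvC, hCc,
      nsmul_eq_mul, Nat.cast_sub (by omega), Nat.cast_sub (by omega), Nat.cast_add,
      Nat.cast_sub (by omega)] at h7
    push_cast at h7
    nlinarith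

theorem conc {k : ℕ} {T : HGraph 2} (hT : IsTreeGraph k T) (hES : ErdosSos k T) (r : ℕ)
    (hk : 4 * (r + 2) ^ 2 ≤ k) : ∀ {δ : ℝ}, 0 < δ → ∃ ε > 0,
    ∀ {E : Finset (Finset ℕ)} {V : Finset ℕ} {x : ℕ → ℝ},
    E ⊆ V.powersetCard (r+2) → ¬ ExpIn (r+2) T E → (∀ i, 0 ≤ x i) →
    ∑ i ∈ V, x i ≤ 1 → lam (k+r-1) (r+2) - ε ≤ PP E x →
    ∃ L ⊆ V, L.card = k + r - 1 ∧ ∀ i ∈ L, 1 / ((k:ℝ) + r - 1) - δ ≤ x i := by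
  have hk16 : 16 ≤ k := by
    have : 2 ^ 2 ≤ (r+2)^2 := Nat.pow_le_pow_left (by omega) 2
    omega
  have hk' : (16:ℝ) ≤ k := by exact_mod_cast hk16
  induction r with
  | zero =>
    intro δ hδ
    have hk1 : 0 < 1 / ((k:ℝ) - 1) := by apply one_div_pos.mpr; linarith
    have hlim : ∀ (C b : ℝ), 0 < b → ∀ᶠ s : ℝ in nhdsWithin 0 (Set.Ioi 0), C * s < b := by
      intro C b hb
      have : Filter.Tendsto (fun s : ℝ => C * s) (nhds 0) (nhds (C * 0)) :=
        (continuous_const.mul continuous_id).tendsto 0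
      rw [mul_zero] at this
      exact nhdsWithin_le_nhds (this.eventually (gt_mem_nhds hb))
    have hpos : ∀ᶠ s : ℝ in nhdsWithin 0 (Set.Ioi 0), 0 < s := self_mem_nhdsWithin
    obtain ⟨s, hs0, h1, h2, h3, h4⟩ := (hpos.and ((hlim 1 1 one_pos).and
      ((hlim (Cb 0) _ hk1).and ((hlim (Ca 0 + k) _ hk1).and (hlim (Cb 0 + k) δ hδ))))).exists
    refine ⟨s ^ 4, by positivity, ?_⟩
    intro E V x hE hf hx hs hP
    obtain ⟨L, hL, hc, hi⟩ := conc_base hT hES hk16 hE hf hx hs hs0 (by linarith) h2 h3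
      (by simpa using hP)
    refine ⟨L, hL, by simpa using hc, ?_⟩
    intro i hiL
    have := hi i hiL
    simp only [Nat.cast_zero, add_zero]
    linarith
  | succ r ih =>
    intro δ hδ
    obtain ⟨ε', hε', hIH⟩ := @ih (le_trans (by gcongr; omega) hk) δ hδ
    have hlim : ∀ (C b : ℝ), 0 < b → ∀ᶠ s : ℝ in nhdsWithin 0 (Set.Ioi 0), C * s < b := by
      intro C b hb
      have : Filter.Tendsto (fun s : ℝ => C * s) (nhds 0) (nhds (C * 0)) :=
        (continuous_const.mul continuous_id).tendsto 0
      rw [mul_zero] at this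
      exact nhdsWithin_le_nhds (this.eventually (gt_mem_nhds hb))
    have hpos : ∀ᶠ s : ℝ in nhdsWithin 0 (Set.Ioi 0), 0 < s := self_mem_nhdsWithin
    have hr0 : (0:ℝ) ≤ r := by positivity
    have hkr : (16:ℝ) ≤ (k:ℝ) + r := by linarith
    have hk1 : 0 < 1 / ((k:ℝ) + r) := by positivity
    have hk2 : 1 / ((k:ℝ) + r) ≤ 1 / 16 := by gcongr
    have hlam := lam_succ (ℓ := k + r - 1) (r+2) (by omega)
    rw [show k + r - 1 + 1 = k + (r+1) - 1 by omega, Nat.cast_sub (by omega)] at hlam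
    push_cast at hlam
    rw [show (k:ℝ) + r - 1 + 1 = k + r by ring] at hlam
    set Λ' := lam (k + r - 1) (r+2)
    set Λ := lam (k + (r+1) - 1) (r+1+2) with hΛ
    set c := 1 / ((k:ℝ) + r) with hc
    set K := Cb (r+1) with hK
    have hKp : 0 < K := Cb_pos _
    have hfin : ∀ᶠ s : ℝ in nhdsWithin 0 (Set.Ioi 0),
        Λ' - ε' < (1 / (1 - c + K * s)) ^ (r+2) * (((r:ℝ) + 2 + 1) * Λ - s - Ca (r+1) * s) := by
      have hcont : ContinuousAt (fun s : ℝ => (1 / (1 - c + K * s)) ^ (r+2) *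
          (((r:ℝ) + 2 + 1) * Λ - s - Ca (r+1) * s)) 0 := by
        have : (1 - c + K * 0) ≠ 0 := by rw [mul_zero]; linarith
        fun_prop (disch := assumption)
      have hval : (1 / (1 - c + K * 0)) ^ (r+2) *
          (((r:ℝ) + 2 + 1) * Λ - 0 - Ca (r+1) * 0) = Λ' := by
        have hne : (1 - c) ≠ 0 := by linarith
        rw [mul_zero, mul_zero, add_zero, sub_zero, sub_zero, hlam, mul_comm, mul_assoc, ← mul_pow,
          mul_one_div_cancel hne, one_pow, mul_one]
      have h := hcont.tendsto
      rw [hval] at h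
      exact nhdsWithin_le_nhds (h.eventually (lt_mem_nhds (by linarith)))
    obtain ⟨s, hs0, h1, h2, h3, h4⟩ := (hpos.and ((hlim 1 1 one_pos).and
      ((hlim K _ hk1).and ((hlim K δ hδ).and hfin)))).exists
    refine ⟨s ^ 4, by positivity, ?_⟩
    intro E V x hE hf hx hs hP
    obtain ⟨B, hBV, hB, hd, v, hv, hmax, hvl⟩ := near_opt hT hES (r+1) hk hE hf hx hs hs0
      (by linarith) (by push_cast; rw [show (k:ℝ) + (r+1) - 1 = k + r by ring]; exact h2) hP
    push_cast at hd hvl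
    rw [show (k:ℝ) + (r+1) - 1 = k + r by ring] at hvl
    have hdv := hd v hv
    rw [show (r:ℝ) + 1 + 2 = r + 2 + 1 by ring] at hdv
    set E'' := (lk E v).filter (fun e => Disjoint e B) with hE''
    have hvB := Finset.mem_sdiff.mp hv
    have hE2 : E'' ⊆ ((V \ B).erase v).powersetCard (r+2) := by
      intro e he
      rw [hE'', Finset.mem_filter] at he
      obtain ⟨h5, h6⟩ := Finset.mem_powersetCard.mp (lk_sub hE v he.1)
      refine Finset.mem_powersetCard.mpr ⟨?_, h6⟩
      intro a ha
      have h7 := Finset.mem_erase.mp (h5 ha)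
      exact Finset.mem_erase.mpr ⟨h7.1, Finset.mem_sdiff.mpr ⟨h7.2,
        fun hb => Finset.disjoint_left.mp he.2 ha hb⟩⟩
    have hf2 : ¬ ExpIn (r+2) T E'' := fun h =>
      hf (ExpIn_of_lk hT (by omega) (by omega) (h.mono (Finset.filter_subset _ _)))
    have hm := PP_meet (B := B) hx (r+1) (lk_sub hE v)
    have hxe : ∑ i ∈ V.erase v, x i ≤ 1 :=
      (Finset.sum_le_sum_of_subset_of_nonneg (Finset.erase_subset _ _) (fun i _ _ => hx i)).trans hs
    have hm2 : (∑ i ∈ B, x i) * (∑ i ∈ V.erase v, x i) ^ (r+1) ≤ (∑ i ∈ B, x i) * 1 := by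
      gcongr
      · exact Finset.sum_nonneg fun i _ => hx i
      · exact pow_le_one₀ (Finset.sum_nonneg fun i _ => hx i) hxe
    have hden : 0 < 1 - c + K * s := by
      have : 0 < K * s := by positivity
      linarith
    set a := 1 / (1 - c + K * s) with ha
    have ha0 : 0 < a := by positivity
    obtain ⟨L, hL, hLc, hLx⟩ := hIH (x := fun i => a * x i) hE2 hf2
      (fun i => mul_nonneg ha0.le (hx i))
      (by rw [← Finset.mul_sum, ha, one_div_mul_eq_div, div_le_one hden]
          have h5 := Finset.add_sum_erase (V \ B) x hv
          have h6 : ∑ i ∈ V \ B, x i ≤ 1 := (Finset.sum_le_sum_of_subset_of_nonneg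
            Finset.sdiff_subset (fun i _ _ => hx i)).trans hs
          linarith)
      (by rw [PP_smul hE2]
          refine h4.le.trans ?_
          gcongr
          linarith)
    have hvL : v ∉ L := fun h => (Finset.mem_erase.mp (hL h)).1 rfl
    refine ⟨insert v L, ?_, ?_, ?_⟩
    · refine Finset.insert_subset hvB.1 ?_
      exact hL.trans ((Finset.erase_subset _ _).trans Finset.sdiff_subset)
    · rw [Finset.card_insert_of_notMem hvL, hLc]; omega
    · push_cast
      rw [show (k:ℝ) + (r+1) - 1 = k + r by ring]
      intro i hi
      rcases Finset.mem_insert.mp hi with rfl | hi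
      · linarith
      · have h5 := hLx i hi
        have h6 : x i = (a * x i) * (1 - c + K * s) := by rw [ha]; field_simp
        have h7 : 0 ≤ K * s := by positivity
        have h8 : 0 ≤ a * x i := mul_nonneg ha0.le (hx i)
        have h9 : (a * x i) * (1 - c) ≤ x i := by
          conv_rhs => rw [h6]
          gcongr
          linarith
        have h10 : (1 / ((k:ℝ) + r - 1) - δ) * (1 - c) ≤ (a * x i) * (1 - c) := by
          gcongr
          linarith
        have h11 : 1 / ((k:ℝ) + r - 1) * (1 - c) = c := by
          rw [hc]
          have : (k:ℝ) + r - 1 ≠ 0 := by linarith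
          have : (k:ℝ) + r ≠ 0 := by linarith
          field_simp
        nlinarith

/-! ### Counting tools -/

/-- Standing assumptions. -/
structure Good (k r ℓ : ℕ) (T : HGraph 2) : Prop where
  hT : IsTreeGraph k T
  hES : ErdosSos k T
  hr : 3 ≤ r
  hk : 4 * r ^ 2 ≤ k
  hℓ : ℓ = k + r - 3

theorem Good.hk36 {k r ℓ : ℕ} {T : HGraph 2} (h : Good k r ℓ T) : 36 ≤ k := by
  have h1 := h.hk
  have : 3 ^ 2 ≤ r ^ 2 := Nat.pow_le_pow_left h.hr 2
  omega

theorem Good.hrl {k r ℓ : ℕ} {T : HGraph 2} (h : Good k r ℓ T) : r + 33 ≤ ℓ := by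
  have h1 := h.hk36
  have := h.hℓ
  omega

theorem Good.cast {k r ℓ : ℕ} {T : HGraph 2} (h : Good k r ℓ T) : (k:ℝ) + (r - 2 : ℕ) - 1 = ℓ := by
  have h1 := h.hk36
  have h2 := h.hr
  rw [h.hℓ, Nat.cast_sub (by omega), Nat.cast_sub (by omega)]
  push_cast; ring

theorem Good.lag {k r ℓ : ℕ} {T : HGraph 2} (h : Good k r ℓ T) {E : Finset (Finset ℕ)}
    {V : Finset ℕ} {x : ℕ → ℝ} {s : ℝ}
    (hE : E ⊆ V.powersetCard r) (hf : ¬ ExpIn r T E) (hx : ∀ i, 0 ≤ x i)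
    (hs : ∑ i ∈ V, x i ≤ s) : PP E x ≤ lam ℓ r * s ^ r := by
  have hr := h.hr
  have h1 := h.hk36
  have hr2 : r - 2 + 2 = r := by omega
  have := LBn (E := E) (V := V) h.hT h.hES (r - 2) (by rw [hr2]; exact h.hk) (by rw [hr2]; exact hE)
    (by rw [hr2]; exact hf) hx hs
  rw [hr2] at this
  rwa [h.hℓ, show k + r - 3 = k + (r - 2) - 1 by omega]

theorem Good.conc {k r ℓ : ℕ} {T : HGraph 2} (h : Good k r ℓ T) {δ : ℝ} (hδ : 0 < δ) : ∃ ε > 0,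
    ∀ {E : Finset (Finset ℕ)} {V : Finset ℕ} {x : ℕ → ℝ},
    E ⊆ V.powersetCard r → ¬ ExpIn r T E → (∀ i, 0 ≤ x i) →
    ∑ i ∈ V, x i ≤ 1 → lam ℓ r - ε ≤ PP E x →
    ∃ L ⊆ V, L.card = ℓ ∧ ∀ i ∈ L, 1 / (ℓ:ℝ) - δ ≤ x i := by
  have hr := h.hr
  have h1 := h.hk36
  have hr2 : r - 2 + 2 = r := by omega
  obtain ⟨ε, h0, hh⟩ := DensityCH.conc h.hT h.hES (r - 2) (by rw [hr2]; exact h.hk) hδ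
  refine ⟨ε, h0, ?_⟩
  intro E V x hE hf hx hs hP
  have hl : k + (r - 2) - 1 = ℓ := by rw [h.hℓ]; omega
  have := hh (E := E) (V := V) (x := x) (by rw [hr2]; exact hE) (by rw [hr2]; exact hf) hx hs
    (by rw [hr2, hl]; exact hP)
  rw [hl, h.cast] at this
  exact this

theorem cnt_sup {V B : Finset ℕ} {q : ℕ} :
    ((V.powersetCard q).filter (fun e => B ⊆ e)).card ≤ V.card ^ (q - B.card) := by
  calc _ ≤ (V.powersetCard (q - B.card)).card := by
        apply Finset.card_le_card_of_injOn (fun e => e \ B)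
        · intro e he
          simp only [Finset.coe_filter, Set.mem_ofPred_eq, Finset.mem_powersetCard] at he
          rw [Finset.mem_coe, Finset.mem_powersetCard]
          refine ⟨Finset.sdiff_subset.trans he.1.1, ?_⟩
          rw [Finset.card_sdiff_of_subset he.2, he.1.2]
        · intro e he e' he' hee
          simp only [Finset.coe_filter, Set.mem_ofPred_eq] at he he'
          have : e \ B ∪ B = e' \ B ∪ B := by rw [show e \ B = e' \ B from hee]
          rwa [Finset.sdiff_union_of_subset he.2, Finset.sdiff_union_of_subset he'.2] at this
    _ = V.card.choose (q - B.card) := Finset.card_powersetCard _ _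
    _ ≤ _ := Nat.choose_le_pow _ _

/-- Lemma P : a member of `L` containing no bad set. -/
theorem avoid {V : Finset ℕ} {q : ℕ} {L Bad : Finset (Finset ℕ)} (hL : L ⊆ V.powersetCard q)
    (hV : 0 < V.card) (hB : PP Bad (fun _ => 1 / (V.card:ℝ)) * (V.card:ℝ) ^ q < L.card) :
    ∃ U ∈ L, ∀ B ∈ Bad, ¬ B ⊆ U := by
  by_contra hcon
  push Not at hcon
  have h1 : L ⊆ Bad.biUnion (fun B => L.filter (fun e => B ⊆ e)) := by
    intro U hU
    obtain ⟨B, hB, hBU⟩ := hcon U hU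
    exact Finset.mem_biUnion.mpr ⟨B, hB, Finset.mem_filter.mpr ⟨hU, hBU⟩⟩
  have hV' : (0:ℝ) < V.card := by exact_mod_cast hV
  have h2 : (L.card : ℝ) ≤ ∑ B ∈ Bad, ((L.filter (fun e => B ⊆ e)).card : ℝ) := by
    exact_mod_cast (Finset.card_le_card h1).trans Finset.card_biUnion_le
  have h3 : ∑ B ∈ Bad, ((L.filter (fun e => B ⊆ e)).card : ℝ) ≤
      PP Bad (fun _ => 1 / (V.card:ℝ)) * (V.card:ℝ) ^ q := by
    unfold PP
    rw [Finset.sum_mul]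
    apply Finset.sum_le_sum
    intro B hB
    rw [Finset.prod_const]
    by_cases hBq : B.card ≤ q
    · have h4 : (L.filter (fun e => B ⊆ e)).card ≤ V.card ^ (q - B.card) :=
        (Finset.card_le_card (Finset.filter_subset_filter _ hL)).trans cnt_sup
      have h5 : ((L.filter (fun e => B ⊆ e)).card : ℝ) ≤ (V.card:ℝ) ^ (q - B.card) := by
        exact_mod_cast h4
      refine h5.trans (le_of_eq ?_)
      rw [one_div, inv_pow, pow_sub₀ _ hV'.ne' hBq, mul_comm]
    · have : L.filter (fun e => B ⊆ e) = ∅ := by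
        rw [Finset.filter_eq_empty_iff]
        intro e he hBe
        have := Finset.card_le_card hBe
        have := (Finset.mem_powersetCard.mp (hL he)).2
        omega
      rw [this]; simp; positivity
  linarith

/-- Crossing `q`-sets with colours in `I`. -/
def Crs (c : ℕ → ℕ) (V : Finset ℕ) (q : ℕ) (I : Finset ℕ) : Finset (Finset ℕ) :=
  (V.powersetCard q).filter (fun e : Finset ℕ => Set.InjOn c (↑e : Set ℕ) ∧ ∀ v ∈ e, c v ∈ I)

theorem mem_Crs {c : ℕ → ℕ} {V : Finset ℕ} {q : ℕ} {I : Finset ℕ} {e : Finset ℕ} :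
    e ∈ Crs c V q I ↔ e ⊆ V ∧ e.card = q ∧ Set.InjOn c ↑e ∧ ∀ v ∈ e, c v ∈ I := by
  unfold Crs; rw [Finset.mem_filter, Finset.mem_powersetCard]; tauto

/-- Lemma C. -/
theorem count_col (c : ℕ → ℕ) (G : Finset (Finset ℕ)) (q : ℕ) (hG : ∀ g ∈ G, g.card = q)
    (V : Finset ℕ) :
    (((V.powersetCard q).filter (fun e : Finset ℕ => Set.InjOn c (↑e : Set ℕ) ∧ e.image c ∈ G)).card : ℝ)
      = PP G (fun i => ((V.filter (fun v => c v = i)).card : ℝ)) := by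
  induction V using Finset.induction_on generalizing G q with
  | empty =>
    by_cases hq : q = 0
    · subst hq
      have : ∀ g ∈ G, g = ∅ := fun g hg => Finset.card_eq_zero.mp (hG g hg)
      by_cases h0 : ∅ ∈ G
      · have hG' : G = {∅} := by
          ext g; constructor
          · intro hg; simp [this g hg]
          · intro hg; rw [Finset.mem_singleton] at hg; subst hg; exact h0
        subst hG'
        simp [PP, Finset.filter_singleton]
      · have hG' : G = ∅ := by
          rw [Finset.eq_empty_iff_forall_notMem]
          intro g hg; rw [this g hg] at hg; exact h0 hg
        subst hG'; simp [PP]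
    · rw [Finset.powersetCard_eq_empty.mpr (by rw [Finset.card_empty]; omega)]
      simp only [Finset.filter_empty, Finset.card_empty, Nat.cast_zero]
      symm
      apply Finset.sum_eq_zero
      intro g hg
      have : g.Nonempty := by rw [← Finset.card_pos, hG g hg]; omega
      obtain ⟨i, hi⟩ := this
      exact Finset.prod_eq_zero hi rfl
  | insert v V hv ih =>
    set a : ℕ → ℝ := fun i => ((V.filter (fun v => c v = i)).card : ℝ) with ha
    have h1 : (fun i => (((insert v V).filter (fun v => c v = i)).card : ℝ))
        = Function.update a (c v) (a (c v) + 1) := by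
      funext i
      rw [Finset.filter_insert]
      by_cases hi : i = c v
      · subst hi
        rw [Function.update_self, if_pos rfl, Finset.card_insert_of_notMem (by simp [hv])]
        push_cast; rfl
      · rw [Function.update_of_ne hi, if_neg (fun h => hi h.symm)]
    rw [h1, PP_update]
    have h2 := PP_split G (c v) a
    have h3 : ∀ g ∈ lk G (c v), g.card = q - 1 := by
      intro g hg
      have := hG _ (mem_lk.mp hg).2
      rw [Finset.card_insert_of_notMem (mem_lk.mp hg).1] at this
      omega
    have e1 := ih G q hG
    have e2 := ih (lk G (c v)) (q-1) h3
    have hsplit : (((insert v V).powersetCard q).filter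
        (fun e : Finset ℕ => Set.InjOn c (↑e : Set ℕ) ∧ e.image c ∈ G)).card =
        ((V.powersetCard q).filter (fun e : Finset ℕ => Set.InjOn c (↑e : Set ℕ) ∧ e.image c ∈ G)).card +
        ((V.powersetCard (q-1)).filter (fun e : Finset ℕ => Set.InjOn c (↑e : Set ℕ) ∧ e.image c ∈ lk G (c v))).card := by
      rw [← Finset.card_filter_add_card_filter_not (s := (((insert v V).powersetCard q).filter
        (fun e : Finset ℕ => Set.InjOn c (↑e : Set ℕ) ∧ e.image c ∈ G))) (fun e => v ∉ e)]
      congr 1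
      · congr 1
        ext e
        simp only [Finset.mem_filter, Finset.mem_powersetCard]
        constructor
        · rintro ⟨⟨⟨h4, h5⟩, h6⟩, h7⟩
          exact ⟨⟨(Finset.subset_insert_iff_of_notMem h7).mp h4, h5⟩, h6⟩
        · rintro ⟨⟨h4, h5⟩, h6⟩
          exact ⟨⟨⟨h4.trans (Finset.subset_insert _ _), h5⟩, h6⟩, fun h => hv (h4 h)⟩
      · apply Finset.card_nbij' (fun e => e.erase v) (fun e => insert v e)
        · intro e he
          simp only [not_not, Finset.coe_filter, Finset.mem_filter, Finset.mem_powersetCard,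
            Set.mem_ofPred_eq] at he ⊢
          obtain ⟨⟨⟨h4, h5⟩, h6, h7⟩, h8⟩ := he
          have hin : insert v (e.erase v) = e := Finset.insert_erase h8
          refine ⟨⟨?_, by rw [Finset.card_erase_of_mem h8, h5]⟩, ?_, ?_⟩
          · rw [← Finset.subset_insert_iff]; exact h4
          · exact h6.mono (by exact_mod_cast Finset.erase_subset v e)
          · rw [mem_lk]
            constructor
            · intro hc
              obtain ⟨w, hw, hwc⟩ := Finset.mem_image.mp hc
              have := h6 (Finset.mem_coe.mpr (Finset.mem_of_mem_erase hw)) (Finset.mem_coe.mpr h8) hwc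
              exact (Finset.mem_erase.mp hw).1 this
            · rw [← Finset.image_insert, hin]; exact h7
        · intro e he
          simp only [not_not, Finset.coe_filter, Finset.mem_filter, Finset.mem_powersetCard,
            Set.mem_ofPred_eq] at he ⊢
          obtain ⟨⟨h4, h5⟩, h6, h7⟩ := he
          have hve : v ∉ e := fun h => hv (h4 h)
          have h8 := mem_lk.mp h7
          have h9 := hG _ h8.2
          refine ⟨⟨⟨Finset.insert_subset_insert _ h4, ?_⟩, ?_, ?_⟩, Finset.mem_insert_self _ _⟩
          · rw [Finset.card_insert_of_notMem hve]
            rw [Finset.card_insert_of_notMem h8.1] at h9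
            omega
          · rw [Finset.coe_insert, Set.injOn_insert (by simpa using hve)]
            refine ⟨h6, ?_⟩
            intro hc
            apply h8.1
            rw [← Finset.coe_image] at hc
            exact_mod_cast hc
          · rw [Finset.image_insert]; exact h8.2
        · intro e he
          simp only [not_not, Finset.coe_filter, Finset.mem_filter, Set.mem_ofPred_eq] at he
          exact Finset.insert_erase he.2
        · intro e he
          simp only [Finset.coe_filter, Finset.mem_powersetCard, Set.mem_ofPred_eq] at he
          exact Finset.erase_insert fun h => hv (he.1.1 h)
    rw [hsplit]
    push_cast
    rw [e1, e2, h2]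
    ring

theorem Crs_card (c : ℕ → ℕ) (V : Finset ℕ) (q : ℕ) (I : Finset ℕ) :
    ((Crs c V q I).card : ℝ) =
      PP (I.powersetCard q) (fun i => ((V.filter (fun v => c v = i)).card : ℝ)) := by
  rw [← count_col c _ q (fun g hg => (Finset.mem_powersetCard.mp hg).2)]
  congr 2
  unfold Crs
  apply Finset.filter_congr
  intro e he
  rw [Finset.mem_powersetCard] at he
  constructor
  · rintro ⟨h1, h2⟩
    refine ⟨h1, Finset.mem_powersetCard.mpr ⟨?_, ?_⟩⟩
    · intro i hi
      obtain ⟨v, hv, rfl⟩ := Finset.mem_image.mp hi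
      exact h2 v hv
    · rw [Finset.card_image_of_injOn h1, he.2]
  · rintro ⟨h1, h2⟩
    exact ⟨h1, fun v hv => (Finset.mem_powersetCard.mp h2).1 (Finset.mem_image_of_mem c hv)⟩

/-- Transversals. -/
theorem Trs_card (c : ℕ → ℕ) (V : Finset ℕ) (J : Finset ℕ) :
    ((Crs c V J.card J).card : ℝ) = ∏ j ∈ J, ((V.filter (fun v => c v = j)).card : ℝ) := by
  rw [Crs_card, Finset.powersetCard_self]; simp [PP]

theorem sum_fibres (c : ℕ → ℕ) (V I : Finset ℕ) (h : ∀ v ∈ V, c v ∈ I) :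
    ∑ i ∈ I, ((V.filter (fun v => c v = i)).card : ℝ) = V.card := by
  rw [Finset.card_eq_sum_card_fiberwise (f := c) (t := I) (fun v hv => h v hv)]
  push_cast; rfl

/-! ### Copies of expansions -/

/-- Edge-copy. -/
def CpF {r : ℕ} (F : HGraph r) (E : Finset (Finset ℕ)) : Prop :=
  ∃ f : ℕ → ℕ, Set.InjOn f ↑F.verts ∧ ∀ e ∈ F.edges, e.image f ∈ E

/-- Core copy : all pairs covered. -/
def KF {r : ℕ} (F : HGraph r) (E : Finset (Finset ℕ)) : Prop :=
  ∃ f : ℕ → ℕ, Set.InjOn f ↑F.verts ∧ (∀ e ∈ F.edges, e.image f ∈ E) ∧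
    ∀ a ∈ F.verts, ∀ b ∈ F.verts, a ≠ b → ∃ e ∈ E, f a ∈ e ∧ f b ∈ e

theorem CpF.mono {r : ℕ} {F : HGraph r} {E E' : Finset (Finset ℕ)} (h : E ⊆ E') (hC : CpF F E) :
    CpF F E' := by
  obtain ⟨f, h1, h2⟩ := hC
  exact ⟨f, h1, fun e he => h (h2 e he)⟩

/-- New vertex. -/
def nv {r : ℕ} (F : HGraph r) (p : ℕ × ℕ) (s : ℕ) : ℕ :=
  (F.verts.sup id + 1) + (p.1 * (F.verts.sup id + 1) + p.2) * r + s

/-- Uncovered pairs. -/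
def up {r : ℕ} (F : HGraph r) : Finset (ℕ × ℕ) :=
  (F.verts ×ˢ F.verts).filter fun p =>
        p.1 < p.2 ∧ ∀ e ∈ F.edges, ¬ (p.1 ∈ e ∧ p.2 ∈ e)

theorem mem_up {r : ℕ} {F : HGraph r} {p : ℕ × ℕ} : p ∈ up F ↔ (p.1 ∈ F.verts ∧ p.2 ∈ F.verts) ∧
    p.1 < p.2 ∧ ∀ e ∈ F.edges, ¬ (p.1 ∈ e ∧ p.2 ∈ e) := by
  unfold up; rw [Finset.mem_filter, Finset.mem_product]

theorem lt_sup {V : Finset ℕ} {v : ℕ} (h : v ∈ V) : v < V.sup id + 1 :=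
  Nat.lt_succ_of_le (Finset.le_sup (f := id) h)

theorem nv_ge {r : ℕ} (F : HGraph r) (p : ℕ × ℕ) (s : ℕ) : F.verts.sup id + 1 ≤ nv F p s := by
  unfold nv; omega

theorem nv_notMem {r : ℕ} (F : HGraph r) (p : ℕ × ℕ) (s : ℕ) : nv F p s ∉ F.verts := fun h =>
  absurd (lt_sup h) (not_lt.mpr (nv_ge F p s))

theorem nv_inj {r : ℕ} {F : HGraph r} {p q : ℕ × ℕ} {s t : ℕ} (hp : p ∈ up F) (hq : q ∈ up F)
    (hs : s < r - 2) (ht : t < r - 2) (h : nv F p s = nv F q t) : p = q ∧ s = t := by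
  have h1 := lt_sup (mem_up.mp hp).1.2
  have h2 := lt_sup (mem_up.mp hq).1.2
  unfold nv at h
  set N := F.verts.sup id + 1
  have h3 : (p.1 * N + p.2) * r + s = (q.1 * N + q.2) * r + t := by omega
  have h4 : s = t := by
    have := congrArg (· % r) h3
    simp only [Nat.mul_add_mod', Nat.mod_eq_of_lt (show s < r by omega),
      Nat.mod_eq_of_lt (show t < r by omega)] at this
    exact this
  subst h4
  have h5 : p.1 * N + p.2 = q.1 * N + q.2 := Nat.eq_of_mul_eq_mul_right (show 0 < r by omega) (by omega)
  have h6 : p.2 = q.2 := by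
    have := congrArg (· % N) h5
    simp only [Nat.mul_add_mod', Nat.mod_eq_of_lt h1, Nat.mod_eq_of_lt h2] at this
    exact this
  have h7 : p.1 = q.1 := Nat.eq_of_mul_eq_mul_right (show 0 < N by omega) (by omega)
  exact ⟨Prod.ext h7 h6, rfl⟩

theorem exp_verts {r : ℕ} (F : HGraph r) : F.expansion.verts = F.verts ∪ (up F).biUnion fun p =>
      (Finset.range (r-2)).image fun s => nv F p s := rfl

theorem exp_edges {r : ℕ} (hr : 2 ≤ r) (F : HGraph r) : F.expansion.edges =
    F.edges ∪ (up F).image fun p =>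
      insert p.1 (insert p.2 ((Finset.range (r-2)).image fun s => nv F p s)) := by
  have : F.expansion.edges = (F.edges ∪ (up F).image fun p =>
      insert p.1 (insert p.2 ((Finset.range (r-2)).image fun s => nv F p s))).filter
      fun e => e ⊆ F.expansion.verts ∧ e.card = r := rfl
  rw [this, Finset.filter_eq_self]
  intro e he
  rw [exp_verts]
  rw [Finset.mem_union] at he
  rcases he with he | he
  · exact ⟨(F.edges_sub e he).trans Finset.subset_union_left, F.edges_card e he⟩
  · obtain ⟨p, hp, rfl⟩ := Finset.mem_image.mp he
    have hp' := mem_up.mp hp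
    constructor
    · intro x hx
      rw [Finset.mem_insert, Finset.mem_insert] at hx
      rcases hx with rfl | rfl | hx
      · exact Finset.mem_union_left _ hp'.1.1
      · exact Finset.mem_union_left _ hp'.1.2
      · exact Finset.mem_union_right _ (Finset.mem_biUnion.mpr ⟨p, hp, hx⟩)
    · rw [Finset.card_insert_of_notMem, Finset.card_insert_of_notMem, Finset.card_image_of_injOn,
        Finset.card_range]
      · omega
      · intro s hs t ht hst
        exact (nv_inj hp hp (by simpa using hs) (by simpa using ht) hst).2
      · intro h
        obtain ⟨s, _, hs⟩ := Finset.mem_image.mp h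
        exact nv_notMem F p s (hs ▸ hp'.1.2)
      · intro h
        rw [Finset.mem_insert] at h
        rcases h with h | h
        · have := hp'.2.1; omega
        · obtain ⟨s, _, hs⟩ := Finset.mem_image.mp h
          exact nv_notMem F p s (hs ▸ hp'.1.1)

theorem CpF.toKF {r : ℕ} (hr : 2 ≤ r) {F : HGraph r} {E : Finset (Finset ℕ)}
    (h : CpF F.expansion E) : KF F E := by
  obtain ⟨f, h1, h2⟩ := h
  rw [exp_edges hr] at h2
  rw [exp_verts] at h1
  refine ⟨f, h1.mono (by exact_mod_cast Finset.subset_union_left),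
    fun e he => h2 e (Finset.mem_union_left _ he), ?_⟩
  have key : ∀ a ∈ F.verts, ∀ b ∈ F.verts, a < b → ∃ e ∈ E, f a ∈ e ∧ f b ∈ e := by
    intro a ha b hb hab
    by_cases hc : ∃ e ∈ F.edges, a ∈ e ∧ b ∈ e
    · obtain ⟨e, he, hae, hbe⟩ := hc
      exact ⟨_, h2 e (Finset.mem_union_left _ he), Finset.mem_image_of_mem _ hae,
        Finset.mem_image_of_mem _ hbe⟩
    · push Not at hc
      have hp : (a, b) ∈ up F := mem_up.mpr ⟨⟨ha, hb⟩, hab, fun e he h => hc e he h.1 h.2⟩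
      refine ⟨_, h2 _ (Finset.mem_union_right _ (Finset.mem_image_of_mem _ hp)), ?_, ?_⟩
      · exact Finset.mem_image_of_mem _ (Finset.mem_insert_self _ _)
      · exact Finset.mem_image_of_mem _ (Finset.mem_insert_of_mem (Finset.mem_insert_self _ _))
  intro a ha b hb hab
  rcases lt_or_gt_of_ne hab with h | h
  · exact key a ha b hb h
  · obtain ⟨e, he, h3, h4⟩ := key b hb a ha h
    exact ⟨e, he, h4, h3⟩

/-- Robustly covered pair. -/
def Rob (E : Finset (Finset ℕ)) (m a b : ℕ) : Prop :=
  ∀ X : Finset ℕ, X.card ≤ m → ∃ e ∈ E, a ∈ e ∧ b ∈ e ∧ e ∩ X ⊆ {a, b}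

theorem greedy {r m : ℕ} {E : Finset (Finset ℕ)} (hE : ∀ e ∈ E, e.card = r) (C : Finset ℕ)
    (a b : ℕ × ℕ → ℕ) (P : Finset (ℕ × ℕ)) (hP : ∀ p ∈ P, Rob E m (a p) (b p))
    (hC : ∀ p ∈ P, a p ∈ C ∧ b p ∈ C)
    (hm : C.card + P.card * r ≤ m) :
    ∃ g : ℕ × ℕ → Finset ℕ, (∀ p ∈ P, g p ∈ E ∧ a p ∈ g p ∧ b p ∈ g p ∧ g p ∩ C ⊆ {a p, b p}) ∧
      ∀ p ∈ P, ∀ q ∈ P, p ≠ q → g p ∩ g q ⊆ C := by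
  induction P using Finset.induction_on with
  | empty => exact ⟨fun _ => ∅, by simp, by simp⟩
  | insert p P hp ih =>
    rw [Finset.card_insert_of_notMem hp] at hm
    obtain ⟨g, h1, h2⟩ := ih (fun q hq => hP q (Finset.mem_insert_of_mem hq))
      (fun q hq => hC q (Finset.mem_insert_of_mem hq)) (by nlinarith)
    have hX : (C ∪ P.biUnion g).card ≤ m := by
      refine (Finset.card_union_le _ _).trans ?_
      have : (P.biUnion g).card ≤ P.card * r :=
        Finset.card_biUnion_le_card_mul _ _ _ fun q hq => (hE _ (h1 q hq).1).le
      nlinarith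
    obtain ⟨e, he, ha, hb, hX⟩ := hP p (Finset.mem_insert_self _ _) _ hX
    have hpC := hC p (Finset.mem_insert_self _ _)
    have hab : ({a p, b p} : Finset ℕ) ⊆ C := by
      intro x hx
      rw [Finset.mem_insert, Finset.mem_singleton] at hx
      rcases hx with rfl | rfl
      exacts [hpC.1, hpC.2]
    have hgq : ∀ q ∈ P, e ∩ g q ⊆ C := fun q hq x hx => by
      rw [Finset.mem_inter] at hx
      exact hab (hX (Finset.mem_inter.mpr ⟨hx.1, Finset.mem_union_right _
        (Finset.mem_biUnion.mpr ⟨q, hq, hx.2⟩)⟩))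
    refine ⟨Function.update g p e, ?_, ?_⟩
    · intro q hq
      by_cases hqp : q = p
      · subst hqp
        rw [Function.update_self]
        exact ⟨he, ha, hb, (Finset.inter_subset_inter_left Finset.subset_union_left).trans hX⟩
      · rw [Function.update_of_ne hqp]
        exact h1 q ((Finset.mem_insert.mp hq).resolve_left hqp)
    · intro q hq q' hq' hne
      by_cases hqp : q = p
      · subst hqp
        rw [Function.update_self, Function.update_of_ne hne.symm]
        exact hgq q' ((Finset.mem_insert.mp hq').resolve_left hne.symm)
      · rw [Function.update_of_ne hqp]
        have hqP := (Finset.mem_insert.mp hq).resolve_left hqp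
        by_cases hqp' : q' = p
        · subst hqp'
          rw [Function.update_self, Finset.inter_comm]
          exact hgq q hqP
        · rw [Function.update_of_ne hqp']
          exact h2 q hqP q' ((Finset.mem_insert.mp hq').resolve_left hqp') hne

/-- Lemma G. -/
theorem lemG {r m : ℕ} (hr : 2 ≤ r) {F : HGraph r} {E : Finset (Finset ℕ)}
    (hE : ∀ e ∈ E, e.card = r)
    {ψ : ℕ → ℕ} (hψ : Set.InjOn ψ ↑F.verts) (hF : ∀ e ∈ F.edges, e.image ψ ∈ E) {e0 : Finset ℕ}
    (he0 : e0.card ≤ r)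
    (hm : F.verts.card + r + F.verts.card ^ 2 * r ≤ m)
    (hR : ∀ a ∈ F.verts, ∀ b ∈ F.verts, a < b → Rob E m (ψ a) (ψ b) ∨
      (e0 ∈ E ∧ ψ a ∈ e0 ∧ ψ b ∈ e0 ∧ e0 ∩ F.verts.image ψ ⊆ {ψ a, ψ b})) :
    CpF F.expansion E := by
  classical
  set C := F.verts.image ψ with hCdef
  have hCc : C.card ≤ F.verts.card := Finset.card_image_le
  have hupc : (up F).card ≤ F.verts.card ^ 2 := by
    refine (Finset.card_le_card (Finset.filter_subset _ _)).trans ?_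
    rw [Finset.card_product, sq]
  obtain ⟨g, hg1, hg2⟩ := greedy hE (C ∪ e0) (fun p => ψ p.1) (fun p => ψ p.2)
    ((up F).filter (fun p => Rob E m (ψ p.1) (ψ p.2)))
    (fun p hp => (Finset.mem_filter.mp hp).2)
    (fun p hp => by
      have := (mem_up.mp (Finset.mem_filter.mp hp).1).1
      exact ⟨Finset.mem_union_left _ (Finset.mem_image_of_mem _ this.1),
        Finset.mem_union_left _ (Finset.mem_image_of_mem _ this.2)⟩)
    (by
      have h1 := Finset.card_union_le C e0
      have h2 : ((up F).filter (fun p => Rob E m (ψ p.1) (ψ p.2))).card ≤ F.verts.card ^ 2 :=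
        (Finset.card_filter_le _ _).trans hupc
      have := Nat.mul_le_mul_right r h2
      omega)
  -- final choice
  obtain ⟨g', hg'1, hg'2⟩ : ∃ g' : ℕ × ℕ → Finset ℕ,
      (∀ p ∈ up F, g' p ∈ E ∧ ψ p.1 ∈ g' p ∧ ψ p.2 ∈ g' p ∧ g' p ∩ C ⊆ {ψ p.1, ψ p.2}) ∧
      ∀ p ∈ up F, ∀ q ∈ up F, p ≠ q → g' p ∩ g' q ⊆ C := by
    refine ⟨fun p => if Rob E m (ψ p.1) (ψ p.2) then g p else e0, ?_, ?_⟩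
    · intro p hp
      have hp' := mem_up.mp hp
      by_cases hR' : Rob E m (ψ p.1) (ψ p.2)
      · simp only [if_pos hR']
        obtain ⟨h1, h2, h3, h4⟩ := hg1 p (Finset.mem_filter.mpr ⟨hp, hR'⟩)
        exact ⟨h1, h2, h3, (Finset.inter_subset_inter_left Finset.subset_union_left).trans h4⟩
      · simp only [if_neg hR']
        exact (hR p.1 hp'.1.1 p.2 hp'.1.2 hp'.2.1).resolve_left hR'
    · have mixed : ∀ p ∈ up F, Rob E m (ψ p.1) (ψ p.2) → g p ∩ e0 ⊆ C := by
        intro p hp hR' x hx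
        rw [Finset.mem_inter] at hx
        have h5 := (hg1 p (Finset.mem_filter.mpr ⟨hp, hR'⟩)).2.2.2
          (Finset.mem_inter.mpr ⟨hx.1, Finset.mem_union_right _ hx.2⟩)
        have hp' := mem_up.mp hp
        rw [Finset.mem_insert, Finset.mem_singleton] at h5
        rcases h5 with rfl | rfl
        · exact Finset.mem_image_of_mem _ hp'.1.1
        · exact Finset.mem_image_of_mem _ hp'.1.2
      intro p hp q hq hpq
      by_cases hRp : Rob E m (ψ p.1) (ψ p.2) <;> by_cases hRq : Rob E m (ψ q.1) (ψ q.2)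
      · simp only [if_pos hRp, if_pos hRq]
        intro x hx
        have hxx := hg2 p (Finset.mem_filter.mpr ⟨hp, hRp⟩) q (Finset.mem_filter.mpr ⟨hq, hRq⟩) hpq hx
        rw [Finset.mem_union] at hxx
        rcases hxx with h | h
        · exact h
        · exact mixed p hp hRp (Finset.mem_inter.mpr ⟨(Finset.mem_inter.mp hx).1, h⟩)
      · simp only [if_pos hRp, if_neg hRq]
        exact mixed p hp hRp
      · simp only [if_neg hRp, if_pos hRq]
        rw [Finset.inter_comm]
        exact mixed q hq hRq
      · exfalso
        have hp' := mem_up.mp hp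
        have hq' := mem_up.mp hq
        obtain ⟨_, a1, a2, a3⟩ := (hR p.1 hp'.1.1 p.2 hp'.1.2 hp'.2.1).resolve_left hRp
        obtain ⟨_, b1, b2, b3⟩ := (hR q.1 hq'.1.1 q.2 hq'.1.2 hq'.2.1).resolve_left hRq
        have c1 : ψ p.1 = ψ q.1 ∨ ψ p.1 = ψ q.2 := by
          have := b3 (Finset.mem_inter.mpr ⟨a1, Finset.mem_image_of_mem _ hp'.1.1⟩)
          simpa using this
        have c2 : ψ p.2 = ψ q.1 ∨ ψ p.2 = ψ q.2 := by
          have := b3 (Finset.mem_inter.mpr ⟨a2, Finset.mem_image_of_mem _ hp'.1.2⟩)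
          simpa using this
        have d1 : p.1 = q.1 ∨ p.1 = q.2 := c1.imp (fun h => hψ hp'.1.1 hq'.1.1 h)
          (fun h => hψ hp'.1.1 hq'.1.2 h)
        have d2 : p.2 = q.1 ∨ p.2 = q.2 := c2.imp (fun h => hψ hp'.1.2 hq'.1.1 h)
          (fun h => hψ hp'.1.2 hq'.1.2 h)
        have := hp'.2.1
        have := hq'.2.1
        apply hpq
        apply Prod.ext <;> omega
  -- enumerations
  have hen : ∀ p : ℕ × ℕ, ∃ γ : ℕ → ℕ, p ∈ up F → Set.InjOn γ ↑(Finset.range (r-2)) ∧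
      (Finset.range (r-2)).image γ = (g' p \ {ψ p.1, ψ p.2}) := by
    intro p
    by_cases hp : p ∈ up F
    · have hp' := mem_up.mp hp
      obtain ⟨h1, h2, h3, h4⟩ := hg'1 p hp
      have hne : ψ p.1 ≠ ψ p.2 := fun h => by
        have := hψ hp'.1.1 hp'.1.2 h
        have := hp'.2.1
        omega
      have hc : (g' p \ {ψ p.1, ψ p.2}).card = r - 2 := by
        rw [Finset.card_sdiff_of_subset, hE _ h1, Finset.card_pair hne]
        intro x hx
        rw [Finset.mem_insert, Finset.mem_singleton] at hx
        rcases hx with rfl | rfl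
        exacts [h2, h3]
      obtain ⟨γ, hγ1, hγ2⟩ := exists_bij (s := Finset.range (r-2)) (t := g' p \ {ψ p.1, ψ p.2})
        (by rw [hc, Finset.card_range])
      exact ⟨γ, fun _ => ⟨hγ1, hγ2⟩⟩
    · exact ⟨id, fun h => absurd h hp⟩
  choose γ hγ using hen
  set N := F.verts.sup id + 1 with hN
  set f : ℕ → ℕ := fun x => if x < N then ψ x else
    γ ((((x - N) / r) / N), (((x - N) / r) % N)) ((x - N) % r) with hf
  have hfc : ∀ x ∈ F.verts, f x = ψ x := by
    intro x hx
    rw [hf]; simp only; rw [if_pos (lt_sup hx)]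
  have hfn : ∀ p ∈ up F, ∀ s < r - 2, f (nv F p s) = γ p s := by
    intro p hp s hs
    have h1 := lt_sup (mem_up.mp hp).1.2
    rw [← hN] at h1
    rw [hf]; simp only
    rw [if_neg (not_lt.mpr (nv_ge F p s))]
    have e1 : nv F p s - N = s + (p.1 * N + p.2) * r := by
      change N + (p.1 * N + p.2) * r + s - N = _
      omega
    have e2 : (nv F p s - N) / r = p.1 * N + p.2 := by
      rw [e1, Nat.add_mul_div_right _ _ (by omega), Nat.div_eq_of_lt (by omega)]; omega
    have e3 : (nv F p s - N) % r = s := by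
      rw [e1, Nat.add_mul_mod_self_right, Nat.mod_eq_of_lt (by omega)]
    rw [e2, e3, Nat.add_comm (p.1 * N), Nat.add_mul_div_right _ _ (by omega), Nat.div_eq_of_lt h1,
      Nat.add_mul_mod_self_right, Nat.mod_eq_of_lt h1, Nat.zero_add]
  have hγm : ∀ p ∈ up F, ∀ s < r - 2, γ p s ∈ g' p ∧ γ p s ∉ C := by
    intro p hp s hs
    have h1 : γ p s ∈ g' p \ {ψ p.1, ψ p.2} := by
      rw [← (hγ p hp).2]; exact Finset.mem_image_of_mem _ (Finset.mem_range.mpr hs)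
    rw [Finset.mem_sdiff] at h1
    exact ⟨h1.1, fun h => h1.2 ((hg'1 p hp).2.2.2 (Finset.mem_inter.mpr ⟨h1.1, h⟩))⟩
  refine ⟨f, ?_, ?_⟩
  · rw [exp_verts]
    have hcase : ∀ x ∈ F.verts ∪ (up F).biUnion fun p => (Finset.range (r-2)).image fun s => nv F p s,
        x ∈ F.verts ∨ ∃ p ∈ up F, ∃ s < r - 2, x = nv F p s := by
      intro x hx
      rw [Finset.mem_union, Finset.mem_biUnion] at hx
      refine hx.imp id ?_
      rintro ⟨p, hp, hx⟩
      obtain ⟨s, hs, rfl⟩ := Finset.mem_image.mp hx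
      exact ⟨p, hp, s, Finset.mem_range.mp hs, rfl⟩
    intro x hx y hy hxy
    rcases hcase x hx with hx | ⟨p, hp, s, hs, rfl⟩ <;> rcases hcase y hy with hy | ⟨q, hq, t, ht, rfl⟩
    · rw [hfc x hx, hfc y hy] at hxy
      exact hψ hx hy hxy
    · rw [hfc x hx, hfn q hq t ht] at hxy
      exact absurd (hxy ▸ Finset.mem_image_of_mem ψ hx) (hγm q hq t ht).2
    · rw [hfc y hy, hfn p hp s hs] at hxy
      exact absurd (hxy ▸ Finset.mem_image_of_mem ψ hy) (hγm p hp s hs).2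
    · rw [hfn p hp s hs, hfn q hq t ht] at hxy
      by_cases hpq : p = q
      · subst hpq
        have := (hγ p hp).1 (by simpa using hs) (by simpa using ht) hxy
        rw [this]
      · have := hg'2 p hp q hq hpq (Finset.mem_inter.mpr ⟨(hγm p hp s hs).1, by
          rw [hxy]; exact (hγm q hq t ht).1⟩)
        exact absurd this (hγm p hp s hs).2
  · rw [exp_edges hr]
    intro e he
    rw [Finset.mem_union] at he
    rcases he with he | he
    · have : e.image f = e.image ψ := Finset.image_congr fun x hx =>
        hfc x (F.edges_sub e he (Finset.mem_coe.mp hx))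
      rw [this]; exact hF e he
    · obtain ⟨p, hp, rfl⟩ := Finset.mem_image.mp he
      have hp' := mem_up.mp hp
      obtain ⟨h1, h2, h3, h4⟩ := hg'1 p hp
      have : (insert p.1 (insert p.2 ((Finset.range (r-2)).image fun s => nv F p s))).image f
          = g' p := by
        rw [Finset.image_insert, Finset.image_insert, Finset.image_image, hfc _ hp'.1.1, hfc _ hp'.1.2]
        have : (Finset.range (r-2)).image (f ∘ fun s => nv F p s) = g' p \ {ψ p.1, ψ p.2} := by
          rw [← (hγ p hp).2]
          exact Finset.image_congr fun s hs => hfn p hp s (by simpa using hs)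
        rw [this]
        ext x
        simp only [Finset.mem_insert, Finset.mem_sdiff, Finset.mem_singleton]
        constructor
        · rintro (rfl | rfl | h)
          exacts [h2, h3, h.1]
        · intro h
          by_cases hx1 : x = ψ p.1
          · exact Or.inl hx1
          · by_cases hx2 : x = ψ p.2
            · exact Or.inr (Or.inl hx2)
            · exact Or.inr (Or.inr ⟨h, by tauto⟩)
      rw [this]; exact h1

/-! ### Expanded trees -/

/-- The added set. -/
def apex (r : ℕ) (T : HGraph 2) : Finset ℕ := (Finset.range (r-2)).image fun s => T.verts.sup id + 1 + s

theorem apex_card (r : ℕ) (T : HGraph 2) : (apex r T).card = r - 2 := by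
  unfold apex
  rw [Finset.card_image_of_injective _ (fun a b h => by simpa using h), Finset.card_range]

theorem apex_disj (r : ℕ) (T : HGraph 2) : Disjoint T.verts (apex r T) := by
  rw [Finset.disjoint_left]
  intro x hx hx'
  obtain ⟨s, _, rfl⟩ := Finset.mem_image.mp hx'
  have := lt_sup hx
  omega

theorem expTree_verts (r : ℕ) (T : HGraph 2) : (expTree r T).verts = T.verts ∪ apex r T := rfl

theorem expTree_edges {r : ℕ} (hr : 2 ≤ r) (T : HGraph 2) :
    (expTree r T).edges = T.edges.image fun e => e ∪ apex r T := by
  have : (expTree r T).edges = (T.edges.image fun e => e ∪ apex r T).filter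
    fun e => e ⊆ T.verts ∪ apex r T ∧ e.card = r := rfl
  rw [this, Finset.filter_eq_self]
  intro e he
  obtain ⟨e1, he1, rfl⟩ := Finset.mem_image.mp he
  have h1 := T.edges_sub e1 he1
  refine ⟨Finset.union_subset_union_left h1, ?_⟩
  rw [Finset.card_union_of_disjoint ((apex_disj r T).mono_left h1), apex_card, T.edges_card e1 he1]
  omega

theorem expTree_card {k r : ℕ} (hr : 2 ≤ r) {T : HGraph 2} (hT : IsTreeGraph k T) :
    (expTree r T).verts.card = k + r - 2 := by
  rw [expTree_verts, Finset.card_union_of_disjoint (apex_disj r T), apex_card, hT.1]; omega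

theorem glue {r : ℕ} (hr : 2 ≤ r) {T : HGraph 2} {φ : ℕ → ℕ} {A : Finset ℕ}
    (h1 : Set.InjOn φ ↑T.verts) (h2 : A.card = r - 2) (h3 : ∀ a ∈ T.verts, φ a ∉ A) :
    ∃ ψ : ℕ → ℕ, Set.InjOn ψ ↑(expTree r T).verts ∧
      (expTree r T).verts.image ψ = T.verts.image φ ∪ A ∧
      ∀ e ∈ (expTree r T).edges, ∃ e' ∈ T.edges, e.image ψ = e'.image φ ∪ A := by
  classical
  obtain ⟨α, hα1, hα2⟩ := exists_bij (s := apex r T) (t := A) (by rw [apex_card, h2])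
  have hd := apex_disj r T
  rw [Finset.disjoint_left] at hd
  set ψ : ℕ → ℕ := fun x => if x ∈ T.verts then φ x else α x with hψ
  have e1 : ∀ x ∈ T.verts, ψ x = φ x := fun x hx => by simp [hψ, hx]
  have e2 : ∀ x ∈ apex r T, ψ x = α x := fun x hx => by
    have : x ∉ T.verts := fun h => hd h hx
    simp [hψ, this]
  have e3 : (apex r T).image ψ = A := by
    rw [← hα2]; exact Finset.image_congr fun x hx => e2 x hx
  refine ⟨ψ, ?_, ?_, ?_⟩
  · rw [expTree_verts]
    intro x hx y hy hxy
    rw [Finset.mem_coe, Finset.mem_union] at hx hy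
    rcases hx with hx | hx <;> rcases hy with hy | hy
    · rw [e1 x hx, e1 y hy] at hxy; exact h1 hx hy hxy
    · rw [e1 x hx, e2 y hy] at hxy
      exact absurd (hxy ▸ hα2 ▸ Finset.mem_image_of_mem α hy) (h3 x hx)
    · rw [e2 x hx, e1 y hy] at hxy
      exact absurd (hxy ▸ hα2 ▸ Finset.mem_image_of_mem α hx) (h3 y hy)
    · rw [e2 x hx, e2 y hy] at hxy; exact hα1 hx hy hxy
  · rw [expTree_verts, Finset.image_union, e3]
    congr 1
    exact Finset.image_congr fun x hx => e1 x hx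
  · intro e he
    rw [expTree_edges hr] at he
    obtain ⟨e', he', rfl⟩ := Finset.mem_image.mp he
    refine ⟨e', he', ?_⟩
    rw [Finset.image_union, e3]
    congr 1
    exact Finset.image_congr fun x hx => e1 x (T.edges_sub e' he' hx)

/-- Robustness constant. -/
def mm (k r : ℕ) : ℕ := (k + r) + r + (k + r) ^ 2 * r

/-- Containing the expansion. -/
def Cp (r : ℕ) (T : HGraph 2) (E : Finset (Finset ℕ)) : Prop := CpF (expTree r T).expansion E

theorem Cp.mono {r : ℕ} {T : HGraph 2} {E E' : Finset (Finset ℕ)} (h : E ⊆ E') (hC : Cp r T E) :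
    Cp r T E' := CpF.mono h hC

theorem embG {k r : ℕ} (hr : 2 ≤ r) {T : HGraph 2} (hT : IsTreeGraph k T) {E : Finset (Finset ℕ)}
    (hE : ∀ e ∈ E, e.card = r) {φ : ℕ → ℕ} {A C e0 : Finset ℕ}
    (h1 : Set.InjOn φ ↑T.verts) (h2 : A.card = r - 2) (h3 : ∀ a ∈ T.verts, φ a ∉ A)
    (hC : T.verts.image φ ∪ A = C) (h4 : ∀ e ∈ T.edges, e.image φ ∪ A ∈ E) (he0 : e0.card ≤ r)
    (hR : ∀ a ∈ C, ∀ b ∈ C, a ≠ b → Rob E (mm k r) a b ∨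
      (e0 ∈ E ∧ a ∈ e0 ∧ b ∈ e0 ∧ e0 ∩ C ⊆ {a, b})) : Cp r T E := by
  obtain ⟨ψ, g1, g2, g3⟩ := glue hr h1 h2 h3
  refine lemG (m := mm k r) hr hE g1 ?_ he0 ?_ ?_
  · intro e he
    obtain ⟨e', he', h⟩ := g3 e he
    rw [h]; exact h4 e' he'
  · rw [expTree_card hr hT]
    unfold mm
    have h5 : k + r - 2 ≤ k + r := by omega
    have := Nat.mul_le_mul_right r (Nat.pow_le_pow_left h5 2)
    omega
  · intro a ha b hb hab
    rw [g2, hC]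
    have hm : ∀ x ∈ (expTree r T).verts, ψ x ∈ C := fun x hx => by
      rw [← hC, ← g2]; exact Finset.mem_image_of_mem _ hx
    exact hR _ (hm a ha) _ (hm b hb) fun h => by
      have := g1 ha hb h
      omega

theorem KF_of_ExpIn {r : ℕ} (hr : 2 ≤ r) {T : HGraph 2} {k : ℕ} (hT : IsTreeGraph k T) (hk : 2 ≤ k)
    {E E' : Finset (Finset ℕ)} {R : Finset ℕ}
    (hE' : E' ⊆ E) (hR : ∀ e ∈ E', e ⊆ R)
    (hcov : ∀ a ∈ R, ∀ b ∈ R, a ≠ b → ∃ e ∈ E, a ∈ e ∧ b ∈ e)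
    (h : ExpIn r T E') : KF (expTree r T) E := by
  obtain ⟨φ, A, h1, h2, h3, h4⟩ := h
  obtain ⟨ψ, g1, g2, g3⟩ := glue hr h1 h2 h3
  have hsub : T.verts.image φ ∪ A ⊆ R := by
    apply Finset.union_subset
    · intro x hx
      obtain ⟨a, ha, rfl⟩ := Finset.mem_image.mp hx
      obtain ⟨e, he, hae⟩ := tree_edge hT hk ha
      exact hR _ (h4 e he) (Finset.mem_union_left _ (Finset.mem_image_of_mem _ hae))
    · have hne : T.edges.Nonempty := by rw [← Finset.card_pos, hT.2.1]; omega
      obtain ⟨e, he⟩ := hne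
      exact Finset.subset_union_right.trans (hR _ (h4 e he))
  have hm : ∀ x ∈ (expTree r T).verts, ψ x ∈ R := fun x hx => by
    apply hsub; rw [← g2]; exact Finset.mem_image_of_mem _ hx
  refine ⟨ψ, g1, ?_, ?_⟩
  · intro e he
    obtain ⟨e', he', h⟩ := g3 e he
    rw [h]; exact hE' (h4 e' he')
  · intro a ha b hb hab
    exact hcov _ (hm a ha) _ (hm b hb) fun h => hab (g1 ha hb h)

theorem tree_two {k : ℕ} {T : HGraph 2} (hT : IsTreeGraph k T) {r : ℕ} (hr : 2 ≤ r) (hk : 2 ≤ k)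
    {x : ℕ} (hx : x ∈ (expTree r T).verts) :
    ∃ y ∈ (expTree r T).verts, x ≠ y := by
  have h := expTree_card hr hT
  by_contra hcon
  push Not at hcon
  have : (expTree r T).verts ⊆ {x} := fun y hy => by rw [Finset.mem_singleton]; exact (hcon y hy).symm
  have := Finset.card_le_card this
  rw [h, Finset.card_singleton] at this
  omega

/-- ℓ-partite graphs have no core. -/
theorem part_free {k r ℓ : ℕ} {T : HGraph 2} (h : Good k r ℓ T) {E : Finset (Finset ℕ)} {c : ℕ → ℕ}
    (hc : ∀ e ∈ E, Set.InjOn c (↑e : Set ℕ)) (hl : ∀ e ∈ E, ∀ v ∈ e, c v < ℓ) :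
    ¬ KF (expTree r T) E := by
  have hr := h.hr
  have hk := h.hk36
  rintro ⟨ψ, g1, g2, g3⟩
  have hcard := expTree_card (r := r) (by omega) h.hT
  have hmaps : ∀ x ∈ (expTree r T).verts, (c ∘ ψ) x ∈ Finset.range ℓ := by
    intro x hx
    obtain ⟨y, hy, hxy⟩ := tree_two h.hT (r := r) (by omega) (by omega) hx
    obtain ⟨e, he, h1, h2⟩ := g3 x hx y hy hxy
    exact Finset.mem_range.mpr (hl e he _ h1)
  obtain ⟨x, hx, y, hy, hxy, hcxy⟩ := Finset.exists_ne_map_eq_of_card_lt_of_maps_to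
    (by rw [Finset.card_range, hcard, h.hℓ]; omega) hmaps
  obtain ⟨e, he, h1, h2⟩ := g3 x hx y hy hxy
  exact hxy (g1 hx hy (hc e he h1 h2 hcxy))

/-- Core-freeness is closed under homomorphic images. -/
theorem KF_hom {r : ℕ} {F : HGraph r} {E E' : Finset (Finset ℕ)} (hE : ∀ e ∈ E, e.card = r)
    (hE' : ∀ e ∈ E', e.card = r) {σ : ℕ → ℕ} (hσ : ∀ e ∈ E', e.image σ ∈ E) (h : KF F E') : KF F E := by
  obtain ⟨ψ, g1, g2, g3⟩ := h
  have hinj : ∀ e ∈ E', Set.InjOn σ (↑e : Set ℕ) := fun e he => by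
    rw [← Finset.card_image_iff, hE _ (hσ e he), hE' e he]
  refine ⟨σ ∘ ψ, ?_, ?_, ?_⟩
  · intro a ha b hb hab
    by_contra hne
    obtain ⟨e, he, h1, h2⟩ := g3 a ha b hb hne
    exact hne (g1 ha hb (hinj e he h1 h2 hab))
  · intro e he
    rw [← Finset.image_image]; exact hσ _ (g2 e he)
  · intro a ha b hb hab
    obtain ⟨e, he, h1, h2⟩ := g3 a ha b hb hab
    exact ⟨_, hσ e he, Finset.mem_image_of_mem _ h1, Finset.mem_image_of_mem _ h2⟩

theorem Rob_symm {E : Finset (Finset ℕ)} {m a b : ℕ} (h : Rob E m a b) : Rob E m b a := by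
  intro X hX
  obtain ⟨e, he, h1, h2, h3⟩ := h X hX
  exact ⟨e, he, h2, h1, by rw [Finset.pair_comm]; exact h3⟩

/-- Non-robust pairs have small codegree. -/
theorem not_Rob {V : Finset ℕ} {r m a b : ℕ} (hr : 3 ≤ r) {E : Finset (Finset ℕ)}
    (hE : E ⊆ V.powersetCard r) (hab : a ≠ b) (h : ¬ Rob E m a b) :
    (E.filter (fun e => a ∈ e ∧ b ∈ e)).card ≤ m * V.card ^ (r - 3) := by
  unfold Rob at h
  push Not at h
  obtain ⟨X, hX, h⟩ := h
  have hsub : E.filter (fun e => a ∈ e ∧ b ∈ e) ⊆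
      (X \ {a, b}).biUnion fun x => (V.powersetCard r).filter (fun e => ({a, b, x} : Finset ℕ) ⊆ e) := by
    intro e he
    rw [Finset.mem_filter] at he
    have := h e he.1 he.2.1 he.2.2
    rw [Finset.not_subset] at this
    obtain ⟨x, hx, hx'⟩ := this
    rw [Finset.mem_inter] at hx
    refine Finset.mem_biUnion.mpr ⟨x, Finset.mem_sdiff.mpr ⟨hx.2, hx'⟩,
      Finset.mem_filter.mpr ⟨hE he.1, ?_⟩⟩
    intro y hy
    simp only [Finset.mem_insert, Finset.mem_singleton] at hy
    rcases hy with rfl | rfl | rfl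
    exacts [he.2.1, he.2.2, hx.1]
  refine (Finset.card_le_card hsub).trans ?_
  refine (Finset.card_biUnion_le_card_mul _ _ (V.card ^ (r-3)) ?_).trans
    (Nat.mul_le_mul_right _ ((Finset.card_le_card Finset.sdiff_subset).trans hX))
  intro x hx
  rw [Finset.mem_sdiff, Finset.mem_insert, Finset.mem_singleton] at hx
  refine cnt_sup.trans (le_of_eq ?_)
  congr 2
  rw [Finset.card_insert_of_notMem, Finset.card_insert_of_notMem, Finset.card_singleton]
  · simp; tauto
  · simp only [Finset.mem_insert, Finset.mem_singleton]
    rintro (h | h)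
    · exact hab h
    · exact hx.2 (Or.inl h.symm)

/-! ### Embedding lemmas -/

/-- Number of missing link sets. -/
def TY (E : Finset (Finset ℕ)) (c : ℕ → ℕ) (V : Finset ℕ) (ℓ r w i : ℕ) : ℕ :=
  (Crs c V (r-1) (Finset.range ℓ \ {i}) \ lk E w).card

theorem PP_union_le {A B : Finset (Finset ℕ)} {x : ℕ → ℝ} (hx : ∀ i, 0 ≤ x i) :
    PP (A ∪ B) x ≤ PP A x + PP B x := by
  unfold PP
  rw [← Finset.sum_union_inter]
  have : 0 ≤ ∑ e ∈ A ∩ B, ∏ i ∈ e, x i :=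
    Finset.sum_nonneg fun e _ => Finset.prod_nonneg fun i _ => hx i
  linarith

theorem PPc {S : Finset (Finset ℕ)} {j n : ℕ} {ζ : ℝ} (hS : ∀ B ∈ S, B.card = j) (hn : 0 < n)
    (h : (S.card : ℝ) ≤ ζ * (n:ℝ) ^ j) : PP S (fun _ => 1 / (n:ℝ)) ≤ ζ := by
  have hn' : (0:ℝ) < n := by exact_mod_cast hn
  have : PP S (fun _ => 1 / (n:ℝ)) = S.card * (1 / (n:ℝ)) ^ j := by
    unfold PP
    rw [Finset.sum_congr rfl (fun B hB => by rw [Finset.prod_const, hS B hB]), Finset.sum_const,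
      nsmul_eq_mul]
  rw [this, one_div, inv_pow, ← div_eq_mul_inv, div_le_iff₀ (by positivity)]
  exact h

theorem lk_filter_card {E : Finset (Finset ℕ)} {w x : ℕ} (hwx : w ≠ x) :
    ((lk E w).filter (fun f => x ∈ f)).card ≤ (E.filter (fun e => w ∈ e ∧ x ∈ e)).card := by
  apply Finset.card_le_card_of_injOn (fun f => insert w f)
  · intro f hf
    rw [Finset.mem_coe, Finset.mem_filter, mem_lk] at hf
    rw [Finset.mem_coe, Finset.mem_filter]
    exact ⟨hf.1.2, Finset.mem_insert_self _ _, Finset.mem_insert_of_mem hf.2⟩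
  · intro f hf g hg hfg
    rw [Finset.mem_coe, Finset.mem_filter, mem_lk] at hf hg
    have h : (insert w f).erase w = (insert w g).erase w := by
      rw [show insert w f = insert w g from hfg]
    rwa [Finset.erase_insert hf.1.1, Finset.erase_insert hg.1.1] at h

theorem Crs_surj {c : ℕ → ℕ} {V I f : Finset ℕ} {q : ℕ} (hf : f ∈ Crs c V q I) (hI : I.card = q)
    {j : ℕ} (hj : j ∈ I) : ∃ x ∈ f, c x = j := by
  rw [mem_Crs] at hf
  have h1 : f.image c = I := by
    apply Finset.eq_of_subset_of_card_le
    · intro y hy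
      obtain ⟨x, hx, rfl⟩ := Finset.mem_image.mp hy
      exact hf.2.2.2 x hx
    · rw [Finset.card_image_of_injOn hf.2.2.1, hf.2.1, hI]
  rw [← h1] at hj
  obtain ⟨x, hx, h⟩ := Finset.mem_image.mp hj
  exact ⟨x, hx, h⟩

/-- `LN` for one part. -/
theorem light_part {V : Finset ℕ} {r ℓ m w i j : ℕ} (hr : 3 ≤ r) (hrl : r ≤ ℓ)
    {E : Finset (Finset ℕ)}
    {c : ℕ → ℕ} (hE : E ⊆ V.powersetCard r)
    (hP : ∀ j < ℓ, (V.card:ℝ) / (2 * ℓ) ≤ ((V.filter (fun v => c v = j)).card : ℝ))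
    (hj : j < ℓ) (hij : j ≠ i) (Λ : Finset ℕ) (hΛ : ∀ x ∈ Λ, x ∈ V ∧ c x = j ∧ w ≠ x ∧ ¬ Rob E m w x) :
    (Λ.card : ℝ) * ((V.card:ℝ) / (2 * ℓ)) ^ (r - 2) ≤
      TY E c V ℓ r w i + Λ.card * (m * (V.card:ℝ) ^ (r - 3)) := by
  classical
  have hsub0 : {j} ⊆ Finset.range ℓ \ {i} := by
    intro x hx
    rw [Finset.mem_singleton] at hx; subst hx
    rw [Finset.mem_sdiff, Finset.mem_range, Finset.mem_singleton]
    exact ⟨hj, hij⟩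
  have hcJ : r - 1 ≤ (Finset.range ℓ \ {i}).card := by
    have := Finset.le_card_sdiff {i} (Finset.range ℓ)
    rw [Finset.card_range, Finset.card_singleton] at this
    omega
  obtain ⟨I, hI1, hI2, hI3⟩ := Finset.exists_subsuperset_card_eq hsub0
    (by rw [Finset.card_singleton]; omega) hcJ
  have hjI : j ∈ I := hI1 (Finset.mem_singleton_self j)
  set V' := V.filter (fun x => c x = j → x ∈ Λ) with hV'
  have hcard := Trs_card c V' I
  rw [hI3, ← Finset.mul_prod_erase _ _ hjI] at hcard
  have hf1 : V'.filter (fun v => c v = j) = Λ := by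
    ext x
    simp only [hV', Finset.mem_filter]
    constructor
    · rintro ⟨⟨_, h2⟩, h3⟩; exact h2 h3
    · intro hx; exact ⟨⟨(hΛ x hx).1, fun _ => hx⟩, (hΛ x hx).2.1⟩
  have hf2 : ((V.card:ℝ) / (2 * ℓ)) ^ (r - 2) ≤
      ∏ x ∈ I.erase j, ((V'.filter (fun v => c v = x)).card : ℝ) := by
    have hc : (I.erase j).card = r - 2 := by rw [Finset.card_erase_of_mem hjI, hI3]; omega
    rw [← hc, ← Finset.prod_const]
    apply Finset.prod_le_prod
    · intro x _; positivity
    · intro x hx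
      have hx' := hI2 (Finset.mem_of_mem_erase hx)
      rw [Finset.mem_sdiff, Finset.mem_range] at hx'
      refine (hP x hx'.1).trans (le_of_eq ?_)
      congr 2
      ext y
      simp only [hV', Finset.mem_filter]
      constructor
      · rintro ⟨h1, h2⟩
        exact ⟨⟨h1, fun h => absurd (h2.symm.trans h) (Finset.ne_of_mem_erase hx)⟩, h2⟩
      · rintro ⟨⟨h1, _⟩, h2⟩; exact ⟨h1, h2⟩
  have hup : (Crs c V' (r-1) I).card ≤ TY E c V ℓ r w i + Λ.card * (m * V.card ^ (r - 3)) := by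
    have hsub : Crs c V' (r-1) I ⊆ (Crs c V (r-1) (Finset.range ℓ \ {i}) \ lk E w) ∪
        Λ.biUnion (fun x => (lk E w).filter (fun f => x ∈ f)) := by
      intro f hf
      have hf' := mem_Crs.mp hf
      by_cases hl : f ∈ lk E w
      · apply Finset.mem_union_right
        obtain ⟨x, hx, hxj⟩ := Crs_surj hf hI3 hjI
        have hxV := hf'.1 hx
        rw [hV', Finset.mem_filter] at hxV
        exact Finset.mem_biUnion.mpr ⟨x, hxV.2 hxj, Finset.mem_filter.mpr ⟨hl, hx⟩⟩
      · apply Finset.mem_union_left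
        rw [Finset.mem_sdiff, mem_Crs]
        exact ⟨⟨hf'.1.trans (Finset.filter_subset _ _), hf'.2.1, hf'.2.2.1,
          fun v hv => hI2 (hf'.2.2.2 v hv)⟩, hl⟩
    refine (Finset.card_le_card hsub).trans ((Finset.card_union_le _ _).trans ?_)
    refine Nat.add_le_add_left ?_ _
    apply Finset.card_biUnion_le_card_mul
    intro x hx
    exact (lk_filter_card (hΛ x hx).2.2.1).trans (not_Rob hr hE (hΛ x hx).2.2.1 (hΛ x hx).2.2.2)
  calc (Λ.card : ℝ) * ((V.card:ℝ) / (2 * ℓ)) ^ (r - 2)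
      ≤ Λ.card * ∏ x ∈ I.erase j, ((V'.filter (fun v => c v = x)).card : ℝ) :=
        mul_le_mul_of_nonneg_left hf2 (by positivity)
    _ = (Crs c V' (r-1) I).card := by rw [hcard, hf1]
    _ ≤ _ := by exact_mod_cast hup

open Classical in
/-- Light neighbours. -/
noncomputable def Lt (E : Finset (Finset ℕ)) (c : ℕ → ℕ) (V : Finset ℕ) (m w i : ℕ) : Finset ℕ :=
  V.filter (fun x => c x ≠ i ∧ w ≠ x ∧ ¬ Rob E m w x)

theorem light {V : Finset ℕ} {r ℓ m w i : ℕ} {ζ : ℝ} (hr : 3 ≤ r) (hrl : r ≤ ℓ)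
    {E : Finset (Finset ℕ)}
    {c : ℕ → ℕ} (hE : E ⊆ V.powersetCard r) (hc : ∀ v ∈ V, c v < ℓ)
    (hP : ∀ j < ℓ, (V.card:ℝ) / (2 * ℓ) ≤ ((V.filter (fun v => c v = j)).card : ℝ))
    (hn : 0 < V.card) (hm : (m:ℝ) ≤ ζ * V.card)
    (hTY : (TY E c V ℓ r w i : ℝ) ≤ ζ * (V.card:ℝ) ^ (r-1)) :
    ((Lt E c V m w i).card : ℝ) ≤ (2 * ℓ) ^ (r-1) * ζ * V.card := by
  classical
  set n : ℝ := (V.card : ℝ) with hnn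
  have hn' : (0:ℝ) < n := by rw [hnn]; exact_mod_cast hn
  have hl : (0:ℝ) < ℓ := by exact_mod_cast (show 0 < ℓ by omega)
  have hpart : ∀ j ∈ Finset.range ℓ, (((Lt E c V m w i).filter (fun x => c x = j)).card : ℝ) ≤
      2 * (2 * ℓ) ^ (r-2) * ζ * n := by
    intro j hj
    rw [Finset.mem_range] at hj
    set Λ := (Lt E c V m w i).filter (fun x => c x = j) with hΛ
    have hζ : 0 ≤ ζ := by
      by_contra hneg
      push Not at hneg
      have : ζ * n < 0 := mul_neg_of_neg_of_pos hneg hn'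
      have : (0:ℝ) ≤ m := Nat.cast_nonneg m
      linarith
    by_cases hij : j = i
    · have : Λ = ∅ := by
        rw [hΛ, Finset.filter_eq_empty_iff]
        intro x hx h
        unfold Lt at hx
        rw [Finset.mem_filter] at hx
        exact hx.2.1 (h.trans hij)
      rw [this]; simp; positivity
    · have h1 := light_part (m := m) (w := w) (i := i) hr hrl hE hP hj hij Λ (by
        intro x hx
        rw [hΛ, Finset.mem_filter] at hx
        unfold Lt at hx
        rw [Finset.mem_filter] at hx
        exact ⟨hx.1.1, hx.2, hx.1.2.2.1, hx.1.2.2.2⟩)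
      rw [← hnn] at h1
      have h2 : (Λ.card : ℝ) ≤ n := by
        rw [hnn]
        exact_mod_cast Finset.card_le_card ((Finset.filter_subset _ _).trans (by
          unfold Lt; exact Finset.filter_subset _ _))
      have h3 : (Λ.card : ℝ) * (m * n ^ (r-3)) ≤ n * (ζ * n * n ^ (r-3)) := by
        apply mul_le_mul h2 _ (by positivity) hn'.le
        exact mul_le_mul_of_nonneg_right hm (by positivity)
      have h4 : n * (ζ * n * n ^ (r-3)) = ζ * n ^ (r-1) := by
        rw [show r - 1 = (r - 3) + 2 by omega, pow_add]; ring
      have h5 : (Λ.card : ℝ) * (n / (2 * ℓ)) ^ (r - 2) ≤ 2 * (ζ * n ^ (r-1)) := by linarith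
      have h6 : 2 * (ζ * n ^ (r-1)) = (2 * (2 * ℓ) ^ (r-2) * ζ * n) * (n / (2 * ℓ)) ^ (r - 2) := by
        rw [div_pow, show r - 1 = (r - 2) + 1 by omega, pow_succ]
        field_simp
      rw [h6] at h5
      exact le_of_mul_le_mul_right h5 (by positivity)
  have hsum := sum_fibres c (Lt E c V m w i) (Finset.range ℓ) (by
    intro v hv
    unfold Lt at hv
    exact Finset.mem_range.mpr (hc v (Finset.mem_filter.mp hv).1))
  rw [← hsum]
  calc _ ≤ ∑ _j ∈ Finset.range ℓ, 2 * (2 * (ℓ:ℝ)) ^ (r-2) * ζ * n := Finset.sum_le_sum hpart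
    _ = _ := by
      rw [Finset.sum_const, Finset.card_range, nsmul_eq_mul, show r - 1 = (r - 2) + 1 by omega, pow_succ]
      ring

/-- Number of atypical vertices. -/
theorem atyp {V : Finset ℕ} {r ℓ : ℕ} (hr : 3 ≤ r) {E : Finset (Finset ℕ)}
    {c : ℕ → ℕ} (hc : ∀ v ∈ V, c v < ℓ) {s : ℝ} (W : Finset ℕ) (hW : W ⊆ V)
    (hs : ∀ w ∈ W, s ≤ TY E c V ℓ r w (c w)) :
    (W.card : ℝ) * s ≤ r * ((Crs c V r (Finset.range ℓ) \ E).card : ℝ) := by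
  classical
  set M := Crs c V r (Finset.range ℓ) \ E with hM
  have h1 : ∀ w ∈ W, TY E c V ℓ r w (c w) ≤ (M.filter (fun e => w ∈ e)).card := by
    intro w hw
    unfold TY
    have hwn : ∀ f ∈ Crs c V (r-1) (Finset.range ℓ \ {c w}), w ∉ f := by
      intro f hf hwf
      have := (mem_Crs.mp hf).2.2.2 w hwf
      rw [Finset.mem_sdiff, Finset.mem_singleton] at this
      exact this.2 rfl
    apply Finset.card_le_card_of_injOn (fun f => insert w f)
    · intro f hf
      rw [Finset.mem_coe, Finset.mem_sdiff] at hf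
      have hwf := hwn f hf.1
      have hf1 := mem_Crs.mp hf.1
      rw [Finset.mem_coe, Finset.mem_filter, hM, Finset.mem_sdiff, mem_Crs]
      refine ⟨⟨⟨?_, ?_, ?_, ?_⟩, ?_⟩, Finset.mem_insert_self _ _⟩
      · exact Finset.insert_subset (hW hw) hf1.1
      · rw [Finset.card_insert_of_notMem hwf, hf1.2.1]; omega
      · rw [Finset.coe_insert, Set.injOn_insert (by simpa using hwf)]
        refine ⟨hf1.2.2.1, ?_⟩
        rintro ⟨x, hx, hxw⟩
        have := hf1.2.2.2 x hx
        rw [Finset.mem_sdiff, Finset.mem_singleton] at this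
        exact this.2 hxw
      · intro v hv
        rw [Finset.mem_insert] at hv
        rcases hv with rfl | hv
        · exact Finset.mem_range.mpr (hc _ (hW hw))
        · exact (Finset.mem_sdiff.mp (hf1.2.2.2 v hv)).1
      · intro h; exact hf.2 (mem_lk.mpr ⟨hwf, h⟩)
    · intro f hf g hg hfg
      rw [Finset.mem_coe, Finset.mem_sdiff] at hf hg
      have h : (insert w f).erase w = (insert w g).erase w := by
        rw [show insert w f = insert w g from hfg]
      rwa [Finset.erase_insert (hwn f hf.1), Finset.erase_insert (hwn g hg.1)] at h
  have h2 : ∑ w ∈ W, (M.filter (fun e => w ∈ e)).card ≤ r * M.card := by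
    have := Finset.sum_card_bipartiteAbove_eq_sum_card_bipartiteBelow (s := W) (t := M)
      (fun w e => w ∈ e)
    unfold Finset.bipartiteAbove Finset.bipartiteBelow at this
    rw [this, mul_comm, ← smul_eq_mul]
    apply Finset.sum_le_card_nsmul
    intro e he
    have hec : e.card = r := (mem_Crs.mp (Finset.mem_sdiff.mp he).1).2.1
    rw [← hec]
    exact Finset.card_le_card fun x hx => (Finset.mem_filter.mp hx).2
  calc (W.card : ℝ) * s = ∑ _w ∈ W, s := by rw [Finset.sum_const, nsmul_eq_mul]
    _ ≤ ∑ w ∈ W, ((M.filter (fun e => w ∈ e)).card : ℝ) :=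
        Finset.sum_le_sum fun w hw => (hs w hw).trans (by exact_mod_cast h1 w hw)
    _ ≤ _ := by exact_mod_cast h2

/-- Light pairs. -/
noncomputable def LPr (E : Finset (Finset ℕ)) (c : ℕ → ℕ) (V : Finset ℕ) (m : ℕ) (W : Finset ℕ) :
    Finset (Finset ℕ) := W.biUnion (fun x => (Lt E c V m x (c x)).image (fun y => {x, y}))

theorem LPr_two {E : Finset (Finset ℕ)} {c : ℕ → ℕ} {V W : Finset ℕ} {m : ℕ} :
    ∀ B ∈ LPr E c V m W, B.card = 2 := by
  classical
  intro B hB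
  unfold LPr at hB
  rw [Finset.mem_biUnion] at hB
  obtain ⟨x, _, hB⟩ := hB
  obtain ⟨y, hy, rfl⟩ := Finset.mem_image.mp hB
  unfold Lt at hy
  exact Finset.card_pair (Finset.mem_filter.mp hy).2.2.1

theorem LPr_card {V W : Finset ℕ} {r ℓ m : ℕ} {ζ : ℝ} (hr : 3 ≤ r) (hrl : r ≤ ℓ)
    {E : Finset (Finset ℕ)}
    {c : ℕ → ℕ} (hE : E ⊆ V.powersetCard r) (hc : ∀ v ∈ V, c v < ℓ)
    (hP : ∀ j < ℓ, (V.card:ℝ) / (2 * ℓ) ≤ ((V.filter (fun v => c v = j)).card : ℝ))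
    (hn : 0 < V.card) (hm : (m:ℝ) ≤ ζ * V.card) (hW : W ⊆ V)
    (hTY : ∀ w ∈ W, (TY E c V ℓ r w (c w) : ℝ) ≤ ζ * (V.card:ℝ) ^ (r-1)) :
    ((LPr E c V m W).card : ℝ) ≤ ((2 * ℓ) ^ (r-1) * ζ) * (V.card : ℝ) ^ 2 := by
  have hn' : (0:ℝ) < V.card := by exact_mod_cast hn
  have hζ : 0 ≤ ζ := by
    by_contra hneg
    push Not at hneg
    have : ζ * V.card < 0 := mul_neg_of_neg_of_pos hneg hn'
    have : (0:ℝ) ≤ m := Nat.cast_nonneg m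
    linarith
  have h1 : ((LPr E c V m W).card : ℝ) ≤ ∑ x ∈ W, ((Lt E c V m x (c x)).card : ℝ) := by
    have : (LPr E c V m W).card ≤ ∑ x ∈ W, (Lt E c V m x (c x)).card :=
      Finset.card_biUnion_le.trans (Finset.sum_le_sum fun x _ => Finset.card_image_le)
    exact_mod_cast this
  refine h1.trans ((Finset.sum_le_sum fun x hx =>
    light hr hrl hE hc hP hn hm (hTY x hx)).trans ?_)
  rw [Finset.sum_const, nsmul_eq_mul]
  have : (W.card : ℝ) ≤ V.card := by exact_mod_cast Finset.card_le_card hW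
  have := mul_le_mul_of_nonneg_right this (show 0 ≤ (2 * (ℓ:ℝ)) ^ (r-1) * ζ * V.card by positivity)
  refine this.trans (le_of_eq ?_)
  ring

theorem LPr_rob {E : Finset (Finset ℕ)} {c : ℕ → ℕ} {V W : Finset ℕ} {m x y : ℕ} (hx : x ∈ W)
    (hy : y ∈ V) (hxy : c y ≠ c x) (h : ({x, y} : Finset ℕ) ∉ LPr E c V m W) : Rob E m x y := by
  classical
  by_contra hR
  apply h
  unfold LPr
  refine Finset.mem_biUnion.mpr ⟨x, hx, Finset.mem_image.mpr ⟨y, ?_, rfl⟩⟩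
  unfold Lt
  exact Finset.mem_filter.mpr ⟨hy, hxy, fun h => hxy (by rw [h]), hR⟩

/-! ### Structure near the extremal configuration -/

/-- A near-complete `ℓ`-partite situation. -/
structure Near (k r ℓ : ℕ) (E : Finset (Finset ℕ)) (c : ℕ → ℕ) (V W : Finset ℕ) (ζ : ℝ) : Prop where
  hE : E ⊆ V.powersetCard r
  hc : ∀ v ∈ V, c v < ℓ
  hP : ∀ j < ℓ, (V.card:ℝ) / (2 * ℓ) ≤ ((V.filter (fun v => c v = j)).card : ℝ)
  hn : 0 < V.card
  hm : (mm k r : ℝ) ≤ ζ * V.card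
  hM : ((Crs c V r (Finset.range ℓ) \ E).card : ℝ) ≤ ζ * (V.card:ℝ) ^ r
  hW : W ⊆ V
  hWT : ∀ w ∈ W, (TY E c V ℓ r w (c w) : ℝ) ≤ ζ * (V.card:ℝ) ^ (r-1)
  hWc : ((V \ W).card : ℝ) ≤ ζ * V.card

theorem Near.zeta {k r ℓ : ℕ} {E : Finset (Finset ℕ)} {c : ℕ → ℕ} {V W : Finset ℕ} {ζ : ℝ}
    (h : Near k r ℓ E c V W ζ) : 0 ≤ ζ := by
  have hn' : (0:ℝ) < V.card := by exact_mod_cast h.hn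
  by_contra hneg
  push Not at hneg
  have h1 : ζ * V.card < 0 := mul_neg_of_neg_of_pos hneg hn'
  have h2 : (0:ℝ) ≤ mm k r := Nat.cast_nonneg _
  have := h.hm
  linarith

theorem singles_PP {S : Finset ℕ} {n : ℕ} {z : ℝ} (hn : 0 < n) (h : (S.card:ℝ) ≤ z * n) :
    PP (S.image (fun x => ({x} : Finset ℕ))) (fun _ => 1 / (n:ℝ)) ≤ z := by
  apply PPc (j := 1) _ hn
  · rw [pow_one]
    refine le_trans ?_ h
    exact_mod_cast Finset.card_image_le
  · intro B hB
    obtain ⟨x, _, rfl⟩ := Finset.mem_image.mp hB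
    simp

/-- Lemma I. -/
theorem lemI {k r ℓ : ℕ} {T : HGraph 2} (h : Good k r ℓ T) : ∃ ζ0 > (0:ℝ), ∀ ζ ≤ ζ0,
    ∀ {E : Finset (Finset ℕ)} {c : ℕ → ℕ} {V W : Finset ℕ}, Near k r ℓ E c V W ζ →
    ∀ {w w' i : ℕ} {e : Finset ℕ}, w ∈ V → w' ∈ V → w ≠ w' → i < ℓ →
    (TY E c V ℓ r w i : ℝ) ≤ ζ * (V.card:ℝ) ^ (r-1) →
    (TY E c V ℓ r w' i : ℝ) ≤ ζ * (V.card:ℝ) ^ (r-1) → e ∈ E → w ∈ e → w' ∈ e → Cp r T E := by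
  have hr := h.hr
  have hrl := h.hrl
  have hk := h.hk36
  have hlpos : (0:ℝ) < ℓ := by exact_mod_cast (show 0 < ℓ by omega)
  set CL : ℝ := (2 * ℓ) ^ (r-1) with hCL
  have hCL0 : 0 < CL := by positivity
  refine ⟨(1 / (2 * (ℓ:ℝ))) ^ (ℓ - 1) / (2 * (5 + 3 * CL)), by positivity, ?_⟩
  intro ζ hζ E c V W hN w w' i e hw hw' hww hi hTw hTw' he hwe hwe'
  classical
  have hn' : (0:ℝ) < V.card := by exact_mod_cast hN.hn
  set J := Finset.range ℓ \ {i} with hJ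
  have hJc : J.card = ℓ - 1 := by
    rw [hJ, Finset.card_sdiff_of_subset (by simpa using hi), Finset.card_range, Finset.card_singleton]
  set S := e ∪ (V \ W) ∪ Lt E c V (mm k r) w i ∪ Lt E c V (mm k r) w' i with hS
  have hlw := light hr (by omega) hN.hE hN.hc hN.hP hN.hn hN.hm hTw
  have hlw' := light hr (by omega) hN.hE hN.hc hN.hP hN.hn hN.hm hTw'
  have hec : e.card = r := (Finset.mem_powersetCard.mp (hN.hE he)).2
  have hSc : (S.card : ℝ) ≤ (2 + 2 * CL) * ζ * V.card := by
    have h1 : S.card ≤ e.card + (V \ W).card + (Lt E c V (mm k r) w i).card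
        + (Lt E c V (mm k r) w' i).card := by
      rw [hS]
      have a1 := Finset.card_union_le (e ∪ (V \ W) ∪ Lt E c V (mm k r) w i) (Lt E c V (mm k r) w' i)
      have a2 := Finset.card_union_le (e ∪ (V \ W)) (Lt E c V (mm k r) w i)
      have a3 := Finset.card_union_le e (V \ W)
      omega
    have h2 : (S.card:ℝ) ≤ e.card + (V \ W).card + (Lt E c V (mm k r) w i).card
        + (Lt E c V (mm k r) w' i).card := by exact_mod_cast h1
    have h3 : (e.card : ℝ) ≤ ζ * V.card := by
      refine le_trans ?_ hN.hm
      rw [hec]; unfold mm; exact_mod_cast (by omega)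
    have := hN.hWc
    linarith
  set Bad := (Crs c V r (Finset.range ℓ) \ E) ∪ (Crs c V (r-1) J \ lk E w) ∪
    (Crs c V (r-1) J \ lk E w') ∪ S.image (fun x => ({x} : Finset ℕ)) ∪ LPr E c V (mm k r) W with hBad
  have hx : ∀ _i : ℕ, (0:ℝ) ≤ 1 / (V.card:ℝ) := fun _ => by positivity
  have hPB : PP Bad (fun _ => 1 / (V.card:ℝ)) ≤ (5 + 3 * CL) * ζ := by
    have b1 : PP (Crs c V r (Finset.range ℓ) \ E) (fun _ => 1 / (V.card:ℝ)) ≤ ζ :=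
      PPc (j := r) (fun B hB => (mem_Crs.mp (Finset.mem_sdiff.mp hB).1).2.1) hN.hn hN.hM
    have b2 : PP (Crs c V (r-1) J \ lk E w) (fun _ => 1 / (V.card:ℝ)) ≤ ζ :=
      PPc (j := r-1) (fun B hB => (mem_Crs.mp (Finset.mem_sdiff.mp hB).1).2.1) hN.hn hTw
    have b3 : PP (Crs c V (r-1) J \ lk E w') (fun _ => 1 / (V.card:ℝ)) ≤ ζ :=
      PPc (j := r-1) (fun B hB => (mem_Crs.mp (Finset.mem_sdiff.mp hB).1).2.1) hN.hn hTw'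
    have b4 := singles_PP hN.hn hSc
    have b5 : PP (LPr E c V (mm k r) W) (fun _ => 1 / (V.card:ℝ)) ≤ CL * ζ :=
      PPc (j := 2) LPr_two hN.hn
        (LPr_card hr (by omega) hN.hE hN.hc hN.hP hN.hn hN.hm hN.hW hN.hWT)
    have c1 := PP_union_le (A := (Crs c V r (Finset.range ℓ) \ E) ∪ (Crs c V (r-1) J \ lk E w) ∪
      (Crs c V (r-1) J \ lk E w') ∪ S.image (fun x => ({x} : Finset ℕ)))
      (B := LPr E c V (mm k r) W) hx
    have c2 := PP_union_le (A := (Crs c V r (Finset.range ℓ) \ E) ∪ (Crs c V (r-1) J \ lk E w) ∪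
      (Crs c V (r-1) J \ lk E w')) (B := S.image (fun x => ({x} : Finset ℕ))) hx
    have c3 := PP_union_le (A := (Crs c V r (Finset.range ℓ) \ E) ∪ (Crs c V (r-1) J \ lk E w))
      (B := (Crs c V (r-1) J \ lk E w')) hx
    have c4 := PP_union_le (A := (Crs c V r (Finset.range ℓ) \ E))
      (B := (Crs c V (r-1) J \ lk E w)) hx
    rw [hBad]
    linarith
  have hL : (V.card / (2 * (ℓ:ℝ))) ^ (ℓ - 1) ≤ ((Crs c V (ℓ-1) J).card : ℝ) := by
    rw [← hJc, Trs_card, ← Finset.prod_const]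
    apply Finset.prod_le_prod
    · intro _ _; positivity
    · intro j hj
      rw [hJ, Finset.mem_sdiff, Finset.mem_range] at hj
      exact hN.hP j hj.1
  have hav := avoid (V := V) (q := ℓ - 1) (L := Crs c V (ℓ-1) J) (Bad := Bad)
    (fun e he => by rw [mem_Crs] at he; exact Finset.mem_powersetCard.mpr ⟨he.1, he.2.1⟩) hN.hn (by
      refine lt_of_lt_of_le ?_ hL
      rw [div_eq_mul_one_div (V.card:ℝ), mul_pow, mul_comm]
      apply mul_lt_mul_of_pos_left _ (by positivity)
      have h1 := mul_le_mul_of_nonneg_left hζ (show 0 ≤ 5 + 3 * CL by positivity)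
      have h2 : (5 + 3 * CL) * ((1 / (2 * (ℓ:ℝ))) ^ (ℓ - 1) / (2 * (5 + 3 * CL))) =
          (1 / (2 * (ℓ:ℝ))) ^ (ℓ - 1) / 2 := by field_simp
      have h3 : 0 < (1 / (2 * (ℓ:ℝ))) ^ (ℓ - 1) := by positivity
      linarith)
  obtain ⟨U, hU, hUB⟩ := hav
  rw [mem_Crs] at hU
  obtain ⟨hU1, hU2, hU3, hU4⟩ := hU
  have hsing : ∀ x ∈ U, x ∉ S := fun x hx hxS => hUB {x} (by
    rw [hBad]
    exact Finset.mem_union_left _ (Finset.mem_union_right _ (Finset.mem_image_of_mem _ hxS)))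
    (by simpa using hx)
  have hxe : ∀ x ∈ U, x ∉ e := fun x hx hxe => hsing x hx (by rw [hS]; simp [hxe])
  have hxW : ∀ x ∈ U, x ∈ W := fun x hx => by
    by_contra hxW
    exact hsing x hx (by rw [hS]; simp [hxW, hU1 hx])
  have hci : ∀ x ∈ U, c x ≠ i := fun x hx => by
    have := hU4 x hx
    rw [hJ, Finset.mem_sdiff, Finset.mem_singleton] at this
    exact this.2
  have hRw : ∀ x ∈ U, Rob E (mm k r) w x := fun x hx => by
    by_contra hR
    apply hsing x hx
    rw [hS]
    apply Finset.mem_union_left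
    apply Finset.mem_union_right
    unfold Lt
    exact Finset.mem_filter.mpr ⟨hU1 hx, hci x hx, fun hh => hxe x hx (hh ▸ hwe), hR⟩
  have hRw' : ∀ x ∈ U, Rob E (mm k r) w' x := fun x hx => by
    by_contra hR
    apply hsing x hx
    rw [hS]
    apply Finset.mem_union_right
    unfold Lt
    exact Finset.mem_filter.mpr ⟨hU1 hx, hci x hx, fun hh => hxe x hx (hh ▸ hwe'), hR⟩
  have hRU : ∀ x ∈ U, ∀ y ∈ U, x ≠ y → Rob E (mm k r) x y := fun x hx y hy hxy => by
    apply LPr_rob (c := c) (V := V) (hxW x hx) (hU1 hy)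
    · intro hh; exact hxy (hU3 hx hy hh.symm)
    · intro hh
      refine hUB _ ?_ (show ({x, y} : Finset ℕ) ⊆ U from ?_)
      · rw [hBad]; exact Finset.mem_union_right _ hh
      · intro z hz
        simp only [Finset.mem_insert, Finset.mem_singleton] at hz
        rcases hz with rfl | rfl <;> assumption
  have hwU : w ∉ U := fun hh => hxe w hh hwe
  have hwU' : w' ∉ U := fun hh => hxe w' hh hwe'
  obtain ⟨φ, A, p1, p2, p3, p4, p5⟩ := pair_embed (r := r) h.hT (by omega) (by omega) (U := U)
    (by rw [hU2, h.hℓ]; omega) hwU hwU' hww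
  have hsubJ : ∀ g ∈ U.powersetCard (r-1), g ∈ Crs c V (r-1) J := fun g hg => by
    rw [Finset.mem_powersetCard] at hg
    exact mem_Crs.mpr ⟨hg.1.trans hU1, hg.2, hU3.mono (by exact_mod_cast hg.1),
      fun v hv => hU4 v (hg.1 hv)⟩
  refine embG (by omega) h.hT (fun e he => (Finset.mem_powersetCard.mp (hN.hE he)).2)
    p1 p2 p3 p4 ?_ hec.le (e0 := e) ?_
  · intro d hd
    rcases p5 d hd with h1 | ⟨g, hg, h1 | h1⟩
    · rw [Finset.mem_powersetCard] at h1
      by_contra hnE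
      refine hUB _ ?_ h1.1
      rw [hBad]
      iterate 4 apply Finset.mem_union_left
      refine Finset.mem_sdiff.mpr ⟨mem_Crs.mpr ⟨h1.1.trans hU1, h1.2,
        hU3.mono (by exact_mod_cast h1.1), fun v hv => ?_⟩, hnE⟩
      exact (Finset.mem_sdiff.mp (hU4 v (h1.1 hv))).1
    · rw [h1]
      by_contra hnE
      refine hUB g ?_ (Finset.mem_powersetCard.mp hg).1
      rw [hBad]
      iterate 3 apply Finset.mem_union_left
      apply Finset.mem_union_right
      exact Finset.mem_sdiff.mpr ⟨hsubJ g hg, fun hh => hnE (mem_lk.mp hh).2⟩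
    · rw [h1]
      by_contra hnE
      refine hUB g ?_ (Finset.mem_powersetCard.mp hg).1
      rw [hBad]
      iterate 2 apply Finset.mem_union_left
      apply Finset.mem_union_right
      exact Finset.mem_sdiff.mpr ⟨hsubJ g hg, fun hh => hnE (mem_lk.mp hh).2⟩
  · have hint : e ∩ insert w (insert w' U) ⊆ {w, w'} := by
      intro x hx
      rw [Finset.mem_inter, Finset.mem_insert, Finset.mem_insert] at hx
      rw [Finset.mem_insert, Finset.mem_singleton]
      rcases hx.2 with h1 | h1 | h1
      · exact Or.inl h1
      · exact Or.inr h1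
      · exact absurd hx.1 (hxe x h1)
    intro a ha b hb hab
    rw [Finset.mem_insert, Finset.mem_insert] at ha hb
    rcases ha with rfl | rfl | ha
    · rcases hb with rfl | rfl | hb
      · exact absurd rfl hab
      · exact Or.inr ⟨he, hwe, hwe', hint⟩
      · exact Or.inl (hRw b hb)
    · rcases hb with rfl | rfl | hb
      · exact Or.inr ⟨he, hwe', hwe, by rw [Finset.pair_comm]; exact hint⟩
      · exact absurd rfl hab
      · exact Or.inl (hRw' b hb)
    · rcases hb with rfl | rfl | hb
      · exact Or.inl (Rob_symm (hRw a ha))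
      · exact Or.inl (Rob_symm (hRw' a ha))
      · exact Or.inl (hRU a ha b hb hab)

/-- Lemma A. -/
theorem lemA {k r ℓ : ℕ} {T : HGraph 2} (h : Good k r ℓ T) {γ : ℝ} (hγ : 0 < γ) :
    ∃ ζ0 > (0:ℝ), ∀ ζ ≤ ζ0,
    ∀ {E : Finset (Finset ℕ)} {c : ℕ → ℕ} {V W : Finset ℕ}, Near k r ℓ E c V W ζ →
    ∀ {v : ℕ} {X I : Finset ℕ}, v ∉ X → X ⊆ W → (∀ x ∈ X, Rob E (mm k r) v x) →
    (∀ j < ℓ, γ * V.card ≤ ((X.filter (fun x => c x = j)).card : ℝ)) → I ⊆ Finset.range ℓ →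
    I.card = r - 1 → γ * (V.card:ℝ) ^ (r-1) ≤ ((lk E v ∩ Crs c X (r-1) I).card : ℝ) → Cp r T E := by
  have hr := h.hr
  have hrl := h.hrl
  have hk := h.hk36
  have hlpos : (0:ℝ) < ℓ := by exact_mod_cast (show 0 < ℓ by omega)
  set CL : ℝ := (2 * ℓ) ^ (r-1) with hCL
  have hCL0 : 0 < CL := by positivity
  refine ⟨γ * γ ^ (ℓ - (r - 1)) / (2 * (1 + CL)), by positivity, ?_⟩
  intro ζ hζ E c V W hN v X I hvX hXW hR hX hI hIc hlk
  classical
  have hn' : (0:ℝ) < V.card := by exact_mod_cast hN.hn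
  have hXV : X ⊆ V := hXW.trans hN.hW
  set J := Finset.range ℓ \ I with hJ
  have hJc : J.card = ℓ - (r-1) := by
    rw [hJ, Finset.card_sdiff_of_subset hI, Finset.card_range, hIc]
  set Bad := (Crs c V r (Finset.range ℓ) \ E) ∪ LPr E c V (mm k r) W with hBad
  have hx : ∀ _i : ℕ, (0:ℝ) ≤ 1 / (V.card:ℝ) := fun _ => by positivity
  have hPB : PP Bad (fun _ => 1 / (V.card:ℝ)) ≤ (1 + CL) * ζ := by
    have b1 : PP (Crs c V r (Finset.range ℓ) \ E) (fun _ => 1 / (V.card:ℝ)) ≤ ζ :=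
      PPc (j := r) (fun B hB => (mem_Crs.mp (Finset.mem_sdiff.mp hB).1).2.1) hN.hn hN.hM
    have b5 : PP (LPr E c V (mm k r) W) (fun _ => 1 / (V.card:ℝ)) ≤ CL * ζ :=
      PPc (j := 2) LPr_two hN.hn
        (LPr_card hr (by omega) hN.hE hN.hc hN.hP hN.hn hN.hm hN.hW hN.hWT)
    have c1 := PP_union_le (A := (Crs c V r (Finset.range ℓ) \ E)) (B := LPr E c V (mm k r) W) hx
    rw [hBad]
    linarith
  set L := (Crs c X ℓ (Finset.range ℓ)).filter (fun U => U.filter (fun x => c x ∈ I) ∈ lk E v) with hLdef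
  have hL : γ * (V.card:ℝ) ^ (r-1) * (γ * V.card) ^ (ℓ - (r-1)) ≤ (L.card : ℝ) := by
    have h1 : (γ * V.card) ^ (ℓ - (r-1)) ≤ ((Crs c X (ℓ - (r-1)) J).card : ℝ) := by
      rw [← hJc, Trs_card, ← Finset.prod_const]
      apply Finset.prod_le_prod
      · intro _ _; positivity
      · intro j hj
        rw [hJ, Finset.mem_sdiff, Finset.mem_range] at hj
        exact hX j hj.1
    have hfil : ∀ f ∈ Crs c X (r-1) I, ∀ u ∈ Crs c X (ℓ-(r-1)) J,
        (f ∪ u).filter (fun x => c x ∈ I) = f ∧ (f ∪ u).filter (fun x => c x ∉ I) = u := by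
      intro f hf u hu
      rw [mem_Crs] at hf hu
      have a1 : ∀ x ∈ f, c x ∈ I := hf.2.2.2
      have a2 : ∀ x ∈ u, c x ∉ I := fun x hx => (Finset.mem_sdiff.mp (hu.2.2.2 x hx)).2
      constructor
      · ext x
        rw [Finset.mem_filter, Finset.mem_union]
        constructor
        · rintro ⟨hx | hx, hc⟩
          · exact hx
          · exact absurd hc (a2 x hx)
        · exact fun hx => ⟨Or.inl hx, a1 x hx⟩
      · ext x
        rw [Finset.mem_filter, Finset.mem_union]
        constructor
        · rintro ⟨hx | hx, hc⟩
          · exact absurd (a1 x hx) hc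
          · exact hx
        · exact fun hx => ⟨Or.inr hx, a2 x hx⟩
    have h2 : ((lk E v ∩ Crs c X (r-1) I) ×ˢ Crs c X (ℓ - (r-1)) J).card ≤ L.card := by
      apply Finset.card_le_card_of_injOn (fun p => p.1 ∪ p.2)
      · rintro ⟨f, u⟩ hp
        rw [Finset.mem_coe, Finset.mem_product, Finset.mem_inter] at hp
        obtain ⟨⟨hf1, hf2⟩, hu⟩ := hp
        simp only at hf1 hf2 hu
        have hh := hfil f hf2 u hu
        rw [Finset.mem_coe, hLdef, Finset.mem_filter]
        refine ⟨?_, by rw [hh.1]; exact hf1⟩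
        rw [mem_Crs] at hf2 hu ⊢
        have a1 : ∀ x ∈ f, c x ∈ I := hf2.2.2.2
        have a2 : ∀ x ∈ u, c x ∉ I := fun x hx => (Finset.mem_sdiff.mp (hu.2.2.2 x hx)).2
        have hd : Disjoint f u := by
          rw [Finset.disjoint_left]
          exact fun x hx hx' => a2 x hx' (a1 x hx)
        refine ⟨Finset.union_subset hf2.1 hu.1, ?_, ?_, ?_⟩
        · rw [Finset.card_union_of_disjoint hd, hf2.2.1, hu.2.1]; omega
        · intro a ha b hb hab
          rw [Finset.mem_coe, Finset.mem_union] at ha hb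
          rcases ha with ha | ha <;> rcases hb with hb | hb
          · exact hf2.2.2.1 ha hb hab
          · exact absurd (hab ▸ a1 a ha) (a2 b hb)
          · exact absurd (hab ▸ a1 b hb) (a2 a ha)
          · exact hu.2.2.1 ha hb hab
        · intro x hx
          rcases Finset.mem_union.mp hx with hx | hx
          · exact hI (a1 x hx)
          · exact (Finset.mem_sdiff.mp (hu.2.2.2 x hx)).1
      · rintro ⟨f, u⟩ hp ⟨f', u'⟩ hp' heq
        rw [Finset.mem_coe, Finset.mem_product, Finset.mem_inter] at hp hp'
        have e1 := hfil f hp.1.2 u hp.2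
        have e2 := hfil f' hp'.1.2 u' hp'.2
        have heq' : f ∪ u = f' ∪ u' := heq
        rw [heq'] at e1
        rw [Prod.mk.injEq]
        exact ⟨e1.1.symm.trans e2.1, e1.2.symm.trans e2.2⟩
    rw [Finset.card_product] at h2
    calc _ ≤ ((lk E v ∩ Crs c X (r-1) I).card : ℝ) * ((Crs c X (ℓ - (r-1)) J).card : ℝ) :=
          mul_le_mul hlk h1 (by positivity) (by positivity)
      _ ≤ _ := by exact_mod_cast h2
  have hav := avoid (V := V) (q := ℓ) (L := L) (Bad := Bad)
    (fun e he => by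
      rw [hLdef, Finset.mem_filter, mem_Crs] at he
      exact Finset.mem_powersetCard.mpr ⟨he.1.1.trans hXV, he.1.2.1⟩) hN.hn (by
      refine lt_of_lt_of_le ?_ hL
      have e1 : γ * (V.card:ℝ) ^ (r-1) * (γ * V.card) ^ (ℓ - (r-1)) =
        (γ * γ ^ (ℓ - (r-1))) * (V.card:ℝ) ^ ℓ := by
        have : (V.card:ℝ) ^ ℓ = (V.card:ℝ) ^ (r-1) * (V.card:ℝ) ^ (ℓ - (r-1)) := by
          rw [← pow_add]; congr 1; omega
        rw [this, mul_pow]; ring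
      rw [e1]
      apply mul_lt_mul_of_pos_right _ (by positivity)
      have h1 := mul_le_mul_of_nonneg_left hζ (show 0 ≤ 1 + CL by positivity)
      have h2 : (1 + CL) * (γ * γ ^ (ℓ - (r - 1)) / (2 * (1 + CL))) =
          γ * γ ^ (ℓ - (r-1)) / 2 := by field_simp
      have h3 : 0 < γ * γ ^ (ℓ - (r-1)) := by positivity
      linarith)
  obtain ⟨U, hU, hUB⟩ := hav
  rw [hLdef, Finset.mem_filter, mem_Crs] at hU
  obtain ⟨⟨hU1, hU2, hU3, hU4⟩, hUl⟩ := hU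
  have hRU : ∀ x ∈ U, ∀ y ∈ U, x ≠ y → Rob E (mm k r) x y := fun x hx y hy hxy => by
    apply LPr_rob (c := c) (V := V) (hXW (hU1 hx)) (hXV (hU1 hy))
    · intro hh; exact hxy (hU3 hx hy hh.symm)
    · intro hh
      refine hUB _ ?_ (show ({x, y} : Finset ℕ) ⊆ U from ?_)
      · rw [hBad]; exact Finset.mem_union_right _ hh
      · intro z hz
        simp only [Finset.mem_insert, Finset.mem_singleton] at hz
        rcases hz with rfl | rfl <;> assumption
  have hlks := mem_lk.mp hUl
  have hfc : (U.filter (fun x => c x ∈ I)).card = r - 1 := by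
    have := (Finset.mem_powersetCard.mp (hN.hE hlks.2)).2
    rw [Finset.card_insert_of_notMem hlks.1] at this
    omega
  obtain ⟨φ, A, p1, p2, p3, p4, p5⟩ := leaf_embed (r := r) h.hT (by omega) (by omega) (L := U)
    (f := U.filter (fun x => c x ∈ I)) (w := v)
    (by rw [hU2, h.hℓ]) (fun hv => hvX (hU1 hv)) (Finset.filter_subset _ _) hfc
  refine embG (by omega) h.hT (fun e he => (Finset.mem_powersetCard.mp (hN.hE he)).2)
    p1 p2 p3 p4 ?_ (e0 := ∅) (by simp) ?_
  · intro d hd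
    rcases p5 d hd with h1 | h1
    · rw [Finset.mem_powersetCard] at h1
      by_contra hnE
      refine hUB _ ?_ h1.1
      rw [hBad]
      apply Finset.mem_union_left
      exact Finset.mem_sdiff.mpr ⟨mem_Crs.mpr ⟨(h1.1.trans hU1).trans hXV, h1.2,
        hU3.mono (by exact_mod_cast h1.1), fun v hv => hU4 v (h1.1 hv)⟩, hnE⟩
    · rw [h1]; exact hlks.2
  · intro a ha b hb hab
    left
    rw [Finset.mem_insert] at ha hb
    rcases ha with rfl | ha
    · rcases hb with rfl | hb
      · exact absurd rfl hab
      · exact hR b (hU1 hb)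
    · rcases hb with rfl | hb
      · exact Rob_symm (hR a (hU1 ha))
      · exact hRU a ha b hb hab

theorem Crs_le {k r ℓ : ℕ} {T : HGraph 2} (h : Good k r ℓ T) {c : ℕ → ℕ} {V : Finset ℕ}
    (hc : ∀ v ∈ V, c v < ℓ) :
    ((Crs c V r (Finset.range ℓ)).card : ℝ) ≤ lam ℓ r * (V.card:ℝ) ^ r := by
  have hr := h.hr
  have hk := h.hk36
  rw [Crs_card]
  refine h.lag (V := Finset.range ℓ) (Finset.Subset.refl _) ?_ (fun _ => Nat.cast_nonneg _)
    (sum_fibres c V _ (fun v hv => Finset.mem_range.mpr (hc v hv))).le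
  exact not_ExpIn_small h.hT (by omega) (by omega) (V := Finset.range ℓ)
    (fun e he => (Finset.mem_powersetCard.mp he).1) (by rw [Finset.card_range, h.hℓ])

theorem Crs_le' {k r ℓ i : ℕ} {T : HGraph 2} (h : Good k r ℓ T) {c : ℕ → ℕ} {V : Finset ℕ}
    (hc : ∀ v ∈ V, c v < ℓ) (hi : i < ℓ) :
    ((Crs c V (r-1) (Finset.range ℓ \ {i})).card : ℝ) ≤
      lam (ℓ-1) (r-1) * ((V.card:ℝ) - ((V.filter (fun v => c v = i)).card : ℝ)) ^ (r-1) := by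
  have hr := h.hr
  have hk := h.hk36
  have hl := h.hℓ
  rw [Crs_card]
  have e1 : r - 3 + 2 = r - 1 := by omega
  have e2 : k + (r-3) - 1 = ℓ - 1 := by omega
  have hJc : (Finset.range ℓ \ {i}).card = ℓ - 1 := by
    rw [Finset.card_sdiff_of_subset (by simpa using hi), Finset.card_range, Finset.card_singleton]
  have hsum : ∑ j ∈ Finset.range ℓ \ {i}, ((V.filter (fun v => c v = j)).card : ℝ) =
      (V.card:ℝ) - ((V.filter (fun v => c v = i)).card : ℝ) := by
    have h1 := sum_fibres c V (Finset.range ℓ) (fun v hv => Finset.mem_range.mpr (hc v hv))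
    have h2 := Finset.sum_sdiff (f := fun j => ((V.filter (fun v => c v = j)).card : ℝ))
      (show {i} ⊆ Finset.range ℓ by simpa using hi)
    rw [Finset.sum_singleton] at h2
    linarith
  have := LBn (E := (Finset.range ℓ \ {i}).powersetCard (r-1)) (V := Finset.range ℓ \ {i})
    (x := fun j => ((V.filter (fun v => c v = j)).card : ℝ)) h.hT h.hES (r-3) (by
      rw [e1]
      have : (r-1)^2 ≤ r^2 := Nat.pow_le_pow_left (by omega) 2
      have := h.hk
      omega) (by rw [e1])
    (by
      rw [e1]
      exact not_ExpIn_small h.hT (by omega) (by omega) (V := Finset.range ℓ \ {i})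
        (fun e he => (Finset.mem_powersetCard.mp he).1) (by rw [hJc]; omega))
    (fun _ => Nat.cast_nonneg _) hsum.le
  rwa [e1, e2] at this

theorem meet_card {V S : Finset ℕ} {q : ℕ} :
    ((V.powersetCard q).filter (fun f => ∃ x ∈ S, x ∈ f)).card ≤ S.card * V.card ^ (q-1) := by
  have : (V.powersetCard q).filter (fun f => ∃ x ∈ S, x ∈ f) ⊆
      S.biUnion (fun x => (V.powersetCard q).filter (fun f => ({x}:Finset ℕ) ⊆ f)) := by
    intro f hf
    rw [Finset.mem_filter] at hf
    obtain ⟨hf, x, hx, hxf⟩ := hf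
    exact Finset.mem_biUnion.mpr ⟨x, hx, Finset.mem_filter.mpr ⟨hf, by simpa using hxf⟩⟩
  refine (Finset.card_le_card this).trans (Finset.card_biUnion_le.trans ?_)
  rw [← smul_eq_mul]
  apply Finset.sum_le_card_nsmul
  intro x _
  have := cnt_sup (V := V) (B := {x}) (q := q)
  rwa [Finset.card_singleton] at this

open Classical in
/-- The typical vertices. -/
noncomputable def Typ (E : Finset (Finset ℕ)) (c : ℕ → ℕ) (V : Finset ℕ) (ℓ r : ℕ) (ζ : ℝ) : Finset ℕ :=
  V.filter (fun w => (TY E c V ℓ r w (c w) : ℝ) ≤ ζ * (V.card:ℝ) ^ (r-1))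

theorem mkNear {k r ℓ : ℕ} {T : HGraph 2} (h : Good k r ℓ T) {ζ δ : ℝ} (hζ : 0 < ζ) (hδ : 0 < δ) :
    ∃ ε > (0:ℝ), ∃ N : ℕ, ∀ {E : Finset (Finset ℕ)} {c : ℕ → ℕ} {V : Finset ℕ}, N ≤ V.card →
    E ⊆ V.powersetCard r → (∀ v ∈ V, c v < ℓ) →
    (lam ℓ r - ε) * (V.card:ℝ)^r ≤ ((E ∩ Crs c V r (Finset.range ℓ)).card : ℝ) →
    Near k r ℓ E c V (Typ E c V ℓ r ζ) ζ ∧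
    ∀ j < ℓ, (1 / (ℓ:ℝ) - δ) * V.card ≤ ((V.filter (fun v => c v = j)).card : ℝ) := by
  classical
  have hr := h.hr
  have hk := h.hk36
  have hrl := h.hrl
  have hlpos : (0:ℝ) < ℓ := by exact_mod_cast (show 0 < ℓ by omega)
  have hrpos : (0:ℝ) < r := by exact_mod_cast (show 0 < r by omega)
  obtain ⟨ε0, hε0, hconc⟩ := h.conc (δ := min δ (1 / (2 * ℓ))) (lt_min hδ (by positivity))
  refine ⟨min ε0 (min ζ (ζ * ζ / r)), lt_min hε0 (lt_min hζ (by positivity)),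
    ⌈(mm k r : ℝ) / ζ⌉₊ + 1, ?_⟩
  intro E c V hn hE hc hX
  set ε := min ε0 (min ζ (ζ * ζ / r)) with hε
  have e0 : ε ≤ ε0 := min_le_left _ _
  have e1 : ε ≤ ζ := (min_le_right _ _).trans (min_le_left _ _)
  have e2 : ε ≤ ζ * ζ / r := (min_le_right _ _).trans (min_le_right _ _)
  have hn0 : 0 < V.card := by omega
  have hn' : (0:ℝ) < V.card := by exact_mod_cast hn0
  have hle := Crs_le h hc
  have hXs : ((E ∩ Crs c V r (Finset.range ℓ)).card : ℝ) ≤ ((Crs c V r (Finset.range ℓ)).card : ℝ) := by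
    exact_mod_cast Finset.card_le_card Finset.inter_subset_right
  have hmis : ((Crs c V r (Finset.range ℓ) \ E).card : ℝ) =
      ((Crs c V r (Finset.range ℓ)).card : ℝ) - ((E ∩ Crs c V r (Finset.range ℓ)).card : ℝ) := by
    rw [eq_sub_iff_add_eq]
    have := Finset.card_sdiff_add_card_inter (Crs c V r (Finset.range ℓ)) E
    rw [Finset.inter_comm] at this
    exact_mod_cast this
  have hmis' : ((Crs c V r (Finset.range ℓ) \ E).card : ℝ) ≤ ε * (V.card:ℝ)^r := by
    rw [hmis]; linarith
  -- part sizes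
  have hparts : ∀ j < ℓ, 1 / (ℓ:ℝ) - min δ (1 / (2 * ℓ)) ≤
      1 / (V.card:ℝ) * ((V.filter (fun v => c v = j)).card : ℝ) := by
    obtain ⟨L, hL1, hL2, hL3⟩ := hconc (E := (Finset.range ℓ).powersetCard r) (V := Finset.range ℓ)
      (x := fun j => 1 / (V.card:ℝ) * ((V.filter (fun v => c v = j)).card : ℝ))
      (Finset.Subset.refl _)
      (not_ExpIn_small h.hT (by omega) (by omega) (V := Finset.range ℓ)
        (fun e he => (Finset.mem_powersetCard.mp he).1) (by rw [Finset.card_range, h.hℓ]))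
      (fun i => by positivity)
      (by
        rw [← Finset.mul_sum, sum_fibres c V _ (fun v hv => Finset.mem_range.mpr (hc v hv)),
          one_div_mul_cancel hn'.ne'])
      (by
        rw [PP_smul (V := Finset.range ℓ) (r := r) (Finset.Subset.refl _), ← Crs_card, one_div,
          inv_pow, ← div_eq_inv_mul, le_div_iff₀ (by positivity)]
        refine le_trans ?_ (hX.trans hXs)
        apply mul_le_mul_of_nonneg_right _ (by positivity)
        linarith)
    intro j hj
    apply hL3
    have : L = Finset.range ℓ := Finset.eq_of_subset_of_card_le hL1 (by rw [hL2, Finset.card_range])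
    rw [this]; exact Finset.mem_range.mpr hj
  have hp1 : ∀ z : ℝ, min δ (1 / (2 * (ℓ:ℝ))) ≤ z → ∀ j < ℓ, (1 / (ℓ:ℝ) - z) * V.card ≤
      ((V.filter (fun v => c v = j)).card : ℝ) := by
    intro z hz j hj
    have h1 := hparts j hj
    rw [one_div_mul_eq_div, le_div_iff₀ hn'] at h1
    refine le_trans (mul_le_mul_of_nonneg_right ?_ hn'.le) h1
    linarith
  refine ⟨?_, hp1 δ (min_le_left _ _)⟩
  refine ⟨hE, hc, ?_, hn0, ?_, ?_, ?_, ?_, ?_⟩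
  · intro j hj
    have := hp1 (1 / (2 * ℓ)) (min_le_right _ _) j hj
    refine le_trans (le_of_eq ?_) this
    field_simp; ring
  · have h1 : (mm k r : ℝ) / ζ ≤ V.card := by
      refine (Nat.le_ceil _).trans ?_
      exact_mod_cast (show ⌈(mm k r : ℝ) / ζ⌉₊ ≤ V.card by omega)
    rw [div_le_iff₀ hζ] at h1
    linarith
  · exact hmis'.trans (mul_le_mul_of_nonneg_right e1 (by positivity))
  · exact Finset.filter_subset _ _
  · intro w hw
    exact (Finset.mem_filter.mp hw).2
  · have h1 := atyp (s := ζ * (V.card:ℝ) ^ (r-1)) hr hc (E := E) (V \ Typ E c V ℓ r ζ)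
      Finset.sdiff_subset (by
        intro w hw
        rw [Finset.mem_sdiff] at hw
        have := hw.2
        unfold Typ at this
        rw [Finset.mem_filter, not_and, not_le] at this
        exact (this hw.1).le)
    have h2 := mul_le_mul_of_nonneg_left hmis' hrpos.le
    have h3 : r * (ε * (V.card:ℝ)^r) ≤ ζ * ζ * (V.card:ℝ)^r := by
      rw [← mul_assoc]
      apply mul_le_mul_of_nonneg_right _ (by positivity)
      rw [le_div_iff₀ hrpos] at e2
      linarith
    have e3 : (V.card:ℝ)^r = (V.card:ℝ)^(r-1) * V.card := by
      rw [← pow_succ]; congr 1; omega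
    rw [e3] at h3
    have hpos : 0 < ζ * (V.card:ℝ) ^ (r-1) := by positivity
    rw [← mul_le_mul_iff_left₀ hpos]
    rw [e3] at h2
    nlinarith

theorem lam_D {k r ℓ : ℕ} {T : HGraph 2} (h : Good k r ℓ T) :
    (r:ℝ) * lam ℓ r = lam (ℓ-1) (r-1) * (1 - 1 / (ℓ:ℝ)) ^ (r-1) := by
  have hr := h.hr
  have hrl := h.hrl
  have := lam_succ (ℓ := ℓ - 1) (r - 1) (by omega)
  rw [show ℓ - 1 + 1 = ℓ by omega, show r - 1 + 1 = r by omega] at this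
  have e1 : ((r-1:ℕ):ℝ) + 1 = r := by exact_mod_cast (show r - 1 + 1 = r by omega)
  have e2 : ((ℓ-1:ℕ):ℝ) + 1 = ℓ := by exact_mod_cast (show ℓ - 1 + 1 = ℓ by omega)
  rw [e1, e2] at this
  exact this

theorem cont_D {k r ℓ : ℕ} {T : HGraph 2} (h : Good k r ℓ T) {η : ℝ} (hη : 0 < η) :
    ∃ δ > (0:ℝ), lam (ℓ-1) (r-1) * (1 - 1 / (ℓ:ℝ) + δ) ^ (r-1) ≤ r * lam ℓ r + η := by
  have hc : ContinuousAt (fun δ : ℝ => lam (ℓ-1) (r-1) * (1 - 1 / (ℓ:ℝ) + δ) ^ (r-1)) 0 := by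
    fun_prop
  rw [Metric.continuousAt_iff] at hc
  obtain ⟨d, hd, hh⟩ := hc η hη
  refine ⟨d / 2, by positivity, ?_⟩
  have := hh (x := d / 2) (by rw [dist_zero_right, Real.norm_eq_abs, abs_of_pos (by positivity)]; linarith)
  rw [Real.dist_eq, add_zero, ← lam_D h] at this
  have := (abs_lt.mp this).2
  linarith

theorem lk_sub' {E : Finset (Finset ℕ)} {V : Finset ℕ} {r : ℕ} (hr : 1 ≤ r)
    (hE : E ⊆ V.powersetCard r) (v : ℕ) : lk E v ⊆ (V.erase v).powersetCard (r-1) := by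
  apply lk_sub
  rwa [show r - 1 + 1 = r by omega]

/-- Lemma E1. -/
theorem lemE1 {k r ℓ : ℕ} {T : HGraph 2} (h : Good k r ℓ T) {η : ℝ} (hη : 0 < η) :
    ∃ ε > (0:ℝ), ∃ N : ℕ, ∀ {E : Finset (Finset ℕ)} {c : ℕ → ℕ} {V : Finset ℕ}, N ≤ V.card →
    E ⊆ V.powersetCard r → (∀ v ∈ V, c v < ℓ) →
    (lam ℓ r - ε) * (V.card:ℝ)^r ≤ ((E ∩ Crs c V r (Finset.range ℓ)).card : ℝ) → ¬ Cp r T E →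
    (∀ v ∈ V, ((lk E v).card : ℝ) ≤ (r * lam ℓ r + η) * (V.card:ℝ)^(r-1)) ∧
    ∀ v ∈ V, (r * lam ℓ r - ε) * (V.card:ℝ)^(r-1) ≤ ((lk E v).card : ℝ) →
      ∃ i < ℓ, (TY E c V ℓ r v i : ℝ) ≤ η * (V.card:ℝ)^(r-1) := by
  classical
  have hr := h.hr
  have hk := h.hk36
  have hrl := h.hrl
  have hlpos : (0:ℝ) < ℓ := by exact_mod_cast (show 0 < ℓ by omega)
  have hrpos : (0:ℝ) < r := by exact_mod_cast (show 0 < r by omega)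
  have hlam := lam_pos (ℓ := ℓ) (r := r) (by omega) (by omega)
  set D : ℝ := r * lam ℓ r with hD
  have hDpos : 0 < D := by positivity
  set μ : ℝ := min (η / 16) (D / 16) with hμ
  have hμ0 : 0 < μ := lt_min (by positivity) (by positivity)
  have hμ1 : μ ≤ η / 16 := min_le_left _ _
  have hμ2 : μ ≤ D / 16 := min_le_right _ _
  set γ : ℝ := μ / 2 ^ ℓ with hγ
  have hγ0 : 0 < γ := by positivity
  have hγ1 : γ ≤ μ := div_le_self hμ0.le (one_le_pow₀ (by norm_num))
  obtain ⟨ζA, hζA, hA⟩ := lemA h hγ0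
  obtain ⟨ζI, hζI, hI⟩ := lemI h
  obtain ⟨δ, hδ, hδD⟩ := cont_D h (η := η / 2) (by positivity)
  set ζ := min (min ζA ζI) μ with hζ
  have hζ0 : 0 < ζ := lt_min (lt_min hζA hζI) hμ0
  have hζ1 : ζ ≤ ζA := (min_le_left _ _).trans (min_le_left _ _)
  have hζ2 : ζ ≤ ζI := (min_le_left _ _).trans (min_le_right _ _)
  have hζ3 : ζ ≤ μ := min_le_right _ _
  obtain ⟨ε0, hε0, N, hmk⟩ := mkNear h hζ0 hδ
  refine ⟨min ε0 μ, lt_min hε0 hμ0, N, ?_⟩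
  intro E c V hn hE hc hX hCp
  have hε1 : min ε0 μ ≤ ε0 := min_le_left _ _
  have hε2 : min ε0 μ ≤ μ := min_le_right _ _
  set ε := min ε0 μ with hε
  obtain ⟨hN, hpart⟩ := hmk hn hE hc (le_trans (mul_le_mul_of_nonneg_right (by linarith)
    (by positivity)) hX)
  set W := Typ E c V ℓ r ζ with hWdef
  have hn' : (0:ℝ) < V.card := by exact_mod_cast hN.hn
  set n : ℝ := (V.card:ℝ) with hnn
  have hnp : 0 < n ^ (r-1) := by positivity
  have en : n ^ (r-1) = n * n ^ (r-2) := by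
    rw [← pow_succ']; congr 1; omega
  have en2 : n ^ (r-2) = n * n ^ (r-3) := by
    rw [← pow_succ']; congr 1; omega
  -- dichotomy for each v
  have key : ∀ v ∈ V, ((lk E v).card : ℝ) ≤ 4 * μ * n^(r-1) ∨ ∃ i < ℓ,
      ((lk E v \ Crs c V (r-1) (Finset.range ℓ \ {i})).card : ℝ) ≤ 4 * μ * n^(r-1) := by
    intro v hv
    set X := W.filter (fun x => x ≠ v ∧ Rob E (mm k r) v x) with hXdef
    have hXW : X ⊆ W := Finset.filter_subset _ _
    set B1 := (V.powersetCard (r-1)).filter (fun f => ∃ x ∈ V \ W, x ∈ f) with hB1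
    set NR := V.filter (fun x => x ≠ v ∧ ¬ Rob E (mm k r) v x) with hNR
    set B2 := NR.biUnion (fun x => (lk E v).filter (fun f => x ∈ f)) with hB2
    have b1 : (B1.card : ℝ) ≤ μ * n^(r-1) := by
      have h1 : B1.card ≤ (V \ W).card * V.card ^ (r-1-1) := meet_card
      have h2 : (B1.card:ℝ) ≤ (V \ W).card * n ^ (r-2) := by
        rw [hnn]; exact_mod_cast h1
      have h3 := mul_le_mul_of_nonneg_right (hN.hWc.trans
        (mul_le_mul_of_nonneg_right hζ3 hn'.le)) (show 0 ≤ n^(r-2) by positivity)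
      rw [en]; linarith
    have b2 : (B2.card : ℝ) ≤ μ * n^(r-1) := by
      have h1 : B2.card ≤ V.card * (mm k r * V.card ^ (r-3)) := by
        refine Finset.card_biUnion_le.trans ?_
        refine (Finset.sum_le_card_nsmul _ _ (mm k r * V.card ^ (r-3)) ?_).trans ?_
        · intro x hx
          rw [hNR, Finset.mem_filter] at hx
          exact (lk_filter_card hx.2.1.symm).trans (not_Rob hr hE hx.2.1.symm hx.2.2)
        · rw [smul_eq_mul]
          exact Nat.mul_le_mul_right _ (Finset.card_le_card (Finset.filter_subset _ _))
      have h2 : (B2.card:ℝ) ≤ n * (mm k r * n ^ (r-3)) := by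
        rw [hnn]; exact_mod_cast h1
      have h3 := mul_le_mul_of_nonneg_right (hN.hm.trans
        (mul_le_mul_of_nonneg_right hζ3 hn'.le)) (show 0 ≤ n * n^(r-3) by positivity)
      rw [en, en2]; linarith
    have hdec : ∀ f ∈ lk E v, f ∈ B1 ∨ f ∈ B2 ∨ f ∈ Crs c X (r-1) (Finset.range ℓ) := by
      intro f hf
      have hf1 := Finset.mem_powersetCard.mp (lk_sub' (by omega) hE v hf)
      have hfV : f ⊆ V := hf1.1.trans (Finset.erase_subset _ _)
      by_cases c1 : ∃ x ∈ V \ W, x ∈ f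
      · left; exact Finset.mem_filter.mpr ⟨Finset.mem_powersetCard.mpr ⟨hfV, hf1.2⟩, c1⟩
      right
      by_cases c2 : ∃ x ∈ f, ¬ Rob E (mm k r) v x
      · obtain ⟨x, hxf, hx⟩ := c2
        left
        exact Finset.mem_biUnion.mpr ⟨x, Finset.mem_filter.mpr ⟨hfV hxf,
          (Finset.mem_erase.mp (hf1.1 hxf)).1, hx⟩, Finset.mem_filter.mpr ⟨hf, hxf⟩⟩
      right
      push Not at c1 c2
      have hfW : ∀ x ∈ f, x ∈ W := fun x hx => by
        by_contra hxW
        exact c1 x (Finset.mem_sdiff.mpr ⟨hfV hx, hxW⟩) hx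
      refine mem_Crs.mpr ⟨fun x hx => Finset.mem_filter.mpr ⟨hfW x hx,
        (Finset.mem_erase.mp (hf1.1 hx)).1, c2 x hx⟩, hf1.2, ?_, fun x hx =>
          Finset.mem_range.mpr (hc x (hfV hx))⟩
      intro a ha b hb hab
      by_contra hne
      apply hCp
      have ha' := hN.hWT a (hfW a ha)
      have hb' := hN.hWT b (hfW b hb)
      rw [← hab] at hb'
      exact hI ζ hζ2 hN (hfV ha) (hfV hb) hne (hc a (hfV ha)) ha' hb' (mem_lk.mp hf).2
        (Finset.mem_insert_of_mem ha) (Finset.mem_insert_of_mem hb)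
    by_cases hall : ∀ j < ℓ, γ * n ≤ ((X.filter (fun x => c x = j)).card : ℝ)
    · left
      have hsm : ∀ I ∈ (Finset.range ℓ).powersetCard (r-1),
          ((lk E v ∩ Crs c X (r-1) I).card : ℝ) ≤ γ * n^(r-1) := by
        intro I hI'
        rw [Finset.mem_powersetCard] at hI'
        by_contra hcon
        push Not at hcon
        exact hCp (hA ζ hζ1 hN (v := v) (X := X) (I := I) (by rw [hXdef]; simp) hXW
          (fun x hx => (Finset.mem_filter.mp hx).2.2) hall hI'.1 hI'.2 hcon.le)
      have hsub : lk E v ⊆ B1 ∪ B2 ∪ ((Finset.range ℓ).powersetCard (r-1)).biUnion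
          (fun I => lk E v ∩ Crs c X (r-1) I) := by
        intro f hf
        rcases hdec f hf with h1 | h1 | h1
        · exact Finset.mem_union_left _ (Finset.mem_union_left _ h1)
        · exact Finset.mem_union_left _ (Finset.mem_union_right _ h1)
        · apply Finset.mem_union_right
          rw [mem_Crs] at h1
          refine Finset.mem_biUnion.mpr ⟨f.image c, Finset.mem_powersetCard.mpr ⟨?_, ?_⟩,
            Finset.mem_inter.mpr ⟨hf, mem_Crs.mpr ⟨h1.1, h1.2.1, h1.2.2.1, fun v hv =>
              Finset.mem_image_of_mem _ hv⟩⟩⟩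
          · intro y hy
            obtain ⟨x, hx, rfl⟩ := Finset.mem_image.mp hy
            exact h1.2.2.2 x hx
          · rw [Finset.card_image_of_injOn h1.2.2.1, h1.2.1]
      have h1 : (lk E v).card ≤ B1.card + B2.card + ∑ I ∈ (Finset.range ℓ).powersetCard (r-1),
          (lk E v ∩ Crs c X (r-1) I).card :=
        (Finset.card_le_card hsub).trans ((Finset.card_union_le _ _).trans
          (Nat.add_le_add (Finset.card_union_le _ _) Finset.card_biUnion_le))
      have h2 : ((lk E v).card:ℝ) ≤ B1.card + B2.card + ∑ I ∈ (Finset.range ℓ).powersetCard (r-1),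
          ((lk E v ∩ Crs c X (r-1) I).card:ℝ) := by exact_mod_cast h1
      have h3 := Finset.sum_le_sum hsm
      rw [Finset.sum_const, Finset.card_powersetCard, Finset.card_range, nsmul_eq_mul] at h3
      have h4 : (ℓ.choose (r-1) : ℝ) ≤ 2 ^ ℓ := by exact_mod_cast Nat.choose_le_two_pow _ _
      have h5 : (ℓ.choose (r-1) : ℝ) * (γ * n^(r-1)) ≤ 2 ^ ℓ * (γ * n^(r-1)) :=
        mul_le_mul_of_nonneg_right h4 (by positivity)
      have h6 : 2 ^ ℓ * (γ * n^(r-1)) = μ * n^(r-1) := by rw [hγ]; field_simp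
      have : 0 < μ * n^(r-1) := by positivity
      linarith
    · right
      push Not at hall
      obtain ⟨i, hi, hXi⟩ := hall
      refine ⟨i, hi, ?_⟩
      set B3 := (V.powersetCard (r-1)).filter (fun f => ∃ x ∈ X.filter (fun x => c x = i), x ∈ f) with hB3
      have b3 : (B3.card : ℝ) ≤ μ * n^(r-1) := by
        have h1 : B3.card ≤ (X.filter (fun x => c x = i)).card * V.card ^ (r-1-1) := meet_card
        have h2 : (B3.card:ℝ) ≤ (X.filter (fun x => c x = i)).card * n ^ (r-2) := by
          rw [hnn]; exact_mod_cast h1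
        have h3 := mul_le_mul_of_nonneg_right (hXi.le.trans
          (mul_le_mul_of_nonneg_right hγ1 hn'.le)) (show 0 ≤ n^(r-2) by positivity)
        rw [en]; linarith
      have hsub : lk E v \ Crs c V (r-1) (Finset.range ℓ \ {i}) ⊆ B1 ∪ B2 ∪ B3 := by
        intro f hf
        rw [Finset.mem_sdiff] at hf
        rcases hdec f hf.1 with h1 | h1 | h1
        · exact Finset.mem_union_left _ (Finset.mem_union_left _ h1)
        · exact Finset.mem_union_left _ (Finset.mem_union_right _ h1)
        · apply Finset.mem_union_right
          rw [mem_Crs] at h1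
          have hfV : f ⊆ V := h1.1.trans (hXW.trans hN.hW)
          by_contra hcon
          apply hf.2
          refine mem_Crs.mpr ⟨hfV, h1.2.1, h1.2.2.1, fun x hx => ?_⟩
          rw [Finset.mem_sdiff, Finset.mem_singleton]
          refine ⟨h1.2.2.2 x hx, fun hci => hcon ?_⟩
          exact Finset.mem_filter.mpr ⟨Finset.mem_powersetCard.mpr ⟨hfV, h1.2.1⟩,
            x, Finset.mem_filter.mpr ⟨h1.1 hx, hci⟩, hx⟩
      have h1 : (lk E v \ Crs c V (r-1) (Finset.range ℓ \ {i})).card ≤ B1.card + B2.card + B3.card :=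
        (Finset.card_le_card hsub).trans ((Finset.card_union_le _ _).trans
          (Nat.add_le_add_right (Finset.card_union_le _ _) _))
      have h2 : ((lk E v \ Crs c V (r-1) (Finset.range ℓ \ {i})).card : ℝ) ≤
        B1.card + B2.card + B3.card := by exact_mod_cast h1
      have : 0 < μ * n^(r-1) := by positivity
      linarith
  have hK : ∀ i < ℓ, ((Crs c V (r-1) (Finset.range ℓ \ {i})).card : ℝ) ≤ (D + η / 2) * n^(r-1) := by
    intro i hi
    have h1 := Crs_le' h hc hi
    have h2 := hpart i hi
    have h3 : n - ((V.filter (fun v => c v = i)).card : ℝ) ≤ (1 - 1 / (ℓ:ℝ) + δ) * n := by linarith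
    have h4 : 0 ≤ n - ((V.filter (fun v => c v = i)).card : ℝ) := by
      rw [sub_nonneg, hnn]
      exact_mod_cast Finset.card_le_card (Finset.filter_subset _ _)
    have hlam' := lam_pos (ℓ := ℓ-1) (r := r-1) (by omega) (by omega)
    have h5 := mul_le_mul_of_nonneg_left (pow_le_pow_left₀ h4 h3 (r-1)) hlam'.le
    rw [mul_pow, ← mul_assoc] at h5
    exact h1.trans (h5.trans (mul_le_mul_of_nonneg_right hδD hnp.le))
  have hsplit : ∀ v i, ((lk E v).card : ℝ) =
      ((lk E v \ Crs c V (r-1) (Finset.range ℓ \ {i})).card : ℝ) +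
      ((lk E v ∩ Crs c V (r-1) (Finset.range ℓ \ {i})).card : ℝ) := fun v i => by
    exact_mod_cast (Finset.card_sdiff_add_card_inter (lk E v) _).symm
  have hsplit2 : ∀ v i, ((Crs c V (r-1) (Finset.range ℓ \ {i})).card : ℝ) =
      (TY E c V ℓ r v i : ℝ) +
      ((lk E v ∩ Crs c V (r-1) (Finset.range ℓ \ {i})).card : ℝ) := fun v i => by
    rw [Finset.inter_comm]
    exact_mod_cast (Finset.card_sdiff_add_card_inter (Crs c V (r-1) (Finset.range ℓ \ {i})) _).symm
  have hμn : 16 * μ * n^(r-1) ≤ η * n^(r-1) := mul_le_mul_of_nonneg_right (by linarith) hnp.le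
  have hμn' : 16 * μ * n^(r-1) ≤ D * n^(r-1) := mul_le_mul_of_nonneg_right (by linarith) hnp.le
  have hεn : ε * n^(r-1) ≤ μ * n^(r-1) := mul_le_mul_of_nonneg_right hε2 hnp.le
  have hpp : 0 < μ * n^(r-1) := by positivity
  constructor
  · intro v hv
    rcases key v hv with h1 | ⟨i, hi, h1⟩
    · linarith
    · have h2 := hsplit v i
      have h3 := hsplit2 v i
      have h4 := hK i hi
      have h5 : (0:ℝ) ≤ TY E c V ℓ r v i := Nat.cast_nonneg _
      linarith
  · intro v hv hdeg
    rcases key v hv with h1 | ⟨i, hi, h1⟩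
    · exfalso; linarith
    · refine ⟨i, hi, ?_⟩
      have h2 := hsplit v i
      have h3 := hsplit2 v i
      have h4 := hK i hi
      linarith

/-- Lemma E. -/
theorem lemE {k r ℓ : ℕ} {T : HGraph 2} (h : Good k r ℓ T) :
    ∃ ε > (0:ℝ), ∃ N : ℕ, ∀ {E : Finset (Finset ℕ)} {c : ℕ → ℕ} {V : Finset ℕ}, N ≤ V.card →
    E ⊆ V.powersetCard r → (∀ v ∈ V, c v < ℓ) →
    (lam ℓ r - ε) * (V.card:ℝ)^r ≤ ((E ∩ Crs c V r (Finset.range ℓ)).card : ℝ) → ¬ Cp r T E →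
    (∀ v ∈ V, (r * lam ℓ r - ε) * (V.card:ℝ)^(r-1) ≤ ((lk E v).card : ℝ)) →
    ∃ c' : ℕ → ℕ, (∀ v ∈ V, c' v < ℓ) ∧ ∀ e ∈ E, Set.InjOn c' (↑e : Set ℕ) := by
  classical
  obtain ⟨ζI, hζI, hI⟩ := lemI h
  obtain ⟨ε1, hε1, N1, hmk⟩ := mkNear h hζI hζI
  obtain ⟨ε2, hε2, N2, hE1⟩ := lemE1 h hζI
  refine ⟨min ε1 ε2, lt_min hε1 hε2, max N1 N2, ?_⟩
  intro E c V hn hE hc hX hCp hdeg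
  have m1 : min ε1 ε2 ≤ ε1 := min_le_left _ _
  have m2 : min ε1 ε2 ≤ ε2 := min_le_right _ _
  have hN := (hmk ((le_max_left _ _).trans hn) hE hc (le_trans (mul_le_mul_of_nonneg_right
    (by linarith) (by positivity)) hX)).1
  have h2 := (hE1 ((le_max_right _ _).trans hn) hE hc (le_trans (mul_le_mul_of_nonneg_right
    (by linarith) (by positivity)) hX) hCp).2
  have h3 : ∀ v ∈ V, ∃ i < ℓ, (TY E c V ℓ r v i : ℝ) ≤ ζI * (V.card:ℝ)^(r-1) := fun v hv =>
    h2 v hv (le_trans (mul_le_mul_of_nonneg_right (by linarith) (by positivity)) (hdeg v hv))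
  choose! i hi1 hi2 using h3
  refine ⟨i, hi1, ?_⟩
  intro e he a ha b hb hab
  by_contra hne
  have heV := (Finset.mem_powersetCard.mp (hE he)).1
  refine hCp (hI ζI le_rfl hN (heV ha) (heV hb) hne (hi1 a (heV ha)) (hi2 a (heV ha)) ?_ he ha hb)
  rw [hab]; exact hi2 b (heV hb)

/-! ### Symmetrization via pullbacks -/

/-- Fibre sizes. -/
def fb (V : Finset ℕ) (ρ : ℕ → ℕ) (i : ℕ) : ℝ := ((V.filter (fun v => ρ v = i)).card : ℝ)

/-- Pullback of a hypergraph. -/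
def pb (E : Finset (Finset ℕ)) (V : Finset ℕ) (r : ℕ) (ρ : ℕ → ℕ) : Finset (Finset ℕ) :=
  (V.powersetCard r).filter (fun e : Finset ℕ => Set.InjOn ρ (↑e : Set ℕ) ∧ e.image ρ ∈ E)

theorem pb_card {E : Finset (Finset ℕ)} {V : Finset ℕ} {r : ℕ} (hE : E ⊆ V.powersetCard r)
    (ρ : ℕ → ℕ) : ((pb E V r ρ).card : ℝ) = PP E (fb V ρ) :=
  count_col ρ E r (fun g hg => (Finset.mem_powersetCard.mp (hE hg)).2) V

theorem pb_sub (E : Finset (Finset ℕ)) (V : Finset ℕ) (r : ℕ) (ρ : ℕ → ℕ) :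
    pb E V r ρ ⊆ V.powersetCard r := Finset.filter_subset _ _

theorem pb_id {E : Finset (Finset ℕ)} {V : Finset ℕ} {r : ℕ} (hE : E ⊆ V.powersetCard r) :
    pb E V r id = E := by
  ext e
  unfold pb
  rw [Finset.mem_filter, Finset.image_id]
  constructor
  · exact fun h => h.2.2
  · exact fun h => ⟨hE h, Set.injOn_id _, h⟩

theorem pb_KF {E : Finset (Finset ℕ)} {V : Finset ℕ} {r : ℕ} {F : HGraph r} (hE : E ⊆ V.powersetCard r)
    {ρ : ℕ → ℕ} (h : ¬ KF F E) : ¬ KF F (pb E V r ρ) := by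
  intro hk
  refine h (KF_hom (σ := ρ) (fun e he => (Finset.mem_powersetCard.mp (hE he)).2)
    (fun e he => (Finset.mem_powersetCard.mp (pb_sub E V r ρ he)).2) ?_ hk)
  intro e he
  exact (Finset.mem_filter.mp he).2.2

theorem fb_nonneg (V : Finset ℕ) (ρ : ℕ → ℕ) (i : ℕ) : 0 ≤ fb V ρ i := Nat.cast_nonneg _

theorem fb_zero {V : Finset ℕ} {ρ : ℕ → ℕ} {i : ℕ} (h : i ∉ V.image ρ) : fb V ρ i = 0 := by
  unfold fb
  rw [Nat.cast_eq_zero, Finset.card_eq_zero, Finset.filter_eq_empty_iff]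
  intro v hv hvi
  exact h (Finset.mem_image.mpr ⟨v, hv, hvi⟩)

theorem fb_update {V : Finset ℕ} {ρ : ℕ → ℕ} {x u v : ℕ} (hx : x ∈ V) (hv : ρ x = v) (huv : u ≠ v) :
    fb V (Function.update ρ x u) =
      Function.update (Function.update (fb V ρ) u (fb V ρ u + 1)) v (fb V ρ v - 1) := by
  funext i
  unfold fb
  by_cases hi : i = v
  · subst hi
    rw [Function.update_self]
    have : V.filter (fun y => Function.update ρ x u y = i) = (V.filter (fun y => ρ y = i)).erase x := by
      ext y
      rw [Finset.mem_erase, Finset.mem_filter, Finset.mem_filter]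
      by_cases hy : y = x
      · subst hy; simp [huv]
      · simp [hy]
    rw [this, Finset.card_erase_of_mem (Finset.mem_filter.mpr ⟨hx, hv⟩), Nat.cast_sub, Nat.cast_one]
    exact Finset.card_pos.mpr ⟨x, Finset.mem_filter.mpr ⟨hx, hv⟩⟩
  · rw [Function.update_of_ne hi]
    by_cases hiu : i = u
    · subst hiu
      rw [Function.update_self]
      have : V.filter (fun y => Function.update ρ x i y = i) = insert x (V.filter (fun y => ρ y = i)) := by
        ext y
        rw [Finset.mem_insert, Finset.mem_filter, Finset.mem_filter]
        by_cases hy : y = x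
        · subst hy; simp [hx]
        · simp [hy]
      rw [this, Finset.card_insert_of_notMem, Nat.cast_add, Nat.cast_one]
      rw [Finset.mem_filter, hv]
      exact fun hh => huv hh.2.symm
    · rw [Function.update_of_ne hiu]
      congr 2
      apply Finset.filter_congr
      intro y _
      by_cases hy : y = x
      · subst hy
        rw [Function.update_self, hv]
        exact ⟨fun hh => absurd hh.symm hiu, fun hh => absurd hh.symm hi⟩
      · rw [Function.update_of_ne hy]

theorem PP_lk_shift_u {E : Finset (Finset ℕ)} {u v : ℕ} (h : u ≠ v) {x : ℕ → ℝ} (a b : ℝ)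
    (h0 : PP (lk (lk E u) v) x = 0) :
    PP (lk E u) (Function.update (Function.update x u a) v b) = PP (lk E u) x := by
  rw [PP_update, lk_comm, PP_lk_update, lk_comm, h0, dl_lk_comm E h, PP_lk_update,
    ← dl_lk_comm E h, PP_split (lk E u) v x, h0]
  ring

theorem PP_lk_shift_v {E : Finset (Finset ℕ)} {u v : ℕ} {x : ℕ → ℝ} (a b : ℝ)
    (h0 : PP (lk (lk E u) v) x = 0) :
    PP (lk E v) (Function.update (Function.update x u a) v b) = PP (lk E v) x := by
  rw [PP_lk_update, PP_update, lk_comm, h0, PP_split (lk E v) u x, lk_comm, h0]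
  ring

/-- The pair is covered inside the image. -/
def Cov (E : Finset (Finset ℕ)) (R : Finset ℕ) (a b : ℕ) : Prop := ∃ e ∈ E, e ⊆ R ∧ a ∈ e ∧ b ∈ e

theorem cross_zero {E : Finset (Finset ℕ)} {V : Finset ℕ} {ρ : ℕ → ℕ} {u v : ℕ}
    (hu : u ∈ V.image ρ) (hv : v ∈ V.image ρ) (h : ¬ Cov E (V.image ρ) u v) :
    PP (lk (lk E u) v) (fb V ρ) = 0 := by
  unfold PP
  apply Finset.sum_eq_zero
  intro f hf
  rw [mem_lk, mem_lk] at hf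
  have h1 : ¬ insert u (insert v f) ⊆ V.image ρ := fun hs =>
    h ⟨_, hf.2.2, hs, by simp, by simp⟩
  rw [Finset.not_subset] at h1
  obtain ⟨y, hy, hyR⟩ := h1
  rw [Finset.mem_insert, Finset.mem_insert] at hy
  rcases hy with rfl | rfl | hy
  · exact absurd hu hyR
  · exact absurd hv hyR
  · exact Finset.prod_eq_zero hy (fb_zero hyR)

theorem Cov_symm {E : Finset (Finset ℕ)} {R : Finset ℕ} {a b : ℕ} (h : Cov E R a b) : Cov E R b a := by
  obtain ⟨e, h1, h2, h3, h4⟩ := h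
  exact ⟨e, h1, h2, h4, h3⟩

theorem image_update_sub {V : Finset ℕ} {ρ : ℕ → ℕ} {x u : ℕ} (hu : u ∈ V.image ρ) :
    V.image (Function.update ρ x u) ⊆ V.image ρ := by
  intro y hy
  obtain ⟨z, hz, rfl⟩ := Finset.mem_image.mp hy
  by_cases hzx : z = x
  · subst hzx; rw [Function.update_self]; exact hu
  · rw [Function.update_of_ne hzx]; exact Finset.mem_image_of_mem _ hz

theorem sym_induct {E : Finset (Finset ℕ)} {V : Finset ℕ} {r : ℕ} (hE : E ⊆ V.powersetCard r)
    (Q : (ℕ → ℕ) → Prop)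
    (base : ∀ ρ : ℕ → ℕ, (∀ a ∈ V.image ρ, ∀ b ∈ V.image ρ, a ≠ b → Cov E (V.image ρ) a b) →
      V.image ρ ⊆ V → Q ρ)
    (step : ∀ (ρ : ℕ → ℕ) (x u : ℕ), x ∈ V →
      (pb E V r ρ).card ≤ (pb E V r (Function.update ρ x u)).card →
      Q (Function.update ρ x u) → Q ρ) :
    ∀ ρ : ℕ → ℕ, V.image ρ ⊆ V → Q ρ := by
  have main : ∀ m : ℕ, ∀ ρ : ℕ → ℕ, V.image ρ ⊆ V → (V.image ρ).card = m → Q ρ := by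
    intro m
    induction m using Nat.strong_induction_on with
    | _ m IH =>
    intro ρ0 hρ0 hm0
    -- inner induction
    have inner : ∀ s : ℕ, ∀ ρ : ℕ → ℕ, V.image ρ ⊆ V → (V.image ρ).card = m → ∀ u ∈ V.image ρ,
        ∀ v ∈ V.image ρ, u ≠ v → ¬ Cov E (V.image ρ) u v →
        PP (lk E v) (fb V ρ) ≤ PP (lk E u) (fb V ρ) →
        (V.filter (fun y => ρ y = v)).card = s → Q ρ := by
      intro s
      induction s with
      | zero =>
        intro ρ _ _ u _ v hv _ _ _ hs
        obtain ⟨y, hy, hyv⟩ := Finset.mem_image.mp hv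
        rw [Finset.card_eq_zero, Finset.filter_eq_empty_iff] at hs
        exact absurd hyv (hs hy)
      | succ s ihs =>
        intro ρ hρ hm u hu v hv huv hcov hle hs
        obtain ⟨x, hx, hxv⟩ := Finset.mem_image.mp hv
        have hz := cross_zero hu hv hcov
        have hfb := fb_update hx hxv huv
        have hsubR := image_update_sub (x := x) hu
        apply step ρ x u hx
        · have h1 := pb_card hE ρ
          have h2 := pb_card hE (Function.update ρ x u)
          rw [hfb, PP_shift E huv, hz] at h2
          have : ((pb E V r ρ).card : ℝ) ≤ (pb E V r (Function.update ρ x u)).card := by linarith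
          exact_mod_cast this
        · by_cases hvR : v ∈ V.image (Function.update ρ x u)
          · have hRR : V.image (Function.update ρ x u) = V.image ρ := by
              apply Finset.Subset.antisymm hsubR
              intro y hy
              obtain ⟨z, hz, rfl⟩ := Finset.mem_image.mp hy
              by_cases hzx : z = x
              · subst hzx; rw [hxv]; exact hvR
              · exact Finset.mem_image.mpr ⟨z, hz, Function.update_of_ne hzx _ _⟩
            apply ihs _ (hsubR.trans hρ) (by rw [hRR]; exact hm) u (by rw [hRR]; exact hu) v hvR huv
              (by rw [hRR]; exact hcov)
            · rw [hfb, PP_lk_shift_u huv _ _ hz, PP_lk_shift_v _ _ hz]; exact hle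
            · have h1 := congrFun hfb v
              rw [Function.update_self] at h1
              unfold fb at h1
              rw [hs] at h1
              push_cast at h1
              have : ((V.filter (fun y => Function.update ρ x u y = v)).card : ℝ) = s := by linarith
              exact_mod_cast this
          · apply IH (V.image (Function.update ρ x u)).card _ _ (hsubR.trans hρ) rfl
            rw [← hm]
            apply Finset.card_lt_card
            exact Finset.ssubset_iff_subset_ne.mpr ⟨hsubR, fun hh => hvR (hh ▸ hv)⟩
    by_cases hb : ∀ a ∈ V.image ρ0, ∀ b ∈ V.image ρ0, a ≠ b → Cov E (V.image ρ0) a b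
    · exact base ρ0 hb hρ0
    · push Not at hb
      obtain ⟨a, ha, b, hb, hab, hcov⟩ := hb
      rcases le_total (PP (lk E b) (fb V ρ0)) (PP (lk E a) (fb V ρ0)) with hle | hle
      · exact inner _ ρ0 hρ0 hm0 a ha b hb hab hcov hle rfl
      · exact inner _ ρ0 hρ0 hm0 b hb a ha hab.symm (fun hh => hcov (Cov_symm hh)) hle rfl
  exact fun ρ hρ => main _ ρ hρ rfl

theorem PP_restrict {E : Finset (Finset ℕ)} {V : Finset ℕ} {ρ : ℕ → ℕ} :
    PP E (fb V ρ) = PP (E.filter (fun e => e ⊆ V.image ρ)) (fb V ρ) := by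
  unfold PP
  rw [Finset.sum_filter]
  apply Finset.sum_congr rfl
  intro e _
  split_ifs with h
  · rfl
  · rw [Finset.not_subset] at h
    obtain ⟨y, hy, hyR⟩ := h
    exact Finset.prod_eq_zero hy (fb_zero hyR)

theorem base_free {k r ℓ : ℕ} {T : HGraph 2} (h : Good k r ℓ T) {E : Finset (Finset ℕ)} {R : Finset ℕ}
    (hK : ¬ KF (expTree r T) E)
    (hcov : ∀ a ∈ R, ∀ b ∈ R, a ≠ b → Cov E R a b) :
    ¬ ExpIn r T (E.filter (fun e => e ⊆ R)) := by
  have hr := h.hr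
  have hk := h.hk36
  intro hX
  refine hK (KF_of_ExpIn (by omega) h.hT (by omega) (Finset.filter_subset _ _)
    (fun e he => (Finset.mem_filter.mp he).2) ?_ hX)
  intro a ha b hb hab
  obtain ⟨e, h1, _, h3, h4⟩ := hcov a ha b hb hab
  exact ⟨e, h1, h3, h4⟩

theorem fb_sum {V : Finset ℕ} {ρ : ℕ → ℕ} : ∑ i ∈ V.image ρ, fb V ρ i = V.card :=
  sum_fibres ρ V _ (fun _ hv => Finset.mem_image_of_mem _ hv)

/-- P0. -/
theorem lemP0 {k r ℓ : ℕ} {T : HGraph 2} (h : Good k r ℓ T) {E : Finset (Finset ℕ)} {V : Finset ℕ}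
    (hE : E ⊆ V.powersetCard r) (hK : ¬ KF (expTree r T) E) :
    (E.card : ℝ) ≤ lam ℓ r * (V.card:ℝ)^r := by
  have := sym_induct hE (fun ρ => ((pb E V r ρ).card : ℝ) ≤ lam ℓ r * (V.card:ℝ)^r) ?_ ?_ id (by simp)
  · rwa [pb_id hE] at this
  · intro ρ hcov _
    rw [pb_card hE, PP_restrict]
    refine h.lag (V := V.image ρ) ?_ (base_free h hK hcov) (fb_nonneg V ρ) fb_sum.le
    intro e he
    rw [Finset.mem_filter] at he
    exact Finset.mem_powersetCard.mpr ⟨he.2, (Finset.mem_powersetCard.mp (hE he.1)).2⟩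
  · intro ρ x u _ hle hq
    refine le_trans ?_ hq
    exact_mod_cast hle

/-! ### Low degree vertices and stability -/

/-- Vertices of low degree. -/
noncomputable def Zl (E : Finset (Finset ℕ)) (V : Finset ℕ) (θ : ℝ) : Finset ℕ :=
  V.filter (fun v => ((lk E v).card : ℝ) < θ)

theorem one_sub_pow_le {p : ℝ} (h0 : 0 ≤ p) (h1 : p ≤ 1) (r : ℕ) :
    (1 - p)^r ≤ 1 - r * p + (r:ℝ)^2 * p^2 := by
  induction r with
  | zero => simp
  | succ r ih =>
    have h2 : (1-p)^(r+1) ≤ (1 - r * p + (r:ℝ)^2 * p^2) * (1 - p) := by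
      rw [pow_succ]
      exact mul_le_mul_of_nonneg_right ih (by linarith)
    refine h2.trans ?_
    push_cast
    have hr : (0:ℝ) ≤ r := Nat.cast_nonneg _
    have h3 : 0 ≤ (r:ℝ)^2 * p^2 * p := by positivity
    have h4 : 0 ≤ (r:ℝ) * p^2 := by positivity
    have h5 : 0 ≤ p^2 := by positivity
    nlinarith

theorem filt_sub {G : Finset (Finset ℕ)} {V : Finset ℕ} {q : ℕ} (hG : G ⊆ V.powersetCard q) (S : Finset ℕ) :
    (G.card : ℝ) ≤ (G.filter (fun e => e ⊆ S)).card + ((V \ S).card : ℝ) * (V.card:ℝ)^(q-1) := by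
  classical
  have h1 := Finset.card_filter_add_card_filter_not (s := G) (fun e : Finset ℕ => e ⊆ S)
  have h2 : G.filter (fun e => ¬ e ⊆ S) ⊆ (V.powersetCard q).filter (fun f => ∃ x ∈ V \ S, x ∈ f) := by
    intro e he
    rw [Finset.mem_filter] at he
    rw [Finset.mem_filter]
    refine ⟨hG he.1, ?_⟩
    obtain ⟨x, hx, hxS⟩ := Finset.not_subset.mp he.2
    exact ⟨x, Finset.mem_sdiff.mpr ⟨(Finset.mem_powersetCard.mp (hG he.1)).1 hx, hxS⟩, hx⟩
  have h3 := (Finset.card_le_card h2).trans meet_card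
  rw [← h1]
  push_cast
  have h4 : ((G.filter (fun e => ¬ e ⊆ S)).card : ℝ) ≤ ((V \ S).card : ℝ) * (V.card:ℝ)^(q-1) := by
    exact_mod_cast h3
  linarith

theorem negpos {a b x y C : ℝ} (hab : a ≤ b) (hx : 0 ≤ x) (hxy : x ≤ y) (hC : 0 ≤ C) (h : b * y ≤ C) :
    a * x ≤ C := by
  rcases le_total a 0 with ha | ha
  · exact (mul_nonpos_of_nonpos_of_nonneg ha hx).trans hC
  · exact (mul_le_mul hab hxy hx (ha.trans hab)).trans h

theorem Zlem {k r ℓ : ℕ} {T : HGraph 2} (h : Good k r ℓ T) {ε1 δ : ℝ} (hε1 : 0 < ε1) (hδ : 0 < δ) :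
    ∃ ε > 0, ∃ N : ℕ, ∀ {E : Finset (Finset ℕ)} {V : Finset ℕ}, N ≤ V.card → E ⊆ V.powersetCard r →
      (∀ S ⊆ V, ((E.filter (fun e => e ⊆ S)).card : ℝ) ≤ lam ℓ r * (S.card:ℝ)^r + ε * (V.card:ℝ)^r) →
      (lam ℓ r - ε) * (V.card:ℝ)^r ≤ E.card →
      ((Zl E V ((r * lam ℓ r - ε1) * (V.card:ℝ)^(r-1))).card : ℝ) ≤ δ * V.card := by
  have hr := h.hr
  have hr0 : (0:ℝ) < r := by exact_mod_cast (show 0 < r by omega)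
  have hl1 := h.hrl
  have hlam0 := lam_pos (ℓ := ℓ) (r := r) (by omega) (by omega)
  have hlam1 := lam_le_one (ℓ := ℓ) (r := r) (by omega) (by omega)
  obtain ⟨δ', hδ'0, hd1, hd2, hd3⟩ : ∃ δ' : ℝ, 0 < δ' ∧ δ' ≤ δ ∧ δ' ≤ 1/4 ∧ δ' * (4 * (r:ℝ)^2) ≤ ε1 := by
    refine ⟨min δ (min (1/4) (ε1 / (4 * (r:ℝ)^2))), by positivity, min_le_left _ _,
      (min_le_right _ _).trans (min_le_left _ _), ?_⟩
    rw [← le_div_iff₀ (by positivity)]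
    exact (min_le_right _ _).trans (min_le_right _ _)
  refine ⟨δ' * ε1 / 8, by positivity, ⌈1/δ'⌉₊ + 1, ?_⟩
  intro E V hN hE hS hcard
  by_contra hcon
  push Not at hcon
  set n : ℝ := (V.card:ℝ) with hn
  set Z := Zl E V ((r * lam ℓ r - ε1) * n^(r-1)) with hZ
  have hn1 : 1/δ' ≤ n := by
    have h1 : ((⌈1/δ'⌉₊ + 1 : ℕ) : ℝ) ≤ n := by rw [hn]; exact_mod_cast hN
    push_cast at h1
    have := Nat.le_ceil (1/δ')
    linarith
  have hn0 : 0 < n := lt_of_lt_of_le (one_div_pos.mpr hδ'0) hn1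
  have hdn : 1 ≤ δ' * n := by rw [div_le_iff₀ hδ'0] at hn1; linarith
  have hZc : δ' * n < Z.card := lt_of_le_of_lt (mul_le_mul_of_nonneg_right hd1 hn0.le) hcon
  obtain ⟨Z0, hZ0, hZ0c⟩ := Finset.exists_subset_card_eq (s := Z) (n := ⌈δ' * n⌉₊) (by
    exact Nat.ceil_le.mpr hZc.le)
  have hZV : Z ⊆ V := Finset.filter_subset _ _
  set p := (Z0.card : ℝ) / n with hp
  have hpn : (Z0.card : ℝ) = p * n := by rw [hp, div_mul_cancel₀ _ hn0.ne']
  have hp1 : δ' ≤ p := by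
    rw [hp, le_div_iff₀ hn0, hZ0c]; exact Nat.le_ceil _
  have hp2 : p ≤ 2 * δ' := by
    rw [hp, div_le_iff₀ hn0, hZ0c]
    have := (Nat.ceil_lt_add_one (mul_nonneg hδ'0.le hn0.le)).le
    linarith
  clear_value p
  clear hp
  have h1 := hS (V \ Z0) Finset.sdiff_subset
  have hVZ : ((V \ Z0).card : ℝ) = n * (1 - p) := by
    rw [Finset.card_sdiff_of_subset (hZ0.trans hZV), Nat.cast_sub (Finset.card_le_card (hZ0.trans hZV)), hpn]
    ring
  have h2 : (E.card : ℝ) ≤ (E.filter (fun e => e ⊆ V \ Z0)).card + ∑ v ∈ Z0, ((lk E v).card : ℝ) := by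
    have hsub : E ⊆ E.filter (fun e => e ⊆ V \ Z0) ∪ Z0.biUnion (fun v => E.filter (fun e => v ∈ e)) := by
      intro e he
      rw [Finset.mem_union, Finset.mem_filter, Finset.mem_biUnion]
      by_cases hh : e ⊆ V \ Z0
      · exact Or.inl ⟨he, hh⟩
      · right
        obtain ⟨x, hx, hxS⟩ := Finset.not_subset.mp hh
        refine ⟨x, ?_, Finset.mem_filter.mpr ⟨he, hx⟩⟩
        by_contra hxZ
        exact hxS (Finset.mem_sdiff.mpr ⟨(Finset.mem_powersetCard.mp (hE he)).1 hx, hxZ⟩)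
    have h3 := (Finset.card_le_card hsub).trans ((Finset.card_union_le _ _).trans
      (Nat.add_le_add_left Finset.card_biUnion_le _))
    have h4 : ∀ v, (lk E v).card = (E.filter (v ∈ ·)).card := card_lk E
    simp_rw [h4]
    exact_mod_cast h3
  have h3 : ∑ v ∈ Z0, ((lk E v).card : ℝ) ≤ p * n * ((r * lam ℓ r - ε1) * n^(r-1)) := by
    rw [← hpn, ← nsmul_eq_mul]
    apply Finset.sum_le_card_nsmul
    intro v hv
    have := hZ0 hv
    rw [hZ, Zl, Finset.mem_filter] at this
    exact this.2.le
  have hpow : n * n^(r-1) = n^r := by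
    rw [← pow_succ']; congr 1; omega
  have h3' : p * n * ((r * lam ℓ r - ε1) * n^(r-1)) = p * (r * lam ℓ r - ε1) * n^r := by
    rw [← hpow]; ring
  rw [hVZ, mul_pow] at h1
  have h5 := one_sub_pow_le (p := p) (by linarith) (by linarith) r
  have h6 : lam ℓ r * (n^r * (1-p)^r) ≤ lam ℓ r * (1 - r * p + (r:ℝ)^2 * p^2) * n^r := by
    have : lam ℓ r * (n^r * (1-p)^r) = lam ℓ r * (1-p)^r * n^r := by ring
    rw [this]
    exact mul_le_mul_of_nonneg_right (mul_le_mul_of_nonneg_left h5 hlam0.le) (by positivity)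
  have h7 : (lam ℓ r - δ' * ε1 / 8) * n^r ≤ (lam ℓ r * (1 - r * p + (r:ℝ)^2 * p^2) + δ' * ε1/8
      + p * (r * lam ℓ r - ε1)) * n^r := by
    rw [h3'] at h3
    linarith
  have h8 := le_of_mul_le_mul_right h7 (by positivity)
  have h9 : lam ℓ r * ((r:ℝ)^2 * p^2) ≤ 1 * ((r:ℝ)^2 * p^2) := mul_le_mul_of_nonneg_right hlam1 (by positivity)
  have h10 : p * (r:ℝ)^2 * p ≤ (2 * δ') * (r:ℝ)^2 * p :=
    mul_le_mul_of_nonneg_right (mul_le_mul_of_nonneg_right hp2 (by positivity)) (by linarith)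
  have h11 : δ' * (4 * (r:ℝ)^2) * p ≤ ε1 * p := mul_le_mul_of_nonneg_right hd3 (by linarith)
  have h12 : δ' * ε1 ≤ p * ε1 := mul_le_mul_of_nonneg_right hp1 hε1.le
  have h13 : 0 < δ' * ε1 := by positivity
  nlinarith

theorem lemS' {k r ℓ : ℕ} {T : HGraph 2} (h : Good k r ℓ T) :
    ∃ ε0 > 0, ∃ N : ℕ, ∀ {G : Finset (Finset ℕ)} {V : Finset ℕ} {c : ℕ → ℕ}, N ≤ V.card →
      G ⊆ V.powersetCard r → ¬ Cp r T G →
      ((Zl G V ((r * lam ℓ r - ε0) * (V.card:ℝ)^(r-1))).card : ℝ) ≤ ε0 * V.card →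
      (∀ v ∈ V, c v < ℓ) →
      (lam ℓ r - 4 * ε0) * (V.card:ℝ)^r ≤ ((G ∩ Crs c V r (Finset.range ℓ)).card : ℝ) →
      ∃ c' : ℕ → ℕ, (∀ v ∈ V \ Zl G V ((r * lam ℓ r - ε0) * (V.card:ℝ)^(r-1)), c' v < ℓ) ∧
        ∀ e ∈ G, e ⊆ V \ Zl G V ((r * lam ℓ r - ε0) * (V.card:ℝ)^(r-1)) → Set.InjOn c' ↑e := by
  have hr := h.hr
  have hl1 := h.hrl
  obtain ⟨ε, hε, N, hN⟩ := lemE h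
  refine ⟨min (1/2) (ε/5), by positivity, 2 * N, ?_⟩
  set ε0 := min (1/2) (ε/5) with hε0
  have he1 : ε0 ≤ 1/2 := min_le_left _ _
  have he2 : 5 * ε0 ≤ ε := by
    have : ε0 ≤ ε/5 := min_le_right _ _
    linarith
  have he0 : 0 < ε0 := by rw [hε0]; positivity
  intro G V c hn hG hC hZ hcS hcr
  set Z := Zl G V ((r * lam ℓ r - ε0) * (V.card:ℝ)^(r-1)) with hZd
  set n : ℝ := (V.card:ℝ) with hnd
  have hn0 : 0 ≤ n := Nat.cast_nonneg _
  have hZV : Z ⊆ V := Finset.filter_subset _ _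
  have hV' : ((V \ Z).card : ℝ) = n - Z.card := by
    rw [Finset.card_sdiff_of_subset hZV, Nat.cast_sub (Finset.card_le_card hZV)]
  have hV'n : ((V \ Z).card : ℝ) ≤ n := by
    rw [hV']; have : (0:ℝ) ≤ Z.card := Nat.cast_nonneg _
    linarith
  have hpow : n * n^(r-1) = n^r := by
    rw [← pow_succ']; congr 1; omega
  have hpow2 : n * n^(r-1-1) = n^(r-1) := by
    rw [← pow_succ']; congr 1; omega
  have hN' : N ≤ (V \ Z).card := by
    have h1 : (2 * N : ℝ) ≤ n := by rw [hnd]; exact_mod_cast hn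
    have h2 : (N:ℝ) ≤ ((V \ Z).card : ℝ) := by
      rw [hV']
      nlinarith
    exact_mod_cast h2
  have key := hN (E := G.filter (fun e => e ⊆ V \ Z)) (c := c)
    (V := V \ Z) hN' ?_ ?_ ?_ ?_ ?_
  · obtain ⟨c', hc1, hc2⟩ := key
    refine ⟨c', hc1, ?_⟩
    intro e he heZ
    exact hc2 e (Finset.mem_filter.mpr ⟨he, heZ⟩)
  · intro e he
    rw [Finset.mem_filter] at he
    exact Finset.mem_powersetCard.mpr ⟨he.2, (Finset.mem_powersetCard.mp (hG he.1)).2⟩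
  · intro v hv
    exact hcS v (Finset.mem_sdiff.mp hv).1
  · have h1 := filt_sub (G := G ∩ Crs c V r (Finset.range ℓ)) (Finset.inter_subset_left.trans hG) (V \ Z)
    have h3 : ((V \ (V \ Z)).card : ℝ) * n^(r-1) ≤ ε0 * n^r := by
      rw [Finset.sdiff_sdiff_eq_self hZV]
      calc (Z.card : ℝ) * n^(r-1) ≤ ε0 * n * n^(r-1) := by gcongr
        _ = _ := by rw [← hpow]; ring
    have h4 : (((G ∩ Crs c V r (Finset.range ℓ)).filter (fun e => e ⊆ V \ Z)).card : ℝ) ≤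
        ((G.filter (fun e => e ⊆ V \ Z) ∩ Crs c (V \ Z) r (Finset.range ℓ)).card : ℝ) := by
      have : (G ∩ Crs c V r (Finset.range ℓ)).filter (fun e => e ⊆ V \ Z) ⊆
        (G.filter (fun e => e ⊆ V \ Z) ∩ Crs c (V \ Z) r (Finset.range ℓ)) := by
        intro e he
        rw [Finset.mem_filter, Finset.mem_inter, mem_Crs] at he
        rw [Finset.mem_inter, Finset.mem_filter, mem_Crs]
        exact ⟨⟨he.1.1, he.2⟩, he.2, he.1.2.2⟩
      exact_mod_cast Finset.card_le_card this
    refine negpos (b := lam ℓ r - 5 * ε0) (y := n^r) (by linarith) (by positivity) (by gcongr) (Nat.cast_nonneg _) ?_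
    refine le_trans ?_ h4
    linarith
  · intro hh
    exact hC (hh.mono (Finset.filter_subset _ _))
  · intro v hv
    have hvd : (r * lam ℓ r - ε0) * n^(r-1) ≤ (lk G v).card := by
      have := (Finset.mem_sdiff.mp hv).2
      rw [hZd, Zl, Finset.mem_filter] at this
      push Not at this
      exact this (Finset.mem_sdiff.mp hv).1
    have h1 := filt_sub (G := lk G v) (V := V) (q := r-1)
      ((lk_sub' (by omega) hG v).trans (Finset.powersetCard_mono (Finset.erase_subset _ _))) (V \ Z)
    have h2 : (((lk G v).filter (fun e => e ⊆ V \ Z)).card : ℝ) ≤ (lk (G.filter (fun e => e ⊆ V \ Z)) v).card := by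
      have : (lk G v).filter (fun e => e ⊆ V \ Z) ⊆ lk (G.filter (fun e => e ⊆ V \ Z)) v := by
        intro f hf
        rw [Finset.mem_filter, mem_lk] at hf
        rw [mem_lk, Finset.mem_filter]
        exact ⟨hf.1.1, hf.1.2, Finset.insert_subset hv hf.2⟩
      exact_mod_cast Finset.card_le_card this
    have h3 : ((V \ (V \ Z)).card : ℝ) * n^(r-1-1) ≤ ε0 * n^(r-1) := by
      rw [Finset.sdiff_sdiff_eq_self hZV]
      calc (Z.card : ℝ) * n^(r-1-1) ≤ ε0 * n * n^(r-1-1) := by gcongr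
        _ = _ := by rw [← hpow2]; ring
    refine negpos (b := r * lam ℓ r - 2 * ε0) (y := n^(r-1)) (by linarith) (by positivity) (by gcongr) (Nat.cast_nonneg _) ?_
    refine le_trans ?_ h2
    linarith

/-- Extract a crossing bound from a colouring outside a small set. -/
theorem cross_of {G : Finset (Finset ℕ)} {V Z : Finset ℕ} {r ℓ : ℕ} {c : ℕ → ℕ} (hℓ : 0 < ℓ) (hG : G ⊆ V.powersetCard r)
    (hZV : Z ⊆ V)
    (hc : ∀ v ∈ V \ Z, c v < ℓ) (hinj : ∀ e ∈ G, e ⊆ V \ Z → Set.InjOn c ↑e) :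
    ∃ c' : ℕ → ℕ, (∀ v ∈ V, c' v < ℓ) ∧
      (G.card : ℝ) ≤ (G ∩ Crs c' V r (Finset.range ℓ)).card + (Z.card:ℝ) * (V.card:ℝ)^(r-1) := by
  refine ⟨fun v => if v ∈ V \ Z then c v else 0, ?_, ?_⟩
  · intro v _
    by_cases hv : v ∈ V \ Z
    · simp only [hv, if_true]; exact hc v hv
    · simp only [hv, if_false]; exact hℓ
  · have h1 := filt_sub hG (V \ Z)
    rw [Finset.sdiff_sdiff_eq_self hZV] at h1
    refine h1.trans ?_
    gcongr
    intro e he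
    rw [Finset.mem_filter] at he
    rw [Finset.mem_inter, mem_Crs]
    have hp := Finset.mem_powersetCard.mp (hG he.1)
    refine ⟨he.1, hp.1, hp.2, ?_, ?_⟩
    · intro a ha b hb hab
      have ha' := he.2 (Finset.mem_coe.mp ha)
      have hb' := he.2 (Finset.mem_coe.mp hb)
      simp only [ha', hb', if_true] at hab
      exact hinj e he.1 he.2 ha hb hab
    · intro v hv
      simp only [he.2 hv, if_true]
      exact Finset.mem_range.mpr (hc v (he.2 hv))

theorem lemS {k r ℓ : ℕ} {T : HGraph 2} (h : Good k r ℓ T) :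
    ∃ ε0 > 0, ∃ N : ℕ, ∀ {G : Finset (Finset ℕ)} {V S : Finset ℕ} {c : ℕ → ℕ}, N ≤ V.card →
      G ⊆ V.powersetCard r → ¬ Cp r T G → (lam ℓ r - ε0) * (V.card:ℝ)^r ≤ G.card →
      ((Zl G V ((r * lam ℓ r - ε0) * (V.card:ℝ)^(r-1))).card : ℝ) ≤ ε0 * V.card →
      ((V \ S).card : ℝ) ≤ 3 * ε0 * V.card → (∀ v ∈ S, c v < ℓ) →
      (∀ e ∈ G, e ⊆ S → Set.InjOn c ↑e) →
      ∃ c' : ℕ → ℕ, (∀ v ∈ V \ Zl G V ((r * lam ℓ r - ε0) * (V.card:ℝ)^(r-1)), c' v < ℓ) ∧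
        ∀ e ∈ G, e ⊆ V \ Zl G V ((r * lam ℓ r - ε0) * (V.card:ℝ)^(r-1)) → Set.InjOn c' ↑e := by
  have hr := h.hr
  have hl1 := h.hrl
  obtain ⟨ε0, hε0, N, hN⟩ := lemS' h
  refine ⟨ε0, hε0, N, ?_⟩
  intro G V S c hn hG hC hcard hZ hS hcS hinj
  set n : ℝ := (V.card:ℝ) with hnd
  have hn0 : 0 ≤ n := Nat.cast_nonneg _
  have hpow : n * n^(r-1) = n^r := by
    rw [← pow_succ']; congr 1; omega
  have hVS : V \ (V \ S) ⊆ S := by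
    intro x hx
    simp only [Finset.mem_sdiff] at hx
    tauto
  obtain ⟨c', h1, h2⟩ := cross_of (ℓ := ℓ) (c := c) (by omega) hG (Finset.sdiff_subset (s := V) (t := S))
    (fun v hv => hcS v (hVS hv)) (fun e he hee => hinj e he (hee.trans hVS))
  refine hN hn hG hC hZ h1 ?_
  have h3 : ((V \ S).card : ℝ) * n^(r-1) ≤ 3 * ε0 * n^r := by
    calc ((V \ S).card : ℝ) * n^(r-1) ≤ 3 * ε0 * n * n^(r-1) := by gcongr
      _ = _ := by rw [← hpow]; ring
  linarith

theorem not_Cp_of_KF {k r ℓ : ℕ} {T : HGraph 2} (h : Good k r ℓ T) {E : Finset (Finset ℕ)}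
    (hK : ¬ KF (expTree r T) E) : ¬ Cp r T E := by
  have hr := h.hr
  intro hh
  exact hK (CpF.toKF (by omega) hh)

theorem KF.mono {r : ℕ} {F : HGraph r} {E E' : Finset (Finset ℕ)} (h : E ⊆ E') (hC : KF F E) :
    KF F E' := by
  obtain ⟨f, h1, h2, h3⟩ := hC
  refine ⟨f, h1, fun e he => h (h2 e he), ?_⟩
  intro a ha b hb hab
  obtain ⟨e, he, h4⟩ := h3 a ha b hb hab
  exact ⟨e, h he, h4⟩

theorem stabKF {k r ℓ : ℕ} {T : HGraph 2} (h : Good k r ℓ T) {ε' : ℝ} (hε' : 0 < ε') :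
    ∃ ε > (0:ℝ), ∃ N : ℕ, ∀ {E : Finset (Finset ℕ)} {V : Finset ℕ}, N ≤ V.card → E ⊆ V.powersetCard r →
      ¬ KF (expTree r T) E → (lam ℓ r - ε) * (V.card:ℝ)^r ≤ E.card →
      ∃ c : ℕ → ℕ, (∀ v ∈ V, c v < ℓ) ∧
        (lam ℓ r - ε') * (V.card:ℝ)^r ≤ ((E ∩ Crs c V r (Finset.range ℓ)).card : ℝ) := by
  have hr := h.hr
  have hl1 := h.hrl
  have hℓ0 : (0:ℝ) < ℓ := by exact_mod_cast (show 0 < ℓ by omega)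
  obtain ⟨ε0, hε0, N0, hS⟩ := lemS h
  obtain ⟨ε1, hε1, N1, hZ⟩ := Zlem h hε0 (δ := min ε0 (ε'/2)) (by positivity)
  obtain ⟨ε2, hε2, hconc⟩ := h.conc (δ := ε0 / ℓ) (by positivity)
  obtain ⟨ε, hε, he0, he1, he2, he3⟩ : ∃ ε : ℝ, 0 < ε ∧ ε ≤ ε0 ∧ ε ≤ ε1 ∧ ε ≤ ε2 ∧ ε ≤ ε'/2 := by
    refine ⟨min (min ε0 ε1) (min ε2 (ε'/2)), by positivity, ?_, ?_, ?_, ?_⟩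
    · exact (min_le_left _ _).trans (min_le_left _ _)
    · exact (min_le_left _ _).trans (min_le_right _ _)
    · exact (min_le_right _ _).trans (min_le_left _ _)
    · exact (min_le_right _ _).trans (min_le_right _ _)
  refine ⟨ε, hε, N0 + N1 + ⌈1/ε0⌉₊ + 1, ?_⟩
  intro E V hN hE hK hcard
  set n : ℝ := (V.card : ℝ) with hn
  have hn1 : 1 ≤ ε0 * n := by
    have h1 : ((⌈1/ε0⌉₊ : ℕ) : ℝ) ≤ n := by
      rw [hn]; exact_mod_cast (show ⌈1/ε0⌉₊ ≤ V.card by omega)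
    have h2 := (Nat.le_ceil (1/ε0)).trans h1
    rw [div_le_iff₀ hε0] at h2
    linarith
  have hn0 : 0 < n := by
    rw [hn]; exact_mod_cast (show 0 < V.card by omega)
  have hpow : n * n^(r-1) = n^r := by
    rw [← pow_succ']; congr 1; omega
  have hZb : ∀ ρ : ℕ → ℕ, (lam ℓ r - ε) * n^r ≤ (pb E V r ρ).card →
      ((Zl (pb E V r ρ) V ((r * lam ℓ r - ε0) * n^(r-1))).card : ℝ) ≤ min ε0 (ε'/2) * n := by
    intro ρ hρ
    refine hZ (by omega) (pb_sub E V r ρ) ?_ ?_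
    · intro S _
      have h1 := lemP0 h (V := S) (E := (pb E V r ρ).filter (fun e => e ⊆ S)) ?_ ?_
      · refine h1.trans ?_
        have : 0 ≤ ε1 * n^r := by positivity
        linarith
      · intro e he
        rw [Finset.mem_filter] at he
        exact Finset.mem_powersetCard.mpr ⟨he.2, (Finset.mem_powersetCard.mp (pb_sub E V r ρ he.1)).2⟩
      · intro hh
        exact pb_KF hE hK (hh.mono (Finset.filter_subset _ _))
    · refine le_trans ?_ hρ
      have : 0 ≤ n^r := by positivity
      exact mul_le_mul_of_nonneg_right (by linarith) this
  have hSS : ∀ (ρ : ℕ → ℕ) (S : Finset ℕ) (c : ℕ → ℕ), (lam ℓ r - ε) * n^r ≤ (pb E V r ρ).card →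
      ((V \ S).card : ℝ) ≤ 3 * ε0 * n → (∀ v ∈ S, c v < ℓ) →
      (∀ e ∈ pb E V r ρ, e ⊆ S → Set.InjOn c ↑e) →
      ∃ c' : ℕ → ℕ, (∀ v ∈ V \ Zl (pb E V r ρ) V ((r * lam ℓ r - ε0) * n^(r-1)), c' v < ℓ) ∧
        ∀ e ∈ pb E V r ρ, e ⊆ V \ Zl (pb E V r ρ) V ((r * lam ℓ r - ε0) * n^(r-1)) → Set.InjOn c' ↑e := by
    intro ρ S c hρ hSc hc hi
    refine hS (by omega) (pb_sub E V r ρ) (not_Cp_of_KF h (pb_KF hE hK)) ?_ ?_ hSc hc hi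
    · refine le_trans ?_ hρ
      have : 0 ≤ n^r := by positivity
      exact mul_le_mul_of_nonneg_right (by linarith) this
    · refine (hZb ρ hρ).trans ?_
      exact mul_le_mul_of_nonneg_right (min_le_left _ _) hn0.le
  have main := sym_induct hE (fun ρ => (lam ℓ r - ε) * n^r ≤ (pb E V r ρ).card →
      ∃ c' : ℕ → ℕ, (∀ v ∈ V \ Zl (pb E V r ρ) V ((r * lam ℓ r - ε0) * n^(r-1)), c' v < ℓ) ∧
        ∀ e ∈ pb E V r ρ, e ⊆ V \ Zl (pb E V r ρ) V ((r * lam ℓ r - ε0) * n^(r-1)) → Set.InjOn c' ↑e) ?_ ?_ id (by simp)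
  · rw [pb_id hE] at main
    obtain ⟨c, hc1, hc2⟩ := main hcard
    obtain ⟨c', hc'1, hc'2⟩ := cross_of (by omega) hE (Finset.filter_subset _ _) hc1 hc2
    refine ⟨c', hc'1, ?_⟩
    have h1 := hZb id
    rw [pb_id hE] at h1
    have h2 := (h1 hcard).trans (mul_le_mul_of_nonneg_right (min_le_right _ _) hn0.le)
    have h3 := mul_le_mul_of_nonneg_right h2 (show 0 ≤ n^(r-1) by positivity)
    have h4 : ε'/2 * n * n^(r-1) = ε'/2 * n^r := by rw [← hpow]; ring
    have h5 : ε * n^r ≤ ε'/2 * n^r := mul_le_mul_of_nonneg_right he3 (by positivity)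
    have h6 := h3.trans_eq h4
    have h7 := hcard.trans hc'2
    have h8 : (lam ℓ r - ε') * n^r = (lam ℓ r - ε) * n^r - (ε'/2 * n^r) - (ε'/2*n^r) + ε * n^r := by ring
    rw [h8]
    simp only [Zl] at h6
    linarith
  · intro ρ hcov hR hρ
    have hx : ∀ i, 0 ≤ fb V ρ i / n := fun i => div_nonneg (fb_nonneg V ρ i) hn0.le
    have hfilt : E.filter (fun e => e ⊆ V.image ρ) ⊆ (V.image ρ).powersetCard r := by
      intro e he
      rw [Finset.mem_filter] at he
      exact Finset.mem_powersetCard.mpr ⟨he.2, (Finset.mem_powersetCard.mp (hE he.1)).2⟩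
    have key := hconc (E := E.filter (fun e => e ⊆ V.image ρ)) (V := V.image ρ) (x := fun i => fb V ρ i / n)
      hfilt (base_free h hK hcov) hx ?_ ?_
    · obtain ⟨L, hLR, hLc, hL⟩ := key
      obtain ⟨φ, hφ1, hφ2⟩ := exists_bij (s := L) (t := Finset.range ℓ) (by rw [hLc, Finset.card_range])
      refine hSS ρ (V.filter (fun v => ρ v ∈ L)) (fun v => φ (ρ v)) hρ ?_ ?_ ?_
      · have h1 : ((V.filter (fun v => ρ v ∈ L)).card : ℝ) = ∑ i ∈ L, fb V ρ i := by
          have := sum_fibres ρ (V.filter (fun v => ρ v ∈ L)) L (fun v hv => (Finset.mem_filter.mp hv).2)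
          rw [← this]
          apply Finset.sum_congr rfl
          intro i hi
          unfold fb
          congr 2
          ext v
          simp only [Finset.mem_filter]
          constructor
          · rintro ⟨⟨a, b⟩, c⟩; exact ⟨a, c⟩
          · rintro ⟨a, c⟩; exact ⟨⟨a, c ▸ hi⟩, c⟩
        have h2 : (1 - ε0) * n ≤ ∑ i ∈ L, fb V ρ i := by
          have h3 : ∑ i ∈ L, ((1 - ε0)/ℓ * n) ≤ ∑ i ∈ L, fb V ρ i := by
            apply Finset.sum_le_sum
            intro i hi
            have := hL i hi
            rw [← sub_div, le_div_iff₀ hn0] at this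
            exact this
          rw [Finset.sum_const, hLc, nsmul_eq_mul] at h3
          have h4 : (ℓ:ℝ) * ((1 - ε0)/ℓ * n) = (1 - ε0) * n := by field_simp
          linarith
        have h3 : ((V \ V.filter (fun v => ρ v ∈ L)).card : ℝ) = n - (V.filter (fun v => ρ v ∈ L)).card := by
          rw [Finset.card_sdiff_of_subset (Finset.filter_subset _ _), Nat.cast_sub (Finset.card_le_card (Finset.filter_subset _ _))]
        rw [h3, h1]
        nlinarith
      · intro v hv
        have := (Finset.mem_filter.mp hv).2
        have h2 : φ (ρ v) ∈ L.image φ := Finset.mem_image_of_mem _ this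
        rw [hφ2] at h2
        exact Finset.mem_range.mp h2
      · intro e he heS a ha b hb hab
        have hi := (Finset.mem_filter.mp he).2.1
        exact hi ha hb (hφ1 (Finset.mem_filter.mp (heS ha)).2 (Finset.mem_filter.mp (heS hb)).2 hab)
    · rw [← Finset.sum_div, fb_sum, div_self hn0.ne']
    · have h1 : PP (E.filter (fun e => e ⊆ V.image ρ)) (fun i => fb V ρ i / n) = (pb E V r ρ).card / n^r := by
        rw [pb_card hE, PP_restrict]
        have := PP_smul (E := E.filter (fun e => e ⊆ V.image ρ)) (r := r) hfilt (fb V ρ) (1/n)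
        have h2 : (fun i => fb V ρ i / n) = fun i => (1/n) * fb V ρ i := by funext i; ring
        rw [h2, this, one_div, inv_pow, inv_mul_eq_div]
      rw [h1, le_div_iff₀ (by positivity)]
      refine le_trans ?_ hρ
      exact mul_le_mul_of_nonneg_right (by linarith) (by positivity)
  · intro ρ x u hx hle hq hρ
    have hρ' : (lam ℓ r - ε) * n^r ≤ (pb E V r (Function.update ρ x u)).card :=
      hρ.trans (by exact_mod_cast hle)
    obtain ⟨c, hc1, hc2⟩ := hq hρ'
    set Z' := Zl (pb E V r (Function.update ρ x u)) V ((r * lam ℓ r - ε0) * n^(r-1)) with hZ'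
    refine hSS ρ ((V \ Z') \ {x}) c hρ ?_ ?_ ?_
    · have hsub : V \ ((V \ Z') \ {x}) ⊆ Z' ∪ {x} := by
        intro y hy
        simp only [Finset.mem_sdiff, Finset.mem_union, Finset.mem_singleton] at hy ⊢
        tauto
      have h3 := (Finset.card_le_card hsub).trans (Finset.card_union_le _ _)
      rw [Finset.card_singleton] at h3
      have h4 : ((V \ ((V \ Z') \ {x})).card : ℝ) ≤ Z'.card + 1 := by exact_mod_cast h3
      have h5 := (hZb _ hρ').trans (mul_le_mul_of_nonneg_right (min_le_left _ _) hn0.le)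
      have h6 : 0 < ε0 * n := by positivity
      linarith
    · intro v hv
      exact hc1 v (Finset.mem_sdiff.mp hv).1
    · intro e he heS
      refine hc2 e ?_ (heS.trans Finset.sdiff_subset)
      have hxe : ∀ y ∈ e, y ≠ x := by
        intro y hy hyx
        have := (Finset.mem_sdiff.mp (heS hy)).2
        exact this (Finset.mem_singleton.mpr hyx)
      rw [pb, Finset.mem_filter] at he ⊢
      have heq : ∀ y ∈ e, Function.update ρ x u y = ρ y := fun y hy => Function.update_of_ne (hxe y hy) _ _
      refine ⟨he.1, ?_, ?_⟩
      · intro a ha b hb hab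
        rw [heq a ha, heq b hb] at hab
        exact he.2.1 ha hb hab
      · rw [Finset.image_congr (g := ρ) (fun y hy => heq y hy)]
        exact he.2.2

/-! ### Cleaning -/

theorem clean {k r ℓ : ℕ} {T : HGraph 2} (h : Good k r ℓ T) {E : Finset (Finset ℕ)} {V : Finset ℕ}
    (hE : E ⊆ V.powersetCard r) (hC : ¬ Cp r T E) :
    ∃ E1 ⊆ E, ¬ KF (expTree r T) E1 ∧ (E.card : ℝ) ≤ E1.card + mm k r * (V.card:ℝ)^(r-1) := by
  classical
  have hr := h.hr
  refine ⟨E.filter (fun e => ∀ a ∈ e, ∀ b ∈ e, a ≠ b → Rob E (mm k r) a b), Finset.filter_subset _ _, ?_, ?_⟩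
  · rintro ⟨f, h1, h2, h3⟩
    refine hC (lemG (m := mm k r) (e0 := ∅) (by omega) (fun e he => (Finset.mem_powersetCard.mp (hE he)).2)
      h1 (fun e he => (Finset.mem_filter.mp (h2 e he)).1) (by simp) ?_ ?_)
    · have hcard := expTree_card (k := k) (r := r) (by omega) h.hT
      unfold mm
      have h4 : (expTree r T).verts.card ≤ k + r := by omega
      have h5 := Nat.mul_le_mul_right r (Nat.pow_le_pow_left h4 2)
      omega
    · intro a ha b hb hab
      left
      obtain ⟨e, he, h4, h5⟩ := h3 a ha b hb hab.ne
      exact (Finset.mem_filter.mp he).2 _ h4 _ h5 (fun hh => hab.ne (h1 ha hb hh))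
  · have h1 := Finset.card_filter_add_card_filter_not (s := E)
      (fun e : Finset ℕ => ∀ a ∈ e, ∀ b ∈ e, a ≠ b → Rob E (mm k r) a b)
    have hsub : E.filter (fun e : Finset ℕ => ¬ ∀ a ∈ e, ∀ b ∈ e, a ≠ b → Rob E (mm k r) a b) ⊆
        ((V ×ˢ V).filter (fun p => p.1 ≠ p.2 ∧ ¬ Rob E (mm k r) p.1 p.2)).biUnion
          (fun p => E.filter (fun e => p.1 ∈ e ∧ p.2 ∈ e)) := by
      intro e he
      rw [Finset.mem_filter] at he
      obtain ⟨heE, hne⟩ := he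
      push Not at hne
      obtain ⟨a, ha, b, hb, hab, hR⟩ := hne
      have hp := (Finset.mem_powersetCard.mp (hE heE)).1
      rw [Finset.mem_biUnion]
      exact ⟨(a, b), Finset.mem_filter.mpr ⟨Finset.mem_product.mpr ⟨hp ha, hp hb⟩, hab, hR⟩,
        Finset.mem_filter.mpr ⟨heE, ha, hb⟩⟩
    have h2 : (E.filter (fun e : Finset ℕ => ¬ ∀ a ∈ e, ∀ b ∈ e, a ≠ b → Rob E (mm k r) a b)).card ≤
        mm k r * V.card^(r-1) := by
      refine (Finset.card_le_card hsub).trans ?_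
      refine (Finset.card_biUnion_le_card_mul _ _ (mm k r * V.card^(r-3)) ?_).trans ?_
      · intro p hp
        rw [Finset.mem_filter] at hp
        exact not_Rob hr hE hp.2.1 hp.2.2
      · have h3 : ((V ×ˢ V).filter (fun p => p.1 ≠ p.2 ∧ ¬ Rob E (mm k r) p.1 p.2)).card ≤ V.card^2 := by
          refine (Finset.card_le_card (Finset.filter_subset _ _)).trans ?_
          rw [Finset.card_product, sq]
        refine (Nat.mul_le_mul_right _ h3).trans ?_
        have : V.card^2 * (mm k r * V.card^(r-3)) = mm k r * V.card^(2 + (r-3)) := by ring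
        rw [this, show 2 + (r-3) = r - 1 by omega]
    rw [← h1]
    push_cast
    have h3 : ((E.filter (fun e : Finset ℕ => ¬ ∀ a ∈ e, ∀ b ∈ e, a ≠ b → Rob E (mm k r) a b)).card : ℝ) ≤
        mm k r * (V.card : ℝ)^(r-1) := by exact_mod_cast h2
    linarith

theorem Cp_ub {k r ℓ : ℕ} {T : HGraph 2} (h : Good k r ℓ T) {E : Finset (Finset ℕ)} {V : Finset ℕ}
    (hE : E ⊆ V.powersetCard r) (hC : ¬ Cp r T E) :
    (E.card : ℝ) ≤ lam ℓ r * (V.card:ℝ)^r + mm k r * (V.card:ℝ)^(r-1) := by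
  obtain ⟨E1, h1, h2, h3⟩ := clean h hE hC
  have := lemP0 h (h1.trans hE) h2
  linarith

theorem big_n {C ε : ℝ} (hε : 0 < ε) {q n : ℕ} (hq : 1 ≤ q) (hn : ⌈C/ε⌉₊ ≤ n) :
    C * (n:ℝ)^(q-1) ≤ ε * (n:ℝ)^q := by
  have h1 : C/ε ≤ n := (Nat.le_ceil _).trans (by exact_mod_cast hn)
  rw [div_le_iff₀ hε] at h1
  have h2 : (n:ℝ)^q = n * (n:ℝ)^(q-1) := by rw [← pow_succ']; congr 1; omega
  rw [h2, ← mul_assoc]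
  exact mul_le_mul_of_nonneg_right (by linarith) (by positivity)

theorem stabCp {k r ℓ : ℕ} {T : HGraph 2} (h : Good k r ℓ T) {ε' : ℝ} (hε' : 0 < ε') :
    ∃ ε > (0:ℝ), ∃ N : ℕ, ∀ {E : Finset (Finset ℕ)} {V : Finset ℕ}, N ≤ V.card → E ⊆ V.powersetCard r →
      ¬ Cp r T E → (lam ℓ r - ε) * (V.card:ℝ)^r ≤ E.card →
      ∃ c : ℕ → ℕ, (∀ v ∈ V, c v < ℓ) ∧
        (lam ℓ r - ε') * (V.card:ℝ)^r ≤ ((E ∩ Crs c V r (Finset.range ℓ)).card : ℝ) := by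
  have hr := h.hr
  obtain ⟨ε, hε, N, hN⟩ := stabKF h hε'
  refine ⟨ε/2, by positivity, N + ⌈(mm k r : ℝ)/(ε/2)⌉₊, ?_⟩
  intro E V hn hE hC hcard
  obtain ⟨E1, h1, h2, h3⟩ := clean h hE hC
  have h4 := big_n (C := (mm k r : ℝ)) (ε := ε/2) (q := r) (n := V.card) (by positivity) (by omega) (by omega)
  obtain ⟨c, hc, hcc⟩ := hN (by omega) (h1.trans hE) h2 (by linarith)
  refine ⟨c, hc, hcc.trans ?_⟩
  exact_mod_cast Finset.card_le_card (Finset.inter_subset_inter_right h1)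

theorem lemV {k r ℓ : ℕ} {T : HGraph 2} (h : Good k r ℓ T) {η : ℝ} (hη : 0 < η) :
    ∃ ε > (0:ℝ), ∃ N : ℕ, ∀ {E : Finset (Finset ℕ)} {V : Finset ℕ}, N ≤ V.card → E ⊆ V.powersetCard r →
      ¬ Cp r T E → (lam ℓ r - ε) * (V.card:ℝ)^r ≤ E.card →
      ∀ v ∈ V, ((lk E v).card : ℝ) ≤ (r * lam ℓ r + η) * (V.card:ℝ)^(r-1) := by
  obtain ⟨ε1, hε1, N1, h1⟩ := lemE1 h hη
  obtain ⟨ε2, hε2, N2, h2⟩ := stabCp h hε1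
  refine ⟨ε2, hε2, N1 + N2, ?_⟩
  intro E V hn hE hC hcard
  obtain ⟨c, hc, hcc⟩ := h2 (by omega) hE hC hcard
  exact (h1 (by omega) hE hc hcc hC).1

theorem lemPart {k r ℓ : ℕ} {T : HGraph 2} (h : Good k r ℓ T) :
    ∃ ε1 > (0:ℝ), ∀ δ > (0:ℝ), ∃ ε > (0:ℝ), ∃ N : ℕ, ∀ {E : Finset (Finset ℕ)} {V : Finset ℕ},
      N ≤ V.card → E ⊆ V.powersetCard r →
      ¬ Cp r T E → (lam ℓ r - ε) * (V.card:ℝ)^r ≤ E.card →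
      ((Zl E V ((r * lam ℓ r - ε1) * (V.card:ℝ)^(r-1))).card : ℝ) ≤ δ * V.card ∧
      ∃ c' : ℕ → ℕ, (∀ v ∈ V \ Zl E V ((r * lam ℓ r - ε1) * (V.card:ℝ)^(r-1)), c' v < ℓ) ∧
        ∀ e ∈ E, e ⊆ V \ Zl E V ((r * lam ℓ r - ε1) * (V.card:ℝ)^(r-1)) → Set.InjOn c' ↑e := by
  have hr := h.hr
  obtain ⟨ε0, hε0, N0, h0⟩ := lemS' h
  refine ⟨ε0, hε0, ?_⟩
  intro δ hδ
  obtain ⟨ε2, hε2, N2, h2⟩ := Zlem h hε0 (δ := min δ ε0) (by positivity)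
  obtain ⟨ε3, hε3, N3, h3⟩ := stabCp h hε0
  refine ⟨min ε2 ε3, by positivity, N0 + N2 + N3 + ⌈(mm k r : ℝ)/ε2⌉₊, ?_⟩
  intro E V hn hE hC hcard
  set n : ℝ := (V.card : ℝ) with hnd
  have hn0 : 0 ≤ n := Nat.cast_nonneg _
  have hnr : 0 ≤ n^r := by positivity
  have hZ := h2 (E := E) (V := V) (by omega) hE ?_ ?_
  · refine ⟨hZ.trans (mul_le_mul_of_nonneg_right (min_le_left _ _) hn0), ?_⟩
    obtain ⟨c, hc, hcc⟩ := h3 (by omega) hE hC (le_trans (mul_le_mul_of_nonneg_right (by linarith [min_le_right ε2 ε3]) hnr) hcard)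
    refine h0 (by omega) hE hC (hZ.trans (mul_le_mul_of_nonneg_right (min_le_right _ _) hn0)) hc ?_
    refine le_trans (mul_le_mul_of_nonneg_right (by linarith) hnr) hcc
  · intro S hS
    have h4 := Cp_ub h (V := S) (E := E.filter (fun e => e ⊆ S)) ?_ ?_
    · have h5 := big_n (C := (mm k r : ℝ)) (ε := ε2) (q := r) (n := V.card) (by positivity) (by omega) (by omega)
      have h6 : (S.card : ℝ) ≤ n := by rw [hnd]; exact_mod_cast Finset.card_le_card hS
      have h7 : (mm k r : ℝ) * (S.card:ℝ)^(r-1) ≤ mm k r * n^(r-1) := by gcongr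
      linarith
    · intro e he
      rw [Finset.mem_filter] at he
      exact Finset.mem_powersetCard.mpr ⟨he.2, (Finset.mem_powersetCard.mp (hE he.1)).2⟩
    · intro hh
      exact hC (hh.mono (Finset.filter_subset _ _))
  · exact le_trans (mul_le_mul_of_nonneg_right (by linarith [min_le_left ε2 ε3]) hnr) hcard

/-! ### Balanced colourings and Turán numbers -/

theorem lk_pw {I : Finset ℕ} {u q : ℕ} (hu : u ∈ I) :
    lk (I.powersetCard (q+1)) u = (I.erase u).powersetCard q := by
  ext f
  rw [mem_lk, Finset.mem_powersetCard, Finset.mem_powersetCard]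
  constructor
  · rintro ⟨h1, h2, h3⟩
    rw [Finset.card_insert_of_notMem h1] at h3
    refine ⟨?_, by omega⟩
    intro y hy
    rw [Finset.mem_erase]
    exact ⟨fun hh => h1 (hh ▸ hy), h2 (Finset.mem_insert_of_mem hy)⟩
  · rintro ⟨h1, h2⟩
    have h3 : u ∉ f := fun hh => (Finset.mem_erase.mp (h1 hh)).1 rfl
    refine ⟨h3, ?_, by rw [Finset.card_insert_of_notMem h3, h2]⟩
    exact Finset.insert_subset hu (h1.trans (Finset.erase_subset _ _))

theorem dl_pw {I : Finset ℕ} {u q : ℕ} :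
    dl (I.powersetCard q) u = (I.erase u).powersetCard q := by
  ext f
  rw [mem_dl, Finset.mem_powersetCard, Finset.mem_powersetCard, Finset.subset_erase]
  tauto

theorem improve {r ℓ : ℕ} (hr : 2 ≤ r) {c : ℕ → ℕ} {V : Finset ℕ} (hc : ∀ v ∈ V, c v < ℓ) {i j : ℕ}
    (hi : i < ℓ) (hj : j < ℓ)
    (hij : (V.filter (fun v => c v = j)).card + 2 ≤ (V.filter (fun v => c v = i)).card)
    (hpos : 0 < (Crs c V r (Finset.range ℓ)).card) :
    ∃ c' : ℕ → ℕ, (∀ v ∈ V, c' v < ℓ) ∧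
      (Crs c V r (Finset.range ℓ)).card < (Crs c' V r (Finset.range ℓ)).card := by
  obtain ⟨q, rfl⟩ : ∃ q, r = q + 2 := ⟨r - 2, by omega⟩
  have hne : j ≠ i := by rintro rfl; omega
  obtain ⟨x, hx⟩ := Finset.card_pos.mp (show 0 < (V.filter (fun v => c v = i)).card by omega)
  rw [Finset.mem_filter] at hx
  refine ⟨Function.update c x j, ?_, ?_⟩
  · intro v hv
    by_cases h : v = x
    · subst h; rw [Function.update_self]; exact hj
    · rw [Function.update_of_ne h]; exact hc v hv
  · have h1 := Crs_card c V (q+2) (Finset.range ℓ)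
    have h2 := Crs_card (Function.update c x j) V (q+2) (Finset.range ℓ)
    change _ = PP _ (fb V (Function.update c x j)) at h2
    change _ = PP _ (fb V c) at h1
    rw [fb_update hx.1 hx.2 hne, PP_shift _ hne, ← h1] at h2
    have hI : j ∈ Finset.range ℓ := Finset.mem_range.mpr hj
    have hI' : i ∈ Finset.range ℓ := Finset.mem_range.mpr hi
    have hA := PP_split (lk ((Finset.range ℓ).powersetCard (q+2)) j) i (fb V c)
    have hB := PP_split (lk ((Finset.range ℓ).powersetCard (q+2)) i) j (fb V c)
    rw [lk_comm _ i j] at hB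
    have hd : dl (lk ((Finset.range ℓ).powersetCard (q+2)) j) i = dl (lk ((Finset.range ℓ).powersetCard (q+2)) i) j := by
      rw [lk_pw (q := q+1) hI, lk_pw (q := q+1) hI', dl_pw, dl_pw, Finset.erase_right_comm]
    have hC : 0 < PP (lk (lk ((Finset.range ℓ).powersetCard (q+2)) j) i) (fb V c) := by
      rw [lk_pw (q := q+1) hI, lk_pw (q := q) (Finset.mem_erase.mpr ⟨hne.symm, hI'⟩)]
      obtain ⟨e, he⟩ := Finset.card_pos.mp hpos
      rw [mem_Crs] at he
      have hcard : (e.image c).card = q + 2 := by rw [Finset.card_image_of_injOn he.2.2.1, he.2.1]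
      have h3 : q ≤ (((e.image c).erase j).erase i).card := by
        have h4 := Finset.pred_card_le_card_erase (s := e.image c) (a := j)
        have h5 := Finset.pred_card_le_card_erase (s := (e.image c).erase j) (a := i)
        omega
      obtain ⟨g, hg1, hg2⟩ := Finset.exists_subset_card_eq h3
      have hgc : ∀ y ∈ g, y ∈ e.image c := fun y hy => Finset.mem_of_mem_erase (Finset.mem_of_mem_erase (hg1 hy))
      unfold PP
      refine Finset.sum_pos' (fun f _ => Finset.prod_nonneg (fun y _ => fb_nonneg V c y)) ⟨g, ?_, ?_⟩
      · rw [Finset.mem_powersetCard]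
        refine ⟨?_, hg2⟩
        intro y hy
        have h6 := hg1 hy
        simp only [Finset.mem_erase] at h6 ⊢
        refine ⟨h6.1, h6.2.1, ?_⟩
        obtain ⟨z, hz, rfl⟩ := Finset.mem_image.mp h6.2.2
        exact he.2.2.2 z hz
      · apply Finset.prod_pos
        intro y hy
        obtain ⟨z, hz, hzy⟩ := Finset.mem_image.mp (hgc y hy)
        unfold fb
        exact_mod_cast Finset.card_pos.mpr ⟨z, Finset.mem_filter.mpr ⟨he.1 hz, hzy⟩⟩
    have hab : fb V c j + 2 ≤ fb V c i := by unfold fb; exact_mod_cast hij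
    rw [hd] at hA
    have hgain : ((Crs c V (q+2) (Finset.range ℓ)).card : ℝ) < (Crs (Function.update c x j) V (q+2) (Finset.range ℓ)).card := by
      rw [h2, hA, hB]
      nlinarith
    exact_mod_cast hgain

/-- Balanced colouring. -/
def Bal (c : ℕ → ℕ) (V : Finset ℕ) (ℓ : ℕ) : Prop :=
  ∀ i < ℓ, V.card / ℓ ≤ (V.filter (fun v => c v = i)).card ∧ (V.filter (fun v => c v = i)).card ≤ V.card / ℓ + 1

theorem sum_fib {c : ℕ → ℕ} {V : Finset ℕ} {ℓ : ℕ} (hc : ∀ v ∈ V, c v < ℓ) :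
    ∑ i ∈ Finset.range ℓ, (V.filter (fun v => c v = i)).card = V.card :=
  (Finset.card_eq_sum_card_fiberwise (f := c) (t := Finset.range ℓ)
    (fun v hv => Finset.mem_coe.mpr (Finset.mem_range.mpr (hc v hv)))).symm

theorem bal_of {c : ℕ → ℕ} {V : Finset ℕ} {ℓ : ℕ} (hc : ∀ v ∈ V, c v < ℓ)
    (h : ∀ i < ℓ, ∀ j < ℓ, (V.filter (fun v => c v = i)).card ≤ (V.filter (fun v => c v = j)).card + 1) :
    Bal c V ℓ := by
  have hs := sum_fib hc
  intro i hi
  have hd := Nat.div_add_mod V.card ℓ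
  have hm := Nat.mod_lt V.card (show 0 < ℓ by omega)
  set q := V.card / ℓ with hq
  constructor
  · by_contra hcon
    push Not at hcon
    have h1 : ∑ i ∈ Finset.range ℓ, (V.filter (fun v => c v = i)).card < ∑ _i ∈ Finset.range ℓ, q := by
      apply Finset.sum_lt_sum
      · intro j hj
        have := h j (Finset.mem_range.mp hj) i hi
        omega
      · exact ⟨i, Finset.mem_range.mpr hi, hcon⟩
    rw [Finset.sum_const, Finset.card_range, smul_eq_mul] at h1
    omega
  · by_contra hcon
    push Not at hcon
    have h1 : ∑ _i ∈ Finset.range ℓ, (q+1) < ∑ i ∈ Finset.range ℓ, (V.filter (fun v => c v = i)).card := by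
      apply Finset.sum_lt_sum
      · intro j hj
        have := h i hi j (Finset.mem_range.mp hj)
        omega
      · exact ⟨i, Finset.mem_range.mpr hi, hcon⟩
    rw [Finset.sum_const, Finset.card_range, smul_eq_mul] at h1
    have : ℓ * (q+1) = ℓ * q + ℓ := by ring
    omega

theorem bal_count {c : ℕ → ℕ} {V : Finset ℕ} {ℓ : ℕ} (hc : ∀ v ∈ V, c v < ℓ) (hB : Bal c V ℓ) :
    ((Finset.range ℓ).filter (fun i => (V.filter (fun v => c v = i)).card = V.card / ℓ + 1)).card = V.card % ℓ := by
  have hs := sum_fib hc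
  have hd := Nat.div_add_mod V.card ℓ
  set q := V.card / ℓ with hq
  have h1 : ∑ i ∈ Finset.range ℓ, (V.filter (fun v => c v = i)).card =
      ∑ i ∈ Finset.range ℓ, (q + if (V.filter (fun v => c v = i)).card = q + 1 then 1 else 0) := by
    apply Finset.sum_congr rfl
    intro i hi
    have := hB i (Finset.mem_range.mp hi)
    split_ifs with h <;> omega
  rw [Finset.sum_add_distrib, Finset.sum_const, Finset.card_range, smul_eq_mul, ← Finset.card_filter] at h1
  omega

/-- Glue bijections along a partition of the source into two pieces. -/
theorem perm_of {s A B : Finset ℕ} (hA : A ⊆ s) (hB : B ⊆ s) (h : A.card = B.card) :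
    ∃ σ : ℕ → ℕ, Set.InjOn σ ↑s ∧ (∀ i ∈ s, σ i ∈ s) ∧ ∀ i ∈ s, i ∈ A ↔ σ i ∈ B := by
  classical
  obtain ⟨f, hf1, hf2⟩ := exists_bij h
  obtain ⟨g, hg1, hg2⟩ := exists_bij (s := s \ A) (t := s \ B) (by
    rw [Finset.card_sdiff_of_subset hA, Finset.card_sdiff_of_subset hB, h])
  have hfB : ∀ i ∈ A, f i ∈ B := fun i hi => hf2 ▸ Finset.mem_image_of_mem f hi
  have hgB : ∀ i ∈ s, i ∉ A → g i ∈ s \ B := fun i hi hA => hg2 ▸ Finset.mem_image_of_mem g (Finset.mem_sdiff.mpr ⟨hi, hA⟩)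
  have hiff : ∀ i ∈ s, i ∈ A ↔ (if i ∈ A then f i else g i) ∈ B := by
    intro i hi
    by_cases h : i ∈ A
    · simp only [h, if_true]; exact ⟨fun _ => hfB i h, fun _ => trivial⟩
    · simp only [h, if_false]; exact ⟨fun hh => hh.elim, fun hh => (Finset.mem_sdiff.mp (hgB i hi h)).2 hh⟩
  refine ⟨fun i => if i ∈ A then f i else g i, ?_, ?_, hiff⟩
  · intro a ha b hb hab
    have h1 := hiff a ha
    have h2 := hiff b hb
    change (if a ∈ A then f a else g a) = (if b ∈ A then f b else g b) at hab
    by_cases hA1 : a ∈ A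
    · have hB1 : b ∈ A := h2.mpr (hab ▸ h1.mp hA1)
      simp only [hA1, hB1, if_true] at hab
      exact hf1 hA1 hB1 hab
    · have hB1 : b ∉ A := fun hh => hA1 (h1.mpr (hab ▸ h2.mp hh))
      simp only [hA1, hB1, if_false] at hab
      exact hg1 (Finset.mem_coe.mpr (Finset.mem_sdiff.mpr ⟨ha, hA1⟩)) (Finset.mem_coe.mpr (Finset.mem_sdiff.mpr ⟨hb, hB1⟩)) hab
  · intro i hi
    by_cases h : i ∈ A
    · simp only [h, if_true]; exact hB (hfB i h)
    · simp only [h, if_false]; exact (Finset.mem_sdiff.mp (hgB i hi h)).1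

/-- Balanced colourings are isomorphic. -/
theorem bal_iso {c c' : ℕ → ℕ} {V V' : Finset ℕ} {ℓ : ℕ} (hc : ∀ v ∈ V, c v < ℓ) (hc' : ∀ v ∈ V', c' v < ℓ)
    (hB : Bal c V ℓ) (hB' : Bal c' V' ℓ) (hV : V.card = V'.card) :
    ∃ φ : ℕ → ℕ, Set.InjOn φ ↑V ∧ V.image φ = V' ∧ ∀ u ∈ V, ∀ v ∈ V, c u = c v ↔ c' (φ u) = c' (φ v) := by
  classical
  obtain ⟨σ, hσ1, hσ2, hσ3⟩ := perm_of (s := Finset.range ℓ)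
    (Finset.filter_subset (fun i => (V.filter (fun v => c v = i)).card = V.card / ℓ + 1) _)
    (Finset.filter_subset (fun i => (V'.filter (fun v => c' v = i)).card = V'.card / ℓ + 1) _)
    (by rw [bal_count hc hB, bal_count hc' hB', hV])
  have hcard : ∀ i ∈ Finset.range ℓ, (V.filter (fun v => c v = i)).card = (V'.filter (fun v => c' v = σ i)).card := by
    intro i hi
    have h1 := hσ3 i hi
    rw [Finset.mem_filter, Finset.mem_filter] at h1
    have h2 := hB i (Finset.mem_range.mp hi)
    have h3 := hB' (σ i) (Finset.mem_range.mp (hσ2 i hi))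
    have h4 := hσ2 i hi
    rw [hV] at h1 h2
    by_cases h5 : (V.filter (fun v => c v = i)).card = V'.card / ℓ + 1
    · rw [h5, (h1.mp ⟨hi, h5⟩).2]
    · have h6 : (V'.filter (fun v => c' v = σ i)).card ≠ V'.card / ℓ + 1 := fun hh => h5 (h1.mpr ⟨h4, hh⟩).2
      omega
  have hbij : ∀ i, ∃ f : ℕ → ℕ, i ∈ Finset.range ℓ → (Set.InjOn f ↑(V.filter (fun v => c v = i)) ∧
      (V.filter (fun v => c v = i)).image f = V'.filter (fun v => c' v = σ i)) := by
    intro i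
    by_cases hi : i ∈ Finset.range ℓ
    · obtain ⟨f, h1, h2⟩ := exists_bij (hcard i hi)
      exact ⟨f, fun _ => ⟨h1, h2⟩⟩
    · exact ⟨id, fun hh => (hi hh).elim⟩
  choose f hf using hbij
  have hcr : ∀ v ∈ V, c v ∈ Finset.range ℓ := fun v hv => Finset.mem_range.mpr (hc v hv)
  have hmem : ∀ v ∈ V, f (c v) v ∈ V' ∧ c' (f (c v) v) = σ (c v) := by
    intro v hv
    have h1 := (hf (c v) (hcr v hv)).2
    have h2 : f (c v) v ∈ (V.filter (fun w => c w = c v)).image (f (c v)) :=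
      Finset.mem_image_of_mem _ (Finset.mem_filter.mpr ⟨hv, rfl⟩)
    rw [h1] at h2
    exact Finset.mem_filter.mp h2
  have hiff : ∀ u ∈ V, ∀ v ∈ V, c u = c v ↔ c' (f (c u) u) = c' (f (c v) v) := by
    intro u hu v hv
    rw [(hmem u hu).2, (hmem v hv).2]
    exact ⟨fun h => h ▸ rfl, fun h => hσ1 (hcr u hu) (hcr v hv) h⟩
  have hinj : Set.InjOn (fun v => f (c v) v) ↑V := by
    intro u hu v hv huv
    change f (c u) u = f (c v) v at huv
    have h1 : c u = c v := (hiff u hu v hv).mpr (by rw [huv])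
    rw [← h1] at huv
    exact (hf (c u) (hcr u hu)).1 (Finset.mem_coe.mpr (Finset.mem_filter.mpr ⟨hu, rfl⟩))
      (Finset.mem_coe.mpr (Finset.mem_filter.mpr ⟨hv, h1.symm⟩)) huv
  refine ⟨fun v => f (c v) v, hinj, ?_, hiff⟩
  apply Finset.eq_of_subset_of_card_le
  · intro y hy
    obtain ⟨v, hv, rfl⟩ := Finset.mem_image.mp hy
    exact (hmem v hv).1
  · rw [Finset.card_image_of_injOn hinj, hV]

theorem Crs_card_iso {c c' φ : ℕ → ℕ} {V V' : Finset ℕ} {ℓ r : ℕ} (hc : ∀ v ∈ V, c v < ℓ) (hc' : ∀ v ∈ V', c' v < ℓ)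
    (h1 : Set.InjOn φ ↑V) (h2 : V.image φ = V') (h3 : ∀ u ∈ V, ∀ v ∈ V, c u = c v ↔ c' (φ u) = c' (φ v)) :
    ∀ e, e ⊆ V → (e ∈ Crs c V r (Finset.range ℓ) ↔ e.image φ ∈ Crs c' V' r (Finset.range ℓ)) := by
  intro e he
  have hφ : Set.InjOn φ ↑e := h1.mono (by exact_mod_cast he)
  rw [mem_Crs, mem_Crs, Finset.card_image_of_injOn hφ]
  constructor
  · rintro ⟨-, g2, g3, -⟩
    refine ⟨?_, g2, ?_, ?_⟩
    · rw [← h2]; exact Finset.image_subset_image he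
    · intro a ha b hb hab
      rw [Finset.coe_image] at ha hb
      obtain ⟨x, hx, rfl⟩ := ha
      obtain ⟨y, hy, rfl⟩ := hb
      rw [g3 hx hy ((h3 x (he hx) y (he hy)).mpr hab)]
    · intro v hv
      obtain ⟨x, hx, rfl⟩ := Finset.mem_image.mp hv
      exact Finset.mem_range.mpr (hc' _ (h2 ▸ Finset.mem_image_of_mem φ (he hx)))
  · rintro ⟨-, g2, g3, -⟩
    refine ⟨he, g2, ?_, fun v hv => Finset.mem_range.mpr (hc v (he hv))⟩
    intro a ha b hb hab
    refine hφ ha hb (g3 ?_ ?_ ((h3 a (he ha) b (he hb)).mp hab))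
    · exact Finset.mem_coe.mpr (Finset.mem_image_of_mem φ ha)
    · exact Finset.mem_coe.mpr (Finset.mem_image_of_mem φ hb)

theorem Crs_card_bal {c c' : ℕ → ℕ} {V V' : Finset ℕ} {ℓ r : ℕ} (hc : ∀ v ∈ V, c v < ℓ) (hc' : ∀ v ∈ V', c' v < ℓ)
    (hB : Bal c V ℓ) (hB' : Bal c' V' ℓ) (hV : V.card = V'.card) :
    (Crs c V r (Finset.range ℓ)).card ≤ (Crs c' V' r (Finset.range ℓ)).card := by
  obtain ⟨φ, h1, h2, h3⟩ := bal_iso hc hc' hB hB' hV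
  have key := Crs_card_iso (r := r) hc hc' h1 h2 h3
  apply Finset.card_le_card_of_injOn (fun e => e.image φ)
  · intro e he
    exact Finset.mem_coe.mpr ((key e (mem_Crs.mp he).1).mp he)
  · intro e he e' he' hee
    have g1 := (mem_Crs.mp he).1
    have g2 := (mem_Crs.mp he').1
    have hee' : e.image φ = e'.image φ := hee
    ext y
    constructor
    · intro hy
      have : φ y ∈ e'.image φ := hee' ▸ Finset.mem_image_of_mem φ hy
      obtain ⟨z, hz, hzy⟩ := Finset.mem_image.mp this
      rwa [← h1 (g2 hz) (g1 hy) hzy]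
    · intro hy
      have : φ y ∈ e.image φ := hee' ▸ Finset.mem_image_of_mem φ hy
      obtain ⟨z, hz, hzy⟩ := Finset.mem_image.mp this
      rwa [← h1 (g1 hz) (g2 hy) hzy]

theorem bal_mod {ℓ : ℕ} (hℓ : 0 < ℓ) (t n : ℕ) : Bal (fun v => v % ℓ) (Finset.Ico t n) ℓ := by
  apply bal_of (fun v _ => Nat.mod_lt v hℓ)
  have key : ∀ i < ℓ, ((Finset.Ico t n).filter (fun v => v % ℓ = i)).card =
      (max (⌈((n:ℚ) - i) / (ℓ : ℚ)⌉ - ⌈((t:ℚ) - i) / (ℓ : ℚ)⌉) 0 : ℤ) := by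
    intro i hi
    rw [← Nat.Ico_filter_modEq_card t n hℓ i]
    congr 2
    ext v
    rw [Finset.mem_filter, Finset.mem_filter, Nat.ModEq, Nat.mod_eq_of_lt hi]
  have hℓq : (0:ℚ) < ℓ := by exact_mod_cast hℓ
  intro i hi j hj
  have h1 := key i hi
  have h2 := key j hj
  have e1 := Int.ceil_lt_add_one (((n:ℚ) - i) / (ℓ : ℚ))
  have e2 := Int.le_ceil (((t:ℚ) - i) / (ℓ : ℚ))
  have e3 := Int.le_ceil (((n:ℚ) - j) / (ℓ : ℚ))
  have e4 := Int.ceil_lt_add_one (((t:ℚ) - j) / (ℓ : ℚ))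
  have e5 : ((n:ℚ) - i) / (ℓ : ℚ) - ((t:ℚ) - i) / (ℓ : ℚ) = ((n:ℚ) - j) / (ℓ : ℚ) - ((t:ℚ) - j) / (ℓ : ℚ) := by
    field_simp; ring
  have e6 : ((⌈((n:ℚ) - i) / (ℓ : ℚ)⌉ - ⌈((t:ℚ) - i) / (ℓ : ℚ)⌉ : ℤ) : ℚ) <
      ((⌈((n:ℚ) - j) / (ℓ : ℚ)⌉ - ⌈((t:ℚ) - j) / (ℓ : ℚ)⌉ + 2 : ℤ) : ℚ) := by
    push_cast
    linarith
  have e7 : ⌈((n:ℚ) - i) / (ℓ : ℚ)⌉ - ⌈((t:ℚ) - i) / (ℓ : ℚ)⌉ <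
      ⌈((n:ℚ) - j) / (ℓ : ℚ)⌉ - ⌈((t:ℚ) - j) / (ℓ : ℚ)⌉ + 2 := by exact_mod_cast e6
  omega

/-- Turán number. -/
def tn (r ℓ n : ℕ) : ℕ := (Crs (fun v => v % ℓ) (Finset.range n) r (Finset.range ℓ)).card

theorem tn_bal {c : ℕ → ℕ} {V : Finset ℕ} {ℓ r : ℕ} (hℓ : 0 < ℓ) (hc : ∀ v ∈ V, c v < ℓ) (hB : Bal c V ℓ) :
    (Crs c V r (Finset.range ℓ)).card = tn r ℓ V.card := by
  have h1 := bal_mod hℓ 0 V.card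
  rw [← Finset.range_eq_Ico] at h1
  apply le_antisymm
  · exact Crs_card_bal hc (fun v _ => Nat.mod_lt v hℓ) hB h1 (by simp)
  · exact Crs_card_bal (fun v _ => Nat.mod_lt v hℓ) hc h1 hB (by simp)

theorem tn_max {c : ℕ → ℕ} {V : Finset ℕ} {ℓ r : ℕ} (hr : 2 ≤ r) (hℓ : 0 < ℓ) (hc : ∀ v ∈ V, c v < ℓ)
    (hpos : 0 < (Crs c V r (Finset.range ℓ)).card) (hge : tn r ℓ V.card ≤ (Crs c V r (Finset.range ℓ)).card) :
    (Crs c V r (Finset.range ℓ)).card = tn r ℓ V.card ∧ Bal c V ℓ := by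
  set S : Set ℕ := {m | ∃ c' : ℕ → ℕ, (∀ v ∈ V, c' v < ℓ) ∧ (Crs c' V r (Finset.range ℓ)).card = m} with hS
  have hbdd : BddAbove S := by
    refine ⟨(V.powersetCard r).card, ?_⟩
    rintro m ⟨c', _, rfl⟩
    exact Finset.card_le_card (Finset.filter_subset _ _)
  have hcS : (Crs c V r (Finset.range ℓ)).card ∈ S := ⟨c, hc, rfl⟩
  have hle := le_csSup hbdd hcS
  have hmaxbal : ∀ c' : ℕ → ℕ, (∀ v ∈ V, c' v < ℓ) → (Crs c' V r (Finset.range ℓ)).card = sSup S → Bal c' V ℓ := by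
    intro c' hc' hcard
    apply bal_of hc'
    intro i hi j hj
    by_contra hcon
    push Not at hcon
    obtain ⟨c2, h1, h2⟩ := improve hr hc' hi hj (by omega) (by omega)
    have := le_csSup hbdd (show (Crs c2 V r (Finset.range ℓ)).card ∈ S from ⟨c2, h1, rfl⟩)
    omega
  obtain ⟨c1, hc1, hc1m⟩ := Nat.sSup_mem ⟨_, hcS⟩ hbdd
  have h1 := tn_bal (r := r) hℓ hc1 (hmaxbal c1 hc1 hc1m)
  have h2 : (Crs c V r (Finset.range ℓ)).card = sSup S := by omega
  exact ⟨by omega, hmaxbal c hc h2⟩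

theorem crs_le_tn {c : ℕ → ℕ} {V : Finset ℕ} {ℓ r : ℕ} (hr : 2 ≤ r) (hℓ : 0 < ℓ) (hc : ∀ v ∈ V, c v < ℓ) :
    (Crs c V r (Finset.range ℓ)).card ≤ tn r ℓ V.card := by
  by_contra hcon
  push Not at hcon
  have := (tn_max hr hℓ hc (by omega) hcon.le).1
  omega

/-! ### Growth of the Turán numbers -/

theorem pow_sub_low {x a : ℝ} (ha : 0 ≤ a) (hx : a ≤ x) (q : ℕ) :
    x^q - q * a * x^(q-1) ≤ (x - a)^q := by
  induction q with
  | zero => simp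
  | succ q ih =>
    have h0 : 0 ≤ x - a := by linarith
    have h1 := mul_le_mul_of_nonneg_left ih h0
    rw [pow_succ' (x - a)]
    refine le_trans ?_ h1
    rcases Nat.eq_zero_or_pos q with rfl | hq
    · simp
    · obtain ⟨p, rfl⟩ : ∃ p, q = p + 1 := ⟨q - 1, by omega⟩
      simp only [Nat.add_sub_cancel]
      push_cast
      have h2 : 0 ≤ ((p:ℝ)+1) * a^2 * x^p := by
        have : 0 ≤ x := by linarith
        positivity
      have e : (x - a) * (x^(p+1) - ((p:ℝ)+1) * a * x^p)
        = (x^(p+1+1) - ((p:ℝ)+1+1) * a * x^(p+1)) + ((p:ℝ)+1) * a^2 * x^p := by ring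
      rw [e]; linarith

theorem Crs_insert {c : ℕ → ℕ} {V I : Finset ℕ} {v q : ℕ} (hv : v ∉ V) (hI : c v ∈ I) :
    (Crs c (insert v V) (q+1) I).card = (Crs c V (q+1) I).card + (Crs c V q (I \ {c v})).card := by
  have h1 : Crs c (insert v V) (q+1) I = Crs c V (q+1) I ∪ (Crs c V q (I \ {c v})).image (insert v) := by
    ext e
    simp only [Finset.mem_union, Finset.mem_image, mem_Crs]
    constructor
    · rintro ⟨a1, a2, a3, a4⟩
      by_cases hve : v ∈ e
      · right
        refine ⟨e.erase v, ⟨?_, ?_, ?_, ?_⟩, Finset.insert_erase hve⟩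
        · intro y hy
          rw [Finset.mem_erase] at hy
          exact (Finset.mem_insert.mp (a1 hy.2)).resolve_left hy.1
        · rw [Finset.card_erase_of_mem hve, a2]; rfl
        · exact a3.mono (by exact_mod_cast Finset.erase_subset _ _)
        · intro y hy
          rw [Finset.mem_erase] at hy
          rw [Finset.mem_sdiff, Finset.mem_singleton]
          exact ⟨a4 y hy.2, fun hh => hy.1 (a3 (Finset.mem_coe.mpr hy.2) (Finset.mem_coe.mpr hve) hh)⟩
      · left
        refine ⟨?_, a2, a3, a4⟩
        intro y hy
        exact (Finset.mem_insert.mp (a1 hy)).resolve_left (fun hh => hve (hh ▸ hy))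
    · rintro (⟨a1, a2, a3, a4⟩ | ⟨f, ⟨a1, a2, a3, a4⟩, rfl⟩)
      · exact ⟨a1.trans (Finset.subset_insert _ _), a2, a3, a4⟩
      · have hvf : v ∉ f := fun hh => hv (a1 hh)
        refine ⟨Finset.insert_subset_insert _ a1, by rw [Finset.card_insert_of_notMem hvf, a2], ?_, ?_⟩
        · rw [Finset.coe_insert, Set.injOn_insert (by exact_mod_cast hvf)]
          refine ⟨a3, ?_⟩
          rintro ⟨y, hy, hyc⟩
          have := a4 y hy
          rw [Finset.mem_sdiff, Finset.mem_singleton] at this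
          exact this.2 hyc
        · intro y hy
          rcases Finset.mem_insert.mp hy with rfl | hy
          · exact hI
          · exact (Finset.mem_sdiff.mp (a4 y hy)).1
  rw [h1, Finset.card_union_of_disjoint, Finset.card_image_of_injOn]
  · intro f hf g hg hfg
    have hf' := mem_Crs.mp (Finset.mem_coe.mp hf)
    have hg' := mem_Crs.mp (Finset.mem_coe.mp hg)
    have e1 : (insert v f).erase v = f := Finset.erase_insert (fun hh => hv (hf'.1 hh))
    have e2 : (insert v g).erase v = g := Finset.erase_insert (fun hh => hv (hg'.1 hh))
    rw [← e1, hfg, e2]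
  · rw [Finset.disjoint_left]
    intro e he he'
    obtain ⟨f, -, rfl⟩ := Finset.mem_image.mp he'
    exact hv ((mem_Crs.mp he).1 (Finset.mem_insert_self _ _))

theorem Crs_lb {c : ℕ → ℕ} {V I : Finset ℕ} {q : ℕ} {a : ℝ} (ha : 0 ≤ a)
    (hf : ∀ i ∈ I, a ≤ ((V.filter (fun v => c v = i)).card : ℝ)) :
    (I.card.choose q : ℝ) * a^q ≤ ((Crs c V q I).card : ℝ) := by
  rw [Crs_card, PP]
  have : ∀ e ∈ I.powersetCard q, a^q ≤ ∏ i ∈ e, ((V.filter (fun v => c v = i)).card : ℝ) := by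
    intro e he
    rw [Finset.mem_powersetCard] at he
    rw [← he.2, ← Finset.prod_const]
    exact Finset.prod_le_prod (fun _ _ => ha) (fun i hi => hf i (he.1 hi))
  have h2 := Finset.card_nsmul_le_sum _ _ _ this
  rw [Finset.card_powersetCard, nsmul_eq_mul] at h2
  exact h2

theorem fib_mod_lb {ℓ n : ℕ} (hℓ : 0 < ℓ) {i : ℕ} (hi : i < ℓ) :
    ((n:ℝ) - ℓ) / ℓ ≤ (((Finset.range n).filter (fun v => v % ℓ = i)).card : ℝ) := by
  have h1 := (bal_mod hℓ 0 n i hi).1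
  rw [← Finset.range_eq_Ico, Finset.card_range] at h1
  have h2 : n < ℓ * (n / ℓ + 1) := by
    have := Nat.div_add_mod n ℓ
    have h3 := Nat.mod_lt n hℓ
    rw [Nat.mul_add]; omega
  have h2' : (n:ℝ) ≤ ℓ * (((n/ℓ : ℕ):ℝ) + 1) := by exact_mod_cast h2.le
  have h1' : ((n/ℓ : ℕ):ℝ) ≤ (((Finset.range n).filter (fun v => v % ℓ = i)).card : ℝ) := by exact_mod_cast h1
  refine le_trans ?_ h1'
  rw [div_le_iff₀ (by exact_mod_cast hℓ)]
  nlinarith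

theorem Good.hl0 {k r ℓ : ℕ} {T : HGraph 2} (h : Good k r ℓ T) : 0 < ℓ := by
  have := h.hrl; omega

theorem D_choose {k r ℓ : ℕ} {T : HGraph 2} (h : Good k r ℓ T) :
    (r:ℝ) * lam ℓ r * (ℓ:ℝ)^(r-1) = ((ℓ-1).choose (r-1) : ℝ) := by
  have h0 := h.hrl
  have h3 := h.hr
  rw [lam_D h, ← lam_choose (ℓ := ℓ-1) (r := r-1) (by omega) (by omega), mul_assoc, ← mul_pow]
  have hl : (ℓ:ℝ) ≠ 0 := by have := h.hl0; positivity
  congr 2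
  rw [Nat.cast_sub (by omega)]
  field_simp
  push_cast; ring

theorem tn_low {k r ℓ : ℕ} {T : HGraph 2} (h : Good k r ℓ T) {η : ℝ} (hη : 0 < η) :
    ∃ N : ℕ, ∀ n, N ≤ n → (lam ℓ r - η) * (n:ℝ)^r ≤ tn r ℓ n := by
  have h0 := h.hrl
  have h3 := h.hr
  have hl := h.hl0
  have hl' : (0:ℝ) < ℓ := by exact_mod_cast hl
  refine ⟨⌈lam ℓ r * (r * ℓ) / η⌉₊ + ℓ, fun n hn => ?_⟩
  have hb := big_n (C := lam ℓ r * (r * ℓ)) hη (q := r) (n := n) (by omega) (by omega)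
  have hnl : (ℓ:ℝ) ≤ n := by exact_mod_cast (by omega : ℓ ≤ n)
  have h1 := Crs_lb (c := fun v => v % ℓ) (V := Finset.range n) (I := Finset.range ℓ) (q := r)
    (a := ((n:ℝ) - ℓ) / ℓ) (div_nonneg (by linarith) hl'.le)
    (fun i hi => fib_mod_lb hl (Finset.mem_range.mp hi))
  rw [Finset.card_range, ← lam_choose (by omega) (by omega), mul_assoc, ← mul_pow,
    mul_div_cancel₀ _ hl'.ne'] at h1
  have h2 := pow_sub_low hl'.le hnl r
  have h4 := mul_le_mul_of_nonneg_left h2 (lam_pos (ℓ := ℓ) (r := r) (by omega) (by omega)).le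
  unfold tn
  nlinarith

theorem tn_succ {r ℓ : ℕ} (hr : 1 ≤ r) (hl : 0 < ℓ) (n : ℕ) :
    tn r ℓ (n+1) = tn r ℓ n +
      (Crs (fun v => v % ℓ) (Finset.range n) (r-1) (Finset.range ℓ \ {n % ℓ})).card := by
  obtain ⟨q, rfl⟩ : ∃ q, r = q + 1 := ⟨r - 1, by omega⟩
  unfold tn
  rw [Finset.range_add_one, Crs_insert (c := fun v => v % ℓ) (v := n) Finset.notMem_range_self (Finset.mem_range.mpr (Nat.mod_lt _ hl))]
  rfl

theorem inc_low {k r ℓ : ℕ} {T : HGraph 2} (h : Good k r ℓ T) {η : ℝ} (hη : 0 < η) :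
    ∃ N : ℕ, ∀ n, N ≤ n → (tn r ℓ n : ℝ) + (r * lam ℓ r - η) * (n:ℝ)^(r-1) ≤ tn r ℓ (n+1) := by
  have h0 := h.hrl
  have h3 := h.hr
  have hl := h.hl0
  have hl' : (0:ℝ) < ℓ := by exact_mod_cast hl
  refine ⟨⌈r * lam ℓ r * ((r-1:ℕ) * ℓ) / η⌉₊ + ℓ, fun n hn => ?_⟩
  have hb := big_n (C := r * lam ℓ r * ((r-1:ℕ) * ℓ)) hη (q := r-1) (n := n) (by omega) (by omega)
  have hnl : (ℓ:ℝ) ≤ n := by exact_mod_cast (by omega : ℓ ≤ n)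
  have hm : n % ℓ ∈ Finset.range ℓ := Finset.mem_range.mpr (Nat.mod_lt _ hl)
  have h1 := Crs_lb (c := fun v => v % ℓ) (V := Finset.range n) (I := Finset.range ℓ \ {n % ℓ}) (q := r-1)
    (a := ((n:ℝ) - ℓ) / ℓ) (div_nonneg (by linarith) hl'.le)
    (fun i hi => fib_mod_lb hl (Finset.mem_range.mp (Finset.mem_sdiff.mp hi).1))
  have hcard : (Finset.range ℓ \ {n % ℓ}).card = ℓ - 1 := by
    rw [Finset.card_sdiff_of_subset (Finset.singleton_subset_iff.mpr hm), Finset.card_range, Finset.card_singleton]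
  rw [hcard, ← D_choose h, mul_assoc _ ((ℓ:ℝ)^(r-1)), ← mul_pow, mul_div_cancel₀ _ hl'.ne'] at h1
  have h2 := pow_sub_low hl'.le hnl (r-1)
  have hp : 0 ≤ (r:ℝ) * lam ℓ r := mul_nonneg (by positivity) (lam_pos (ℓ := ℓ) (r := r) (by omega) (by omega)).le
  have h4 := mul_le_mul_of_nonneg_left h2 hp
  rw [tn_succ (by omega) hl]
  push_cast
  nlinarith

theorem inc_up {k r ℓ : ℕ} {T : HGraph 2} (h : Good k r ℓ T) {η : ℝ} (hη : 0 < η) :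
    ∃ N : ℕ, ∀ n, N ≤ n → (tn r ℓ (n+1) : ℝ) ≤ tn r ℓ n + (r * lam ℓ r + η) * (n:ℝ)^(r-1) := by
  have h0 := h.hrl
  have h3 := h.hr
  have hl := h.hl0
  have hl' : (0:ℝ) < ℓ := by exact_mod_cast hl
  obtain ⟨δ, hδ, hD⟩ := cont_D h hη
  refine ⟨⌈1 / δ⌉₊ + ℓ, fun n hn => ?_⟩
  have hm : n % ℓ < ℓ := Nat.mod_lt _ hl
  have h1 := Crs_le' h (c := fun v => v % ℓ) (V := Finset.range n) (fun v _ => Nat.mod_lt _ hl) hm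
  have h2 := fib_mod_lb (n := n) hl hm
  have hn' : 1 ≤ δ * n := by
    have : 1 / δ ≤ (n:ℝ) := (Nat.le_ceil _).trans (by exact_mod_cast (by omega : ⌈1 / δ⌉₊ ≤ n))
    rw [div_le_iff₀ hδ] at this
    linarith
  have h5 : ((n:ℝ) - ℓ) / ℓ = n / ℓ - 1 := by field_simp
  have hfle : (((Finset.range n).filter (fun v => v % ℓ = n % ℓ)).card : ℝ) ≤ n := by
    have := Finset.card_filter_le (Finset.range n) (fun v => v % ℓ = n % ℓ)
    rw [Finset.card_range] at this
    exact_mod_cast this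
  rw [Finset.card_range] at h1
  have h6 : ((n:ℝ) - (((Finset.range n).filter (fun v => v % ℓ = n % ℓ)).card : ℝ))^(r-1) ≤
      ((1 - 1 / (ℓ:ℝ) + δ) * n)^(r-1) := by
    apply pow_le_pow_left₀ (by linarith)
    have : (1 - 1 / (ℓ:ℝ) + δ) * n = n - n / ℓ + δ * n := by ring
    rw [this]; linarith
  have h7 := mul_le_mul_of_nonneg_left h6 (lam_pos (ℓ := ℓ-1) (r := r-1) (by omega) (by omega)).le
  rw [mul_pow, ← mul_assoc] at h7
  have h8 := mul_le_mul_of_nonneg_right hD (show (0:ℝ) ≤ (n:ℝ)^(r-1) by positivity)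
  rw [tn_succ (by omega) hl]
  push_cast
  linarith

theorem tn_gap_low {k r ℓ : ℕ} {T : HGraph 2} (h : Good k r ℓ T) {η : ℝ} (hη : 0 < η) (hη' : η ≤ r * lam ℓ r) :
    ∃ N : ℕ, ∀ n, N ≤ n → ∀ j : ℕ, (tn r ℓ n : ℝ) + j * ((r * lam ℓ r - η) * (n:ℝ)^(r-1)) ≤ tn r ℓ (n+j) := by
  obtain ⟨N, hN⟩ := inc_low h hη
  refine ⟨N, fun n hn j => ?_⟩
  induction j with
  | zero => simp
  | succ j ih =>
    have h1 := hN (n+j) (by omega)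
    have h2 : (n:ℝ)^(r-1) ≤ ((n+j:ℕ):ℝ)^(r-1) := pow_le_pow_left₀ (by positivity) (by push_cast; linarith [Nat.cast_nonneg (α := ℝ) j]) _
    have h3 := mul_le_mul_of_nonneg_left h2 (show 0 ≤ r * lam ℓ r - η by linarith)
    rw [← Nat.add_assoc]
    push_cast
    push_cast at h1 h3
    linarith

theorem tn_gap_up {k r ℓ : ℕ} {T : HGraph 2} (h : Good k r ℓ T) {η : ℝ} (hη : 0 < η) :
    ∃ N : ℕ, ∀ n, N ≤ n → ∀ j m : ℕ, n + j ≤ m →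
      (tn r ℓ (n+j) : ℝ) ≤ tn r ℓ n + j * ((r * lam ℓ r + η) * (m:ℝ)^(r-1)) := by
  obtain ⟨N, hN⟩ := inc_up h hη
  have h0 := h.hrl
  have hp : 0 ≤ (r:ℝ) * lam ℓ r := mul_nonneg (by positivity) (lam_pos (ℓ := ℓ) (r := r) (by omega) (by omega)).le
  refine ⟨N, fun n hn j => ?_⟩
  induction j with
  | zero => intro m _; simp
  | succ j ih =>
    intro m hm
    have ih := ih m (by omega)
    have h1 := hN (n+j) (by omega)
    have h2 : ((n+j:ℕ):ℝ)^(r-1) ≤ (m:ℝ)^(r-1) := pow_le_pow_left₀ (by positivity) (by exact_mod_cast (by omega : n + j ≤ m)) _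
    have h3 := mul_le_mul_of_nonneg_left h2 (show 0 ≤ r * lam ℓ r + η by linarith)
    rw [← Nat.add_assoc]
    push_cast
    push_cast at h1 h3
    linarith

/-! ### The exact Turán theorem for one copy -/

theorem deg_sum {E : Finset (Finset ℕ)} {V : Finset ℕ} {r : ℕ} (hE : E ⊆ V.powersetCard r) (Z : Finset ℕ) :
    E.card ≤ (E.filter (fun e => e ⊆ V \ Z)).card + ∑ z ∈ Z, (lk E z).card := by
  have h1 : E ⊆ E.filter (fun e => e ⊆ V \ Z) ∪ Z.biUnion (fun z => E.filter (z ∈ ·)) := by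
    intro e he
    rw [Finset.mem_union, Finset.mem_filter, Finset.mem_biUnion]
    by_cases hh : ∃ z ∈ Z, z ∈ e
    · obtain ⟨z, hz, hze⟩ := hh
      exact Or.inr ⟨z, hz, Finset.mem_filter.mpr ⟨he, hze⟩⟩
    · left
      refine ⟨he, fun y hy => Finset.mem_sdiff.mpr ⟨(Finset.mem_powersetCard.mp (hE he)).1 hy, fun hz => hh ⟨y, hz, hy⟩⟩⟩
  refine (Finset.card_le_card h1).trans ((Finset.card_union_le _ _).trans ?_)
  refine Nat.add_le_add_left (Finset.card_biUnion_le.trans (le_of_eq ?_)) _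
  exact Finset.sum_congr rfl (fun z _ => (card_lk E z).symm)

theorem turan {k r ℓ : ℕ} {T : HGraph 2} (h : Good k r ℓ T) :
    ∃ N : ℕ, ∀ {E : Finset (Finset ℕ)} {V : Finset ℕ}, N ≤ V.card → E ⊆ V.powersetCard r →
      ¬ Cp r T E → tn r ℓ V.card ≤ E.card →
      ∃ c : ℕ → ℕ, (∀ v ∈ V, c v < ℓ) ∧ Bal c V ℓ ∧ E = Crs c V r (Finset.range ℓ) := by
  have h0 := h.hrl
  have h3 := h.hr
  have hl := h.hl0
  have hlp : 0 < lam ℓ r := lam_pos (by omega) (by omega)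
  have hr0 : (0:ℝ) < r := by exact_mod_cast (by omega : 0 < r)
  have hp : 0 < (r:ℝ) * lam ℓ r := mul_pos hr0 hlp
  obtain ⟨ε1, hε1, hP⟩ := lemPart h
  have hden : 0 < 2 * ((r * lam ℓ r) * r + ε1) := by positivity
  obtain ⟨ε, hε, N1, hP⟩ := hP (ε1 / (2 * ((r * lam ℓ r) * r + ε1))) (by positivity)
  set δ : ℝ := ε1 / (2 * ((r * lam ℓ r) * r + ε1)) with hδ
  have hδ0 : 0 < δ := by rw [hδ]; positivity
  have hδe : δ * (2 * ((r * lam ℓ r) * r + ε1)) = ε1 := div_mul_cancel₀ _ hden.ne'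
  have hδ1 : δ ≤ 1/2 := by
    rw [hδ, div_le_iff₀ hden]
    have : 0 ≤ (r * lam ℓ r) * r := by positivity
    linarith
  have hδ2 : (r * lam ℓ r) * (r * δ) ≤ ε1 / 2 := by nlinarith
  clear_value δ
  have hη : 0 < min (ε1/2) (r * lam ℓ r) := lt_min (by linarith) hp
  obtain ⟨N2, hG⟩ := tn_gap_low h hη (min_le_right _ _)
  have hηl : min (ε1/2) (r * lam ℓ r) ≤ ε1 / 2 := min_le_left _ _
  have hηr : min (ε1/2) (r * lam ℓ r) ≤ r * lam ℓ r := min_le_right _ _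
  set η := min (ε1/2) (r * lam ℓ r)
  clear_value η
  obtain ⟨N3, hT⟩ := tn_low h hε
  obtain ⟨N4, hT'⟩ := tn_low h (show 0 < lam ℓ r / 2 by linarith)
  refine ⟨N1 + 2 * N2 + N3 + N4 + 1, fun {E V} hN hE hC hcard => ?_⟩
  have hn1 : (1:ℝ) ≤ V.card := by exact_mod_cast (by omega : 1 ≤ V.card)
  have hcR : (tn r ℓ V.card : ℝ) ≤ E.card := by exact_mod_cast hcard
  obtain ⟨hZ, c, hc1, hc2⟩ := hP (by omega) hE hC ((hT _ (by omega)).trans hcR)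
  set Z := Zl E V ((r * lam ℓ r - ε1) * (V.card:ℝ)^(r-1)) with hZdef
  have hZV : Z ⊆ V := Finset.filter_subset _ _
  have hfilt : E.filter (fun e => e ⊆ V \ Z) ⊆ Crs c (V \ Z) r (Finset.range ℓ) := by
    intro e he
    rw [Finset.mem_filter] at he
    rw [mem_Crs]
    exact ⟨he.2, (Finset.mem_powersetCard.mp (hE he.1)).2, hc2 e he.1 he.2,
      fun v hv => Finset.mem_range.mpr (hc1 v (he.2 hv))⟩
  have hle := (Finset.card_le_card hfilt).trans (crs_le_tn (by omega) hl hc1)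
  rw [Finset.card_sdiff_of_subset hZV] at hle
  have hZ0 : Z = ∅ := by
    by_contra hne
    have hpos : 0 < Z.card := Finset.card_pos.mpr (Finset.nonempty_iff_ne_empty.mpr hne)
    have hd := deg_sum hE Z
    have hd' : (E.card:ℝ) ≤ ((E.filter (fun e => e ⊆ V \ Z)).card : ℝ) + ∑ z ∈ Z, ((lk E z).card : ℝ) := by
      exact_mod_cast hd
    have hs : ∑ z ∈ Z, ((lk E z).card : ℝ) < ∑ z ∈ Z, ((r * lam ℓ r - ε1) * (V.card:ℝ)^(r-1)) := by
      apply Finset.sum_lt_sum_of_nonempty (Finset.nonempty_iff_ne_empty.mpr hne)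
      intro z hz
      exact (Finset.mem_filter.mp hz).2
    rw [Finset.sum_const, nsmul_eq_mul] at hs
    have hjn : Z.card ≤ V.card := Finset.card_le_card hZV
    have hj2 : 2 * Z.card ≤ V.card := by
      have : (2:ℝ) * Z.card ≤ V.card := by nlinarith
      exact_mod_cast this
    have hg := hG (V.card - Z.card) (by omega) Z.card
    rw [Nat.sub_add_cancel hjn] at hg
    have hle' : ((E.filter (fun e => e ⊆ V \ Z)).card : ℝ) ≤ tn r ℓ (V.card - Z.card) := by exact_mod_cast hle
    have hkey : (r * lam ℓ r - ε1) * (V.card:ℝ)^(r-1) ≤ (r * lam ℓ r - η) * ((V.card - Z.card : ℕ):ℝ)^(r-1) := by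
      rw [Nat.cast_sub hjn]
      have hzn : (Z.card:ℝ) ≤ V.card := by exact_mod_cast hjn
      have h5 := pow_sub_low (Nat.cast_nonneg (α := ℝ) Z.card) hzn (r-1)
      have h6 : (Z.card:ℝ) * (V.card:ℝ)^(r-1-1) ≤ δ * (V.card:ℝ)^(r-1) := by
        have e : (V.card:ℝ)^(r-1) = V.card * (V.card:ℝ)^(r-1-1) := by
          rw [← pow_succ']; congr 1; omega
        rw [e, ← mul_assoc]
        exact mul_le_mul_of_nonneg_right hZ (by positivity)
      have h7 : ((r-1:ℕ):ℝ) ≤ r := by exact_mod_cast Nat.sub_le r 1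
      have hX : 0 ≤ (V.card:ℝ)^(r-1) := by positivity
      set X := (V.card:ℝ)^(r-1)
      have h8 : ((r-1:ℕ):ℝ) * ((Z.card:ℝ) * (V.card:ℝ)^(r-1-1)) ≤ r * (δ * X) :=
        mul_le_mul h7 h6 (by positivity) (by positivity)
      have h9 : X - r * (δ * X) ≤ ((V.card:ℝ) - Z.card)^(r-1) := by
        rw [mul_assoc] at h5; linarith
      have h10 := mul_le_mul_of_nonneg_left h9 (show 0 ≤ r * lam ℓ r - η by linarith)
      refine le_trans ?_ h10
      have h11 : 0 ≤ η * (r * (δ * X)) := mul_nonneg hη.le (by positivity)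
      have h12 := mul_le_mul_of_nonneg_right hδ2 hX
      have h13 := mul_le_mul_of_nonneg_right hηl hX
      linarith
    have hjp : (0:ℝ) ≤ Z.card := by positivity
    have := mul_le_mul_of_nonneg_left hkey hjp
    linarith
  rw [hZ0, Finset.sdiff_empty] at hc1 hfilt
  have hEsub : E ⊆ Crs c V r (Finset.range ℓ) := by
    intro e he
    exact hfilt (Finset.mem_filter.mpr ⟨he, (Finset.mem_powersetCard.mp (hE he)).1⟩)
  have hcl := Finset.card_le_card hEsub
  have hpos : 0 < tn r ℓ V.card := by
    have h1 := hT' V.card (by omega)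
    have h2 : 0 < (lam ℓ r - lam ℓ r / 2) * (V.card:ℝ)^r := mul_pos (by linarith) (by positivity)
    exact_mod_cast h2.trans_le h1
  obtain ⟨e1, e2⟩ := tn_max (r := r) (by omega) hl hc1 (by omega) (by omega)
  exact ⟨c, hc1, e2, Finset.eq_of_subset_of_card_le hEsub (by omega)⟩

theorem turan_le {k r ℓ : ℕ} {T : HGraph 2} (h : Good k r ℓ T) :
    ∃ N : ℕ, ∀ {E : Finset (Finset ℕ)} {V : Finset ℕ}, N ≤ V.card → E ⊆ V.powersetCard r →
      ¬ Cp r T E → E.card ≤ tn r ℓ V.card := by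
  obtain ⟨N, hN⟩ := turan h
  refine ⟨N, fun {E V} h1 h2 h3 => ?_⟩
  rcases le_total E.card (tn r ℓ V.card) with h4 | h4
  · exact h4
  · obtain ⟨c, hc, hB, rfl⟩ := hN h1 h2 h3 h4
    exact (tn_bal h.hl0 hc hB).le

/-! ### Matchings -/

/-- The number of vertices of the forbidden configuration. -/
def ms (r : ℕ) (T : HGraph 2) : ℕ := ((expTree r T).expansion).verts.card

theorem exp_cover {k r ℓ : ℕ} {T : HGraph 2} (h : Good k r ℓ T) :
    ∀ v ∈ ((expTree r T).expansion).verts, ∃ e ∈ ((expTree r T).expansion).edges, v ∈ e := by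
  have hr := h.hr
  have hk := h.hk36
  intro v hv
  rw [exp_edges (by omega)]
  rw [exp_verts, Finset.mem_union, Finset.mem_biUnion] at hv
  rcases hv with hv | ⟨p, hp, hv⟩
  · have hc := expTree_card (r := r) (by omega) h.hT
    obtain ⟨u, hu, huv⟩ := Finset.exists_mem_ne (show 1 < (expTree r T).verts.card by omega) v
    by_cases hcov : ∃ e ∈ (expTree r T).edges, v ∈ e ∧ u ∈ e
    · obtain ⟨e, he, h1, -⟩ := hcov
      exact ⟨e, Finset.mem_union_left _ he, h1⟩
    · push Not at hcov
      rcases lt_or_gt_of_ne huv with hlt | hlt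
      · refine ⟨_, Finset.mem_union_right _ (Finset.mem_image_of_mem _ (a := (u, v)) ?_), ?_⟩
        · rw [mem_up]
          exact ⟨⟨hu, hv⟩, hlt, fun e he hh => hcov e he hh.2 hh.1⟩
        · simp
      · refine ⟨_, Finset.mem_union_right _ (Finset.mem_image_of_mem _ (a := (v, u)) ?_), ?_⟩
        · rw [mem_up]
          exact ⟨⟨hv, hu⟩, hlt, fun e he hh => hcov e he hh.1 hh.2⟩
        · simp
  · refine ⟨_, Finset.mem_union_right _ (Finset.mem_image_of_mem _ hp), ?_⟩
    exact Finset.mem_insert_of_mem (Finset.mem_insert_of_mem hv)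

theorem Cp_supp {k r ℓ : ℕ} {T : HGraph 2} (h : Good k r ℓ T) {E : Finset (Finset ℕ)} {V : Finset ℕ}
    (hE : E ⊆ V.powersetCard r) (hC : Cp r T E) :
    ∃ S ⊆ V, S.card = ms r T ∧ Cp r T (E.filter (fun e => e ⊆ S)) := by
  obtain ⟨f, hf, hfe⟩ := hC
  refine ⟨((expTree r T).expansion).verts.image f, ?_, Finset.card_image_of_injOn hf, f, hf, ?_⟩
  · intro y hy
    obtain ⟨v, hv, rfl⟩ := Finset.mem_image.mp hy
    obtain ⟨e, he, hve⟩ := exp_cover h v hv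
    exact (Finset.mem_powersetCard.mp (hE (hfe e he))).1 (Finset.mem_image_of_mem _ hve)
  · intro e he
    exact Finset.mem_filter.mpr ⟨hfe e he, Finset.image_subset_image (((expTree r T).expansion).edges_sub e he)⟩

/-- `s` disjoint copies with union `W`. -/
def Mt (r : ℕ) (T : HGraph 2) (E : Finset (Finset ℕ)) : ℕ → Finset ℕ → Prop
  | 0, W => W = ∅
  | s+1, W => ∃ S W', W = S ∪ W' ∧ Disjoint S W' ∧ S.card = ms r T ∧
      Cp r T (E.filter (fun e => e ⊆ S)) ∧ Mt r T E s W'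

theorem Mt.card {r : ℕ} {T : HGraph 2} {E : Finset (Finset ℕ)} : ∀ {s : ℕ} {W : Finset ℕ}, Mt r T E s W →
    W.card = s * ms r T := by
  intro s
  induction s with
  | zero => intro W hW; rw [show W = ∅ from hW]; simp
  | succ s ih =>
    rintro W ⟨S, W', rfl, hd, hS, -, hM⟩
    rw [Finset.card_union_of_disjoint hd, hS, ih hM]; ring

theorem Mt.mono {r : ℕ} {T : HGraph 2} {E E' : Finset (Finset ℕ)} (hEE : E ⊆ E') :
    ∀ {s : ℕ} {W : Finset ℕ}, Mt r T E s W → Mt r T E' s W := by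
  intro s
  induction s with
  | zero => intro W hW; exact hW
  | succ s ih =>
    rintro W ⟨S, W', rfl, hd, hS, hC, hM⟩
    exact ⟨S, W', rfl, hd, hS, hC.mono (Finset.filter_subset_filter _ hEE), ih hM⟩

theorem Mt.fin {r : ℕ} {T : HGraph 2} {E : Finset (Finset ℕ)} :
    ∀ {s : ℕ} {W : Finset ℕ}, Mt r T E s W → ∃ S : Fin s → Finset ℕ, (∀ i, S i ⊆ W) ∧
      (∀ i, (S i).card = ms r T ∧ Cp r T (E.filter (fun e => e ⊆ S i))) ∧
      ∀ i j, i ≠ j → Disjoint (S i) (S j) := by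
  intro s
  induction s with
  | zero => intro W _; exact ⟨fun _ => ∅, fun i => i.elim0, fun i => i.elim0, fun i => i.elim0⟩
  | succ s ih =>
    rintro W ⟨S, W', rfl, hd, hS, hC, hM⟩
    obtain ⟨R, h1, h2, h3⟩ := ih hM
    refine ⟨Fin.cons S R, ?_, ?_, ?_⟩
    · intro i
      refine Fin.cases ?_ (fun i => ?_) i
      · rw [Fin.cons_zero]; exact Finset.subset_union_left
      · rw [Fin.cons_succ]; exact (h1 i).trans Finset.subset_union_right
    · intro i
      refine Fin.cases ?_ (fun i => ?_) i
      · rw [Fin.cons_zero]; exact ⟨hS, hC⟩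
      · rw [Fin.cons_succ]; exact h2 i
    · intro i j
      refine Fin.cases ?_ (fun i => ?_) i <;> refine Fin.cases ?_ (fun j => ?_) j
      · intro hh; exact absurd rfl hh
      · intro _; rw [Fin.cons_zero, Fin.cons_succ]; exact hd.mono_right (h1 j)
      · intro _; rw [Fin.cons_zero, Fin.cons_succ]; exact (hd.mono_right (h1 i)).symm
      · intro hh; rw [Fin.cons_succ, Fin.cons_succ]; exact h3 i j (fun hij => hh (by rw [hij]))

theorem ext1 {k r ℓ : ℕ} {T : HGraph 2} (h : Good k r ℓ T) {η : ℝ} (hη : 0 < η) :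
    ∃ κ > (0:ℝ), ∃ N : ℕ, ∀ {E : Finset (Finset ℕ)} {V S : Finset ℕ} {v : ℕ}, N ≤ V.card → E ⊆ V.powersetCard r →
      (lam ℓ r - κ) * (V.card:ℝ)^r ≤ E.card → S ⊆ V → ((V \ S).card : ℝ) ≤ κ * V.card → v ∈ S →
      (r * lam ℓ r + η) * (V.card:ℝ)^(r-1) ≤ (lk E v).card → Cp r T (E.filter (fun e => e ⊆ S)) := by
  have h0 := h.hrl
  have h3 := h.hr
  have hlp : 0 < lam ℓ r := lam_pos (by omega) (by omega)
  have hp : 0 < (r:ℝ) * lam ℓ r := mul_pos (by exact_mod_cast (by omega : 0 < r)) hlp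
  obtain ⟨ε, hε, N, hV⟩ := lemV h (show 0 < η / 2 by linarith)
  obtain ⟨κ, hκ, k1, k2, k3⟩ : ∃ κ > (0:ℝ), κ ≤ 1/2 ∧ 2 * κ ≤ ε ∧ 4 * κ ≤ η := by
    refine ⟨min (1/2) (min (ε/2) (η/4)), by positivity, min_le_left _ _, ?_, ?_⟩
    · have := (min_le_right (1/2) (min (ε/2) (η/4))).trans (min_le_left _ _); linarith
    · have := (min_le_right (1/2) (min (ε/2) (η/4))).trans (min_le_right _ _); linarith
  refine ⟨κ, hκ, 2 * N + 1, fun {E V S v} hN hE hcard hS hVS hv hlk => ?_⟩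
  by_contra hC
  have hSV := Finset.card_le_card hS
  have hsd := Finset.card_sdiff_of_subset hS
  have hn1 : (1:ℝ) ≤ V.card := by exact_mod_cast (by omega : 1 ≤ V.card)
  have hSn : (S.card:ℝ) ≤ V.card := by exact_mod_cast hSV
  have hsd' : ((V \ S).card:ℝ) = V.card - S.card := by rw [hsd, Nat.cast_sub hSV]
  have hSc : N ≤ S.card := by
    have : (V.card:ℝ) ≤ 2 * S.card := by
      have := mul_le_mul_of_nonneg_right k1 (show (0:ℝ) ≤ V.card by positivity)
      linarith
    have : V.card ≤ 2 * S.card := by exact_mod_cast this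
    omega
  have hsub : E.filter (fun e => e ⊆ S) ⊆ S.powersetCard r := by
    intro e he
    rw [Finset.mem_filter] at he
    exact Finset.mem_powersetCard.mpr ⟨he.2, (Finset.mem_powersetCard.mp (hE he.1)).2⟩
  have hX : (V.card:ℝ)^r = V.card * (V.card:ℝ)^(r-1) := by rw [← pow_succ']; congr 1; omega
  have hX' : (V.card:ℝ)^(r-1) = V.card * (V.card:ℝ)^(r-1-1) := by rw [← pow_succ']; congr 1; omega
  have hcount : (lam ℓ r - ε) * (S.card:ℝ)^r ≤ (E.filter (fun e => e ⊆ S)).card := by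
    rcases le_total (lam ℓ r - ε) 0 with hneg | hpos
    · exact (mul_nonpos_of_nonpos_of_nonneg hneg (by positivity)).trans (by positivity)
    · have a1 := filt_sub hE S
      have a2 := mul_le_mul_of_nonneg_right hVS (show (0:ℝ) ≤ (V.card:ℝ)^(r-1) by positivity)
      have a3 := mul_le_mul_of_nonneg_left (pow_le_pow_left₀ (by positivity) hSn r) hpos
      have a4 := mul_le_mul_of_nonneg_right k2 (show (0:ℝ) ≤ (V.card:ℝ)^r by positivity)
      have a5 : κ * V.card * (V.card:ℝ)^(r-1) = κ * (V.card:ℝ)^r := by rw [hX]; ring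
      linarith
  have hlk' : ((lk E v).card:ℝ) ≤ (lk (E.filter (fun e => e ⊆ S)) v).card + κ * (V.card:ℝ)^(r-1) := by
    have b0 : lk E v ⊆ V.powersetCard (r-1) := by
      refine (lk_sub' (by omega) hE v).trans ?_
      exact Finset.powersetCard_mono (Finset.erase_subset _ _)
    have b1 := filt_sub b0 S
    have b2 : (lk E v).filter (fun e => e ⊆ S) ⊆ lk (E.filter (fun e => e ⊆ S)) v := by
      intro f hf
      rw [Finset.mem_filter, mem_lk] at hf
      rw [mem_lk, Finset.mem_filter]
      exact ⟨hf.1.1, hf.1.2, Finset.insert_subset hv hf.2⟩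
    have b3 : (((lk E v).filter (fun e => e ⊆ S)).card:ℝ) ≤ (lk (E.filter (fun e => e ⊆ S)) v).card := by
      exact_mod_cast Finset.card_le_card b2
    have b4 := mul_le_mul_of_nonneg_right hVS (show (0:ℝ) ≤ (V.card:ℝ)^(r-1-1) by positivity)
    have b5 : κ * V.card * (V.card:ℝ)^(r-1-1) = κ * (V.card:ℝ)^(r-1) := by rw [hX']; ring
    linarith
  have hfin := hV hSc hsub hC hcount v hv
  have c1 := mul_le_mul_of_nonneg_left (pow_le_pow_left₀ (by positivity) hSn (r-1))
    (show 0 ≤ r * lam ℓ r + η / 2 by linarith)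
  have hpos : 0 < (V.card:ℝ)^(r-1) := by positivity
  have c2 := mul_le_mul_of_nonneg_right k3 hpos.le
  have c3 := mul_pos hη hpos
  linarith

theorem ext2 {k r ℓ : ℕ} {T : HGraph 2} (h : Good k r ℓ T) {η : ℝ} (hη : 0 < η) :
    ∃ κ > (0:ℝ), ∃ N : ℕ, ∀ {E : Finset (Finset ℕ)} {V : Finset ℕ}, N ≤ V.card → E ⊆ V.powersetCard r →
      (lam ℓ r - κ) * (V.card:ℝ)^r ≤ E.card → ∀ u : ℕ, ∀ s : ℕ, ∀ U W : Finset ℕ, U.card = u → U ⊆ V → W ⊆ V →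
      Disjoint U W → ((s + u : ℕ):ℝ) * (ms r T + 1) ≤ κ * V.card →
      (∀ v ∈ U, (r * lam ℓ r + η) * (V.card:ℝ)^(r-1) ≤ (lk E v).card) → Mt r T E s W →
      ∃ W', Mt r T E (s + u) W' ∧ W' ⊆ V := by
  obtain ⟨κ, hκ, N, hx⟩ := ext1 h hη
  refine ⟨κ, hκ, N, fun {E V} hN hE hcard u => ?_⟩
  induction u with
  | zero => intro s U W _ _ hW _ _ _ hM; exact ⟨W, hM, hW⟩
  | succ u ih =>
    intro s U W hUc hU hW hUW hsz hdeg hM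
    obtain ⟨v, hv⟩ := Finset.card_pos.mp (show 0 < U.card by omega)
    have hvW : v ∉ W := Finset.disjoint_left.mp hUW hv
    have hvs : v ∈ V \ (W ∪ U.erase v) := by
      rw [Finset.mem_sdiff, Finset.mem_union, Finset.mem_erase]
      exact ⟨hU hv, by tauto⟩
    have hsz2 : ((V \ (V \ (W ∪ U.erase v))).card : ℝ) ≤ κ * V.card := by
      refine le_trans ?_ hsz
      have h1 : (V \ (V \ (W ∪ U.erase v))).card ≤ (s + (u+1)) * (ms r T + 1) := by
        have : V \ (V \ (W ∪ U.erase v)) ⊆ W ∪ U := by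
          intro y hy
          simp only [Finset.mem_sdiff, Finset.mem_union, Finset.mem_erase] at hy ⊢
          tauto
        refine (Finset.card_le_card this).trans ((Finset.card_union_le _ _).trans ?_)
        rw [hM.card, hUc]; nlinarith
      exact_mod_cast h1
    have hC := hx hN hE hcard Finset.sdiff_subset hsz2 hvs (hdeg v hv)
    obtain ⟨S, hS, hSc, hSC⟩ := Cp_supp h (V := V \ (W ∪ U.erase v)) (by
      intro e he
      rw [Finset.mem_filter] at he
      exact Finset.mem_powersetCard.mpr ⟨he.2, (Finset.mem_powersetCard.mp (hE he.1)).2⟩) hC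
    have hdW : Disjoint S W := by
      rw [Finset.disjoint_left]; intro y hy hyW
      exact (Finset.mem_sdiff.mp (hS hy)).2 (Finset.mem_union_left _ hyW)
    have hdU : Disjoint (U.erase v) S := by
      rw [Finset.disjoint_right]; intro y hy hyW
      exact (Finset.mem_sdiff.mp (hS hy)).2 (Finset.mem_union_right _ hyW)
    have hM' : Mt r T E (s+1) (S ∪ W) := ⟨S, W, rfl, hdW, hSc,
      hSC.mono (Finset.filter_subset_filter _ (Finset.filter_subset _ _)), hM⟩
    have e : s + (u + 1) = s + 1 + u := by omega
    rw [e] at hsz ⊢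
    refine ih (s+1) (U.erase v) (S ∪ W) ?_ ((Finset.erase_subset _ _).trans hU)
      (Finset.union_subset (hS.trans Finset.sdiff_subset) hW) ?_ hsz
      (fun w hw => hdeg w (Finset.mem_of_mem_erase hw)) hM'
    · rw [Finset.card_erase_of_mem hv, hUc]; rfl
    · rw [Finset.disjoint_union_right]
      exact ⟨hdU, hUW.mono_left (Finset.erase_subset _ _)⟩

/-! ### The extremal structure -/

/-- The extremal number. -/
def es (r ℓ n t : ℕ) : ℕ := (n.choose r - (n-t).choose r) + tn r ℓ (n-t)

theorem D_lt {k r ℓ : ℕ} {T : HGraph 2} (h : Good k r ℓ T) :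
    (r:ℝ) * lam ℓ r < 1 / ((r-1).factorial : ℝ) := by
  have h0 := h.hrl
  have h3 := h.hr
  have hl := h.hl0
  have hl' : (0:ℝ) < ℓ := by exact_mod_cast hl
  have h1 := D_choose h
  have h2 : ((ℓ-1).choose (r-1) : ℝ) ≤ ((ℓ-1:ℕ):ℝ)^(r-1) / ((r-1).factorial : ℝ) := Nat.choose_le_pow_div _ _
  have h4 : ((ℓ-1:ℕ):ℝ)^(r-1) < (ℓ:ℝ)^(r-1) :=
    pow_lt_pow_left₀ (by exact_mod_cast (by omega : ℓ - 1 < ℓ)) (by positivity) (by omega)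
  have hf : (0:ℝ) < (r-1).factorial := by exact_mod_cast Nat.factorial_pos _
  have h5 := div_lt_div_of_pos_right h4 hf
  have h6 : (r:ℝ) * lam ℓ r * (ℓ:ℝ)^(r-1) < 1 / ((r-1).factorial : ℝ) * (ℓ:ℝ)^(r-1) := by
    rw [h1, one_div_mul_eq_div]; linarith
  exact lt_of_mul_lt_mul_right h6 (by positivity)

theorem choose_gap {r : ℕ} (hr : 1 ≤ r) (a j : ℕ) : a.choose r + j * a.choose (r-1) ≤ (a+j).choose r := by
  obtain ⟨q, rfl⟩ : ∃ q, r = q + 1 := ⟨r - 1, by omega⟩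
  simp only [Nat.add_sub_cancel]
  induction j with
  | zero => simp
  | succ j ih =>
    rw [← Nat.add_assoc, Nat.choose_succ_succ]
    have := Nat.choose_le_choose q (Nat.le_add_right a j)
    rw [Nat.succ_mul, Nat.succ_eq_add_one]
    omega

theorem meetU_card {V U : Finset ℕ} (hU : U ⊆ V) (r : ℕ) :
    ((V.powersetCard r).filter (fun e => ¬ e ⊆ V \ U)).card = V.card.choose r - (V.card - U.card).choose r := by
  have h1 := Finset.card_filter_add_card_filter_not (s := V.powersetCard r) (fun e => e ⊆ V \ U)
  have h2 : (V.powersetCard r).filter (fun e => e ⊆ V \ U) = (V \ U).powersetCard r := by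
    ext e
    rw [Finset.mem_filter, Finset.mem_powersetCard, Finset.mem_powersetCard]
    constructor
    · rintro ⟨⟨_, h⟩, h'⟩; exact ⟨h', h⟩
    · rintro ⟨h, h'⟩; exact ⟨⟨h.trans Finset.sdiff_subset, h'⟩, h⟩
  rw [h2, Finset.card_powersetCard, Finset.card_powersetCard, Finset.card_sdiff_of_subset hU] at h1
  omega

theorem pow_low' {q : ℕ} {n a κ : ℝ} (hn : 0 ≤ n) (ha : 0 ≤ a) (han : a ≤ n) (hq : 1 ≤ q) (h : a ≤ κ * n) :
    n^q - q * κ * n^q ≤ (n - a)^q := by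
  have h1 := pow_sub_low ha han q
  have h2 := mul_le_mul_of_nonneg_right h (show 0 ≤ n^(q-1) by positivity)
  have h3 : κ * n * n^(q-1) = κ * n^q := by
    rw [mul_assoc, ← pow_succ']; congr 2; omega
  have h4 := mul_le_mul_of_nonneg_left h2 (Nat.cast_nonneg (α := ℝ) q)
  rw [h3] at h4
  linarith

theorem choose_low {r n t : ℕ} {κ : ℝ} (hr : 2 ≤ r) (htn : t + r ≤ n) (h : ((t + r : ℕ):ℝ) ≤ κ * n) :
    (1 / ((r-1).factorial : ℝ) - r * κ) * (n:ℝ)^(r-1) ≤ ((n-t).choose (r-1) : ℝ) := by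
  have h1 : (((n-t) + 1 - (r-1) : ℕ) ^ (r-1) : ℝ) / ((r-1).factorial : ℝ) ≤ ((n-t).choose (r-1) : ℝ) :=
    Nat.pow_le_choose (r-1) (n-t)
  refine le_trans ?_ h1
  have hf1 : (1:ℝ) ≤ (r-1).factorial := by exact_mod_cast Nat.factorial_pos _
  have hf : (0:ℝ) < (r-1).factorial := by linarith
  have hn : (0:ℝ) ≤ n := by positivity
  have h2 := pow_low' (q := r-1) (n := n) hn (Nat.cast_nonneg (t+r)) (by exact_mod_cast htn) (by omega) h
  have h3 : ((n:ℝ) - ((t+r:ℕ):ℝ))^(r-1) ≤ (((n-t) + 1 - (r-1) : ℕ):ℝ)^(r-1) := by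
    apply pow_le_pow_left₀
    · rw [sub_nonneg]; exact_mod_cast htn
    · rw [← Nat.cast_sub htn]; exact_mod_cast (by omega : n - (t+r) ≤ (n-t) + 1 - (r-1))
  rw [le_div_iff₀ hf]
  have hX : 0 ≤ (n:ℝ)^(r-1) := by positivity
  set X := (n:ℝ)^(r-1)
  have hκX : 0 ≤ κ * X := by
    rcases Nat.eq_zero_or_pos n with rfl | hn0
    · have : X = 0 := by simp only [X]; rw [Nat.cast_zero, zero_pow (by omega)]
      rw [this]; simp
    · have : 0 ≤ κ := by
        by_contra hneg
        push Not at hneg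
        have := mul_neg_of_neg_of_pos hneg (show (0:ℝ) < n by exact_mod_cast hn0)
        have h5 : (0:ℝ) ≤ ((t + r : ℕ):ℝ) := by positivity
        linarith
      positivity
  have e1 : (1 / ((r-1).factorial : ℝ) - r * κ) * X * (r-1).factorial = X - r * (κ * X) * (r-1).factorial := by
    field_simp
  rw [e1]
  have h7 : ((r-1:ℕ):ℝ) ≤ r := by exact_mod_cast Nat.sub_le r 1
  have h8 := mul_le_mul_of_nonneg_right h7 hκX
  have h9 : (r:ℝ) * (κ * X) ≤ r * (κ * X) * (r-1).factorial := le_mul_of_one_le_right (by positivity) hf1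
  linarith

theorem exists_last {P : ℕ → Prop} (h0 : P 0) {b : ℕ} (hb : ¬ P (b+1)) : ∃ j ≤ b, P j ∧ ¬ P (j+1) := by
  induction b with
  | zero => exact ⟨0, le_rfl, h0, hb⟩
  | succ b ih =>
    by_cases h : P (b+1)
    · exact ⟨b+1, le_rfl, h, hb⟩
    · obtain ⟨j, hj, h⟩ := ih h; exact ⟨j, by omega, h⟩

theorem main_fwd {k r ℓ : ℕ} {T : HGraph 2} (h : Good k r ℓ T) :
    ∃ N : ℕ, ∃ cT > (0:ℝ), ∀ {E : Finset (Finset ℕ)} {V : Finset ℕ} {t : ℕ}, N ≤ V.card →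
      (t:ℝ) ≤ cT * V.card → E ⊆ V.powersetCard r → (∀ W ⊆ V, ¬ Mt r T E (t+1) W) →
      es r ℓ V.card t ≤ E.card →
      ∃ U ⊆ V, U.card = t ∧ ∃ c : ℕ → ℕ, (∀ v ∈ V \ U, c v < ℓ) ∧ Bal c (V \ U) ℓ ∧
        E = (V.powersetCard r).filter (fun e => ¬ e ⊆ V \ U) ∪ Crs c (V \ U) r (Finset.range ℓ) := by
  have h0 := h.hrl
  have h3 := h.hr
  have hl := h.hl0
  have hlp : 0 < lam ℓ r := lam_pos (by omega) (by omega)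
  have hl1 : lam ℓ r ≤ 1 := lam_le_one (by omega) (by omega)
  have hr0 : (0:ℝ) < r := by exact_mod_cast (by omega : 0 < r)
  have hp : 0 < (r:ℝ) * lam ℓ r := mul_pos hr0 hlp
  have hDl := D_lt h
  obtain ⟨γ, hγ, hγe⟩ : ∃ γ > (0:ℝ), 1 / ((r-1).factorial : ℝ) = r * lam ℓ r + γ :=
    ⟨1 / ((r-1).factorial : ℝ) - r * lam ℓ r, by linarith, by ring⟩
  obtain ⟨D, hD⟩ : ∃ D, D = (r:ℝ) * lam ℓ r := ⟨_, rfl⟩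
  have hDp : 0 < D := by rw [hD]; exact hp
  obtain ⟨m, hm⟩ : ∃ m, m = ms r T := ⟨_, rfl⟩
  have hm0 : (0:ℝ) ≤ m := Nat.cast_nonneg m
  obtain ⟨η, hη, hη1, hη2⟩ : ∃ η > (0:ℝ), (1 + 3 * (m:ℝ)) * η ≤ 3 / 4 * γ ∧ η ≤ D := by
    refine ⟨min (γ / (4 * ((m:ℝ)+1))) D, by positivity, ?_, min_le_right _ _⟩
    have h5 : γ / (4 * ((m:ℝ)+1)) * (4 * ((m:ℝ)+1)) = γ := div_mul_cancel₀ _ (by positivity)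
    have h6 := mul_le_mul_of_nonneg_left (min_le_left (γ / (4 * ((m:ℝ)+1))) D) (show 0 ≤ 1 + 3 * (m:ℝ) by positivity)
    have h7 : 0 < γ / (4 * ((m:ℝ)+1)) := by positivity
    nlinarith
  obtain ⟨κ0, hκ0, N1, hext⟩ := ext2 h hη
  obtain ⟨N2, hT1⟩ := turan h
  obtain ⟨N3, hT2⟩ := turan_le h
  obtain ⟨N4, hlow⟩ := tn_gap_low h hη (by rw [← hD]; exact hη2)
  obtain ⟨N5, hup⟩ := tn_gap_up h hη
  obtain ⟨κ1, hκ1, hκ1a, hκ1b⟩ : ∃ κ1 > (0:ℝ), 2 * κ1 ≤ κ0 ∧ κ1 ≤ lam ℓ r :=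
    ⟨min (κ0/2) (lam ℓ r), by positivity, by have := min_le_left (κ0/2) (lam ℓ r); linarith, min_le_right _ _⟩
  obtain ⟨N6, htl⟩ := tn_low h hκ1
  rw [← hm] at hext
  simp only [← hD] at hext hlow hup
  obtain ⟨κ, hκ, hκa, hκb, hκc, hκd, hκe⟩ : ∃ κ > (0:ℝ), κ ≤ 1/2 ∧ r * κ ≤ γ / 8 ∧ D * (r * κ) ≤ η ∧
      2 * (r * κ) ≤ κ0 ∧ κ ≤ κ0 := by
    obtain ⟨x, hx, x1, x2, x3⟩ : ∃ x > (0:ℝ), x ≤ 1/2 ∧ x ≤ γ / 8 ∧ 2 * x ≤ κ0 ∧ D * x ≤ η := by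
      refine ⟨min (min (1/2) (γ/8)) (min (κ0/2) (η/D)), by positivity, (min_le_left _ _).trans (min_le_left _ _),
        (min_le_left _ _).trans (min_le_right _ _), ?_, ?_⟩
      · have := (min_le_right (min (1/2) (γ/8)) (min (κ0/2) (η/D))).trans (min_le_left _ _); linarith
      · have := (min_le_right (min (1/2) (γ/8)) (min (κ0/2) (η/D))).trans (min_le_right _ _)
        rw [le_div_iff₀ hDp] at this; linarith
    have hxr : (r:ℝ) * (x / r) = x := mul_div_cancel₀ _ hr0.ne'
    have hxle : x / r ≤ x := div_le_self hx.le (by exact_mod_cast (by omega : 1 ≤ r))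
    refine ⟨x / r, by positivity, by linarith, by rw [hxr]; exact x2, by rw [hxr]; exact x3.2,
      by rw [hxr]; exact x3.1, by linarith⟩
  refine ⟨⌈2 * ((m:ℝ) + 1 + r) / κ⌉₊ + 2 * (N1 + N2 + N3 + N4 + N5 + N6 + 1) + 2 * r, κ / (2 * ((m:ℝ)+1)), by positivity,
    fun {E V t} hN ht hE hno hcard => ?_⟩
  obtain ⟨n, hn⟩ : ∃ n, n = V.card := ⟨_, rfl⟩
  rw [← hn] at hN ht hcard
  have hn0 : (1:ℝ) ≤ n := by exact_mod_cast (by omega : 1 ≤ n)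
  have hsz : ((t:ℝ) + 1) * (m + 1) + r ≤ κ * n := by
    have a1 : 2 * ((m:ℝ) + 1 + r) / κ ≤ n := (Nat.le_ceil _).trans (Nat.cast_le.mpr (by omega))
    rw [div_le_iff₀ hκ] at a1
    have a2 : κ / (2 * ((m:ℝ)+1)) * (2 * ((m:ℝ)+1)) = κ := div_mul_cancel₀ _ (by positivity)
    have a3 := mul_le_mul_of_nonneg_right ht (show 0 ≤ 2 * ((m:ℝ)+1) by positivity)
    have a4 : κ / (2 * ((m:ℝ)+1)) * n * (2 * ((m:ℝ)+1)) = κ * n := by rw [mul_right_comm, a2]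
    rw [a4] at a3
    linarith
  have hκn : κ * n ≤ n / 2 := by
    have := mul_le_mul_of_nonneg_right hκa (show (0:ℝ) ≤ n by linarith); linarith
  have hhalf : 2 * ((t+1)*(m+1) + r) ≤ n := by
    have : 2 * (((t:ℝ)+1)*(m+1) + r) ≤ n := by linarith
    exact_mod_cast this
  have htm : t + 1 ≤ (t+1)*(m+1) := Nat.le_mul_of_pos_right _ (by omega)
  have htn : t ≤ n := by omega
  have htκ : (t:ℝ) ≤ κ * n := by
    have : ((t+1:ℕ):ℝ) ≤ (((t+1)*(m+1):ℕ):ℝ) := by exact_mod_cast htm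
    push_cast at this; linarith
  have hX : 0 < (n:ℝ)^(r-1) := by positivity
  have hY : 0 < (n:ℝ)^r := by positivity
  -- density of `E`
  have hdens : (lam ℓ r - κ0) * (n:ℝ)^r ≤ E.card := by
    have b1 := htl (n-t) (by omega)
    rw [Nat.cast_sub htn] at b1
    have b2 := pow_low' (q := r) (n := n) (by linarith) (Nat.cast_nonneg t) (by exact_mod_cast htn) (by omega) htκ
    have b3 := mul_le_mul_of_nonneg_left b2 (show 0 ≤ lam ℓ r - κ1 by linarith)
    have b4 : (tn r ℓ (n-t) : ℝ) ≤ E.card := by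
      have : tn r ℓ (n-t) ≤ es r ℓ n t := Nat.le_add_left _ _
      exact_mod_cast this.trans hcard
    have b5 := mul_le_mul_of_nonneg_right hκd hY.le
    have b6 := mul_le_mul_of_nonneg_right hκ1a hY.le
    have b7 : 0 ≤ r * κ * (n:ℝ)^r := by positivity
    have b8 : (lam ℓ r - κ1) * (r * κ * (n:ℝ)^r) ≤ 1 * (r * κ * (n:ℝ)^r) :=
      mul_le_mul_of_nonneg_right (by linarith) b7
    linarith
  have hext' := hext (E := E) (V := V) (by omega) hE (by rw [← hn]; exact hdens)
  rw [← hn] at hext'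
  -- vertices of large degree
  obtain ⟨U, hUV, hUhi, hUlo⟩ : ∃ U ⊆ V, (∀ v ∈ U, (D + η) * (n:ℝ)^(r-1) ≤ (lk E v).card) ∧
      ∀ v ∈ V \ U, ((lk E v).card : ℝ) ≤ (D + η) * (n:ℝ)^(r-1) := by
    refine ⟨V.filter (fun v => (D + η) * (n:ℝ)^(r-1) ≤ (lk E v).card), Finset.filter_subset _ _,
      fun v hv => (Finset.mem_filter.mp hv).2, fun v hv => ?_⟩
    rw [Finset.mem_sdiff, Finset.mem_filter] at hv
    by_contra hlt
    push Not at hlt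
    exact hv.2 ⟨hv.1, hlt.le⟩
  have hsz' : ∀ a : ℕ, a ≤ t + 1 → (a:ℝ) * (m + 1) ≤ κ0 * n := by
    intro a ha
    have c1 : (a:ℝ) ≤ t + 1 := by exact_mod_cast ha
    have c2 := mul_le_mul_of_nonneg_right c1 (show 0 ≤ (m:ℝ) + 1 by positivity)
    have c3 := mul_le_mul_of_nonneg_right hκe (show (0:ℝ) ≤ n by linarith)
    linarith
  have hUt : U.card ≤ t := by
    by_contra hgt
    obtain ⟨U', hU', hU'c⟩ := Finset.exists_subset_card_eq (show t + 1 ≤ U.card by omega)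
    obtain ⟨W, hW, hWV⟩ := hext' (t+1) 0 U' ∅ hU'c (hU'.trans hUV) (Finset.empty_subset _)
      (Finset.disjoint_empty_right _) (hsz' _ (by omega)) (fun v hv => hUhi v (hU' hv)) rfl
    rw [Nat.zero_add] at hW
    exact hno W hWV hW
  obtain ⟨u, hu⟩ : ∃ u, u = U.card := ⟨_, rfl⟩
  rw [← hu] at hUt
  have hVU : (V \ U).card = n - u := by rw [Finset.card_sdiff_of_subset hUV, hu, hn]
  have hsub : E.filter (fun e => e ⊆ V \ U) ⊆ (V \ U).powersetCard r := by
    intro e he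
    rw [Finset.mem_filter] at he
    exact Finset.mem_powersetCard.mpr ⟨he.2, (Finset.mem_powersetCard.mp (hE he.1)).2⟩
  obtain ⟨H, hH⟩ : ∃ H, H = E.filter (fun e => e ⊆ V \ U) := ⟨_, rfl⟩
  rw [← hH] at hsub
  have hHE : H ⊆ E := by rw [hH]; exact Finset.filter_subset _ _
  obtain ⟨j, hj, ⟨W, hWs, hWM⟩, hjn⟩ := exists_last (P := fun j => ∃ W ⊆ V \ U, Mt r T H j W) (b := t - u)
    ⟨∅, Finset.empty_subset _, rfl⟩ (by
      rintro ⟨W, hWs, hWM⟩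
      obtain ⟨W', hW', hWV'⟩ := hext' u (t - u + 1) U W hu.symm hUV (hWs.trans Finset.sdiff_subset)
        (by
          rw [Finset.disjoint_right]; intro y hy
          exact (Finset.mem_sdiff.mp (hWs hy)).2) (hsz' _ (by omega)) hUhi (hWM.mono hHE)
      rw [show t - u + 1 + u = t + 1 by omega] at hW'
      exact hno W' hWV' hW')
  have hWc : W.card = j * m := by rw [hWM.card, hm]
  have hjm : u + j * m ≤ t * (m+1) := by
    have d1 : j * m ≤ (t - u) * m := Nat.mul_le_mul_right _ hj
    have d2 : u * m + (t - u) * m = t * m := by rw [← Nat.add_mul]; congr 1; omega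
    rw [Nat.mul_succ]; omega
  have htt : t * (m+1) ≤ (t+1) * (m+1) := Nat.mul_le_mul_right _ (by omega)
  have hrest : ¬ Cp r T (H.filter (fun e => e ⊆ (V \ U) \ W)) := by
    intro hC
    obtain ⟨S, hS, hSc, hSC⟩ := Cp_supp h (V := (V \ U) \ W) (by
      intro e he
      rw [Finset.mem_filter] at he
      exact Finset.mem_powersetCard.mpr ⟨he.2, (Finset.mem_powersetCard.mp (hsub he.1)).2⟩) hC
    refine hjn ⟨S ∪ W, Finset.union_subset (hS.trans Finset.sdiff_subset) hWs, S, W, rfl, ?_, hSc,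
      hSC.mono (Finset.filter_subset_filter _ (Finset.filter_subset _ _)), hWM⟩
    rw [Finset.disjoint_left]; intro y hy
    exact (Finset.mem_sdiff.mp (hS hy)).2
  have hVUW : ((V \ U) \ W).card = n - u - j * m := by rw [Finset.card_sdiff_of_subset hWs, hVU, hWc]
  have hHcard : (H.card:ℝ) ≤ tn r ℓ (n-u) + j * m * (3 * η * (n:ℝ)^(r-1)) := by
    have e1 := deg_sum hsub W
    have e2 := hT2 (E := H.filter (fun e => e ⊆ (V \ U) \ W)) (V := (V \ U) \ W) (by omega) (by
      intro e he
      rw [Finset.mem_filter] at he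
      exact Finset.mem_powersetCard.mpr ⟨he.2, (Finset.mem_powersetCard.mp (hsub he.1)).2⟩) hrest
    rw [hVUW] at e2
    have e1' : (H.card:ℝ) ≤ tn r ℓ (n - u - j * m) + ∑ z ∈ W, ((lk H z).card:ℝ) := by
      exact_mod_cast e1.trans (Nat.add_le_add_right e2 _)
    have e3 : ∑ z ∈ W, ((lk H z).card:ℝ) ≤ ∑ z ∈ W, (D + η) * (n:ℝ)^(r-1) := by
      apply Finset.sum_le_sum
      intro z hz
      refine le_trans ?_ (hUlo z (hWs hz))
      have : (lk H z).card ≤ (lk E z).card := by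
        rw [card_lk, card_lk]
        exact Finset.card_le_card (Finset.filter_subset_filter _ hHE)
      exact_mod_cast this
    rw [Finset.sum_const, nsmul_eq_mul, hWc] at e3
    have e4 := hlow (n - u - j * m) (by omega) (j * m)
    rw [Nat.sub_add_cancel (by omega), Nat.sub_sub, Nat.cast_sub (by omega)] at e4
    have e5 := pow_low' (q := r-1) (n := n) (a := ((u + j * m : ℕ):ℝ)) (κ := κ) (by linarith) (Nat.cast_nonneg _)
      (by exact_mod_cast (by omega : u + j * m ≤ n)) (by omega) (by
        have : ((u + j * m : ℕ):ℝ) ≤ (((t+1) * (m+1) : ℕ):ℝ) := by exact_mod_cast hjm.trans htt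
        push_cast at this ⊢
        linarith)
    have e6 : (D - 2 * η) * (n:ℝ)^(r-1) ≤ (D - η) * ((n:ℝ) - ((u + j * m : ℕ):ℝ))^(r-1) := by
      refine le_trans ?_ (mul_le_mul_of_nonneg_left e5 (show 0 ≤ D - η by linarith))
      have f1 : ((r-1:ℕ):ℝ) ≤ r := by exact_mod_cast Nat.sub_le r 1
      have f2 : ((r-1:ℕ):ℝ) * (κ * (n:ℝ)^(r-1)) ≤ r * (κ * (n:ℝ)^(r-1)) := mul_le_mul_of_nonneg_right f1 (by positivity)
      have f3 : (D - η) * (((r-1:ℕ):ℝ) * (κ * (n:ℝ)^(r-1))) ≤ D * (r * (κ * (n:ℝ)^(r-1))) :=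
        mul_le_mul (by linarith) f2 (by positivity) hDp.le
      have f4 := mul_le_mul_of_nonneg_right hκc hX.le
      linarith
    rw [Nat.sub_sub] at e1'
    have e7 := mul_le_mul_of_nonneg_left e6 (show (0:ℝ) ≤ ((j * m : ℕ):ℝ) by positivity)
    push_cast at e3 e4 e7 e1' ⊢
    linarith
  have hsplit : (E.filter (fun e => e ⊆ V \ U)).card + (E.filter (fun e => ¬ e ⊆ V \ U)).card = E.card :=
    Finset.card_filter_add_card_filter_not _
  rw [← hH] at hsplit
  have hmeet_sub : E.filter (fun e => ¬ e ⊆ V \ U) ⊆ (V.powersetCard r).filter (fun e => ¬ e ⊆ V \ U) :=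
    Finset.filter_subset_filter _ hE
  have hmeet := Finset.card_le_card hmeet_sub
  have hmc := meetU_card hUV r
  rw [← hn, ← hu] at hmc
  have hut : u = t := by
    by_contra hne
    have hlt : u < t := by omega
    have g1 := hup (n-t) (by omega) (t-u) n (by omega)
    rw [show n - t + (t - u) = n - u by omega] at g1
    have g2 := choose_gap (r := r) (by omega) (n-t) (t-u)
    rw [show n - t + (t - u) = n - u by omega] at g2
    have g3 := choose_low (r := r) (n := n) (t := t) (κ := κ) (by omega) (by omega) (by
      have : ((t+1:ℕ):ℝ) ≤ (((t+1)*(m+1):ℕ):ℝ) := by exact_mod_cast htm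
      push_cast at this ⊢; linarith)
    have g4 : (n-u).choose r ≤ n.choose r := Nat.choose_le_choose _ (by omega)
    have g5 : (n-t).choose r ≤ n.choose r := Nat.choose_le_choose _ (by omega)
    have g6 : (t-u) * (n-t).choose (r-1) + tn r ℓ (n-t) ≤ H.card := by
      unfold es at hcard; omega
    have g6' : ((t-u:ℕ):ℝ) * ((n-t).choose (r-1):ℝ) + tn r ℓ (n-t) ≤ H.card := by exact_mod_cast g6
    have hτ : (0:ℝ) < ((t-u:ℕ):ℝ) := by exact_mod_cast (by omega : 0 < t - u)
    have hjτ : (j:ℝ) ≤ ((t-u:ℕ):ℝ) := by exact_mod_cast hj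
    have g7 : (j:ℝ) * m * (3 * η * (n:ℝ)^(r-1)) ≤ ((t-u:ℕ):ℝ) * (m * (3 * η * (n:ℝ)^(r-1))) := by
      rw [mul_assoc]; exact mul_le_mul_of_nonneg_right hjτ (by positivity)
    have g8 := mul_le_mul_of_nonneg_left g3 hτ.le
    have g9 : ((t-u:ℕ):ℝ) * ((1 / ((r-1).factorial : ℝ) - r * κ) * (n:ℝ)^(r-1)) ≤
        ((t-u:ℕ):ℝ) * ((D + η) * (n:ℝ)^(r-1) + m * (3 * η * (n:ℝ)^(r-1))) := by linarith
    have g10 := le_of_mul_le_mul_left g9 hτ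
    have g11 : (1 / ((r-1).factorial : ℝ) - r * κ) * (n:ℝ)^(r-1) ≤ (D + η + 3 * m * η) * (n:ℝ)^(r-1) := by linarith
    have g12 := le_of_mul_le_mul_right g11 hX
    rw [hγe, ← hD] at g12
    linarith
  have hj0 : j = 0 := by omega
  subst hj0
  rw [show W = ∅ from hWM, Finset.sdiff_empty] at hrest
  have hHH : H.filter (fun e => e ⊆ V \ U) = H := by
    rw [Finset.filter_eq_self]; intro e he; exact (Finset.mem_powersetCard.mp (hsub he)).1
  rw [hHH] at hrest
  have hHlow : tn r ℓ (n - u) ≤ H.card := by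
    unfold es at hcard; rw [← hut] at hcard; omega
  have hHup := hT2 (E := H) (V := V \ U) (by omega) hsub hrest
  obtain ⟨c, hc, hB, hHc⟩ := hT1 (E := H) (V := V \ U) (by omega) hsub hrest (by rw [hVU]; exact hHlow)
  rw [hVU] at hHup
  have hmeq := Finset.eq_of_subset_of_card_le hmeet_sub (by
    unfold es at hcard; rw [← hut] at hcard; omega)
  refine ⟨U, hUV, by omega, c, hc, hB, ?_⟩
  rw [← hmeq, ← hHc, hH, Finset.union_comm, Finset.filter_union_filter_not_eq]

/-! ### Assembling the theorem -/

/-- The structure of the extremal hypergraph. -/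
def Str (r ℓ t : ℕ) (V : Finset ℕ) (E : Finset (Finset ℕ)) : Prop :=
  ∃ U ⊆ V, U.card = t ∧ ∃ c : ℕ → ℕ, (∀ v ∈ V \ U, c v < ℓ) ∧ Bal c (V \ U) ℓ ∧
    E = (V.powersetCard r).filter (fun e => ¬ e ⊆ V \ U) ∪ Crs c (V \ U) r (Finset.range ℓ)

theorem Str.card {r ℓ t : ℕ} {V : Finset ℕ} {E : Finset (Finset ℕ)} (hl : 0 < ℓ) (h : Str r ℓ t V E) :
    E.card = es r ℓ V.card t := by
  obtain ⟨U, hU, rfl, c, hc, hB, rfl⟩ := h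
  rw [Finset.card_union_of_disjoint, meetU_card hU, tn_bal hl hc hB, Finset.card_sdiff_of_subset hU]
  · rfl
  · rw [Finset.disjoint_left]
    intro e he he'
    exact (Finset.mem_filter.mp he).2 (mem_Crs.mp he').1

theorem Str.noMatching {k r ℓ t : ℕ} {T : HGraph 2} (hg : Good k r ℓ T) {H : HGraph r}
    (h : Str r ℓ t H.verts H.edges) : ¬ ((expTree r T).expansion).HasMatching H (t+1) := by
  obtain ⟨U, hU, hUt, c, hc, hB, hE⟩ := h
  rintro ⟨S, hS, hd, hcp⟩
  have key : ∀ i, ∃ v ∈ U, v ∈ S i := by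
    intro i
    by_contra hno
    push Not at hno
    obtain ⟨f, hf, -, hfe⟩ := hcp i
    have hC : Cp r T (Crs c (H.verts \ U) r (Finset.range ℓ)) := by
      refine ⟨f, hf, fun e he => ?_⟩
      have h1 := hfe e he
      have h2 : e.image f ∈ H.edges ∧ e.image f ⊆ S i := by
        have : e.image f ∈ (H.edges.filter fun e => e ⊆ S i).filter (fun e => e ⊆ H.verts ∩ S i ∧ e.card = r) := h1
        rw [Finset.mem_filter, Finset.mem_filter] at this
        exact this.1
      have h3 : e.image f ⊆ H.verts \ U := by
        intro y hy
        rw [Finset.mem_sdiff]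
        exact ⟨(hS i).1 (h2.2 hy), fun hyU => hno y hyU (h2.2 hy)⟩
      have h4 := h2.1
      rw [hE, Finset.mem_union, Finset.mem_filter] at h4
      rcases h4 with h4 | h4
      · exact absurd h3 h4.2
      · exact h4
    refine not_Cp_of_KF hg (part_free hg (c := c) ?_ ?_) hC
    · intro e he; exact (mem_Crs.mp he).2.2.1
    · intro e he v hv; exact Finset.mem_range.mp ((mem_Crs.mp he).2.2.2 v hv)
  choose g hgU hgS using key
  have h1 := Finset.card_le_card_of_injOn (s := (Finset.univ : Finset (Fin (t+1)))) (t := U) g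
    (fun i _ => hgU i) (by
      intro i _ j _ hij
      by_contra hne
      exact Finset.disjoint_left.mp (hd i j hne) (hgS i) (hij ▸ hgS j))
  rw [Finset.card_univ, Fintype.card_fin] at h1
  omega

theorem Mt.hasMatching {k r ℓ s : ℕ} {T : HGraph 2} (hg : Good k r ℓ T) {H : HGraph r} {W : Finset ℕ}
    (hW : W ⊆ H.verts) (h : Mt r T H.edges s W) : ((expTree r T).expansion).HasMatching H s := by
  obtain ⟨S, h1, h2, h3⟩ := h.fin
  refine ⟨S, fun i => ⟨(h1 i).trans hW, (h2 i).1⟩, h3, fun i => ?_⟩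
  obtain ⟨f, hf, hfe⟩ := (h2 i).2
  have hsub : ∀ e ∈ ((expTree r T).expansion).edges, e.image f ⊆ H.verts ∩ S i := by
    intro e he y hy
    have := Finset.mem_filter.mp (hfe e he)
    exact Finset.mem_inter.mpr ⟨H.edges_sub _ this.1 hy, this.2 hy⟩
  refine ⟨f, hf, fun v hv => ?_, fun e he => ?_⟩
  · obtain ⟨e, he, hve⟩ := exp_cover hg v hv
    exact hsub e he (Finset.mem_image_of_mem _ hve)
  · change e.image f ∈ (H.edges.filter fun e => e ⊆ S i).filter (fun e => e ⊆ H.verts ∩ S i ∧ e.card = r)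
    rw [Finset.mem_filter]
    exact ⟨hfe e he, hsub e he, H.edges_card _ (Finset.mem_filter.mp (hfe e he)).1⟩

/-- The target hypergraph. -/
def tg (r ℓ n t : ℕ) : HGraph r := (completeOn r (Finset.range t)).join (turanOn r ℓ (Finset.Ico t n))

theorem tg_verts {r ℓ n t : ℕ} (htn : t ≤ n) : (tg r ℓ n t).verts = Finset.range n := by
  change Finset.range t ∪ Finset.Ico t n = Finset.range n
  ext x
  rw [Finset.mem_union, Finset.mem_range, Finset.mem_Ico, Finset.mem_range]
  omega

theorem tg_edges {r ℓ n t : ℕ} (hl : 0 < ℓ) (htn : t ≤ n) {e : Finset ℕ}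
    (he : e ∈ (Finset.range n).powersetCard r) :
    e ∈ (tg r ℓ n t).edges ↔ ¬ e ⊆ Finset.Ico t n ∨ e ∈ Crs (fun v => v % ℓ) (Finset.Ico t n) r (Finset.range ℓ) := by
  have hv : Finset.range t ∪ Finset.Ico t n = Finset.range n := tg_verts (r := r) (ℓ := ℓ) htn
  have h1 : (tg r ℓ n t).edges = (((Finset.range t).powersetCard r).filter (fun e => e ⊆ Finset.range t ∧ e.card = r) ∪
      (((Finset.Ico t n).powersetCard r).filter (fun e => ∀ u ∈ e, ∀ v ∈ e, u % ℓ = v % ℓ → u = v)).filter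
        (fun e => e ⊆ Finset.Ico t n ∧ e.card = r) ∪
      ((Finset.range t ∪ Finset.Ico t n).powersetCard r).filter
        (fun e => (e ∩ Finset.range t).Nonempty ∧ (e ∩ Finset.Ico t n).Nonempty)).filter
        (fun e => e ⊆ Finset.range t ∪ Finset.Ico t n ∧ e.card = r) := rfl
  have he' := Finset.mem_powersetCard.mp he
  rw [h1, hv]
  simp only [Finset.mem_filter, Finset.mem_union, Finset.mem_powersetCard, mem_Crs]
  have hinj : (Set.InjOn (fun v => v % ℓ) (↑e : Set ℕ)) ↔ ∀ u ∈ e, ∀ v ∈ e, u % ℓ = v % ℓ → u = v := by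
    constructor
    · intro h u hu v hv huv; exact h (Finset.mem_coe.mpr hu) (Finset.mem_coe.mpr hv) huv
    · intro h u hu v hv huv; exact h u (Finset.mem_coe.mp hu) v (Finset.mem_coe.mp hv) huv
  rw [hinj]
  have hmod : ∀ v ∈ e, v % ℓ ∈ Finset.range ℓ := fun v _ => Finset.mem_range.mpr (Nat.mod_lt _ hl)
  have hA : (¬ e ⊆ Finset.Ico t n) ↔ (e ∩ Finset.range t).Nonempty := by
    rw [Finset.not_subset]
    constructor
    · rintro ⟨x, hx, hx'⟩
      have := Finset.mem_range.mp (he'.1 hx)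
      rw [Finset.mem_Ico] at hx'
      exact ⟨x, Finset.mem_inter.mpr ⟨hx, Finset.mem_range.mpr (by omega)⟩⟩
    · rintro ⟨x, hx⟩
      rw [Finset.mem_inter, Finset.mem_range] at hx
      exact ⟨x, hx.1, by rw [Finset.mem_Ico]; omega⟩
  have hB : e ⊆ Finset.range t ∨ (e ∩ Finset.Ico t n).Nonempty := by
    by_cases h : e ⊆ Finset.range t
    · exact Or.inl h
    · right
      obtain ⟨x, hx, hx'⟩ := Finset.not_subset.mp h
      have := Finset.mem_range.mp (he'.1 hx)
      rw [Finset.mem_range] at hx'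
      exact ⟨x, Finset.mem_inter.mpr ⟨hx, Finset.mem_Ico.mpr (by omega)⟩⟩
  constructor
  · rintro ⟨(h | h) | h, -⟩
    · by_cases hI : e ⊆ Finset.Ico t n
      · right
        refine ⟨hI, he'.2, ?_, hmod⟩
        intro u hu v hv huv
        have a1 := Finset.mem_range.mp (h.1.1 hu)
        have a2 := Finset.mem_Ico.mp (hI hu)
        omega
      · exact Or.inl hI
    · exact Or.inr ⟨h.1.1.1, he'.2, h.1.2, hmod⟩
    · exact Or.inl (hA.mpr h.2.1)
  · rintro (h | h)
    · refine ⟨?_, he'⟩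
      rcases hB with hB | hB
      · exact Or.inl (Or.inl ⟨⟨hB, he'.2⟩, hB, he'.2⟩)
      · exact Or.inr ⟨he', hA.mp h, hB⟩
    · exact ⟨Or.inl (Or.inr ⟨⟨⟨h.1, he'.2⟩, h.2.2.1⟩, h.1, he'.2⟩), he'⟩

theorem Str.toIso {r ℓ n t : ℕ} (hl : 0 < ℓ) (htn : t ≤ n) {H : HGraph r} (hn : H.verts.card = n)
    (h : Str r ℓ t H.verts H.edges) : H.Iso (tg r ℓ n t) := by
  obtain ⟨U, hU, hUt, c, hc, hB, hE⟩ := h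
  have hcard : (H.verts \ U).card = (Finset.Ico t n).card := by
    rw [Finset.card_sdiff_of_subset hU, hn, hUt, Nat.card_Ico]
  obtain ⟨φ, p1, p2, p3⟩ := bal_iso hc (fun v _ => Nat.mod_lt v hl) hB (bal_mod hl t n) hcard
  obtain ⟨ψ, q1, q2⟩ := exists_bij (s := U) (t := Finset.range t) (by rw [hUt, Finset.card_range])
  have hψ : ∀ v ∈ U, ψ v < t := fun v hv => Finset.mem_range.mp (q2 ▸ Finset.mem_image_of_mem _ hv)
  have hφ : ∀ v ∈ H.verts \ U, t ≤ φ v ∧ φ v < n := fun v hv => Finset.mem_Ico.mp (p2 ▸ Finset.mem_image_of_mem _ hv)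
  have hcr := Crs_card_iso (r := r) hc (fun v _ => Nat.mod_lt v hl) p1 p2 p3
  obtain ⟨f, hf⟩ : ∃ f : ℕ → ℕ, f = fun v => if v ∈ U then ψ v else φ v := ⟨_, rfl⟩
  have fU : ∀ v ∈ U, f v = ψ v := fun v hv => by rw [hf]; exact if_pos hv
  have fN : ∀ v ∉ U, f v = φ v := fun v hv => by rw [hf]; exact if_neg hv
  have hmaps : ∀ v ∈ H.verts, f v < n := by
    intro v hv
    by_cases hvU : v ∈ U
    · rw [fU v hvU]; have := hψ v hvU; omega
    · rw [fN v hvU]; exact (hφ v (Finset.mem_sdiff.mpr ⟨hv, hvU⟩)).2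
  have hfI : ∀ v ∈ H.verts, (f v ∈ Finset.Ico t n ↔ v ∈ H.verts \ U) := by
    intro v hv
    rw [Finset.mem_Ico, Finset.mem_sdiff]
    by_cases hvU : v ∈ U
    · rw [fU v hvU]; have := hψ v hvU
      constructor
      · intro hh; omega
      · intro hh; exact absurd hvU hh.2
    · rw [fN v hvU]
      exact ⟨fun _ => ⟨hv, hvU⟩, fun hh => hφ v (Finset.mem_sdiff.mpr hh)⟩
  refine ⟨f, ⟨?_, ?_, ?_⟩, ?_⟩
  · intro v hv
    rw [tg_verts htn]
    exact Finset.mem_coe.mpr (Finset.mem_range.mpr (hmaps v hv))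
  · intro v hv w hw hvw
    have hv' := Finset.mem_coe.mp hv
    have hw' := Finset.mem_coe.mp hw
    by_cases hvU : v ∈ U <;> by_cases hwU : w ∈ U
    · rw [fU v hvU, fU w hwU] at hvw; exact q1 hvU hwU hvw
    · rw [fU v hvU, fN w hwU] at hvw
      have := hψ v hvU; have := hφ w (Finset.mem_sdiff.mpr ⟨hw', hwU⟩); omega
    · rw [fN v hvU, fU w hwU] at hvw
      have := hψ w hwU; have := hφ v (Finset.mem_sdiff.mpr ⟨hv', hvU⟩); omega
    · rw [fN v hvU, fN w hwU] at hvw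
      exact p1 (Finset.mem_coe.mpr (Finset.mem_sdiff.mpr ⟨hv', hvU⟩)) (Finset.mem_coe.mpr (Finset.mem_sdiff.mpr ⟨hw', hwU⟩)) hvw
  · intro y hy
    rw [tg_verts htn] at hy
    have hyn := Finset.mem_range.mp (Finset.mem_coe.mp hy)
    by_cases hyt : y < t
    · have : y ∈ U.image ψ := by rw [q2]; exact Finset.mem_range.mpr hyt
      obtain ⟨v, hv, rfl⟩ := Finset.mem_image.mp this
      exact ⟨v, Finset.mem_coe.mpr (hU hv), fU v hv⟩
    · have : y ∈ (H.verts \ U).image φ := by rw [p2]; exact Finset.mem_Ico.mpr (by omega)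
      obtain ⟨v, hv, rfl⟩ := Finset.mem_image.mp this
      have hv' := Finset.mem_sdiff.mp hv
      exact ⟨v, Finset.mem_coe.mpr hv'.1, fN v hv'.2⟩
  · intro e he
    have he' := Finset.mem_powersetCard.mp he
    have hinj : Set.InjOn f (↑e : Set ℕ) := by
      intro v hv w hw hvw
      have hv' := he'.1 (Finset.mem_coe.mp hv)
      have hw' := he'.1 (Finset.mem_coe.mp hw)
      by_cases hvU : v ∈ U <;> by_cases hwU : w ∈ U
      · rw [fU v hvU, fU w hwU] at hvw; exact q1 hvU hwU hvw
      · rw [fU v hvU, fN w hwU] at hvw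
        have := hψ v hvU; have := hφ w (Finset.mem_sdiff.mpr ⟨hw', hwU⟩); omega
      · rw [fN v hvU, fU w hwU] at hvw
        have := hψ w hwU; have := hφ v (Finset.mem_sdiff.mpr ⟨hv', hvU⟩); omega
      · rw [fN v hvU, fN w hwU] at hvw
        exact p1 (Finset.mem_coe.mpr (Finset.mem_sdiff.mpr ⟨hv', hvU⟩)) (Finset.mem_coe.mpr (Finset.mem_sdiff.mpr ⟨hw', hwU⟩)) hvw
    have himg : e.image f ∈ (Finset.range n).powersetCard r := by
      rw [Finset.mem_powersetCard, Finset.card_image_of_injOn hinj]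
      refine ⟨?_, he'.2⟩
      intro y hy
      obtain ⟨v, hv, rfl⟩ := Finset.mem_image.mp hy
      exact Finset.mem_range.mpr (hmaps v (he'.1 hv))
    rw [tg_edges hl htn himg, hE, Finset.mem_union, Finset.mem_filter]
    have hs : e.image f ⊆ Finset.Ico t n ↔ e ⊆ H.verts \ U := by
      rw [Finset.image_subset_iff]
      constructor
      · intro hh v hv; exact (hfI v (he'.1 hv)).mp (hh v hv)
      · intro hh v hv; exact (hfI v (he'.1 hv)).mpr (hh hv)
    rw [hs]
    by_cases hsub : e ⊆ H.verts \ U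
    · have himg2 : e.image f = e.image φ := by
        apply Finset.image_congr
        intro v hv
        exact fN v (Finset.mem_sdiff.mp (hsub hv)).2
      rw [himg2, ← hcr e hsub]
      tauto
    · tauto

theorem Str.ofIso {r ℓ n t : ℕ} (hl : 0 < ℓ) (htn : t ≤ n) {H : HGraph r} (h : H.Iso (tg r ℓ n t)) :
    H.verts.card = n ∧ Str r ℓ t H.verts H.edges := by
  obtain ⟨f, hf, hfe⟩ := h
  rw [tg_verts htn] at hf
  have himg : H.verts.image f = Finset.range n := by
    apply Finset.coe_injective
    rw [Finset.coe_image]; exact hf.image_eq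
  have hcard : H.verts.card = n := by
    rw [← Finset.card_range n, ← himg, Finset.card_image_of_injOn hf.injOn]
  have hlt : ∀ v ∈ H.verts, f v < n := fun v hv => Finset.mem_range.mp (himg ▸ Finset.mem_image_of_mem _ hv)
  have hfib : ∀ P : ℕ → Prop, ∀ _ : DecidablePred P,
      (H.verts.filter (fun v => P (f v))).card = ((Finset.range n).filter P).card := by
    intro P _
    rw [← himg, Finset.filter_image, Finset.card_image_of_injOn]
    exact hf.injOn.mono (by exact_mod_cast Finset.filter_subset _ _)
  have hsd : H.verts \ H.verts.filter (fun v => f v < t) = H.verts.filter (fun v => ¬ f v < t) := by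
    ext v
    rw [Finset.mem_sdiff, Finset.mem_filter, Finset.mem_filter]; tauto
  refine ⟨hcard, H.verts.filter (fun v => f v < t), Finset.filter_subset _ _, ?_, fun v => f v % ℓ,
    fun v _ => Nat.mod_lt _ hl, ?_, ?_⟩
  · rw [hfib (fun v => v < t) inferInstance]
    have : (Finset.range n).filter (fun v => v < t) = Finset.range t := by
      ext x; simp only [Finset.mem_filter, Finset.mem_range]; omega
    rw [this, Finset.card_range]
  · intro i hi
    rw [hsd, Finset.filter_filter]
    have e1 := hfib (fun v => ¬ v < t) inferInstance
    have e2 := hfib (fun v => ¬ v < t ∧ v % ℓ = i) inferInstance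
    have e3 : (Finset.range n).filter (fun v => ¬ v < t) = Finset.Ico t n := by
      ext x; simp only [Finset.mem_filter, Finset.mem_range, Finset.mem_Ico]; omega
    have e4 : (Finset.range n).filter (fun v => ¬ v < t ∧ v % ℓ = i) =
        (Finset.Ico t n).filter (fun v => v % ℓ = i) := by
      rw [← e3, Finset.filter_filter]
    rw [e4] at e2
    rw [e3] at e1
    simp only [e1, e2]
    exact bal_mod hl t n i hi
  · rw [hsd]
    ext e
    by_cases he : e ∈ H.verts.powersetCard r
    · have he' := Finset.mem_powersetCard.mp he
      have hinj : Set.InjOn f (↑e : Set ℕ) := hf.injOn.mono (by exact_mod_cast he'.1)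
      have hie : e.image f ∈ (Finset.range n).powersetCard r := by
        rw [Finset.mem_powersetCard, Finset.card_image_of_injOn hinj, ← himg]
        exact ⟨Finset.image_subset_image he'.1, he'.2⟩
      rw [hfe e he, tg_edges hl htn hie, Finset.mem_union, Finset.mem_filter]
      have hs : e.image f ⊆ Finset.Ico t n ↔ e ⊆ H.verts.filter (fun v => ¬ f v < t) := by
        rw [Finset.image_subset_iff]
        constructor
        · intro hh v hv
          have := Finset.mem_Ico.mp (hh v hv)
          exact Finset.mem_filter.mpr ⟨he'.1 hv, by omega⟩
        · intro hh v hv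
          have h1 := (Finset.mem_filter.mp (hh hv)).2
          exact Finset.mem_Ico.mpr ⟨by omega, hlt v (he'.1 hv)⟩
      have hc : e.image f ∈ Crs (fun v => v % ℓ) (Finset.Ico t n) r (Finset.range ℓ) ↔
          e ∈ Crs (fun v => f v % ℓ) (H.verts.filter (fun v => ¬ f v < t)) r (Finset.range ℓ) := by
        rw [mem_Crs, mem_Crs, hs, Finset.card_image_of_injOn hinj, Finset.coe_image]
        have hi : Set.InjOn (fun v => v % ℓ) (f '' ↑e) ↔ Set.InjOn (fun v => f v % ℓ) (↑e : Set ℕ) := by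
          constructor
          · intro hh; exact hh.comp hinj (Set.mapsTo_image _ _)
          · rintro hh _ ⟨v, hv, rfl⟩ _ ⟨w, hw, rfl⟩ hvw
            rw [hh hv hw hvw]
        rw [hi]
        have hm1 : ∀ v ∈ e.image f, v % ℓ ∈ Finset.range ℓ := fun v _ => Finset.mem_range.mpr (Nat.mod_lt _ hl)
        have hm2 : ∀ v ∈ e, f v % ℓ ∈ Finset.range ℓ := fun v _ => Finset.mem_range.mpr (Nat.mod_lt _ hl)
        exact ⟨fun hh => ⟨hh.1, hh.2.1, hh.2.2.1, hm2⟩, fun hh => ⟨hh.1, hh.2.1, hh.2.2.1, hm1⟩⟩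
      rw [hs, hc]
      tauto
    · constructor
      · intro hh
        exact absurd (Finset.mem_powersetCard.mpr ⟨H.edges_sub e hh, H.edges_card e hh⟩) he
      · intro hh
        rw [Finset.mem_union, Finset.mem_filter] at hh
        rcases hh with hh | hh
        · exact absurd hh.1 he
        · rw [mem_Crs] at hh
          exact absurd (Finset.mem_powersetCard.mpr ⟨hh.1.trans (Finset.filter_subset _ _), hh.2.1⟩) he

theorem edges_pw {r : ℕ} (H : HGraph r) : H.edges ⊆ H.verts.powersetCard r := fun e he =>
  Finset.mem_powersetCard.mpr ⟨H.edges_sub e he, H.edges_card e he⟩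

theorem Iso_refl {r : ℕ} (H : HGraph r) : H.Iso H := by
  refine ⟨id, Set.bijOn_id _, fun e _ => ?_⟩
  rw [Finset.image_id]

theorem final {k r ℓ : ℕ} {T : HGraph 2} (hg : Good k r ℓ T) :
    ∃ N₀ : ℕ, ∃ cT : ℝ, 0 < cT ∧ ∀ n : ℕ, N₀ ≤ n → ∀ t : ℕ, (t : ℝ) ≤ cT * n →
        ∀ H : HGraph r,
          IsExtremalMatchingFree r n t ((expTree r T).expansion) H ↔ H.Iso (tg r ℓ n t) := by
  have hl := hg.hl0
  obtain ⟨N, c0, hc0, hmain⟩ := main_fwd hg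
  refine ⟨N, min c0 1, lt_min hc0 one_pos, fun n hn t ht => ?_⟩
  have hn0 : (0:ℝ) ≤ n := Nat.cast_nonneg n
  have ht0 : (t:ℝ) ≤ c0 * n := ht.trans (mul_le_mul_of_nonneg_right (min_le_left _ _) hn0)
  have htn : t ≤ n := by
    have := ht.trans (mul_le_mul_of_nonneg_right (min_le_right c0 1) hn0)
    rw [one_mul] at this
    exact_mod_cast this
  have hstr : ∀ H : HGraph r, H.verts.card = n → ¬ ((expTree r T).expansion).HasMatching H (t+1) →
      es r ℓ n t ≤ H.edges.card → Str r ℓ t H.verts H.edges := by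
    intro H hHn hM hcard
    exact hmain (E := H.edges) (V := H.verts) (t := t) (by rw [hHn]; exact hn) (by rw [hHn]; exact ht0)
      (edges_pw H) (fun W hW hWM => hM (hWM.hasMatching hg hW)) (by rw [hHn]; exact hcard)
  obtain ⟨tgn, tgs⟩ := Str.ofIso hl htn (Iso_refl (tg r ℓ n t))
  have hub : ∀ m ∈ {m | ∃ H : HGraph r, H.verts.card = n ∧
      ¬ ((expTree r T).expansion).HasMatching H (t+1) ∧ H.edges.card = m}, m ≤ es r ℓ n t := by
    rintro m ⟨H, h1, h2, rfl⟩
    rcases le_total (es r ℓ n t) H.edges.card with h3 | h3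
    · have := (hstr H h1 h2 h3).card hl
      rw [h1] at this
      exact this.le
    · exact h3
  have hmem : es r ℓ n t ∈ {m | ∃ H : HGraph r, H.verts.card = n ∧
      ¬ ((expTree r T).expansion).HasMatching H (t+1) ∧ H.edges.card = m} :=
    ⟨tg r ℓ n t, tgn, tgs.noMatching hg, by rw [tgs.card hl, tgn]⟩
  have hex : exMatchN r n t ((expTree r T).expansion) = es r ℓ n t :=
    le_antisymm (csSup_le ⟨_, hmem⟩ hub) (le_csSup ⟨_, hub⟩ hmem)
  intro H
  constructor
  · rintro ⟨h1, h2, h3⟩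
    exact (hstr H h1 h2 (by rw [h3, hex])).toIso hl htn h1
  · intro h
    obtain ⟨h1, h2⟩ := Str.ofIso hl htn h
    exact ⟨h1, h2.noMatching hg, by rw [hex, h2.card hl, h1]⟩

/-- the density Corrádi–Hajnal theorem for expansions of
expanded Erdős–Sós trees. -/
theorem statement_11 (r : ℕ) (hr : 3 ≤ r) :
    ∃ M : ℕ, ∀ k : ℕ, M ≤ k → ∀ T : HGraph 2, IsTreeGraph k T → ErdosSos k T →
      ∃ N₀ : ℕ, ∃ cT : ℝ, 0 < cT ∧ ∀ n : ℕ, N₀ ≤ n → ∀ t : ℕ, (t : ℝ) ≤ cT * n →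
        ∀ H : HGraph r,
          IsExtremalMatchingFree r n t ((expTree r T).expansion) H ↔
          H.Iso ((completeOn r (Finset.range t)).join
            (turanOn r (k + r - 3) (Finset.Ico t n))) := by
  exact ⟨4 * r^2, fun _ hk _ hT hES => final ⟨hT, hES, hr, hk, rfl⟩⟩

end DensityCH
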